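/- Let 𝔸 and 𝔹 be generalized algebraic theories. Suppose given a derivable judgment A ⊢ u term and a context morphism f : X → A in 𝔸, and a derivable judgment B ⊢ v term and a context morphism g : Y → B in 𝔹. Then the judgment X⊗Y ⊢ (u ⊗ v)[f ⊗ g] ≡ u[f] ⊗ v[g] term is derivable in 𝔸⊗𝔹, where tensors of terms are formed at their canonical sorts. -/

import Mathlib

set_option linter.unusedVariables false

/-! # Syntax of generalized algebraic theories (following Cartmell / the paper's appendix) -/

namespace GATPaper

/-- A sort-and-term alphabet: a countably infinite set of variables, a set of sort
symbols and a set of term symbols. -/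
structure Alphabet : Type 1 where
  Var : Type
  SortSym : Type
  TermSym : Type
  var_infinite : Infinite Var
  var_countable : Countable Var

attribute [instance] Alphabet.var_infinite Alphabet.var_countable

variable {A B : Alphabet}

/-- Term expressions over an alphabet. -/
inductive Expr (A : Alphabet) : Type where
  | var : A.Var → Expr A
  | app : A.TermSym → List (Expr A) → Expr A

/-- Sort expressions: a sort symbol applied to a list of term expressions. -/
structure SortE (A : Alphabet) : Type where
  head : A.SortSym
  args : List (Expr A)

/-- Occurrence of a variable in a term expression. -/
inductive Occurs (x : A.Var) : Expr A → Prop where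
  | var : Occurs x (Expr.var x)
  | app {t : A.TermSym} {es : List (Expr A)} {e : Expr A} :
      e ∈ es → Occurs x e → Occurs x (Expr.app t es)

/-- Occurrence of a variable in a sort expression. -/
def SOccurs (x : A.Var) (U : SortE A) : Prop := ∃ e ∈ U.args, Occurs x e

/-- Simultaneous substitution along a function on variables. -/
def Expr.subst (σ : A.Var → Expr A) : Expr A → Expr A
  | .var x => σ x
  | .app t es => .app t (es.attach.map fun e => Expr.subst σ e.1)
termination_by e => sizeOf e
decreasing_by
  have := List.sizeOf_lt_of_mem e.2
  simp only [Expr.app.sizeOf_spec]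
  omega

def SortE.subst (σ : A.Var → Expr A) (U : SortE A) : SortE A :=
  ⟨U.head, U.args.map (Expr.subst σ)⟩

open Classical in
/-- The function on variables determined by a finite list of substitution pairs
`(zᵢ, uᵢ)` (substituting `uᵢ` for `zᵢ`, first matching pair winning, all other
variables unchanged). -/
noncomputable def lookupV : List (A.Var × Expr A) → A.Var → Expr A
  | [], x => .var x
  | p :: ps, x => if p.1 = x then p.2 else lookupV ps x

/-- The simultaneous substitution `e[u₁ | z₁, …, u_k | z_k]` where
`ps = [(z₁,u₁),…,(z_k,u_k)]`. -/
noncomputable def Expr.substL (e : Expr A) (ps : List (A.Var × Expr A)) : Expr A :=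
  e.subst (lookupV ps)

noncomputable def SortE.substL (U : SortE A) (ps : List (A.Var × Expr A)) : SortE A :=
  U.subst (lookupV ps)

/-- A (pre)context is a finite list of (variable, sort expression) pairs. -/
abbrev PreCtx (A : Alphabet) := List (A.Var × SortE A)

/-- The list of variables of a precontext, as term expressions. -/
def ctxVars (X : PreCtx A) : List (Expr A) := X.map fun p => Expr.var p.1

/-- The scoping condition of a precontext: the `i`-th sort expression only contains
variables among the first `i` variables. -/
def IsPreCtx (X : PreCtx A) : Prop :=
  ∀ i (hi : i < X.length) (v : A.Var),
    SOccurs v (X[i]'hi).2 → v ∈ (X.take i).map Prod.fst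

/-- Substitution pairs sending the variables of `X` to the entries of `f`. -/
def mkSub (X : PreCtx A) (f : List (Expr A)) : List (A.Var × Expr A) :=
  (X.map Prod.fst).zip f

/-- `Xᵢ[f₁ | x₁, …, f_{i-1} | x_{i-1}]` (0-based: the `i`-th sort of `X`
substituted along the first `i` entries of `f`). -/
noncomputable def subPre (X : PreCtx A) (f : List (Expr A)) (i : ℕ) (hi : i < X.length) :
    SortE A :=
  ((X[i]'hi).2).substL (mkSub (X.take i) (f.take i))

/-- Judgments: context judgments and the four kinds of standard judgments. -/
inductive Judg (A : Alphabet) : Type where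
  | ctx (X : PreCtx A)
  | sort (X : PreCtx A) (U : SortE A)
  | term (X : PreCtx A) (u : Expr A) (U : SortE A)
  | sortEq (X : PreCtx A) (U V : SortE A)
  | termEq (X : PreCtx A) (u v : Expr A) (U : SortE A)

/-- The context of a judgment. -/
def Judg.ctxOf : Judg A → PreCtx A
  | .ctx X => X
  | .sort X _ => X
  | .term X _ _ => X
  | .sortEq X _ _ => X
  | .termEq X _ _ _ => X

/-- The judgment introducing a sort symbol over the context `X`. -/
def introSort (X : PreCtx A) (S : A.SortSym) : Judg A := .sort X ⟨S, ctxVars X⟩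

/-- The judgment introducing a term symbol over the context `X`, with sort `U`. -/
def introTerm (X : PreCtx A) (t : A.TermSym) (U : SortE A) : Judg A :=
  .term X (.app t (ctxVars X)) U

/-- A set of axioms is a pretheory if: no axiom is a context judgment, every
axiom's context is a precontext, every sort symbol has a unique introducing sort
axiom and there are no other sort axioms, and likewise for term symbols. -/
structure IsPretheory (Ax : Set (Judg A)) : Prop where
  no_ctx : ∀ X : PreCtx A, Judg.ctx X ∉ Ax
  wf_ctx : ∀ J ∈ Ax, IsPreCtx J.ctxOf
  sort_intro : ∀ S : A.SortSym, ∃! X : PreCtx A, introSort X S ∈ Ax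
  sort_shape : ∀ (X : PreCtx A) (U : SortE A), Judg.sort X U ∈ Ax → U.args = ctxVars X
  term_intro : ∀ t : A.TermSym, ∃! p : PreCtx A × SortE A, introTerm p.1 t p.2 ∈ Ax
  term_shape : ∀ (X : PreCtx A) (u : Expr A) (U : SortE A), Judg.term X u U ∈ Ax →
      ∃ t : A.TermSym, u = Expr.app t (ctxVars X)

/-- One inference step of the paper's system: `Step Ax D J` holds when `J` is the
conclusion of an instance of one of the sixteen rules all of whose premises
satisfy `D`. -/
inductive Step (Ax : Set (Judg A)) (D : Judg A → Prop) : Judg A → Prop where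
  | ctx_nil : Step Ax D (.ctx [])
  | ctx_cons {X : PreCtx A} {U : SortE A} {x : A.Var}
      (hs : D (.sort X U)) (hfresh : ∀ p ∈ X, p.1 ≠ x)
      (hpre : IsPreCtx (X ++ [(x, U)])) :
      Step Ax D (.ctx (X ++ [(x, U)]))
  | s1 {X : PreCtx A} {U : SortE A} (h : D (.sort X U)) : Step Ax D (.sortEq X U U)
  | s2 {X : PreCtx A} {U V : SortE A} (h : D (.sortEq X U V)) : Step Ax D (.sortEq X V U)
  | s3 {X : PreCtx A} {U V W : SortE A}
      (h1 : D (.sortEq X U V)) (h2 : D (.sortEq X V W)) : Step Ax D (.sortEq X U W)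
  | t1 {X : PreCtx A} {u : Expr A} {U : SortE A}
      (h : D (.term X u U)) : Step Ax D (.termEq X u u U)
  | t2 {X : PreCtx A} {u v : Expr A} {U : SortE A}
      (h : D (.termEq X u v U)) : Step Ax D (.termEq X v u U)
  | t3 {X : PreCtx A} {u v w : Expr A} {U : SortE A}
      (h1 : D (.termEq X u v U)) (h2 : D (.termEq X v w U)) : Step Ax D (.termEq X u w U)
  | seqt {X : PreCtx A} {U U' : SortE A} {u : Expr A}
      (h1 : D (.sortEq X U U')) (h2 : D (.term X u U)) : Step Ax D (.term X u U')
  | seqteq {X : PreCtx A} {U U' : SortE A} {u u' : Expr A}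
      (h1 : D (.sortEq X U U')) (h2 : D (.termEq X u u' U))
      (h3 : D (.term X u U')) (h4 : D (.term X u' U')) : Step Ax D (.termEq X u u' U')
  | var {X : PreCtx A} {i : ℕ} (hi : i < X.length)
      (h : D (.sort X (X[i]'hi).2)) :
      Step Ax D (.term X (.var (X[i]'hi).1) (X[i]'hi).2)
  | sA {X : PreCtx A} {U : SortE A} (hax : Judg.sort X U ∈ Ax) (h : D (.ctx X))
      (hv : ∀ i (hi : i < X.length), D (.term X (.var (X[i]'hi).1) (X[i]'hi).2)) :
      Step Ax D (.sort X U)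
  | tA {X : PreCtx A} {u : Expr A} {U : SortE A} (hax : Judg.term X u U ∈ Ax)
      (h : D (.sort X U))
      (hv : ∀ i (hi : i < X.length), D (.term X (.var (X[i]'hi).1) (X[i]'hi).2)) :
      Step Ax D (.term X u U)
  | seqA {X : PreCtx A} {U U' : SortE A} (hax : Judg.sortEq X U U' ∈ Ax)
      (h1 : D (.sort X U)) (h2 : D (.sort X U')) : Step Ax D (.sortEq X U U')
  | teqA {X : PreCtx A} {u u' : Expr A} {U : SortE A} (hax : Judg.termEq X u u' U ∈ Ax)
      (h1 : D (.term X u U)) (h2 : D (.term X u' U)) : Step Ax D (.termEq X u u' U)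
  | sSub {X : PreCtx A} {S : A.SortSym} (hax : introSort X S ∈ Ax)
      {Y : PreCtx A} (hY : IsPreCtx Y) {f : List (Expr A)} (hlen : f.length = X.length)
      (hJ : D (introSort X S)) (hYc : D (.ctx Y))
      (hargs : ∀ i (hi : i < X.length) (hif : i < f.length),
        D (.term Y (f[i]'hif) (subPre X f i hi))) :
      Step Ax D (.sort Y ⟨S, f⟩)
  | tSub {X : PreCtx A} {t : A.TermSym} {U : SortE A} (hax : introTerm X t U ∈ Ax)
      {Y : PreCtx A} (hY : IsPreCtx Y) {f : List (Expr A)} (hlen : f.length = X.length)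
      (hJ : D (introTerm X t U))
      (hU : D (.sort Y (U.substL (mkSub X f))))
      (hargs : ∀ i (hi : i < X.length) (hif : i < f.length),
        D (.term Y (f[i]'hif) (subPre X f i hi))) :
      Step Ax D (.term Y (.app t f) (U.substL (mkSub X f)))
  | seqSub1 {X : PreCtx A} {U U' : SortE A} (hax : Judg.sortEq X U U' ∈ Ax)
      {Y : PreCtx A} (hY : IsPreCtx Y) {f : List (Expr A)} (hlen : f.length = X.length)
      (hJ : D (.sortEq X U U'))
      (h1 : D (.sort Y (U.substL (mkSub X f)))) (h2 : D (.sort Y (U'.substL (mkSub X f))))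
      (hargs : ∀ i (hi : i < X.length) (hif : i < f.length),
        D (.term Y (f[i]'hif) (subPre X f i hi))) :
      Step Ax D (.sortEq Y (U.substL (mkSub X f)) (U'.substL (mkSub X f)))
  | seqSub2 {X : PreCtx A} {S : A.SortSym} (hax : introSort X S ∈ Ax)
      {Y : PreCtx A} (hY : IsPreCtx Y) {f g : List (Expr A)}
      (hlf : f.length = X.length) (hlg : g.length = X.length)
      (hJ : D (introSort X S))
      (h1 : D (.sort Y ⟨S, f⟩)) (h2 : D (.sort Y ⟨S, g⟩))
      (hargs : ∀ i (hi : i < X.length) (hif : i < f.length) (hig : i < g.length),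
        D (.termEq Y (f[i]'hif) (g[i]'hig) (subPre X f i hi))) :
      Step Ax D (.sortEq Y ⟨S, f⟩ ⟨S, g⟩)
  | teqSub1 {X : PreCtx A} {u u' : Expr A} {U : SortE A}
      (hax : Judg.termEq X u u' U ∈ Ax)
      {Y : PreCtx A} (hY : IsPreCtx Y) {f : List (Expr A)} (hlen : f.length = X.length)
      (hJ : D (.termEq X u u' U))
      (h1 : D (.term Y (u.substL (mkSub X f)) (U.substL (mkSub X f))))
      (h2 : D (.term Y (u'.substL (mkSub X f)) (U.substL (mkSub X f))))
      (hargs : ∀ i (hi : i < X.length) (hif : i < f.length),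
        D (.term Y (f[i]'hif) (subPre X f i hi))) :
      Step Ax D (.termEq Y (u.substL (mkSub X f)) (u'.substL (mkSub X f))
        (U.substL (mkSub X f)))
  | teqSub2 {X : PreCtx A} {t : A.TermSym} {U : SortE A} (hax : introTerm X t U ∈ Ax)
      {Y : PreCtx A} (hY : IsPreCtx Y) {f g : List (Expr A)}
      (hlf : f.length = X.length) (hlg : g.length = X.length)
      (hJ : D (introTerm X t U))
      (h1 : D (.term Y (.app t f) (U.substL (mkSub X f))))
      (h2 : D (.term Y (.app t g) (U.substL (mkSub X f))))
      (hargs : ∀ i (hi : i < X.length) (hif : i < f.length) (hig : i < g.length),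
        D (.termEq Y (f[i]'hif) (g[i]'hig) (subPre X f i hi))) :
      Step Ax D (.termEq Y (.app t f) (.app t g) (U.substL (mkSub X f)))

/-- `DerAt Ax n J`: `J` is the conclusion of an inference step in the `n`-th stage
`𝒟ₙ` of the recursive construction of the derivable judgments. -/
def DerAt (Ax : Set (Judg A)) : ℕ → Judg A → Prop
  | 0, _ => False
  | n + 1, J => DerAt Ax n J ∨ Step Ax (DerAt Ax n) J

/-- A judgment is derivable if it is the conclusion of a step of some stage. -/
def Derivable (Ax : Set (Judg A)) (J : Judg A) : Prop := ∃ n, DerAt Ax n J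

/-- The height of a (derivable) judgment: the least stage at which it appears. -/
noncomputable def ht (Ax : Set (Judg A)) (J : Judg A) : ℕ := sInf {n | DerAt Ax n J}

/-- The height of a context: `0` for the empty context, and the height of
`∂X ⊢ Xₙ sort` otherwise. -/
noncomputable def htCtx (Ax : Set (Judg A)) (X : PreCtx A) : ℕ :=
  match X with
  | [] => 0
  | p :: X' =>
      ht Ax (.sort ((p :: X').dropLast) (((p :: X').getLast (List.cons_ne_nil p X')).2))

/-- A generalized algebraic theory: a pretheory all of whose axioms are derivable. -/
def IsGAT (Ax : Set (Judg A)) : Prop := IsPretheory Ax ∧ ∀ J ∈ Ax, Derivable Ax J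

/-- The partial term judgment `X ⊢ u term` is derivable. -/
def DerTerm (Ax : Set (Judg A)) (X : PreCtx A) (u : Expr A) : Prop :=
  ∃ U, Derivable Ax (.term X u U)

/-- The partial term equality judgment `X ⊢ u ≡ v term` is derivable. -/
def DerTermEq (Ax : Set (Judg A)) (X : PreCtx A) (u v : Expr A) : Prop :=
  ∃ U, Derivable Ax (.termEq X u v U)

/-- Height of a derivable partial term judgment: the minimum of the heights of
`X ⊢ u : U` over all `U`. -/
noncomputable def htTerm (Ax : Set (Judg A)) (X : PreCtx A) (u : Expr A) : ℕ :=
  sInf {n | ∃ U, DerAt Ax n (.term X u U)}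

/-- `f` is a context morphism from `X` to `Y`. -/
def IsMor (Ax : Set (Judg A)) (X Y : PreCtx A) (f : List (Expr A)) : Prop :=
  Derivable Ax (.ctx X) ∧ Derivable Ax (.ctx Y) ∧ f.length = Y.length ∧
  ∀ i (hi : i < Y.length) (hif : i < f.length),
    Derivable Ax (.term X (f[i]'hif) (subPre Y f i hi))

/-- The morphism equality `f ≡ g : X → Y` is derivable. -/
def MorEq (Ax : Set (Judg A)) (X Y : PreCtx A) (f g : List (Expr A)) : Prop :=
  IsMor Ax X Y f ∧ IsMor Ax X Y g ∧
  ∀ i (hi : i < Y.length) (hif : i < f.length) (hig : i < g.length),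
    Derivable Ax (.termEq X (f[i]'hif) (g[i]'hig) (subPre Y f i hi))

/-- The context equality `X ≡ Y ctx` is derivable. -/
def CtxEq (Ax : Set (Judg A)) (X Y : PreCtx A) : Prop :=
  X.length = Y.length ∧ Derivable Ax (.ctx X) ∧ Derivable Ax (.ctx Y) ∧
  ∀ i (hX : i < X.length) (hY : i < Y.length),
    Derivable Ax (.sortEq (X.take i) (X[i]'hX).2
      (((Y[i]'hY).2).substL (mkSub (Y.take i) (ctxVars (X.take i)))))

/-- Height of a context morphism. -/
noncomputable def htMor (Ax : Set (Judg A)) (X Y : PreCtx A) (f : List (Expr A)) : ℕ :=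
  max (htCtx Ax X) (max (htCtx Ax Y)
    ((Finset.range Y.length).sup fun i =>
      if h : i < Y.length ∧ i < f.length then
        ht Ax (.term X (f[i]'h.2) (subPre Y f i h.1))
      else 0))

/-- Height of a morphism equality. -/
noncomputable def htMorEq (Ax : Set (Judg A)) (X Y : PreCtx A) (f g : List (Expr A)) : ℕ :=
  max (htMor Ax X Y f) (max (htMor Ax X Y g)
    ((Finset.range Y.length).sup fun i =>
      if h : i < Y.length ∧ i < f.length ∧ i < g.length then
        ht Ax (.termEq X (f[i]'h.2.1) (g[i]'h.2.2) (subPre Y f i h.1))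
      else 0))

/-- The composite `g ∘ f` of tuples of term expressions, where `f : X → Y` and
`g : Y → Z`: the `i`-th entry is `gᵢ[f]`. -/
noncomputable def compMor (Y : PreCtx A) (f g : List (Expr A)) : List (Expr A) :=
  g.map fun e => e.substL (mkSub Y f)

/-- The canonical sort `𝒮(u)` of a term in a context (as a relation). -/
inductive CanonSort (Ax : Set (Judg A)) (X : PreCtx A) : Expr A → SortE A → Prop where
  | var {i : ℕ} (hi : i < X.length) : CanonSort Ax X (.var (X[i]'hi).1) (X[i]'hi).2
  | app {t : A.TermSym} {f : List (Expr A)} {Xa : PreCtx A} {V : SortE A}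
      (hax : introTerm Xa t V ∈ Ax) :
      CanonSort Ax X (.app t f) (V.substL (mkSub Xa f))


/-! ## The tensor product of generalized algebraic theories (§2 of the paper) -/

/-- The tensor product of two sort-and-term alphabets. -/
abbrev Alphabet.tensor (A B : Alphabet) : Alphabet :=
  { Var := A.Var × B.Var
    SortSym := A.SortSym × B.SortSym
    TermSym := (A.SortSym × B.TermSym) ⊕ (A.TermSym × B.SortSym)
    var_infinite := inferInstance
    var_countable := inferInstance }

/-- An input for the tensor term operations `⊗_t`, `●_t`: a derivable term judgment
`X ⊢ u : U` (notation `u^U`), or an augmented derivable sort judgment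
`(X ⊢ U sort, x)` (notation `x^U`), represented with `tm = var x`. -/
structure TArg (A : Alphabet) : Type where
  ctx : PreCtx A
  tm : Expr A
  srt : SortE A

/-- `L` is the lexicographically ordered `m × n` grid whose `(i,j)` entry is `M i j`. -/
def IsGrid {γ : Type} (m n : ℕ) (M : ℕ → ℕ → γ) (L : List γ) : Prop :=
  L.length = m * n ∧
  ∀ i j (hi : i < m) (hj : j < n) (h : i * n + j < L.length), L[i * n + j]'h = M i j

/-- Substitution pairs `[g 1 | x y₁, …, g n | x yₙ]` where the `yⱼ` are the
variables of `Y`. -/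
def pairsR (x : A.Var) (Y : PreCtx B) (g : ℕ → Expr (A.tensor B)) :
    List ((A.tensor B).Var × Expr (A.tensor B)) :=
  (List.finRange Y.length).map fun j => ((x, (Y.get j).1), g j.1)

/-- Substitution pairs `[g 1 | x₁ y, …, g m | x_m y]` where the `xᵢ` are the
variables of `X`. -/
def pairsL (X : PreCtx A) (y : B.Var) (g : ℕ → Expr (A.tensor B)) :
    List ((A.tensor B).Var × Expr (A.tensor B)) :=
  (List.finRange X.length).map fun i => (((X.get i).1, y), g i.1)

variable {A B : Alphabet}

/-- The graph of the tensor term operation on pairs of (augmented sort / term)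
judgments: `TTg TA TB false a b e` means `e = a ⊗_t b` and
`TTg TA TB true a b e` means `e = a ⊗*_t b` (the variant of §8 in which the two
defining substitution formulas for non-variable terms are interchanged). -/
inductive TTg (TA : Set (Judg A)) (TB : Set (Judg B)) :
    Bool → TArg A → TArg B → Expr (A.tensor B) → Prop where
  | varvar {b : Bool} {X : PreCtx A} {U : SortE A} {x : A.Var}
      {Y : PreCtx B} {V : SortE B} {y : B.Var} :
      TTg TA TB b ⟨X, .var x, U⟩ ⟨Y, .var y, V⟩ (.var (x, y))
  | varapp {b : Bool} {X : PreCtx A} {x : A.Var} {S : A.SortSym} {ss : List (Expr A)}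
      {Y : PreCtx B} {t : B.TermSym} {ts : List (Expr B)} {V : SortE B}
      (SS : ℕ → SortE A) (TSf : ℕ → SortE B)
      (hSS : ∀ i (hi : i < ss.length), CanonSort TA X (ss[i]'hi) (SS i))
      (hTS : ∀ j (hj : j < ts.length), CanonSort TB Y (ts[j]'hj) (TSf j))
      (M : ℕ → ℕ → Expr (A.tensor B)) (out : List (Expr (A.tensor B)))
      (hM : ∀ i (hi : i < ss.length), ∀ j (hj : j < ts.length),
          TTg TA TB b ⟨X, ss[i]'hi, SS i⟩ ⟨Y, ts[j]'hj, TSf j⟩ (M i j))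
      (hMx : ∀ j (hj : j < ts.length),
          TTg TA TB b ⟨X, .var x, ⟨S, ss⟩⟩ ⟨Y, ts[j]'hj, TSf j⟩ (M ss.length j))
      (hout : IsGrid (ss.length + 1) ts.length M out) :
      TTg TA TB b ⟨X, .var x, ⟨S, ss⟩⟩ ⟨Y, .app t ts, V⟩ (.app (Sum.inl (S, t)) out)
  | appvar {b : Bool} {X : PreCtx A} {s : A.TermSym} {ss : List (Expr A)} {U : SortE A}
      {Y : PreCtx B} {y : B.Var} {T : B.SortSym} {ts : List (Expr B)}
      (SS : ℕ → SortE A) (TSf : ℕ → SortE B)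
      (hSS : ∀ i (hi : i < ss.length), CanonSort TA X (ss[i]'hi) (SS i))
      (hTS : ∀ j (hj : j < ts.length), CanonSort TB Y (ts[j]'hj) (TSf j))
      (M : ℕ → ℕ → Expr (A.tensor B)) (out : List (Expr (A.tensor B)))
      (hM : ∀ i (hi : i < ss.length), ∀ j (hj : j < ts.length),
          TTg TA TB b ⟨X, ss[i]'hi, SS i⟩ ⟨Y, ts[j]'hj, TSf j⟩ (M i j))
      (hMy : ∀ i (hi : i < ss.length),
          TTg TA TB b ⟨X, ss[i]'hi, SS i⟩ ⟨Y, .var y, ⟨T, ts⟩⟩ (M i ts.length))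
      (hout : IsGrid ss.length (ts.length + 1) M out) :
      TTg TA TB b ⟨X, .app s ss, U⟩ ⟨Y, .var y, ⟨T, ts⟩⟩ (.app (Sum.inr (s, T)) out)
  | appapp_base {X : PreCtx A} {s : A.TermSym} {ss : List (Expr A)} {U : SortE A}
      {Y : PreCtx B} {t : B.TermSym} {ts : List (Expr B)} {V : SortE B} {x : A.Var}
      (hx : ∀ p ∈ X, p.1 ≠ x)
      (e0 : Expr (A.tensor B))
      (h0 : TTg TA TB false ⟨X, .var x, U⟩ ⟨Y, .app t ts, V⟩ e0)
      (g : ℕ → Expr (A.tensor B))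
      (hg : ∀ j (hj : j < Y.length),
          TTg TA TB false ⟨X, .app s ss, U⟩
            ⟨Y.take j, .var (Y[j]'hj).1, (Y[j]'hj).2⟩ (g j)) :
      TTg TA TB false ⟨X, .app s ss, U⟩ ⟨Y, .app t ts, V⟩ (e0.substL (pairsR x Y g))
  | appapp_star {X : PreCtx A} {s : A.TermSym} {ss : List (Expr A)} {U : SortE A}
      {Y : PreCtx B} {t : B.TermSym} {ts : List (Expr B)} {V : SortE B} {y : B.Var}
      (hy : ∀ p ∈ Y, p.1 ≠ y)
      (e0 : Expr (A.tensor B))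
      (h0 : TTg TA TB true ⟨X, .app s ss, U⟩ ⟨Y, .var y, V⟩ e0)
      (g : ℕ → Expr (A.tensor B))
      (hg : ∀ i (hi : i < X.length),
          TTg TA TB true ⟨X.take i, .var (X[i]'hi).1, (X[i]'hi).2⟩
            ⟨Y, .app t ts, V⟩ (g i)) :
      TTg TA TB true ⟨X, .app s ss, U⟩ ⟨Y, .app t ts, V⟩ (e0.substL (pairsL X y g))

/-- The graph of the operation `●_t` (flag `false`), resp. of `●*_t` (flag `true`). -/
inductive TTd (TA : Set (Judg A)) (TB : Set (Judg B)) :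
    Bool → TArg A → TArg B → Expr (A.tensor B) → Prop where
  | varL {b : Bool} {X : PreCtx A} {x : A.Var} {U : SortE A} {bArg : TArg B}
      {e : Expr (A.tensor B)}
      (h : TTg TA TB b ⟨X, .var x, U⟩ bArg e) : TTd TA TB b ⟨X, .var x, U⟩ bArg e
  | varR {b : Bool} {aArg : TArg A} {Y : PreCtx B} {y : B.Var} {V : SortE B}
      {e : Expr (A.tensor B)}
      (h : TTg TA TB b aArg ⟨Y, .var y, V⟩ e) : TTd TA TB b aArg ⟨Y, .var y, V⟩ e
  | appapp_base {X : PreCtx A} {s : A.TermSym} {ss : List (Expr A)} {U : SortE A}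
      {Y : PreCtx B} {t : B.TermSym} {ts : List (Expr B)} {V : SortE B} {y : B.Var}
      (hy : ∀ p ∈ Y, p.1 ≠ y)
      (e0 : Expr (A.tensor B))
      (h0 : TTg TA TB false ⟨X, .app s ss, U⟩ ⟨Y, .var y, V⟩ e0)
      (g : ℕ → Expr (A.tensor B))
      (hg : ∀ i (hi : i < X.length),
          TTg TA TB false ⟨X.take i, .var (X[i]'hi).1, (X[i]'hi).2⟩
            ⟨Y, .app t ts, V⟩ (g i)) :
      TTd TA TB false ⟨X, .app s ss, U⟩ ⟨Y, .app t ts, V⟩ (e0.substL (pairsL X y g))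
  | appapp_star {X : PreCtx A} {s : A.TermSym} {ss : List (Expr A)} {U : SortE A}
      {Y : PreCtx B} {t : B.TermSym} {ts : List (Expr B)} {V : SortE B} {x : A.Var}
      (hx : ∀ p ∈ X, p.1 ≠ x)
      (e0 : Expr (A.tensor B))
      (h0 : TTg TA TB true ⟨X, .var x, U⟩ ⟨Y, .app t ts, V⟩ e0)
      (g : ℕ → Expr (A.tensor B))
      (hg : ∀ j (hj : j < Y.length),
          TTg TA TB true ⟨X, .app s ss, U⟩
            ⟨Y.take j, .var (Y[j]'hj).1, (Y[j]'hj).2⟩ (g j)) :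
      TTd TA TB true ⟨X, .app s ss, U⟩ ⟨Y, .app t ts, V⟩ (e0.substL (pairsR x Y g))

/-- The graph of the tensor sort operation `⊗_s` (resp. `⊗*_s` for flag `true`):
`TSo TA TB b X x U Y y V W` means `W = U^x ⊗ V^y`. -/
inductive TSo (TA : Set (Judg A)) (TB : Set (Judg B)) :
    Bool → PreCtx A → A.Var → SortE A → PreCtx B → B.Var → SortE B →
    SortE (A.tensor B) → Prop where
  | mk {b : Bool} {X : PreCtx A} {x : A.Var} {S : A.SortSym} {ss : List (Expr A)}
      {Y : PreCtx B} {y : B.Var} {T : B.SortSym} {ts : List (Expr B)}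
      (hx : ∀ p ∈ X, p.1 ≠ x) (hy : ∀ p ∈ Y, p.1 ≠ y)
      (SS : ℕ → SortE A) (TSf : ℕ → SortE B)
      (hSS : ∀ i (hi : i < ss.length), CanonSort TA X (ss[i]'hi) (SS i))
      (hTS : ∀ j (hj : j < ts.length), CanonSort TB Y (ts[j]'hj) (TSf j))
      (M : ℕ → ℕ → Expr (A.tensor B)) (out : List (Expr (A.tensor B)))
      (hM : ∀ i (hi : i < ss.length), ∀ j (hj : j < ts.length),
          TTg TA TB b ⟨X, ss[i]'hi, SS i⟩ ⟨Y, ts[j]'hj, TSf j⟩ (M i j))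
      (hMx : ∀ j (hj : j < ts.length),
          TTg TA TB b ⟨X, .var x, ⟨S, ss⟩⟩ ⟨Y, ts[j]'hj, TSf j⟩ (M ss.length j))
      (hMy : ∀ i (hi : i < ss.length),
          TTg TA TB b ⟨X, ss[i]'hi, SS i⟩ ⟨Y, .var y, ⟨T, ts⟩⟩ (M i ts.length))
      (hout : IsGrid (ss.length + 1) (ts.length + 1) M out) :
      TSo TA TB b X x ⟨S, ss⟩ Y y ⟨T, ts⟩ ⟨(S, T), out.dropLast⟩

/-- The tensor precontext `Z = X ⊗ Y`, with entries `xᵢyⱼ : Xᵢ ⊗ Yⱼ` ordered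
lexicographically. -/
def TCtx (TA : Set (Judg A)) (TB : Set (Judg B)) (b : Bool)
    (X : PreCtx A) (Y : PreCtx B) (Z : PreCtx (A.tensor B)) : Prop :=
  Z.length = X.length * Y.length ∧
  ∀ i j (hi : i < X.length) (hj : j < Y.length) (h : i * Y.length + j < Z.length),
    (Z[i * Y.length + j]'h).1 = ((X[i]'hi).1, (Y[j]'hj).1) ∧
    TSo TA TB b (X.take i) (X[i]'hi).1 (X[i]'hi).2
      (Y.take j) (Y[j]'hj).1 (Y[j]'hj).2 (Z[i * Y.length + j]'h).2

/-- The graph of the tensor operation `⊙` on pairs of judgments of the admissible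
kinds of Table 1 (flag `false`), resp. of the interchanged operation `⊙*` of §8
(flag `true`).  `chA` and `chB` are the functions choosing, for each context, a
variable not occurring in it. -/
inductive TJudg (TA : Set (Judg A)) (TB : Set (Judg B))
    (chA : PreCtx A → A.Var) (chB : PreCtx B → B.Var) :
    Bool → Judg A → Judg B → Judg (A.tensor B) → Prop where
  /- sort ⊙ sort -/
  | ss {b : Bool} {X : PreCtx A} {U : SortE A} {Y : PreCtx B} {V : SortE B}
      {Z : PreCtx (A.tensor B)} {W : SortE (A.tensor B)}
      (hZ : TCtx TA TB b (X ++ [(chA X, U)]) (Y ++ [(chB Y, V)]) Z)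
      (hW : TSo TA TB b X (chA X) U Y (chB Y) V W) :
      TJudg TA TB chA chB b (.sort X U) (.sort Y V) (.sort Z.dropLast W)
  /- sort ⊙ term -/
  | st {b : Bool} {X : PreCtx A} {U : SortE A} {Y : PreCtx B} {v : Expr B} {V : SortE B}
      {Z : PreCtx (A.tensor B)} {e : Expr (A.tensor B)} {W : SortE (A.tensor B)}
      {g : ℕ → Expr (A.tensor B)}
      (hZ : TCtx TA TB b (X ++ [(chA X, U)]) Y Z)
      (he : TTg TA TB b ⟨X, .var (chA X), U⟩ ⟨Y, v, V⟩ e)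
      (hW : TSo TA TB b X (chA X) U Y (chB Y) V W)
      (hg : ∀ i (hi : i < X.length),
          TTg TA TB b ⟨X.take i, .var (X[i]'hi).1, (X[i]'hi).2⟩ ⟨Y, v, V⟩ (g i)) :
      TJudg TA TB chA chB b (.sort X U) (.term Y v V)
        (.term Z e (W.substL (pairsL X (chB Y) g)))
  /- term ⊙ sort -/
  | ts {b : Bool} {X : PreCtx A} {u : Expr A} {U : SortE A} {Y : PreCtx B} {V : SortE B}
      {Z : PreCtx (A.tensor B)} {e : Expr (A.tensor B)} {W : SortE (A.tensor B)}
      {g : ℕ → Expr (A.tensor B)}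
      (hZ : TCtx TA TB b X (Y ++ [(chB Y, V)]) Z)
      (he : TTg TA TB b ⟨X, u, U⟩ ⟨Y, .var (chB Y), V⟩ e)
      (hW : TSo TA TB b X (chA X) U Y (chB Y) V W)
      (hg : ∀ j (hj : j < Y.length),
          TTg TA TB b ⟨X, u, U⟩ ⟨Y.take j, .var (Y[j]'hj).1, (Y[j]'hj).2⟩ (g j)) :
      TJudg TA TB chA chB b (.term X u U) (.sort Y V)
        (.term Z e (W.substL (pairsR (chA X) Y g)))
  /- term ⊙ term -/
  | tt {b : Bool} {X : PreCtx A} {u : Expr A} {U : SortE A}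
      {Y : PreCtx B} {v : Expr B} {V : SortE B}
      {Z : PreCtx (A.tensor B)} {e1 e2 : Expr (A.tensor B)} {W : SortE (A.tensor B)}
      {gx gy : ℕ → Expr (A.tensor B)}
      (hZ : TCtx TA TB b X Y Z)
      (he1 : TTg TA TB b ⟨X, u, U⟩ ⟨Y, v, V⟩ e1)
      (he2 : TTd TA TB b ⟨X, u, U⟩ ⟨Y, v, V⟩ e2)
      (hW : TSo TA TB b X (chA X) U Y (chB Y) V W)
      (hgx : ∀ i (hi : i < X.length),
          TTg TA TB b ⟨X.take i, .var (X[i]'hi).1, (X[i]'hi).2⟩ ⟨Y, v, V⟩ (gx i))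
      (hgy : ∀ j (hj : j < Y.length),
          TTg TA TB b ⟨X, u, U⟩ ⟨Y.take j, .var (Y[j]'hj).1, (Y[j]'hj).2⟩ (gy j)) :
      TJudg TA TB chA chB b (.term X u U) (.term Y v V)
        (.termEq Z e1 e2 (W.substL (pairsL X (chB Y) gx ++ pairsR (chA X) Y gy)))
  /- sort ⊙ sort equality -/
  | sseq {b : Bool} {X : PreCtx A} {U : SortE A} {Y : PreCtx B} {V V' : SortE B}
      {Z : PreCtx (A.tensor B)} {W W' : SortE (A.tensor B)}
      (hZ : TCtx TA TB b (X ++ [(chA X, U)]) (Y ++ [(chB Y, V)]) Z)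
      (hW : TSo TA TB b X (chA X) U Y (chB Y) V W)
      (hW' : TSo TA TB b X (chA X) U Y (chB Y) V' W') :
      TJudg TA TB chA chB b (.sort X U) (.sortEq Y V V') (.sortEq Z.dropLast W W')
  /- sort equality ⊙ sort -/
  | seqs {b : Bool} {X : PreCtx A} {U U' : SortE A} {Y : PreCtx B} {V : SortE B}
      {Z : PreCtx (A.tensor B)} {W W' : SortE (A.tensor B)}
      (hZ : TCtx TA TB b (X ++ [(chA X, U)]) (Y ++ [(chB Y, V)]) Z)
      (hW : TSo TA TB b X (chA X) U Y (chB Y) V W)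
      (hW' : TSo TA TB b X (chA X) U' Y (chB Y) V W') :
      TJudg TA TB chA chB b (.sortEq X U U') (.sort Y V) (.sortEq Z.dropLast W W')
  /- sort ⊙ term equality -/
  | steq {b : Bool} {X : PreCtx A} {U : SortE A} {Y : PreCtx B} {v v' : Expr B}
      {V : SortE B} {Z : PreCtx (A.tensor B)} {e e' : Expr (A.tensor B)}
      {W : SortE (A.tensor B)} {g : ℕ → Expr (A.tensor B)}
      (hZ : TCtx TA TB b (X ++ [(chA X, U)]) Y Z)
      (he : TTg TA TB b ⟨X, .var (chA X), U⟩ ⟨Y, v, V⟩ e)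
      (he' : TTg TA TB b ⟨X, .var (chA X), U⟩ ⟨Y, v', V⟩ e')
      (hW : TSo TA TB b X (chA X) U Y (chB Y) V W)
      (hg : ∀ i (hi : i < X.length),
          TTg TA TB b ⟨X.take i, .var (X[i]'hi).1, (X[i]'hi).2⟩ ⟨Y, v, V⟩ (g i)) :
      TJudg TA TB chA chB b (.sort X U) (.termEq Y v v' V)
        (.termEq Z e e' (W.substL (pairsL X (chB Y) g)))
  /- term equality ⊙ sort -/
  | teqs {b : Bool} {X : PreCtx A} {u u' : Expr A} {U : SortE A} {Y : PreCtx B}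
      {V : SortE B} {Z : PreCtx (A.tensor B)} {e e' : Expr (A.tensor B)}
      {W : SortE (A.tensor B)} {g : ℕ → Expr (A.tensor B)}
      (hZ : TCtx TA TB b X (Y ++ [(chB Y, V)]) Z)
      (he : TTg TA TB b ⟨X, u, U⟩ ⟨Y, .var (chB Y), V⟩ e)
      (he' : TTg TA TB b ⟨X, u', U⟩ ⟨Y, .var (chB Y), V⟩ e')
      (hW : TSo TA TB b X (chA X) U Y (chB Y) V W)
      (hg : ∀ j (hj : j < Y.length),
          TTg TA TB b ⟨X, u, U⟩ ⟨Y.take j, .var (Y[j]'hj).1, (Y[j]'hj).2⟩ (g j)) :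
      TJudg TA TB chA chB b (.termEq X u u' U) (.sort Y V)
        (.termEq Z e e' (W.substL (pairsR (chA X) Y g)))
  /- sort equality ⊙ term -/
  | seqt {b : Bool} {X : PreCtx A} {U U' : SortE A} {Y : PreCtx B} {v : Expr B}
      {V : SortE B} {Z : PreCtx (A.tensor B)} {e e' : Expr (A.tensor B)}
      {W : SortE (A.tensor B)} {g : ℕ → Expr (A.tensor B)}
      (hZ : TCtx TA TB b (X ++ [(chA X, U)]) Y Z)
      (he : TTg TA TB b ⟨X, .var (chA X), U⟩ ⟨Y, v, V⟩ e)
      (he' : TTg TA TB b ⟨X, .var (chA X), U'⟩ ⟨Y, v, V⟩ e')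
      (hW : TSo TA TB b X (chA X) U Y (chB Y) V W)
      (hg : ∀ i (hi : i < X.length),
          TTg TA TB b ⟨X.take i, .var (X[i]'hi).1, (X[i]'hi).2⟩ ⟨Y, v, V⟩ (g i)) :
      TJudg TA TB chA chB b (.sortEq X U U') (.term Y v V)
        (.termEq Z e e' (W.substL (pairsL X (chB Y) g)))
  /- term ⊙ sort equality -/
  | tseq {b : Bool} {X : PreCtx A} {u : Expr A} {U : SortE A} {Y : PreCtx B}
      {V V' : SortE B} {Z : PreCtx (A.tensor B)} {e e' : Expr (A.tensor B)}
      {W : SortE (A.tensor B)} {g : ℕ → Expr (A.tensor B)}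
      (hZ : TCtx TA TB b X (Y ++ [(chB Y, V)]) Z)
      (he : TTg TA TB b ⟨X, u, U⟩ ⟨Y, .var (chB Y), V⟩ e)
      (he' : TTg TA TB b ⟨X, u, U⟩ ⟨Y, .var (chB Y), V'⟩ e')
      (hW : TSo TA TB b X (chA X) U Y (chB Y) V W)
      (hg : ∀ j (hj : j < Y.length),
          TTg TA TB b ⟨X, u, U⟩ ⟨Y.take j, .var (Y[j]'hj).1, (Y[j]'hj).2⟩ (g j)) :
      TJudg TA TB chA chB b (.term X u U) (.sortEq Y V V')
        (.termEq Z e e' (W.substL (pairsR (chA X) Y g)))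

/-- A choice, for every precontext, of a variable not contained in it. -/
def FreshCh {A : Alphabet} (ch : PreCtx A → A.Var) : Prop :=
  ∀ X : PreCtx A, ∀ p ∈ X, p.1 ≠ ch X

/-- The set of axioms of the pretheory `𝔸 ⊗ 𝔹`: the judgments `J ⊙ J'` for `J` an
axiom of `𝔸` and `J'` an axiom of `𝔹`. -/
def tensorAx (TA : Set (Judg A)) (TB : Set (Judg B))
    (chA : PreCtx A → A.Var) (chB : PreCtx B → B.Var) : Set (Judg (A.tensor B)) :=
  {K | ∃ J J', J ∈ TA ∧ J' ∈ TB ∧ TJudg TA TB chA chB false J J' K}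

/-- The pair `(𝔸, 𝔹)` is `h`-derivable: `J ⊙ J'` is derivable in the pretheory
`𝔸 ⊗ 𝔹` whenever `J`, `J'` are derivable judgments of `𝔸`, `𝔹` (of admissible
kinds) with `ht J * ht J' ≤ h`. -/
def hDerivable (TA : Set (Judg A)) (TB : Set (Judg B))
    (chA : PreCtx A → A.Var) (chB : PreCtx B → B.Var) (h : ℕ) : Prop :=
  ∀ (J : Judg A) (J' : Judg B) (K : Judg (A.tensor B)),
    Derivable TA J → Derivable TB J' → ht TA J * ht TB J' ≤ h →
    TJudg TA TB chA chB false J J' K → Derivable (tensorAx TA TB chA chB) K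

/-- The tensor `out = f ⊗ g` of two tuples of derivable terms, each entry being
the tensor of terms taken at their canonical sorts, ordered lexicographically. -/
def TMor (TA : Set (Judg A)) (TB : Set (Judg B)) (b : Bool)
    (X : PreCtx A) (f : List (Expr A)) (Y : PreCtx B) (g : List (Expr B))
    (out : List (Expr (A.tensor B))) : Prop :=
  out.length = f.length * g.length ∧
  ∀ i j (hi : i < f.length) (hj : j < g.length) (h : i * g.length + j < out.length),
    ∃ U V, CanonSort TA X (f[i]'hi) U ∧ CanonSort TB Y (g[j]'hj) V ∧
      TTg TA TB b ⟨X, f[i]'hi, U⟩ ⟨Y, g[j]'hj, V⟩ (out[i * g.length + j]'h)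

/-- The tensor `out = f ⊗ Y` of a tuple of derivable terms of `𝔸` with a context
of `𝔹`: entries `fᵢ^{𝒮(fᵢ)} ⊗ yⱼ^{Yⱼ}`. -/
def TMorCtx (TA : Set (Judg A)) (TB : Set (Judg B)) (b : Bool)
    (X : PreCtx A) (f : List (Expr A)) (Y : PreCtx B)
    (out : List (Expr (A.tensor B))) : Prop :=
  out.length = f.length * Y.length ∧
  ∀ i j (hi : i < f.length) (hj : j < Y.length) (h : i * Y.length + j < out.length),
    ∃ U, CanonSort TA X (f[i]'hi) U ∧
      TTg TA TB b ⟨X, f[i]'hi, U⟩ ⟨Y.take j, .var (Y[j]'hj).1, (Y[j]'hj).2⟩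
        (out[i * Y.length + j]'h)

/-- The tensor `out = X ⊗ g` of a context of `𝔸` with a tuple of derivable terms
of `𝔹`: entries `xᵢ^{Xᵢ} ⊗ gⱼ^{𝒮(gⱼ)}`. -/
def TCtxMor (TA : Set (Judg A)) (TB : Set (Judg B)) (b : Bool)
    (X : PreCtx A) (Y : PreCtx B) (g : List (Expr B))
    (out : List (Expr (A.tensor B))) : Prop :=
  out.length = X.length * g.length ∧
  ∀ i j (hi : i < X.length) (hj : j < g.length) (h : i * g.length + j < out.length),
    ∃ V, CanonSort TB Y (g[j]'hj) V ∧
      TTg TA TB b ⟨X.take i, .var (X[i]'hi).1, (X[i]'hi).2⟩ ⟨Y, g[j]'hj, V⟩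
        (out[i * g.length + j]'h)

/-- The tensor `out = (x₁,…,x_m,u^U) ⊗ Y` of the section determined by a term
`X ⊢ u : U` with a context of `𝔹`. -/
def TSecL (TA : Set (Judg A)) (TB : Set (Judg B)) (b : Bool)
    (X : PreCtx A) (u : Expr A) (U : SortE A) (Y : PreCtx B)
    (out : List (Expr (A.tensor B))) : Prop :=
  out.length = (X.length + 1) * Y.length ∧
  (∀ i j (hi : i < X.length) (hj : j < Y.length) (h : i * Y.length + j < out.length),
      TTg TA TB b ⟨X.take i, .var (X[i]'hi).1, (X[i]'hi).2⟩
        ⟨Y.take j, .var (Y[j]'hj).1, (Y[j]'hj).2⟩ (out[i * Y.length + j]'h)) ∧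
  (∀ j (hj : j < Y.length) (h : X.length * Y.length + j < out.length),
      TTg TA TB b ⟨X, u, U⟩ ⟨Y.take j, .var (Y[j]'hj).1, (Y[j]'hj).2⟩
        (out[X.length * Y.length + j]'h))

/-- The tensor `out = X ⊗ (y₁,…,yₙ,v^V)` of a context of `𝔸` with the section
determined by a term `Y ⊢ v : V` of `𝔹`. -/
def TSecR (TA : Set (Judg A)) (TB : Set (Judg B)) (b : Bool)
    (X : PreCtx A) (Y : PreCtx B) (v : Expr B) (V : SortE B)
    (out : List (Expr (A.tensor B))) : Prop :=
  out.length = X.length * (Y.length + 1) ∧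
  (∀ i j (hi : i < X.length) (hj : j < Y.length)
      (h : i * (Y.length + 1) + j < out.length),
      TTg TA TB b ⟨X.take i, .var (X[i]'hi).1, (X[i]'hi).2⟩
        ⟨Y.take j, .var (Y[j]'hj).1, (Y[j]'hj).2⟩ (out[i * (Y.length + 1) + j]'h)) ∧
  (∀ i (hi : i < X.length) (h : i * (Y.length + 1) + Y.length < out.length),
      TTg TA TB b ⟨X.take i, .var (X[i]'hi).1, (X[i]'hi).2⟩ ⟨Y, v, V⟩
        (out[i * (Y.length + 1) + Y.length]'h))

section
variable {A B : Alphabet}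

/-! ## Expressions and substitution -/

theorem Expr.induct {P : Expr A → Prop} (hv : ∀ x, P (.var x))
    (ha : ∀ t es, (∀ e ∈ es, P e) → P (.app t es)) : ∀ e, P e
  | .var x => hv x
  | .app t es => ha t es fun e _ => Expr.induct hv ha e
termination_by e => sizeOf e
decreasing_by
  have := List.sizeOf_lt_of_mem ‹_›
  simp only [Expr.app.sizeOf_spec]
  omega

@[simp] theorem Expr.subst_var' (σ : A.Var → Expr A) (x : A.Var) :
    (Expr.var x).subst σ = σ x := by rw [Expr.subst]

@[simp] theorem Expr.subst_app (σ : A.Var → Expr A) (t : A.TermSym) (es : List (Expr A)) :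
    (Expr.app t es).subst σ = .app t (es.map (Expr.subst σ)) := by
  rw [Expr.subst]; simp

@[simp] theorem occurs_var {x y : A.Var} : Occurs x (Expr.var y) ↔ x = y :=
  ⟨fun h => by cases h; rfl, fun h => h ▸ .var⟩

@[simp] theorem occurs_app {x : A.Var} {t : A.TermSym} {es : List (Expr A)} :
    Occurs x (Expr.app t es) ↔ ∃ e ∈ es, Occurs x e :=
  ⟨fun h => by cases h with | app h1 h2 => exact ⟨_, h1, h2⟩, fun ⟨_, h1, h2⟩ => .app h1 h2⟩

theorem Expr.subst_congr {σ τ : A.Var → Expr A} {e : Expr A} :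
    (∀ x, Occurs x e → σ x = τ x) → e.subst σ = e.subst τ := by
  induction e using Expr.induct with
  | hv x => intro h; simpa using h x (by simp)
  | ha t es ih =>
    intro h
    simp only [Expr.subst_app, Expr.app.injEq, true_and]
    exact List.map_congr_left fun e he => ih e he fun x hx => h x (.app he hx)

theorem Expr.subst_subst (σ τ : A.Var → Expr A) (e : Expr A) :
    (e.subst σ).subst τ = e.subst fun x => (σ x).subst τ := by
  induction e using Expr.induct with
  | hv x => simp
  | ha t es ih => simpa using ih

@[simp] theorem Expr.subst_id (e : Expr A) : e.subst Expr.var = e := by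
  induction e using Expr.induct with
  | hv x => simp
  | ha t es ih =>
    simp only [Expr.subst_app, Expr.app.injEq, true_and]
    conv_rhs => rw [← List.map_id es]
    exact List.map_congr_left ih

@[simp] theorem SortE.subst_head (σ : A.Var → Expr A) (U : SortE A) :
    (U.subst σ).head = U.head := rfl

@[simp] theorem SortE.subst_args (σ : A.Var → Expr A) (U : SortE A) :
    (U.subst σ).args = U.args.map (Expr.subst σ) := rfl

theorem SortE.subst_mk (σ : A.Var → Expr A) (S : A.SortSym) (es : List (Expr A)) :
    (SortE.mk S es).subst σ = ⟨S, es.map (Expr.subst σ)⟩ := rfl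

theorem SortE.ext' {U V : SortE A} (h1 : U.head = V.head) (h2 : U.args = V.args) : U = V := by
  cases U; cases V; simp_all

theorem SortE.subst_congr {σ τ : A.Var → Expr A} {U : SortE A}
    (h : ∀ x, SOccurs x U → σ x = τ x) : U.subst σ = U.subst τ :=
  SortE.ext' rfl (List.map_congr_left fun e he =>
    Expr.subst_congr fun x hx => h x ⟨e, he, hx⟩)

theorem SortE.subst_subst (σ τ : A.Var → Expr A) (U : SortE A) :
    (U.subst σ).subst τ = U.subst fun x => (σ x).subst τ :=
  SortE.ext' rfl (by simp [Expr.subst_subst])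

@[simp] theorem SortE.subst_id (U : SortE A) : U.subst Expr.var = U :=
  SortE.ext' rfl (by
    conv_rhs => rw [← List.map_id U.args]
    exact List.map_congr_left fun e _ => by simp)

/-! ## Precontexts -/

/-- The variables of a precontext. -/
abbrev keys (X : PreCtx A) : List A.Var := X.map Prod.fst

/-- Precontexts with pairwise distinct variables, each sort being scoped in the preceding ones. -/
def Good (X : PreCtx A) : Prop := (keys X).Nodup ∧ IsPreCtx X

theorem mem_keys {X : PreCtx A} {p : A.Var × SortE A} (h : p ∈ X) : p.1 ∈ keys X :=
  List.mem_map_of_mem h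

theorem exists_of_mem_keys {X : PreCtx A} {x : A.Var} (h : x ∈ keys X) : ∃ U, (x, U) ∈ X := by
  obtain ⟨⟨_, U⟩, h', rfl⟩ := List.mem_map.1 h
  exact ⟨U, h'⟩

theorem isPreCtx_iff {X : PreCtx A} : IsPreCtx X ↔
    ∀ X1 p X2, X = X1 ++ p :: X2 → ∀ v, SOccurs v p.2 → v ∈ keys X1 := by
  constructor
  · rintro h X1 p X2 rfl v hv
    have := h X1.length (by simp) v (by simpa using hv)
    simpa using this
  · intro h i hi v hv
    exact h (X.take i) X[i] (X.drop (i + 1)) (by simp) v hv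

theorem IsPreCtx.front {X Y : PreCtx A} (h : IsPreCtx (X ++ Y)) : IsPreCtx X := by
  rw [isPreCtx_iff] at *
  rintro X1 p X2 rfl
  exact h X1 p (X2 ++ Y) (by simp)

theorem Good.front {X Y : PreCtx A} (h : Good (X ++ Y)) : Good X := by
  refine ⟨?_, h.2.front⟩
  have := h.1
  simp only [keys, List.map_append] at this
  exact this.of_append_left

theorem Good.nil : Good ([] : PreCtx A) := ⟨by simp, fun i hi => absurd hi (by simp)⟩

theorem Good.snoc_iff {X : PreCtx A} {p : A.Var × SortE A} :
    Good (X ++ [p]) ↔ Good X ∧ p.1 ∉ keys X ∧ ∀ v, SOccurs v p.2 → v ∈ keys X := by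
  constructor
  · intro h
    refine ⟨h.front, ?_, fun v hv => (isPreCtx_iff.1 h.2) X p [] rfl v hv⟩
    have := h.1
    simp only [keys, List.map_append, List.map_cons, List.map_nil] at this
    exact fun hm => List.disjoint_of_nodup_append this hm (by simp)
  · rintro ⟨h1, h2, h3⟩
    refine ⟨?_, ?_⟩
    · simp only [keys, List.map_append, List.map_cons, List.map_nil]
      rw [List.nodup_append]
      refine ⟨h1.1, by simp, ?_⟩
      rintro a ha b hb rfl
      simp only [List.mem_singleton] at hb
      exact h2 (hb ▸ ha)
    · rw [isPreCtx_iff]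
      intro X1 q X2 he v hv
      rcases List.eq_nil_or_concat X2 with rfl | ⟨L, b, rfl⟩
      · obtain ⟨rfl, hq⟩ := List.append_inj' he rfl
        simp only [List.cons.injEq, and_true] at hq
        exact h3 v (hq ▸ hv)
      · have : X ++ [p] = (X1 ++ q :: L) ++ [b] := by rw [he]; simp
        obtain ⟨rfl, -⟩ := List.append_inj' this rfl
        exact (isPreCtx_iff.1 h1.2) X1 q L rfl v hv

theorem Good.scoped {X : PreCtx A} (h : Good X) {p : A.Var × SortE A} (hp : p ∈ X) {v : A.Var}
    (hv : SOccurs v p.2) : v ∈ keys X := by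
  obtain ⟨X1, X2, rfl⟩ := List.append_of_mem hp
  have := (isPreCtx_iff.1 h.2) X1 p X2 rfl v hv
  simp only [keys, List.map_append, List.mem_append]
  exact Or.inl this

theorem Good.unique {X : PreCtx A} (h : Good X) {x : A.Var} {U V : SortE A} (h1 : (x, U) ∈ X)
    (h2 : (x, V) ∈ X) : U = V := by
  have := List.inj_on_of_nodup_map h.1 h1 h2 rfl
  simpa using this

/-! ## Lookup -/

theorem lookupV_zip_map (σ : A.Var → Expr A) (l : List A.Var) {x : A.Var} (hx : x ∈ l) :
    lookupV (l.zip (l.map σ)) x = σ x := by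
  induction l with
  | nil => simp at hx
  | cons a l ih =>
    simp only [List.map_cons, List.zip_cons_cons, lookupV]
    split_ifs with h
    · exact h ▸ rfl
    · exact ih (by simpa [Ne.symm h] using hx)

theorem lookupV_append_left {l l' : List (A.Var × Expr A)} {x : A.Var}
    (hx : x ∈ l.map Prod.fst) : lookupV (l ++ l') x = lookupV l x := by
  induction l with
  | nil => simp at hx
  | cons a l ih =>
    simp only [List.cons_append, lookupV]
    split_ifs with h
    · rfl
    · exact ih (by
        rw [List.map_cons, List.mem_cons] at hx
        exact hx.resolve_left (Ne.symm h))

theorem lookupV_append_right {l l' : List (A.Var × Expr A)} {x : A.Var}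
    (hx : x ∉ l.map Prod.fst) : lookupV (l ++ l') x = lookupV l' x := by
  induction l with
  | nil => simp
  | cons a l ih =>
    simp only [List.map_cons, List.mem_cons, not_or] at hx
    simp only [List.cons_append, lookupV, if_neg (Ne.symm hx.1)]
    exact ih hx.2

theorem lookupV_of_not_mem {l : List (A.Var × Expr A)} {x : A.Var}
    (hx : x ∉ l.map Prod.fst) : lookupV l x = .var x := by
  simpa [lookupV] using lookupV_append_right (l' := []) hx

/-- The substitution function determined by a context and a tuple. -/
noncomputable def sub (X : PreCtx A) (f : List (Expr A)) : A.Var → Expr A := lookupV (mkSub X f)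

theorem sub_map (X : PreCtx A) (σ : A.Var → Expr A) {x : A.Var} (hx : x ∈ keys X) :
    sub X (X.map fun p => σ p.1) x = σ x := by
  have := lookupV_zip_map σ (keys X) hx
  simpa [sub, mkSub, Function.comp_def] using this

theorem sub_getElem {X : PreCtx A} (hX : (keys X).Nodup) {f : List (Expr A)}
    {i : ℕ} (hi : i < X.length) (hif : i < f.length) : sub X f (X[i]).1 = f[i] := by
  induction X generalizing f i with
  | nil => simp at hi
  | cons p X ih =>
    cases f with
    | nil => simp at hif
    | cons a f =>
      simp only [keys, List.map_cons, List.nodup_cons] at hX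
      simp only [sub, mkSub, List.map_cons, List.zip_cons_cons, lookupV]
      cases i with
      | zero => simp
      | succ i =>
        simp only [List.length_cons, Nat.add_lt_add_iff_right] at hi hif
        simp only [List.getElem_cons_succ]
        rw [if_neg]
        · exact ih hX.2 hi hif
        · intro h
          exact hX.1 (h ▸ mem_keys (List.getElem_mem hi))

theorem map_sub {X : PreCtx A} (hX : (keys X).Nodup) {f : List (Expr A)}
    (hl : f.length = X.length) : (X.map fun p => sub X f p.1) = f := by
  apply List.ext_getElem (by simp [hl])
  intro i h1 h2
  simp only [List.getElem_map]
  exact sub_getElem hX (by simpa using h1) h2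

theorem mkSub_take (X : PreCtx A) (f : List (Expr A)) (i : ℕ) :
    mkSub (X.take i) (f.take i) = (mkSub X f).take i := by
  simp [mkSub, List.map_take, List.take_zipWith, List.zip]

theorem subPre_eq {X : PreCtx A} (hX : IsPreCtx X) {f : List (Expr A)}
    (hl : f.length = X.length) {i : ℕ} (hi : i < X.length) :
    subPre X f i hi = (X[i]).2.subst (sub X f) := by
  unfold subPre SortE.substL
  refine SortE.subst_congr fun v hv => ?_
  have hm := hX i hi v hv
  rw [mkSub_take]
  unfold sub
  conv_rhs => rw [← List.take_append_drop i (mkSub X f)]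
  refine (lookupV_append_left ?_).symm
  rw [List.map_take, show (mkSub X f).map Prod.fst = X.map Prod.fst from ?_, ← List.map_take]
  · exact hm
  · unfold mkSub
    rw [List.map_fst_zip]
    simp [hl]

theorem args_iff {X : PreCtx A} (hX : Good X) {f : List (Expr A)} (hl : f.length = X.length)
    {Q : Expr A → SortE A → Prop} :
    (∀ i (hi : i < X.length) (hif : i < f.length), Q (f[i]'hif) (subPre X f i hi)) ↔
      ∀ p ∈ X, Q (sub X f p.1) (p.2.subst (sub X f)) := by
  constructor
  · intro h p hp
    obtain ⟨i, hi, rfl⟩ := List.mem_iff_getElem.1 hp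
    have := h i hi (hl ▸ hi)
    rwa [subPre_eq hX.2 hl, ← sub_getElem hX.1 hi (hl ▸ hi)] at this
  · intro h i hi hif
    rw [subPre_eq hX.2 hl, ← sub_getElem hX.1 hi hif]
    exact h _ (List.getElem_mem hi)

theorem args_iff₂ {X : PreCtx A} (hX : Good X) {f g : List (Expr A)} (hl : f.length = X.length)
    (hl' : g.length = X.length) {Q : Expr A → Expr A → SortE A → Prop} :
    (∀ i (hi : i < X.length) (hif : i < f.length) (hig : i < g.length),
        Q (f[i]'hif) (g[i]'hig) (subPre X f i hi)) ↔
      ∀ p ∈ X, Q (sub X f p.1) (sub X g p.1) (p.2.subst (sub X f)) := by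
  constructor
  · intro h p hp
    obtain ⟨i, hi, rfl⟩ := List.mem_iff_getElem.1 hp
    have := h i hi (hl ▸ hi) (hl' ▸ hi)
    rwa [subPre_eq hX.2 hl, ← sub_getElem hX.1 hi (hl ▸ hi),
      ← sub_getElem hX.1 hi (hl' ▸ hi)] at this
  · intro h i hi hif hig
    rw [subPre_eq hX.2 hl, ← sub_getElem hX.1 hi hif, ← sub_getElem hX.1 hi hig]
    exact h _ (List.getElem_mem hi)

/-! ## A functional presentation of derivability -/

/-- Standard judgments without their context. -/
inductive CJ (A : Alphabet) : Type where
  | sort (U : SortE A)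
  | term (u : Expr A) (U : SortE A)
  | sortEq (U V : SortE A)
  | termEq (u v : Expr A) (U : SortE A)

/-- The standard judgment with the given context. -/
def CJ.toJudg (X : PreCtx A) : CJ A → Judg A
  | .sort U => .sort X U
  | .term u U => .term X u U
  | .sortEq U V => .sortEq X U V
  | .termEq u v U => .termEq X u v U

/-- The context-free part of the substitution of a judgment. -/
def CJ.subst (σ : A.Var → Expr A) : CJ A → CJ A
  | .sort U => .sort (U.subst σ)
  | .term u U => .term (u.subst σ) (U.subst σ)
  | .sortEq U V => .sortEq (U.subst σ) (V.subst σ)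
  | .termEq u v U => .termEq (u.subst σ) (v.subst σ) (U.subst σ)

/-- The image of the variables of a context under a function. -/
abbrev imgs (X : PreCtx A) (σ : A.Var → Expr A) : List (Expr A) := X.map fun p => σ p.1

/-- Derivability of standard judgments, substitutions being given by functions and
well-formedness of the ambient context being left implicit. -/
inductive Der (T : Set (Judg A)) : PreCtx A → CJ A → Prop where
  | s1 {X : PreCtx A} {U : SortE A} (h : Der T X (.sort U)) : Der T X (.sortEq U U)
  | s2 {X : PreCtx A} {U V : SortE A} (h : Der T X (.sortEq U V)) : Der T X (.sortEq V U)
  | s3 {X : PreCtx A} {U V W : SortE A} (h : Der T X (.sortEq U V))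
      (h' : Der T X (.sortEq V W)) : Der T X (.sortEq U W)
  | t1 {X : PreCtx A} {u : Expr A} {U : SortE A} (h : Der T X (.term u U)) :
      Der T X (.termEq u u U)
  | t2 {X : PreCtx A} {u v : Expr A} {U : SortE A} (h : Der T X (.termEq u v U)) :
      Der T X (.termEq v u U)
  | t3 {X : PreCtx A} {u v w : Expr A} {U : SortE A} (h : Der T X (.termEq u v U))
      (h' : Der T X (.termEq v w U)) : Der T X (.termEq u w U)
  | conv {X : PreCtx A} {u : Expr A} {U V : SortE A} (h : Der T X (.sortEq U V))
      (h' : Der T X (.term u U)) : Der T X (.term u V)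
  | econv {X : PreCtx A} {u v : Expr A} {U V : SortE A} (h : Der T X (.sortEq U V))
      (h' : Der T X (.termEq u v U)) (h1 : Der T X (.term u V)) (h2 : Der T X (.term v V)) :
      Der T X (.termEq u v V)
  | var {X : PreCtx A} {x : A.Var} {U : SortE A} (hx : (x, U) ∈ X) (h : Der T X (.sort U)) :
      Der T X (.term (.var x) U)
  | sort {X Xa : PreCtx A} {S : A.SortSym} {σ : A.Var → Expr A} (hax : introSort Xa S ∈ T)
      (hg : Good Xa) (hc : ∀ X1 p X2, Xa = X1 ++ p :: X2 → Der T X1 (.sort p.2))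
      (ha : ∀ p ∈ Xa, Der T X (.term (σ p.1) (p.2.subst σ))) :
      Der T X (.sort ⟨S, imgs Xa σ⟩)
  | term {X Xa : PreCtx A} {t : A.TermSym} {V : SortE A} {σ : A.Var → Expr A}
      (hax : introTerm Xa t V ∈ T)
      (hg : Good Xa) (hc : ∀ X1 p X2, Xa = X1 ++ p :: X2 → Der T X1 (.sort p.2))
      (hV : Der T Xa (.sort V)) (ha : ∀ p ∈ Xa, Der T X (.term (σ p.1) (p.2.subst σ)))
      (h : Der T X (.sort (V.subst σ))) :
      Der T X (.term (.app t (imgs Xa σ)) (V.subst σ))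
  | sax {X Xa : PreCtx A} {U V : SortE A} {σ : A.Var → Expr A} (hax : Judg.sortEq Xa U V ∈ T)
      (hg : Good Xa) (hc : ∀ X1 p X2, Xa = X1 ++ p :: X2 → Der T X1 (.sort p.2))
      (hU : Der T Xa (.sort U)) (hV : Der T Xa (.sort V))
      (ha : ∀ p ∈ Xa, Der T X (.term (σ p.1) (p.2.subst σ)))
      (h1 : Der T X (.sort (U.subst σ))) (h2 : Der T X (.sort (V.subst σ))) :
      Der T X (.sortEq (U.subst σ) (V.subst σ))
  | scong {X Xa : PreCtx A} {S : A.SortSym} {σ τ : A.Var → Expr A} (hax : introSort Xa S ∈ T)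
      (hg : Good Xa) (hc : ∀ X1 p X2, Xa = X1 ++ p :: X2 → Der T X1 (.sort p.2))
      (ha : ∀ p ∈ Xa, Der T X (.termEq (σ p.1) (τ p.1) (p.2.subst σ)))
      (h1 : Der T X (.sort ⟨S, imgs Xa σ⟩)) (h2 : Der T X (.sort ⟨S, imgs Xa τ⟩)) :
      Der T X (.sortEq ⟨S, imgs Xa σ⟩ ⟨S, imgs Xa τ⟩)
  | tax {X Xa : PreCtx A} {u v : Expr A} {U : SortE A} {σ : A.Var → Expr A}
      (hax : Judg.termEq Xa u v U ∈ T)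
      (hg : Good Xa) (hc : ∀ X1 p X2, Xa = X1 ++ p :: X2 → Der T X1 (.sort p.2))
      (hu : Der T Xa (.term u U)) (hv : Der T Xa (.term v U))
      (ha : ∀ p ∈ Xa, Der T X (.term (σ p.1) (p.2.subst σ)))
      (h1 : Der T X (.term (u.subst σ) (U.subst σ)))
      (h2 : Der T X (.term (v.subst σ) (U.subst σ))) :
      Der T X (.termEq (u.subst σ) (v.subst σ) (U.subst σ))
  | tcong {X Xa : PreCtx A} {t : A.TermSym} {V : SortE A} {σ τ : A.Var → Expr A}
      (hax : introTerm Xa t V ∈ T)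
      (hg : Good Xa) (hc : ∀ X1 p X2, Xa = X1 ++ p :: X2 → Der T X1 (.sort p.2))
      (hV : Der T Xa (.sort V))
      (ha : ∀ p ∈ Xa, Der T X (.termEq (σ p.1) (τ p.1) (p.2.subst σ)))
      (h1 : Der T X (.term (.app t (imgs Xa σ)) (V.subst σ)))
      (h2 : Der T X (.term (.app t (imgs Xa τ)) (V.subst σ))) :
      Der T X (.termEq (.app t (imgs Xa σ)) (.app t (imgs Xa τ)) (V.subst σ))

variable {T : Set (Judg A)}

/-- Well-formed contexts, relative to a notion of derivability of sorts. -/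
def LC (D : PreCtx A → CJ A → Prop) (X : PreCtx A) : Prop :=
  Good X ∧ ∀ X1 p X2, X = X1 ++ p :: X2 → D X1 (.sort p.2)

theorem LC.nil (D : PreCtx A → CJ A → Prop) : LC D [] :=
  ⟨Good.nil, fun X1 p X2 h => by simp at h⟩

theorem LC.front {D : PreCtx A → CJ A → Prop} {X Y : PreCtx A} (h : LC D (X ++ Y)) : LC D X :=
  ⟨h.1.front, fun X1 p X2 he => h.2 X1 p (X2 ++ Y) (by rw [he]; simp)⟩

theorem LC.snoc_iff {D : PreCtx A → CJ A → Prop} {X : PreCtx A} {p : A.Var × SortE A} :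
    LC D (X ++ [p]) ↔ LC D X ∧ D X (.sort p.2) ∧ p.1 ∉ keys X ∧
      ∀ v, SOccurs v p.2 → v ∈ keys X := by
  constructor
  · intro h
    exact ⟨h.front, h.2 X p [] rfl, (Good.snoc_iff.1 h.1).2⟩
  · rintro ⟨h1, h2, h3⟩
    refine ⟨Good.snoc_iff.2 ⟨h1.1, h3⟩, fun X1 q X2 he => ?_⟩
    rcases List.eq_nil_or_concat X2 with rfl | ⟨L, b, rfl⟩
    · obtain ⟨rfl, hq⟩ := List.append_inj' he rfl
      simp only [List.cons.injEq, and_true] at hq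
      exact hq ▸ h2
    · have : X ++ [p] = (X1 ++ q :: L) ++ [b] := by rw [he]; simp
      obtain ⟨rfl, -⟩ := List.append_inj' this rfl
      exact h1.2 X1 q L rfl

theorem LC.mono {D D' : PreCtx A → CJ A → Prop} (h : ∀ X U, D X (.sort U) → D' X (.sort U))
    {X : PreCtx A} (hX : LC D X) : LC D' X :=
  ⟨hX.1, fun X1 p X2 he => h _ _ (hX.2 X1 p X2 he)⟩

theorem imgs_subst (X : PreCtx A) (σ τ : A.Var → Expr A) :
    (imgs X σ).map (Expr.subst τ) = imgs X fun x => (σ x).subst τ := by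
  simp [imgs, Function.comp_def]

theorem imgs_var (X : PreCtx A) : imgs X Expr.var = ctxVars X := rfl

theorem imgs_congr {X : PreCtx A} {σ τ : A.Var → Expr A} (h : ∀ p ∈ X, σ p.1 = τ p.1) :
    imgs X σ = imgs X τ := List.map_congr_left h

/-! ## Presuppositions -/

/-- The presuppositions of a judgment. -/
def CJ.Presup (D : PreCtx A → CJ A → Prop) (X : PreCtx A) : CJ A → Prop
  | .sort U => True
  | .term u U => D X (.sort U)
  | .sortEq U V => D X (.sort U) ∧ D X (.sort V)
  | .termEq u v U => D X (.term u U) ∧ D X (.term v U)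

theorem Der.presup {X : PreCtx A} {j : CJ A} (h : Der T X j) : j.Presup (Der T) X := by
  induction h with
  | s1 h => exact ⟨h, h⟩
  | s2 _ ih => exact ⟨ih.2, ih.1⟩
  | s3 _ _ ih ih' => exact ⟨ih.1, ih'.2⟩
  | t1 h => exact ⟨h, h⟩
  | t2 _ ih => exact ⟨ih.2, ih.1⟩
  | t3 _ _ ih ih' => exact ⟨ih.1, ih'.2⟩
  | conv _ _ ih => exact ih.2
  | econv _ _ h1 h2 => exact ⟨h1, h2⟩
  | var _ h => exact h
  | sort => trivial
  | term _ _ _ _ _ h => exact h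
  | sax _ _ _ _ _ _ h1 h2 => exact ⟨h1, h2⟩
  | scong _ _ _ _ h1 h2 => exact ⟨h1, h2⟩
  | tax _ _ _ _ _ _ h1 h2 => exact ⟨h1, h2⟩
  | tcong _ _ _ _ _ h1 h2 => exact ⟨h1, h2⟩

theorem Der.econv' {X : PreCtx A} {u v : Expr A} {U V : SortE A} (h : Der T X (.sortEq U V))
    (h' : Der T X (.termEq u v U)) : Der T X (.termEq u v V) :=
  .econv h h' (.conv h h'.presup.1) (.conv h h'.presup.2)

/-! ## Substitution -/

/-- Functional context morphisms. -/
def SMor (D : PreCtx A → CJ A → Prop) (Z X : PreCtx A) (σ : A.Var → Expr A) : Prop :=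
  ∀ p ∈ X, D Z (.term (σ p.1) (p.2.subst σ))

theorem Der.subst {X Z : PreCtx A} {j : CJ A} {σ : A.Var → Expr A} (h : Der T X j)
    (hσ : SMor (Der T) Z X σ) : Der T Z (j.subst σ) := by
  induction h with
  | s1 _ ih => exact .s1 (ih hσ)
  | s2 _ ih => exact .s2 (ih hσ)
  | s3 _ _ ih ih' => exact .s3 (ih hσ) (ih' hσ)
  | t1 _ ih => exact .t1 (ih hσ)
  | t2 _ ih => exact .t2 (ih hσ)
  | t3 _ _ ih ih' => exact .t3 (ih hσ) (ih' hσ)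
  | conv _ _ ih ih' => exact .conv (ih hσ) (ih' hσ)
  | econv _ _ _ _ ih ih' ih1 ih2 => exact .econv (ih hσ) (ih' hσ) (ih1 hσ) (ih2 hσ)
  | var hx _ ih => simpa [CJ.subst] using hσ _ hx
  | sort hax hg hc ha ihc iha =>
    simp only [CJ.subst, SortE.subst_mk, imgs_subst]
    exact .sort hax hg hc fun p hp => by
      simpa [CJ.subst, SortE.subst_subst] using iha p hp hσ
  | term hax hg hc hV ha h ihc ihV iha ih =>
    simp only [CJ.subst, SortE.subst_subst, imgs_subst, Expr.subst_app] at ih ⊢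
    exact .term hax hg hc hV (fun p hp => by
      simpa [CJ.subst, SortE.subst_subst] using iha p hp hσ) (ih hσ)
  | sax hax hg hc hU hV ha h1 h2 ihc ihU ihV iha ih1 ih2 =>
    simp only [CJ.subst, SortE.subst_subst] at ih1 ih2 ⊢
    exact .sax hax hg hc hU hV (fun p hp => by
      simpa [CJ.subst, SortE.subst_subst] using iha p hp hσ) (ih1 hσ) (ih2 hσ)
  | scong hax hg hc ha h1 h2 ihc iha ih1 ih2 =>
    simp only [CJ.subst, SortE.subst_mk, imgs_subst] at ih1 ih2 ⊢
    exact .scong hax hg hc (fun p hp => by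
      simpa [CJ.subst, SortE.subst_subst] using iha p hp hσ) (ih1 hσ) (ih2 hσ)
  | tax hax hg hc hU hV ha h1 h2 ihc ihU ihV iha ih1 ih2 =>
    simp only [CJ.subst, SortE.subst_subst, Expr.subst_subst] at ih1 ih2 ⊢
    exact .tax hax hg hc hU hV (fun p hp => by
      simpa [CJ.subst, SortE.subst_subst] using iha p hp hσ) (ih1 hσ) (ih2 hσ)
  | tcong hax hg hc hV ha h1 h2 ihc ihV iha ih1 ih2 =>
    simp only [CJ.subst, SortE.subst_subst, imgs_subst, Expr.subst_app] at ih1 ih2 ⊢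
    exact .tcong hax hg hc hV (fun p hp => by
      simpa [CJ.subst, SortE.subst_subst] using iha p hp hσ) (ih1 hσ) (ih2 hσ)

theorem Der.weaken {X Z : PreCtx A} {j : CJ A} (h : Der T X j) (hXZ : X ⊆ Z) : Der T Z j := by
  induction h with
  | s1 _ ih => exact .s1 (ih hXZ)
  | s2 _ ih => exact .s2 (ih hXZ)
  | s3 _ _ ih ih' => exact .s3 (ih hXZ) (ih' hXZ)
  | t1 _ ih => exact .t1 (ih hXZ)
  | t2 _ ih => exact .t2 (ih hXZ)
  | t3 _ _ ih ih' => exact .t3 (ih hXZ) (ih' hXZ)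
  | conv _ _ ih ih' => exact .conv (ih hXZ) (ih' hXZ)
  | econv _ _ _ _ ih ih' ih1 ih2 => exact .econv (ih hXZ) (ih' hXZ) (ih1 hXZ) (ih2 hXZ)
  | var hx _ ih => exact .var (hXZ hx) (ih hXZ)
  | sort hax hg hc ha ihc iha => exact .sort hax hg hc fun p hp => iha p hp hXZ
  | term hax hg hc hV ha h ihc ihV iha ih =>
    exact .term hax hg hc hV (fun p hp => iha p hp hXZ) (ih hXZ)
  | sax hax hg hc hU hV ha h1 h2 ihc ihU ihV iha ih1 ih2 =>
    exact .sax hax hg hc hU hV (fun p hp => iha p hp hXZ) (ih1 hXZ) (ih2 hXZ)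
  | scong hax hg hc ha h1 h2 ihc iha ih1 ih2 =>
    exact .scong hax hg hc (fun p hp => iha p hp hXZ) (ih1 hXZ) (ih2 hXZ)
  | tax hax hg hc hU hV ha h1 h2 ihc ihU ihV iha ih1 ih2 =>
    exact .tax hax hg hc hU hV (fun p hp => iha p hp hXZ) (ih1 hXZ) (ih2 hXZ)
  | tcong hax hg hc hV ha h1 h2 ihc ihV iha ih1 ih2 =>
    exact .tcong hax hg hc hV (fun p hp => iha p hp hXZ) (ih1 hXZ) (ih2 hXZ)

theorem LC.sort_of_mem {X : PreCtx A} (hX : LC (Der T) X) {p : A.Var × SortE A} (hp : p ∈ X) :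
    Der T X (.sort p.2) := by
  obtain ⟨X1, X2, rfl⟩ := List.append_of_mem hp
  exact (hX.2 X1 p X2 rfl).weaken (by simp)

theorem LC.var_of_mem {X : PreCtx A} (hX : LC (Der T) X) {p : A.Var × SortE A} (hp : p ∈ X) :
    Der T X (.term (.var p.1) p.2) := .var hp (hX.sort_of_mem hp)

/-! ## Congruence of substitution -/

/-- Pointwise equality of two functional context morphisms. -/
def SEq (D : PreCtx A → CJ A → Prop) (Z X : PreCtx A) (σ τ : A.Var → Expr A) : Prop :=
  ∀ p ∈ X, D Z (.termEq (σ p.1) (τ p.1) (p.2.subst σ))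

/-- The judgments expressing that a judgment is respected by a pair of substitutions. -/
def CJ.Cong (D : PreCtx A → CJ A → Prop) (Z : PreCtx A) (σ τ : A.Var → Expr A) : CJ A → Prop
  | .sort U => D Z (.sortEq (U.subst σ) (U.subst τ))
  | .term u U => D Z (.termEq (u.subst σ) (u.subst τ) (U.subst σ))
  | .sortEq U V => D Z (.sortEq (U.subst σ) (U.subst τ)) ∧ D Z (.sortEq (V.subst σ) (V.subst τ))
  | .termEq u v U => True

theorem Der.cong {X Z : PreCtx A} {j : CJ A} {σ τ : A.Var → Expr A} (h : Der T X j)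
    (hσ : SMor (Der T) Z X σ) (hτ : SMor (Der T) Z X τ) (he : SEq (Der T) Z X σ τ) :
    j.Cong (Der T) Z σ τ := by
  induction h with
  | s1 _ ih => exact ⟨ih hσ hτ he, ih hσ hτ he⟩
  | s2 _ ih => exact ⟨(ih hσ hτ he).2, (ih hσ hτ he).1⟩
  | s3 _ _ ih ih' => exact ⟨(ih hσ hτ he).1, (ih' hσ hτ he).2⟩
  | t1 _ ih => trivial
  | t2 _ ih => trivial
  | t3 _ _ ih ih' => trivial
  | conv h h' ih ih' => exact .econv' (h.subst hσ) (ih' hσ hτ he)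
  | econv => trivial
  | var hx _ ih => simpa [CJ.Cong] using he _ hx
  | sort hax hg hc ha ihc iha =>
    have h1 := (Der.sort hax hg hc ha).subst hσ
    have h2 := (Der.sort hax hg hc ha).subst hτ
    simp only [CJ.subst, CJ.Cong, SortE.subst_mk, imgs_subst] at h1 h2 ⊢
    exact .scong hax hg hc (fun p hp => by
      simpa [CJ.Cong, SortE.subst_subst] using iha p hp hσ hτ he) h1 h2
  | term hax hg hc hV ha h ihc ihV iha ih =>
    have h1 := (Der.term hax hg hc hV ha h).subst hσ
    have h2 := (Der.term hax hg hc hV ha h).subst hτ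
    have h3 := ih hσ hτ he
    simp only [CJ.subst, CJ.Cong, SortE.subst_subst, imgs_subst, Expr.subst_app] at h1 h2 h3 ⊢
    exact .tcong hax hg hc hV (fun p hp => by
      simpa [CJ.Cong, SortE.subst_subst] using iha p hp hσ hτ he) h1 (.conv (.s2 h3) h2)
  | sax hax hg hc hU hV ha h1 h2 ihc ihU ihV iha ih1 ih2 => exact ⟨ih1 hσ hτ he, ih2 hσ hτ he⟩
  | scong hax hg hc ha h1 h2 ihc iha ih1 ih2 => exact ⟨ih1 hσ hτ he, ih2 hσ hτ he⟩
  | tax hax hg hc hU hV ha h1 h2 ihc ihU ihV iha ih1 ih2 => trivial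
  | tcong hax hg hc hV ha h1 h2 ihc ihV iha ih1 ih2 => trivial

/-- One-sided form: a function pointwise equal to a context morphism is one itself. -/
theorem SMor.of_seq {X Z : PreCtx A} {σ τ : A.Var → Expr A} (hX : LC (Der T) X)
    (hτ : SMor (Der T) Z X τ)
    (he : ∀ p ∈ X, Der T Z (.termEq (σ p.1) (τ p.1) (p.2.subst τ))) :
    SMor (Der T) Z X σ ∧ SEq (Der T) Z X σ τ := by
  suffices H : ∀ X, LC (Der T) X → SMor (Der T) Z X τ →
      (∀ p ∈ X, Der T Z (.termEq (σ p.1) (τ p.1) (p.2.subst τ))) →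
      SMor (Der T) Z X σ ∧ SEq (Der T) Z X σ τ from H X hX hτ he
  clear hX hτ he X
  intro X
  induction X using List.reverseRecOn with
  | nil => intro _ _ _; exact ⟨fun p hp => by simp at hp, fun p hp => by simp at hp⟩
  | append_singleton X p ih =>
    intro hX hτ he
    obtain ⟨hX', hs, -⟩ := LC.snoc_iff.1 hX
    have hτ' : SMor (Der T) Z X τ := fun q hq => hτ q (by simp [hq])
    obtain ⟨h1, h2⟩ := ih hX' hτ' fun q hq => he q (by simp [hq])
    have h3 : Der T Z (.sortEq (p.2.subst σ) (p.2.subst τ)) := hs.cong h1 hτ' h2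
    have h4 := Der.econv' (.s2 h3) (he p (by simp))
    refine ⟨fun q hq => ?_, fun q hq => ?_⟩ <;>
      simp only [List.mem_append, List.mem_singleton] at hq <;>
      rcases hq with hq | rfl
    · exact h1 q hq
    · exact h4.presup.1
    · exact h2 q hq
    · exact h4

/-! ## Monotonicity -/

end

section
variable {A B : Alphabet} {T : Set (Judg A)}

/-! ## Comparison of the two presentations -/

/-- Every variable of the judgment lies in the given list. -/
def CJ.ScopedIn (l : List A.Var) : CJ A → Prop
  | .sort U => ∀ v, SOccurs v U → v ∈ l
  | .term u U => (∀ v, Occurs v u → v ∈ l) ∧ ∀ v, SOccurs v U → v ∈ l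
  | .sortEq U V => (∀ v, SOccurs v U → v ∈ l) ∧ ∀ v, SOccurs v V → v ∈ l
  | .termEq u w U => (∀ v, Occurs v u → v ∈ l) ∧ (∀ v, Occurs v w → v ∈ l) ∧
      ∀ v, SOccurs v U → v ∈ l

theorem Der.scoped {X : PreCtx A} {j : CJ A} (h : Der T X j) : j.ScopedIn (keys X) := by
  induction h with
  | s1 _ ih => exact ⟨ih, ih⟩
  | s2 _ ih => exact ⟨ih.2, ih.1⟩
  | s3 _ _ ih ih' => exact ⟨ih.1, ih'.2⟩
  | t1 _ ih => exact ⟨ih.1, ih.1, ih.2⟩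
  | t2 _ ih => exact ⟨ih.2.1, ih.1, ih.2.2⟩
  | t3 _ _ ih ih' => exact ⟨ih.1, ih'.2⟩
  | conv _ _ ih ih' => exact ⟨ih'.1, ih.2⟩
  | econv _ _ _ _ ih ih' ih1 ih2 => exact ⟨ih1.1, ih2⟩
  | var hx _ ih =>
    refine ⟨fun v hv => ?_, ih⟩
    rw [occurs_var] at hv
    exact hv ▸ mem_keys hx
  | sort hax hg hc ha ihc iha =>
    rintro v ⟨e, he, hv⟩
    obtain ⟨p, hp, rfl⟩ := List.mem_map.1 he
    exact (iha p hp).1 v hv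
  | term hax hg hc hV ha h ihc ihV iha ih =>
    refine ⟨fun v hv => ?_, ih⟩
    rw [occurs_app] at hv
    obtain ⟨e, he, hv⟩ := hv
    obtain ⟨p, hp, rfl⟩ := List.mem_map.1 he
    exact (iha p hp).1 v hv
  | sax hax hg hc hU hV ha h1 h2 ihc ihU ihV iha ih1 ih2 => exact ⟨ih1, ih2⟩
  | scong hax hg hc ha h1 h2 ihc iha ih1 ih2 => exact ⟨ih1, ih2⟩
  | tax hax hg hc hU hV ha h1 h2 ihc ihU ihV iha ih1 ih2 => exact ⟨ih1.1, ih2⟩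
  | tcong hax hg hc hV ha h1 h2 ihc ihV iha ih1 ih2 => exact ⟨ih1.1, ih2⟩

theorem DerAt.mono {n m : ℕ} (hnm : n ≤ m) {J : Judg A} (h : DerAt T n J) : DerAt T m J := by
  induction hnm with
  | refl => exact h
  | step _ ih => exact Or.inl ih

theorem Step.mono {D D' : Judg A → Prop} (hD : ∀ J, D J → D' J) {J : Judg A}
    (h : Step T D J) : Step T D' J := by
  cases h with
  | ctx_nil => exact .ctx_nil
  | ctx_cons hs hf hp => exact .ctx_cons (hD _ hs) hf hp
  | s1 h => exact .s1 (hD _ h)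
  | s2 h => exact .s2 (hD _ h)
  | s3 h h' => exact .s3 (hD _ h) (hD _ h')
  | t1 h => exact .t1 (hD _ h)
  | t2 h => exact .t2 (hD _ h)
  | t3 h h' => exact .t3 (hD _ h) (hD _ h')
  | seqt h h' => exact .seqt (hD _ h) (hD _ h')
  | seqteq h1 h2 h3 h4 => exact .seqteq (hD _ h1) (hD _ h2) (hD _ h3) (hD _ h4)
  | var hi h => exact .var hi (hD _ h)
  | sA hax h hv => exact .sA hax (hD _ h) fun i hi => hD _ (hv i hi)
  | tA hax h hv => exact .tA hax (hD _ h) fun i hi => hD _ (hv i hi)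
  | seqA hax h h' => exact .seqA hax (hD _ h) (hD _ h')
  | teqA hax h h' => exact .teqA hax (hD _ h) (hD _ h')
  | sSub hax hY hl hJ hc ha => exact .sSub hax hY hl (hD _ hJ) (hD _ hc) fun i a b => hD _ (ha i a b)
  | tSub hax hY hl hJ hc ha => exact .tSub hax hY hl (hD _ hJ) (hD _ hc) fun i a b => hD _ (ha i a b)
  | seqSub1 hax hY hl hJ h1 h2 ha =>
    exact .seqSub1 hax hY hl (hD _ hJ) (hD _ h1) (hD _ h2) fun i a b => hD _ (ha i a b)
  | seqSub2 hax hY hl hl' hJ h1 h2 ha =>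
    exact .seqSub2 hax hY hl hl' (hD _ hJ) (hD _ h1) (hD _ h2) fun i a b c => hD _ (ha i a b c)
  | teqSub1 hax hY hl hJ h1 h2 ha =>
    exact .teqSub1 hax hY hl (hD _ hJ) (hD _ h1) (hD _ h2) fun i a b => hD _ (ha i a b)
  | teqSub2 hax hY hl hl' hJ h1 h2 ha =>
    exact .teqSub2 hax hY hl hl' (hD _ hJ) (hD _ h1) (hD _ h2) fun i a b c => hD _ (ha i a b c)

theorem Derivable.induct {P : Judg A → Prop} (hP : ∀ J, Step T P J → P J) {J : Judg A}
    (h : Derivable T J) : P J := by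
  obtain ⟨n, h⟩ := h
  induction n generalizing J with
  | zero => exact h.elim
  | succ n ih => exact h.elim ih fun h => hP J (h.mono fun K hK => ih hK)

theorem exists_stage_of_finset {ι : Type} (s : Finset ι) {P : ι → ℕ → Prop}
    (hP : ∀ i n m, n ≤ m → P i n → P i m) (h : ∀ i ∈ s, ∃ n, P i n) :
    ∃ n, ∀ i ∈ s, P i n := by
  classical
  choose! f hf using h
  exact ⟨s.sup f, fun i hi => hP i _ _ (Finset.le_sup hi) (hf i hi)⟩

theorem exists_stage_lt {L : ℕ} {P : ℕ → ℕ → Prop}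
    (hP : ∀ i n m, n ≤ m → P i n → P i m) (h : ∀ i, i < L → ∃ n, P i n) :
    ∃ n, ∀ i, i < L → P i n := by
  obtain ⟨n, hn⟩ := exists_stage_of_finset (Finset.range L) hP (by simpa using h)
  exact ⟨n, by simpa using hn⟩

theorem DerAt.family {L : ℕ} {Q : ℕ → Judg A → Prop}
    (h : ∀ i, i < L → ∀ J, Q i J → Derivable T J) (hQ : ∀ i J J', Q i J → Q i J' → J = J') :
    ∃ n, ∀ i, i < L → ∀ J, Q i J → DerAt T n J := by
  refine exists_stage_lt (P := fun i n => ∀ J, Q i J → DerAt T n J)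
    (fun i n m hnm h J hJ => (h J hJ).mono hnm) fun i hi => ?_
  by_cases hex : ∃ J, Q i J
  · obtain ⟨J, hJ⟩ := hex
    obtain ⟨n, hn⟩ := h i hi J hJ
    exact ⟨n, fun J' hJ' => hQ i J J' hJ hJ' ▸ hn⟩
  · exact ⟨0, fun J hJ => (hex ⟨J, hJ⟩).elim⟩

theorem Derivable.of_stage {n : ℕ} {J : Judg A} (h : Step T (DerAt T n) J) : Derivable T J :=
  ⟨n + 1, Or.inr h⟩

theorem Derivable.step {J : Judg A} (h : Step T (Derivable T) J) : Derivable T J := by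
  suffices H : ∃ n, Step T (DerAt T n) J from H.elim fun n hn => .of_stage hn
  have up1 : ∀ {n : ℕ} (m : ℕ) {K : Judg A}, DerAt T n K → DerAt T (n + m) K :=
    fun m _ h => h.mono (by omega)
  have up2 : ∀ {n : ℕ} (m : ℕ) {K : Judg A}, DerAt T n K → DerAt T (m + n) K :=
    fun m _ h => h.mono (by omega)
  cases h with
  | ctx_nil => exact ⟨0, .ctx_nil⟩
  | ctx_cons hs hf hp => obtain ⟨n, hs⟩ := hs; exact ⟨n, .ctx_cons hs hf hp⟩
  | s1 h => obtain ⟨n, h⟩ := h; exact ⟨n, .s1 h⟩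
  | s2 h => obtain ⟨n, h⟩ := h; exact ⟨n, .s2 h⟩
  | s3 h h' => obtain ⟨n, h⟩ := h; obtain ⟨m, h'⟩ := h'; exact ⟨n + m, .s3 (up1 _ h) (up2 _ h')⟩
  | t1 h => obtain ⟨n, h⟩ := h; exact ⟨n, .t1 h⟩
  | t2 h => obtain ⟨n, h⟩ := h; exact ⟨n, .t2 h⟩
  | t3 h h' => obtain ⟨n, h⟩ := h; obtain ⟨m, h'⟩ := h'; exact ⟨n + m, .t3 (up1 _ h) (up2 _ h')⟩
  | seqt h h' =>
    obtain ⟨n, h⟩ := h; obtain ⟨m, h'⟩ := h'; exact ⟨n + m, .seqt (up1 _ h) (up2 _ h')⟩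
  | seqteq h1 h2 h3 h4 =>
    obtain ⟨n1, h1⟩ := h1
    obtain ⟨n2, h2⟩ := h2
    obtain ⟨n3, h3⟩ := h3
    obtain ⟨n4, h4⟩ := h4
    exact ⟨(n1 + n2) + (n3 + n4), .seqteq (up1 _ (up1 _ h1)) (up1 _ (up2 _ h2))
      (up2 _ (up1 _ h3)) (up2 _ (up2 _ h4))⟩
  | var hi h => obtain ⟨n, h⟩ := h; exact ⟨n, .var hi h⟩
  | @sA X U hax h hv =>
    obtain ⟨n, h⟩ := h
    obtain ⟨m, hv⟩ := DerAt.family (T := T) (Q := fun i J => ∃ hi : i < X.length,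
      J = .term X (.var (X[i]'hi).1) (X[i]'hi).2)
      (by rintro i - _ ⟨hi, rfl⟩; exact hv i hi) (by rintro i _ _ ⟨_, rfl⟩ ⟨_, rfl⟩; rfl)
    exact ⟨n + m, .sA hax (up1 _ h) fun i hi => up2 _ (hv i hi _ ⟨hi, rfl⟩)⟩
  | @tA X u U hax h hv =>
    obtain ⟨n, h⟩ := h
    obtain ⟨m, hv⟩ := DerAt.family (T := T) (Q := fun i J => ∃ hi : i < X.length,
      J = .term X (.var (X[i]'hi).1) (X[i]'hi).2)
      (by rintro i - _ ⟨hi, rfl⟩; exact hv i hi) (by rintro i _ _ ⟨_, rfl⟩ ⟨_, rfl⟩; rfl)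
    exact ⟨n + m, .tA hax (up1 _ h) fun i hi => up2 _ (hv i hi _ ⟨hi, rfl⟩)⟩
  | seqA hax h h' =>
    obtain ⟨n, h⟩ := h; obtain ⟨m, h'⟩ := h'; exact ⟨n + m, .seqA hax (up1 _ h) (up2 _ h')⟩
  | teqA hax h h' =>
    obtain ⟨n, h⟩ := h; obtain ⟨m, h'⟩ := h'; exact ⟨n + m, .teqA hax (up1 _ h) (up2 _ h')⟩
  | @sSub X S hax Y hY f hl hJ hc ha =>
    obtain ⟨n1, h1⟩ := hJ
    obtain ⟨n2, h2⟩ := hc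
    obtain ⟨m, hv⟩ := DerAt.family (T := T) (Q := fun i J => ∃ (hi : i < X.length)
      (hif : i < f.length), J = .term Y (f[i]'hif) (subPre X f i hi))
      (by rintro i - _ ⟨hi, hif, rfl⟩; exact ha i hi hif)
      (by rintro i _ _ ⟨_, _, rfl⟩ ⟨_, _, rfl⟩; rfl)
    exact ⟨(n1 + n2) + m, .sSub hax hY hl (up1 _ (up1 _ h1)) (up1 _ (up2 _ h2))
      fun i hi hif => up2 _ (hv i hi _ ⟨hi, hif, rfl⟩)⟩
  | @tSub X t U hax Y hY f hl hJ hc ha =>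
    obtain ⟨n1, h1⟩ := hJ
    obtain ⟨n2, h2⟩ := hc
    obtain ⟨m, hv⟩ := DerAt.family (T := T) (Q := fun i J => ∃ (hi : i < X.length)
      (hif : i < f.length), J = .term Y (f[i]'hif) (subPre X f i hi))
      (by rintro i - _ ⟨hi, hif, rfl⟩; exact ha i hi hif)
      (by rintro i _ _ ⟨_, _, rfl⟩ ⟨_, _, rfl⟩; rfl)
    exact ⟨(n1 + n2) + m, .tSub hax hY hl (up1 _ (up1 _ h1)) (up1 _ (up2 _ h2))
      fun i hi hif => up2 _ (hv i hi _ ⟨hi, hif, rfl⟩)⟩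
  | @seqSub1 X U U' hax Y hY f hl hJ h1 h2 ha =>
    obtain ⟨n1, h1⟩ := h1
    obtain ⟨n2, h2⟩ := h2
    obtain ⟨n3, h3⟩ := hJ
    obtain ⟨m, hv⟩ := DerAt.family (T := T) (Q := fun i J => ∃ (hi : i < X.length)
      (hif : i < f.length), J = .term Y (f[i]'hif) (subPre X f i hi))
      (by rintro i - _ ⟨hi, hif, rfl⟩; exact ha i hi hif)
      (by rintro i _ _ ⟨_, _, rfl⟩ ⟨_, _, rfl⟩; rfl)
    exact ⟨(n1 + n2) + (n3 + m), .seqSub1 hax hY hl (up2 _ (up1 _ h3)) (up1 _ (up1 _ h1))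
      (up1 _ (up2 _ h2)) fun i hi hif => up2 _ (up2 _ (hv i hi _ ⟨hi, hif, rfl⟩))⟩
  | @seqSub2 X S hax Y hY f g hl hl' hJ h1 h2 ha =>
    obtain ⟨n1, h1⟩ := h1
    obtain ⟨n2, h2⟩ := h2
    obtain ⟨n3, h3⟩ := hJ
    obtain ⟨m, hv⟩ := DerAt.family (T := T) (Q := fun i J => ∃ (hi : i < X.length)
      (hif : i < f.length) (hig : i < g.length),
      J = .termEq Y (f[i]'hif) (g[i]'hig) (subPre X f i hi))
      (by rintro i - _ ⟨hi, hif, hig, rfl⟩; exact ha i hi hif hig)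
      (by rintro i _ _ ⟨_, _, _, rfl⟩ ⟨_, _, _, rfl⟩; rfl)
    exact ⟨(n1 + n2) + (n3 + m), .seqSub2 hax hY hl hl' (up2 _ (up1 _ h3)) (up1 _ (up1 _ h1))
      (up1 _ (up2 _ h2)) fun i hi hif hig => up2 _ (up2 _ (hv i hi _ ⟨hi, hif, hig, rfl⟩))⟩
  | @teqSub1 X u u' U hax Y hY f hl hJ h1 h2 ha =>
    obtain ⟨n1, h1⟩ := h1
    obtain ⟨n2, h2⟩ := h2
    obtain ⟨n3, h3⟩ := hJ
    obtain ⟨m, hv⟩ := DerAt.family (T := T) (Q := fun i J => ∃ (hi : i < X.length)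
      (hif : i < f.length), J = .term Y (f[i]'hif) (subPre X f i hi))
      (by rintro i - _ ⟨hi, hif, rfl⟩; exact ha i hi hif)
      (by rintro i _ _ ⟨_, _, rfl⟩ ⟨_, _, rfl⟩; rfl)
    exact ⟨(n1 + n2) + (n3 + m), .teqSub1 hax hY hl (up2 _ (up1 _ h3)) (up1 _ (up1 _ h1))
      (up1 _ (up2 _ h2)) fun i hi hif => up2 _ (up2 _ (hv i hi _ ⟨hi, hif, rfl⟩))⟩
  | @teqSub2 X t U hax Y hY f g hl hl' hJ h1 h2 ha =>
    obtain ⟨n1, h1⟩ := h1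
    obtain ⟨n2, h2⟩ := h2
    obtain ⟨n3, h3⟩ := hJ
    obtain ⟨m, hv⟩ := DerAt.family (T := T) (Q := fun i J => ∃ (hi : i < X.length)
      (hif : i < f.length) (hig : i < g.length),
      J = .termEq Y (f[i]'hif) (g[i]'hig) (subPre X f i hi))
      (by rintro i - _ ⟨hi, hif, hig, rfl⟩; exact ha i hi hif hig)
      (by rintro i _ _ ⟨_, _, _, rfl⟩ ⟨_, _, _, rfl⟩; rfl)
    exact ⟨(n1 + n2) + (n3 + m), .teqSub2 hax hY hl hl' (up2 _ (up1 _ h3)) (up1 _ (up1 _ h1))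
      (up1 _ (up2 _ h2)) fun i hi hif hig => up2 _ (up2 _ (hv i hi _ ⟨hi, hif, hig, rfl⟩))⟩

/-- Well-formedness of the context together with functional derivability. -/
def JDer (T : Set (Judg A)) : Judg A → Prop
  | .ctx X => LC (Der T) X
  | .sort X U => LC (Der T) X ∧ Der T X (.sort U)
  | .term X u U => LC (Der T) X ∧ Der T X (.term u U)
  | .sortEq X U V => LC (Der T) X ∧ Der T X (.sortEq U V)
  | .termEq X u v U => LC (Der T) X ∧ Der T X (.termEq u v U)

/-- Axioms introducing symbols do so over the variables of their context. -/
structure Shape (T : Set (Judg A)) : Prop where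
  sort : ∀ (X : PreCtx A) (U : SortE A), Judg.sort X U ∈ T → U.args = ctxVars X
  term : ∀ (X : PreCtx A) (u : Expr A) (U : SortE A), Judg.term X u U ∈ T →
      ∃ t : A.TermSym, u = Expr.app t (ctxVars X)

theorem imgs_sub {X : PreCtx A} (hX : Good X) {f : List (Expr A)} (hl : f.length = X.length) :
    imgs X (sub X f) = f := map_sub hX.1 hl

theorem Derivable.jder (hT : Shape T) {J : Judg A} (h : Derivable T J) : JDer T J := by
  refine h.induct fun J h => ?_
  cases h with
  | ctx_nil => exact LC.nil _
  | ctx_cons hs hf hp =>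
    exact LC.snoc_iff.2 ⟨hs.1, hs.2, fun hm => by
      obtain ⟨U, hU⟩ := exists_of_mem_keys hm
      exact hf _ hU rfl, fun v hv => isPreCtx_iff.1 hp _ _ [] rfl v hv⟩
  | s1 h => exact ⟨h.1, .s1 h.2⟩
  | s2 h => exact ⟨h.1, .s2 h.2⟩
  | s3 h h' => exact ⟨h.1, .s3 h.2 h'.2⟩
  | t1 h => exact ⟨h.1, .t1 h.2⟩
  | t2 h => exact ⟨h.1, .t2 h.2⟩
  | t3 h h' => exact ⟨h.1, .t3 h.2 h'.2⟩
  | seqt h h' => exact ⟨h.1, .conv h.2 h'.2⟩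
  | seqteq h1 h2 h3 h4 => exact ⟨h1.1, .econv h1.2 h2.2 h3.2 h4.2⟩
  | var hi h => exact ⟨h.1, .var (List.getElem_mem hi) h.2⟩
  | @sA X U hax h hv =>
    obtain ⟨S, es⟩ := U
    obtain rfl := hT.sort _ _ hax
    exact ⟨h, .sort (σ := Expr.var) hax h.1 h.2 fun p hp => by simpa using h.var_of_mem hp⟩
  | @tA X u U hax h hv =>
    obtain ⟨t, rfl⟩ := hT.term _ _ _ hax
    have := Der.term (σ := Expr.var) (X := X) hax h.1.1 h.1.2 h.2
      (fun p hp => by simpa using h.1.var_of_mem hp) (by simpa using h.2)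
    rw [SortE.subst_id] at this
    exact ⟨h.1, this⟩
  | @seqA X U V hax h h' =>
    have := Der.sax (σ := Expr.var) (X := X) hax h.1.1 h.1.2 h.2 h'.2
      (fun p hp => by simpa using h.1.var_of_mem hp) (by simpa using h.2) (by simpa using h'.2)
    simp only [SortE.subst_id] at this
    exact ⟨h.1, this⟩
  | @teqA X u v U hax h h' =>
    have := Der.tax (σ := Expr.var) (X := X) hax h.1.1 h.1.2 h.2 h'.2
      (fun p hp => by simpa using h.1.var_of_mem hp) (by simpa using h.2) (by simpa using h'.2)
    simp only [SortE.subst_id, Expr.subst_id] at this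
    exact ⟨h.1, this⟩
  | @sSub X S hax Y hY f hl hJ hc ha =>
    have hg := hJ.1.1
    rw [args_iff (Q := fun u U => JDer T (.term Y u U)) hg hl] at ha
    rw [← imgs_sub hg hl]
    exact ⟨hc, .sort hax hg hJ.1.2 fun p hp => (ha p hp).2⟩
  | @tSub X t U hax Y hY f hl hJ hc ha =>
    have hg := hJ.1.1
    rw [args_iff (Q := fun u U => JDer T (.term Y u U)) hg hl] at ha
    have := Der.term hax hg hJ.1.2 hJ.2.presup (fun p hp => (ha p hp).2) hc.2
    rw [imgs_sub hg hl] at this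
    exact ⟨hc.1, this⟩
  | @seqSub1 X U U' hax Y hY f hl hJ h1 h2 ha =>
    have hg := hJ.1.1
    rw [args_iff (Q := fun u U => JDer T (.term Y u U)) hg hl] at ha
    exact ⟨h1.1, .sax hax hg hJ.1.2 hJ.2.presup.1 hJ.2.presup.2 (fun p hp => (ha p hp).2) h1.2 h2.2⟩
  | @seqSub2 X S hax Y hY f g hl hl' hJ h1 h2 ha =>
    have hg := hJ.1.1
    rw [args_iff₂ (Q := fun u v U => JDer T (.termEq Y u v U)) hg hl hl'] at ha
    rw [← imgs_sub hg hl] at h1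
    rw [← imgs_sub hg hl'] at h2
    have := Der.scong hax hg hJ.1.2 (fun p hp => (ha p hp).2) h1.2 h2.2
    rw [imgs_sub hg hl, imgs_sub hg hl'] at this
    exact ⟨h1.1, this⟩
  | @teqSub1 X u u' U hax Y hY f hl hJ h1 h2 ha =>
    have hg := hJ.1.1
    rw [args_iff (Q := fun u U => JDer T (.term Y u U)) hg hl] at ha
    exact ⟨h1.1, .tax hax hg hJ.1.2 hJ.2.presup.1 hJ.2.presup.2 (fun p hp => (ha p hp).2) h1.2 h2.2⟩
  | @teqSub2 X t U hax Y hY f g hl hl' hJ h1 h2 ha =>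
    have hg := hJ.1.1
    rw [args_iff₂ (Q := fun u v U => JDer T (.termEq Y u v U)) hg hl hl'] at ha
    have := Der.tcong hax hg hJ.1.2 hJ.2.presup (fun p hp => (ha p hp).2)
      (by rw [imgs_sub hg hl]; exact h1.2) (by rw [imgs_sub hg hl']; exact h2.2)
    rw [imgs_sub hg hl, imgs_sub hg hl'] at this
    exact ⟨h1.1, this⟩

theorem args_imgs {X : PreCtx A} (hX : Good X) (σ : A.Var → Expr A)
    {Q : Expr A → SortE A → Prop} (h : ∀ p ∈ X, Q (σ p.1) (p.2.subst σ)) :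
    ∀ i (hi : i < X.length) (hif : i < (imgs X σ).length),
      Q ((imgs X σ)[i]'hif) (subPre X (imgs X σ) i hi) := by
  refine (args_iff hX (by simp)).2 fun p hp => ?_
  rw [sub_map X σ (mem_keys hp), SortE.subst_congr fun v hv => sub_map X σ (hX.scoped hp hv)]
  exact h p hp

theorem args_imgs₂ {X : PreCtx A} (hX : Good X) (σ τ : A.Var → Expr A)
    {Q : Expr A → Expr A → SortE A → Prop} (h : ∀ p ∈ X, Q (σ p.1) (τ p.1) (p.2.subst σ)) :
    ∀ i (hi : i < X.length) (hif : i < (imgs X σ).length) (hig : i < (imgs X τ).length),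
      Q ((imgs X σ)[i]'hif) ((imgs X τ)[i]'hig) (subPre X (imgs X σ) i hi) := by
  refine (args_iff₂ hX (by simp) (by simp)).2 fun p hp => ?_
  rw [sub_map X σ (mem_keys hp), sub_map X τ (mem_keys hp),
    SortE.subst_congr fun v hv => sub_map X σ (hX.scoped hp hv)]
  exact h p hp

theorem SortE.substL_imgs {X : PreCtx A} {U : SortE A} (h : ∀ v, SOccurs v U → v ∈ keys X)
    (σ : A.Var → Expr A) : U.substL (mkSub X (imgs X σ)) = U.subst σ :=
  SortE.subst_congr fun v hv => sub_map X σ (h v hv)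

theorem Expr.substL_imgs {X : PreCtx A} {e : Expr A} (h : ∀ v, Occurs v e → v ∈ keys X)
    (σ : A.Var → Expr A) : e.substL (mkSub X (imgs X σ)) = e.subst σ :=
  Expr.subst_congr fun v hv => sub_map X σ (h v hv)

theorem derivable_ctx {X : PreCtx A} (hg : Good X)
    (h : ∀ X1 p X2, X = X1 ++ p :: X2 → Derivable T (.ctx X1) → Derivable T (.sort X1 p.2)) :
    Derivable T (.ctx X) := by
  induction X using List.reverseRecOn with
  | nil => exact .step .ctx_nil
  | append_singleton X p ih =>
    have h1 := ih hg.front fun X1 q X2 he => h X1 q (X2 ++ [p]) (by rw [he]; simp)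
    exact .step (.ctx_cons (h X p [] rfl h1) (fun q hq hqp =>
      (Good.snoc_iff.1 hg).2.1 (hqp ▸ mem_keys hq)) hg.2)

theorem Derivable.good {X : PreCtx A} (h : Derivable T (.ctx X)) : Good X := by
  suffices H : ∀ J, Derivable T J → Good J.ctxOf from H _ h
  intro J h
  refine h.induct (P := fun J => Good J.ctxOf) fun J h => ?_
  cases h with
  | ctx_nil => exact Good.nil
  | ctx_cons hs hf hp =>
    exact Good.snoc_iff.2 ⟨hs, fun hm => by
      obtain ⟨U, hU⟩ := exists_of_mem_keys hm
      exact hf _ hU rfl, fun v hv => isPreCtx_iff.1 hp _ _ [] rfl v hv⟩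
  | sSub _ _ _ _ h => exact h
  | _ => assumption

theorem Der.derivable_of_subset {X : PreCtx A} {j : CJ A} (h : Der T X j) :
    ∀ Z, X ⊆ Z → Derivable T (.ctx Z) → Derivable T (j.toJudg Z) := by
  have ctx : ∀ {Xa : PreCtx A}, Good Xa → (∀ X1 p X2, Xa = X1 ++ p :: X2 → ∀ Z, X1 ⊆ Z →
      Derivable T (.ctx Z) → Derivable T ((CJ.sort p.2).toJudg Z)) →
      Derivable T (.ctx Xa) ∧ ∀ i (hi : i < Xa.length),
        Derivable T (.term Xa (.var (Xa[i]'hi).1) (Xa[i]'hi).2) := by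
    intro Xa hg hc
    have h1 := derivable_ctx hg fun X1 p X2 he h => hc X1 p X2 he X1 (fun _ h => h) h
    refine ⟨h1, fun i hi => .step (.var hi ?_)⟩
    exact hc (Xa.take i) Xa[i] (Xa.drop (i + 1)) (by simp) Xa (List.take_subset i Xa) h1
  induction h with
  | s1 _ ih => exact fun Z h hZ => .step (.s1 (ih Z h hZ))
  | s2 _ ih => exact fun Z h hZ => .step (.s2 (ih Z h hZ))
  | s3 _ _ ih ih' => exact fun Z h hZ => .step (.s3 (ih Z h hZ) (ih' Z h hZ))
  | t1 _ ih => exact fun Z h hZ => .step (.t1 (ih Z h hZ))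
  | t2 _ ih => exact fun Z h hZ => .step (.t2 (ih Z h hZ))
  | t3 _ _ ih ih' => exact fun Z h hZ => .step (.t3 (ih Z h hZ) (ih' Z h hZ))
  | conv _ _ ih ih' => exact fun Z h hZ => .step (.seqt (ih Z h hZ) (ih' Z h hZ))
  | econv _ _ _ _ ih ih' ih1 ih2 =>
    exact fun Z h hZ => .step (.seqteq (ih Z h hZ) (ih' Z h hZ) (ih1 Z h hZ) (ih2 Z h hZ))
  | var hx _ ih =>
    intro Z h hZ
    obtain ⟨i, hi, he⟩ := List.mem_iff_getElem.1 (h hx)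
    have := Step.var (Ax := T) (D := Derivable T) hi (by rw [he]; exact ih Z h hZ)
    rw [he] at this
    exact .step this
  | sort hax hg hc ha ihc iha =>
    intro Z h hZ
    obtain ⟨h1, h2⟩ := ctx hg ihc
    exact .step (.sSub hax hZ.good.2 (by simp) (.step (.sA hax h1 h2)) hZ
      (args_imgs hg _ (Q := fun u U => Derivable T (.term Z u U)) fun p hp => iha p hp Z h hZ))
  | @term X Xa t V σ hax hg hc hV ha h ihc ihV iha ih =>
    intro Z h hZ
    obtain ⟨h1, h2⟩ := ctx hg ihc
    have e := SortE.substL_imgs hV.scoped σ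
    have := Step.tSub hax hZ.good.2 (by simp)
      (.step (.tA hax (ihV Xa (fun _ h => h) h1) h2)) (by rw [e]; exact ih Z h hZ)
      (args_imgs hg σ (Q := fun u U => Derivable T (.term Z u U)) fun p hp => iha p hp Z h hZ)
    rw [e] at this
    exact .step this
  | @sax X Xa U V σ hax hg hc hU hV ha _ _ ihc ihU ihV iha ih1 ih2 =>
    intro Z h hZ
    obtain ⟨h1, h2⟩ := ctx hg ihc
    have e := SortE.substL_imgs hU.scoped σ
    have e' := SortE.substL_imgs hV.scoped σ
    have := Step.seqSub1 hax hZ.good.2 (by simp)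
      (.step (.seqA hax (ihU Xa (fun _ h => h) h1) (ihV Xa (fun _ h => h) h1)))
      (by rw [e]; exact ih1 Z h hZ) (by rw [e']; exact ih2 Z h hZ)
      (args_imgs hg σ (Q := fun u U => Derivable T (.term Z u U)) fun p hp => iha p hp Z h hZ)
    rw [e, e'] at this
    exact .step this
  | @scong X Xa S σ τ hax hg hc ha _ _ ihc iha ih1 ih2 =>
    intro Z h hZ
    obtain ⟨h1, h2⟩ := ctx hg ihc
    exact .step (.seqSub2 hax hZ.good.2 (by simp) (by simp) (.step (.sA hax h1 h2))
      (ih1 Z h hZ) (ih2 Z h hZ)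
      (args_imgs₂ hg σ τ (Q := fun u v U => Derivable T (.termEq Z u v U))
        fun p hp => iha p hp Z h hZ))
  | @tax X Xa u v U σ hax hg hc hu hv ha _ _ ihc ihu ihv iha ih1 ih2 =>
    intro Z h hZ
    obtain ⟨h1, h2⟩ := ctx hg ihc
    have e := SortE.substL_imgs hu.scoped.2 σ
    have e1 := Expr.substL_imgs hu.scoped.1 σ
    have e2 := Expr.substL_imgs hv.scoped.1 σ
    have := Step.teqSub1 hax hZ.good.2 (by simp)
      (.step (.teqA hax (ihu Xa (fun _ h => h) h1) (ihv Xa (fun _ h => h) h1)))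
      (by rw [e, e1]; exact ih1 Z h hZ) (by rw [e, e2]; exact ih2 Z h hZ)
      (args_imgs hg σ (Q := fun u U => Derivable T (.term Z u U)) fun p hp => iha p hp Z h hZ)
    rw [e, e1, e2] at this
    exact .step this
  | @tcong X Xa t V σ τ hax hg hc hV ha _ _ ihc ihV iha ih1 ih2 =>
    intro Z h hZ
    obtain ⟨h1, h2⟩ := ctx hg ihc
    have e := SortE.substL_imgs hV.scoped σ
    have := Step.teqSub2 hax hZ.good.2 (by simp) (by simp)
      (.step (.tA hax (ihV Xa (fun _ h => h) h1) h2)) (by rw [e]; exact ih1 Z h hZ)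
      (by rw [e]; exact ih2 Z h hZ)
      (args_imgs₂ hg σ τ (Q := fun u v U => Derivable T (.termEq Z u v U))
        fun p hp => iha p hp Z h hZ)
    rw [e] at this
    exact .step this

theorem LC.derivable {X : PreCtx A} (hX : LC (Der T) X) : Derivable T (.ctx X) :=
  derivable_ctx hX.1 fun X1 p X2 he h =>
    (hX.2 X1 p X2 he).derivable_of_subset X1 (fun _ h => h) h

theorem Der.derivable {X : PreCtx A} {j : CJ A} (h : Der T X j) (hX : LC (Der T) X) :
    Derivable T (j.toJudg X) :=
  h.derivable_of_subset X (fun _ h => h) hX.derivable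

/-! ## A stratification of derivability

The arguments of a formed expression are required to be derivable at a strictly lower level,
while equality and conversion rules may be used freely within a level. -/

/-- One level of the stratification, over the lower level `D`. -/
inductive NS (T : Set (Judg A)) (D : PreCtx A → CJ A → Prop) : PreCtx A → CJ A → Prop where
  | s1 {X : PreCtx A} {U : SortE A} (h : NS T D X (.sort U)) : NS T D X (.sortEq U U)
  | s2 {X : PreCtx A} {U V : SortE A} (h : NS T D X (.sortEq U V)) : NS T D X (.sortEq V U)
  | s3 {X : PreCtx A} {U V W : SortE A} (h : NS T D X (.sortEq U V))
      (h' : NS T D X (.sortEq V W)) : NS T D X (.sortEq U W)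
  | t1 {X : PreCtx A} {u : Expr A} {U : SortE A} (h : NS T D X (.term u U)) :
      NS T D X (.termEq u u U)
  | t2 {X : PreCtx A} {u v : Expr A} {U : SortE A} (h : NS T D X (.termEq u v U)) :
      NS T D X (.termEq v u U)
  | t3 {X : PreCtx A} {u v w : Expr A} {U : SortE A} (h : NS T D X (.termEq u v U))
      (h' : NS T D X (.termEq v w U)) : NS T D X (.termEq u w U)
  | conv {X : PreCtx A} {u : Expr A} {U V : SortE A} (h : NS T D X (.sortEq U V))
      (h' : NS T D X (.term u U)) : NS T D X (.term u V)
  | econv {X : PreCtx A} {u v : Expr A} {U V : SortE A} (h : NS T D X (.sortEq U V))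
      (h' : NS T D X (.termEq u v U)) : NS T D X (.termEq u v V)
  | var {X : PreCtx A} {x : A.Var} {U : SortE A} (hx : (x, U) ∈ X) (h : NS T D X (.sort U)) :
      NS T D X (.term (.var x) U)
  | sort {X Xa : PreCtx A} {S : A.SortSym} {σ : A.Var → Expr A} (hax : introSort Xa S ∈ T)
      (hc : LC D Xa) (ha : SMor D X Xa σ) : NS T D X (.sort ⟨S, imgs Xa σ⟩)
  | term {X Xa : PreCtx A} {t : A.TermSym} {V : SortE A} {σ : A.Var → Expr A}
      (hax : introTerm Xa t V ∈ T) (hc : LC D Xa) (hV : D Xa (.sort V)) (ha : SMor D X Xa σ)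
      (h : NS T D X (.sort (V.subst σ))) : NS T D X (.term (.app t (imgs Xa σ)) (V.subst σ))
  | sax {X Xa : PreCtx A} {U V : SortE A} {σ : A.Var → Expr A} (hax : Judg.sortEq Xa U V ∈ T)
      (hc : LC D Xa) (hU : D Xa (.sort U)) (hV : D Xa (.sort V)) (ha : SMor D X Xa σ)
      (h1 : NS T D X (.sort (U.subst σ))) (h2 : NS T D X (.sort (V.subst σ))) :
      NS T D X (.sortEq (U.subst σ) (V.subst σ))
  | scong {X Xa : PreCtx A} {S : A.SortSym} {σ τ : A.Var → Expr A} (hax : introSort Xa S ∈ T)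
      (hc : LC D Xa) (ha : SEq D X Xa σ τ)
      (h1 : NS T D X (.sort ⟨S, imgs Xa σ⟩)) (h2 : NS T D X (.sort ⟨S, imgs Xa τ⟩)) :
      NS T D X (.sortEq ⟨S, imgs Xa σ⟩ ⟨S, imgs Xa τ⟩)
  | tax {X Xa : PreCtx A} {u v : Expr A} {U : SortE A} {σ : A.Var → Expr A}
      (hax : Judg.termEq Xa u v U ∈ T) (hc : LC D Xa)
      (hu : D Xa (.term u U)) (hv : D Xa (.term v U)) (ha : SMor D X Xa σ)
      (h1 : D X (.term (u.subst σ) (U.subst σ))) (h2 : D X (.term (v.subst σ) (U.subst σ))) :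
      NS T D X (.termEq (u.subst σ) (v.subst σ) (U.subst σ))
  | tcong {X Xa : PreCtx A} {t : A.TermSym} {V : SortE A} {σ τ : A.Var → Expr A}
      (hax : introTerm Xa t V ∈ T) (hc : LC D Xa) (hV : D Xa (.sort V)) (ha : SEq D X Xa σ τ)
      (h1 : NS T D X (.term (.app t (imgs Xa σ)) (V.subst σ)))
      (h2 : NS T D X (.term (.app t (imgs Xa τ)) (V.subst σ))) :
      NS T D X (.termEq (.app t (imgs Xa σ)) (.app t (imgs Xa τ)) (V.subst σ))

/-- The levels of derivability. -/
def lev (T : Set (Judg A)) : ℕ → PreCtx A → CJ A → Prop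
  | 0 => fun _ _ => False
  | n + 1 => NS T (lev T n)

theorem SMor.mono {D D' : PreCtx A → CJ A → Prop} (h : ∀ X j, D X j → D' X j)
    {Z X : PreCtx A} {σ : A.Var → Expr A} (hσ : SMor D Z X σ) : SMor D' Z X σ :=
  fun p hp => h _ _ (hσ p hp)

theorem SEq.mono {D D' : PreCtx A → CJ A → Prop} (h : ∀ X j, D X j → D' X j)
    {Z X : PreCtx A} {σ τ : A.Var → Expr A} (hσ : SEq D Z X σ τ) : SEq D' Z X σ τ :=
  fun p hp => h _ _ (hσ p hp)

theorem NS.mono {D D' : PreCtx A → CJ A → Prop} (hD : ∀ X j, D X j → D' X j) {X : PreCtx A}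
    {j : CJ A} (h : NS T D X j) : NS T D' X j := by
  have hL : ∀ {X}, LC D X → LC D' X := fun h => h.mono fun X U => hD X _
  induction h with
  | s1 _ ih => exact .s1 ih
  | s2 _ ih => exact .s2 ih
  | s3 _ _ ih ih' => exact .s3 ih ih'
  | t1 _ ih => exact .t1 ih
  | t2 _ ih => exact .t2 ih
  | t3 _ _ ih ih' => exact .t3 ih ih'
  | conv _ _ ih ih' => exact .conv ih ih'
  | econv _ _ ih ih' => exact .econv ih ih'
  | var hx _ ih => exact .var hx ih
  | sort hax hc ha => exact .sort hax (hL hc) (ha.mono hD)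
  | term hax hc hV ha h ih => exact .term hax (hL hc) (hD _ _ hV) (ha.mono hD) ih
  | sax hax hc hU hV ha h1 h2 ih1 ih2 =>
    exact .sax hax (hL hc) (hD _ _ hU) (hD _ _ hV) (ha.mono hD) ih1 ih2
  | scong hax hc ha h1 h2 ih1 ih2 => exact .scong hax (hL hc) (ha.mono hD) ih1 ih2
  | tax hax hc hU hV ha h1 h2 =>
    exact .tax hax (hL hc) (hD _ _ hU) (hD _ _ hV) (ha.mono hD) (hD _ _ h1) (hD _ _ h2)
  | tcong hax hc hV ha h1 h2 ih1 ih2 =>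
    exact .tcong hax (hL hc) (hD _ _ hV) (ha.mono hD) ih1 ih2

theorem lev_succ {n : ℕ} {X : PreCtx A} {j : CJ A} (h : lev T n X j) : lev T (n + 1) X j := by
  induction n generalizing X j with
  | zero => exact h.elim
  | succ n ih => exact NS.mono (fun X j => ih) h

theorem lev_mono {n m : ℕ} (hnm : n ≤ m) {X : PreCtx A} {j : CJ A} (h : lev T n X j) :
    lev T m X j := by
  induction hnm with
  | refl => exact h
  | step _ ih => exact lev_succ ih

theorem lev_weaken {n : ℕ} {X Z : PreCtx A} {j : CJ A} (h : lev T n X j) (hXZ : X ⊆ Z) :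
    lev T n Z j := by
  induction n generalizing X Z j with
  | zero => exact h.elim
  | succ n ihn =>
    change NS T (lev T n) X j at h
    change NS T (lev T n) Z j
    induction h with
    | s1 _ ih => exact .s1 ih
    | s2 _ ih => exact .s2 ih
    | s3 _ _ ih ih' => exact .s3 ih ih'
    | t1 _ ih => exact .t1 ih
    | t2 _ ih => exact .t2 ih
    | t3 _ _ ih ih' => exact .t3 ih ih'
    | conv _ _ ih ih' => exact .conv ih ih'
    | econv _ _ ih ih' => exact .econv ih ih'
    | var hx _ ih => exact .var (hXZ hx) ih
    | sort hax hc ha => exact .sort hax hc fun p hp => ihn (ha p hp) hXZ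
    | term hax hc hV ha h ih => exact .term hax hc hV (fun p hp => ihn (ha p hp) hXZ) ih
    | sax hax hc hU hV ha h1 h2 ih1 ih2 =>
      exact .sax hax hc hU hV (fun p hp => ihn (ha p hp) hXZ) ih1 ih2
    | scong hax hc ha h1 h2 ih1 ih2 =>
      exact .scong hax hc (fun p hp => ihn (ha p hp) hXZ) ih1 ih2
    | tax hax hc hU hV ha h1 h2 =>
      exact .tax hax hc hU hV (fun p hp => ihn (ha p hp) hXZ) (ihn h1 hXZ) (ihn h2 hXZ)
    | tcong hax hc hV ha h1 h2 ih1 ih2 =>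
      exact .tcong hax hc hV (fun p hp => ihn (ha p hp) hXZ) ih1 ih2

theorem lev_presup {n : ℕ} {X : PreCtx A} {j : CJ A} (h : lev T n X j) :
    j.Presup (lev T n) X := by
  cases n with
  | zero => exact h.elim
  | succ n =>
    change NS T (lev T n) X j at h
    change j.Presup (NS T (lev T n)) X
    induction h with
    | s1 h => exact ⟨h, h⟩
    | s2 _ ih => exact ⟨ih.2, ih.1⟩
    | s3 _ _ ih ih' => exact ⟨ih.1, ih'.2⟩
    | t1 h => exact ⟨h, h⟩
    | t2 _ ih => exact ⟨ih.2, ih.1⟩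
    | t3 _ _ ih ih' => exact ⟨ih.1, ih'.2⟩
    | conv _ _ ih => exact ih.2
    | econv h _ _ ih => exact ⟨.conv h ih.1, .conv h ih.2⟩
    | var _ h => exact h
    | sort => trivial
    | term _ _ _ _ h => exact h
    | sax _ _ _ _ _ h1 h2 => exact ⟨h1, h2⟩
    | scong _ _ _ h1 h2 => exact ⟨h1, h2⟩
    | tax _ _ _ _ _ h1 h2 => exact ⟨lev_succ h1, lev_succ h2⟩
    | tcong _ _ _ _ h1 h2 => exact ⟨h1, h2⟩

theorem lev_der {n : ℕ} {X : PreCtx A} {j : CJ A} (h : lev T n X j) : Der T X j := by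
  induction n generalizing X j with
  | zero => exact h.elim
  | succ n ihn =>
    change NS T (lev T n) X j at h
    induction h with
    | s1 _ ih => exact .s1 ih
    | s2 _ ih => exact .s2 ih
    | s3 _ _ ih ih' => exact .s3 ih ih'
    | t1 _ ih => exact .t1 ih
    | t2 _ ih => exact .t2 ih
    | t3 _ _ ih ih' => exact .t3 ih ih'
    | conv _ _ ih ih' => exact .conv ih ih'
    | econv _ _ ih ih' => exact .econv' ih ih'
    | var hx _ ih => exact .var hx ih
    | sort hax hc ha =>
      exact .sort hax hc.1 (fun _ _ _ he => ihn (hc.2 _ _ _ he)) fun p hp => ihn (ha p hp)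
    | term hax hc hV ha h ih =>
      exact .term hax hc.1 (fun _ _ _ he => ihn (hc.2 _ _ _ he)) (ihn hV)
        (fun p hp => ihn (ha p hp)) ih
    | sax hax hc hU hV ha h1 h2 ih1 ih2 =>
      exact .sax hax hc.1 (fun _ _ _ he => ihn (hc.2 _ _ _ he)) (ihn hU) (ihn hV)
        (fun p hp => ihn (ha p hp)) ih1 ih2
    | scong hax hc ha h1 h2 ih1 ih2 =>
      exact .scong hax hc.1 (fun _ _ _ he => ihn (hc.2 _ _ _ he)) (fun p hp => ihn (ha p hp)) ih1 ih2
    | tax hax hc hU hV ha h1 h2 =>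
      exact .tax hax hc.1 (fun _ _ _ he => ihn (hc.2 _ _ _ he)) (ihn hU) (ihn hV)
        (fun p hp => ihn (ha p hp)) (ihn h1) (ihn h2)
    | tcong hax hc hV ha h1 h2 ih1 ih2 =>
      exact .tcong hax hc.1 (fun _ _ _ he => ihn (hc.2 _ _ _ he)) (ihn hV)
        (fun p hp => ihn (ha p hp)) ih1 ih2

theorem LC.lev_der {n : ℕ} {X : PreCtx A} (h : LC (lev T n) X) : LC (Der T) X :=
  h.mono fun _ _ h => GATPaper.lev_der h

theorem LC.lev_mono {n m : ℕ} (hnm : n ≤ m) {X : PreCtx A} (h : LC (lev T n) X) :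
    LC (lev T m) X := h.mono fun _ _ h => GATPaper.lev_mono hnm h

theorem exists_lev_of_mem {Y X : PreCtx A} {j : A.Var × SortE A → CJ A}
    (h : ∀ p ∈ X, ∃ n, lev T n Y (j p)) : ∃ n, ∀ p ∈ X, lev T n Y (j p) := by
  induction X with
  | nil => exact ⟨0, by simp⟩
  | cons p X ih =>
    obtain ⟨n, hn⟩ := ih fun q hq => h q (by simp [hq])
    obtain ⟨m, hm⟩ := h p (by simp)
    refine ⟨n + m, fun q hq => ?_⟩
    rcases List.mem_cons.1 hq with rfl | hq
    · exact lev_mono (by omega) hm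
    · exact lev_mono (by omega) (hn q hq)

theorem exists_lev_ctx {X : PreCtx A} (hg : Good X)
    (h : ∀ X1 p X2, X = X1 ++ p :: X2 → ∃ n, lev T n X1 (.sort p.2)) :
    ∃ n, LC (lev T n) X := by
  induction X using List.reverseRecOn with
  | nil => exact ⟨0, LC.nil _⟩
  | append_singleton X p ih =>
    obtain ⟨n, hn⟩ := ih hg.front fun X1 q X2 he => h X1 q (X2 ++ [p]) (by rw [he]; simp)
    obtain ⟨m, hm⟩ := h X p [] rfl
    exact ⟨n + m, LC.snoc_iff.2 ⟨hn.lev_mono (by omega), lev_mono (by omega) hm,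
      (Good.snoc_iff.1 hg).2⟩⟩

theorem Der.exists_lev {X : PreCtx A} {j : CJ A} (h : Der T X j) : ∃ n, lev T n X j := by
  have up1 : ∀ {n : ℕ} (m : ℕ) {X : PreCtx A} {j : CJ A}, lev T n X j → lev T (n + m) X j :=
    fun m _ _ h => lev_mono (by omega) h
  have up2 : ∀ {n : ℕ} (m : ℕ) {X : PreCtx A} {j : CJ A}, lev T n X j → lev T (m + n) X j :=
    fun m _ _ h => lev_mono (by omega) h
  have two : ∀ {X Y : PreCtx A} {j k l : CJ A}, (∃ n, lev T n X j) → (∃ n, lev T n Y k) →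
      (∀ n, lev T (n + 1) X j → lev T (n + 1) Y k → lev T (n + 1) Y l) → ∃ n, lev T n Y l := by
    rintro X Y j k l ⟨n, hn⟩ ⟨m, hm⟩ h
    exact ⟨_, h (n + m) (up1 1 (up1 m hn)) (up1 1 (up2 n hm))⟩
  induction h with
  | s1 _ ih => exact two ih ih fun n h _ => NS.s1 h
  | s2 _ ih => exact two ih ih fun n h _ => NS.s2 h
  | s3 _ _ ih ih' => exact two ih ih' fun n h h' => NS.s3 h h'
  | t1 _ ih => exact two ih ih fun n h _ => NS.t1 h
  | t2 _ ih => exact two ih ih fun n h _ => NS.t2 h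
  | t3 _ _ ih ih' => exact two ih ih' fun n h h' => NS.t3 h h'
  | conv _ _ ih ih' => exact two ih ih' fun n h h' => NS.conv h h'
  | econv _ _ _ _ ih ih' => exact two ih ih' fun n h h' => NS.econv h h'
  | var hx _ ih => exact two ih ih fun n h _ => NS.var hx h
  | sort hax hg hc ha ihc iha =>
    obtain ⟨n, hn⟩ := exists_lev_ctx hg ihc
    obtain ⟨m, hm⟩ := exists_lev_of_mem iha
    exact ⟨n + m + 1, NS.sort hax (hn.lev_mono (by omega)) fun p hp => up2 _ (hm p hp)⟩
  | term hax hg hc hV ha h ihc ihV iha ih =>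
    obtain ⟨n, hn⟩ := exists_lev_ctx hg ihc
    obtain ⟨m, hm⟩ := exists_lev_of_mem iha
    obtain ⟨k, hk⟩ := ihV
    obtain ⟨l, hl⟩ := ih
    exact ⟨(n + m) + (k + l) + 1, NS.term hax (hn.lev_mono (by omega)) (up2 _ (up1 _ hk))
      (fun p hp => up1 _ (up2 _ (hm p hp))) (up1 1 (up2 _ (up2 _ hl)))⟩
  | sax hax hg hc hU hV ha h1 h2 ihc ihU ihV iha ih1 ih2 =>
    obtain ⟨n, hn⟩ := exists_lev_ctx hg ihc
    obtain ⟨m, hm⟩ := exists_lev_of_mem iha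
    obtain ⟨k, hk⟩ := ihU
    obtain ⟨l, hl⟩ := ihV
    obtain ⟨i, hi⟩ := ih1
    obtain ⟨j, hj⟩ := ih2
    exact ⟨((n + m) + (k + l)) + (i + j) + 1, NS.sax hax (hn.lev_mono (by omega))
      (up1 _ (up2 _ (up1 _ hk))) (up1 _ (up2 _ (up2 _ hl)))
      (fun p hp => up1 _ (up1 _ (up2 _ (hm p hp)))) (up1 1 (up2 _ (up1 _ hi)))
      (up1 1 (up2 _ (up2 _ hj)))⟩
  | scong hax hg hc ha h1 h2 ihc iha ih1 ih2 =>
    obtain ⟨n, hn⟩ := exists_lev_ctx hg ihc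
    obtain ⟨m, hm⟩ := exists_lev_of_mem iha
    obtain ⟨i, hi⟩ := ih1
    obtain ⟨j, hj⟩ := ih2
    exact ⟨(n + m) + (i + j) + 1, NS.scong hax (hn.lev_mono (by omega))
      (fun p hp => up1 _ (up2 _ (hm p hp))) (up1 1 (up2 _ (up1 _ hi)))
      (up1 1 (up2 _ (up2 _ hj)))⟩
  | tax hax hg hc hU hV ha h1 h2 ihc ihU ihV iha ih1 ih2 =>
    obtain ⟨n, hn⟩ := exists_lev_ctx hg ihc
    obtain ⟨m, hm⟩ := exists_lev_of_mem iha
    obtain ⟨k, hk⟩ := ihU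
    obtain ⟨l, hl⟩ := ihV
    obtain ⟨i, hi⟩ := ih1
    obtain ⟨j, hj⟩ := ih2
    exact ⟨((n + m) + (k + l)) + (i + j) + 1, NS.tax hax (hn.lev_mono (by omega))
      (up1 _ (up2 _ (up1 _ hk))) (up1 _ (up2 _ (up2 _ hl)))
      (fun p hp => up1 _ (up1 _ (up2 _ (hm p hp)))) (up2 _ (up1 _ hi))
      (up2 _ (up2 _ hj))⟩
  | tcong hax hg hc hV ha h1 h2 ihc ihV iha ih1 ih2 =>
    obtain ⟨n, hn⟩ := exists_lev_ctx hg ihc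
    obtain ⟨m, hm⟩ := exists_lev_of_mem iha
    obtain ⟨k, hk⟩ := ihV
    obtain ⟨i, hi⟩ := ih1
    obtain ⟨j, hj⟩ := ih2
    exact ⟨((n + m) + k) + (i + j) + 1, NS.tcong hax (hn.lev_mono (by omega))
      (up1 _ (up2 _ hk)) (fun p hp => up1 _ (up1 _ (up2 _ (hm p hp))))
      (up1 1 (up2 _ (up1 _ hi))) (up1 1 (up2 _ (up2 _ hj)))⟩

theorem LC.exists_lev {X : PreCtx A} (hX : LC (Der T) X) : ∃ n, LC (lev T n) X :=
  exists_lev_ctx hX.1 fun X1 p X2 he => (hX.2 X1 p X2 he).exists_lev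

/-! ## Inversion -/

theorem CanonSort.of_mem {X : PreCtx A} {x : A.Var} {U : SortE A} (h : (x, U) ∈ X) :
    CanonSort T X (.var x) U := by
  obtain ⟨i, hi, he⟩ := List.mem_iff_getElem.1 h
  have := CanonSort.var (Ax := T) hi
  rwa [he] at this

theorem canonSort_var_iff {X : PreCtx A} {x : A.Var} {U : SortE A} :
    CanonSort T X (.var x) U ↔ (x, U) ∈ X := by
  refine ⟨fun h => ?_, .of_mem⟩
  generalize he : Expr.var x = e at h
  cases h with
  | var hi =>
    obtain rfl := Expr.var.inj he
    exact List.getElem_mem hi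
  | app => cases he

theorem lev_sort_inv {n : ℕ} {X : PreCtx A} {S : A.SortSym} {rs : List (Expr A)}
    (h : lev T (n + 1) X (.sort ⟨S, rs⟩)) :
    ∃ Xa σ, introSort Xa S ∈ T ∧ LC (lev T n) Xa ∧ SMor (lev T n) X Xa σ ∧ rs = imgs Xa σ := by
  change NS T (lev T n) X _ at h
  cases h with
  | sort hax hc ha => exact ⟨_, _, hax, hc, ha, rfl⟩

theorem lev_var_inv {n : ℕ} {X : PreCtx A} {x : A.Var} {U : SortE A}
    (h : lev T (n + 1) X (.term (.var x) U)) :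
    ∃ U0, (x, U0) ∈ X ∧ lev T (n + 1) X (.sort U0) ∧ lev T (n + 1) X (.sortEq U0 U) := by
  change NS T (lev T n) X _ at h
  generalize hj : CJ.term (.var x) U = j at h
  induction h generalizing U with
  | conv h h' ih ih' =>
    cases hj
    obtain ⟨U0, h1, h2, h3⟩ := ih' rfl
    exact ⟨U0, h1, h2, NS.s3 h3 h⟩
  | var hx h => cases hj; exact ⟨_, hx, h, NS.s1 h⟩
  | _ => cases hj

theorem lev_app_inv {n : ℕ} {X : PreCtx A} {t : A.TermSym} {rs : List (Expr A)} {U : SortE A}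
    (h : lev T (n + 1) X (.term (.app t rs) U)) :
    ∃ Xa V σ, introTerm Xa t V ∈ T ∧ LC (lev T n) Xa ∧ lev T n Xa (.sort V) ∧
      SMor (lev T n) X Xa σ ∧ lev T (n + 1) X (.sort (V.subst σ)) ∧ rs = imgs Xa σ ∧
      lev T (n + 1) X (.sortEq (V.subst σ) U) := by
  change NS T (lev T n) X _ at h
  generalize hj : CJ.term (.app t rs) U = j at h
  induction h generalizing U with
  | conv h h' ih ih' =>
    cases hj
    obtain ⟨Xa, V, σ, h1, h2, h3, h4, h5, h6, h7⟩ := ih' rfl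
    exact ⟨Xa, V, σ, h1, h2, h3, h4, h5, h6, NS.s3 h7 h⟩
  | term hax hc hV ha h =>
    cases hj; exact ⟨_, _, _, hax, hc, hV, ha, h, rfl, NS.s1 h⟩
  | _ => cases hj

theorem lev_canon {n : ℕ} {X : PreCtx A} {u : Expr A} {U : SortE A}
    (h : lev T n X (.term u U)) :
    ∃ U0, CanonSort T X u U0 ∧ lev T n X (.term u U0) ∧ lev T n X (.sortEq U0 U) := by
  cases n with
  | zero => exact h.elim
  | succ n =>
    cases u with
    | var x =>
      obtain ⟨U0, h1, h2, h3⟩ := lev_var_inv h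
      exact ⟨U0, .of_mem h1, NS.var h1 h2, h3⟩
    | app t rs =>
      obtain ⟨Xa, V, σ, h1, h2, h3, h4, h5, rfl, h7⟩ := lev_app_inv h
      refine ⟨V.subst σ, ?_, NS.term h1 h2 h3 h4 h5, h7⟩
      have := CanonSort.app (X := X) (f := imgs Xa σ) h1
      rwa [SortE.substL_imgs (lev_der h3).scoped] at this

/-! ## Raw well-formedness -/

/-- Terms with the correct arities and variables in the given context. -/
inductive WT (T : Set (Judg A)) (X : PreCtx A) : Expr A → Prop where
  | var {x : A.Var} (hx : x ∈ keys X) : WT T X (.var x)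
  | app {t : A.TermSym} {es : List (Expr A)} {Xa : PreCtx A} {V : SortE A}
      (hax : introTerm Xa t V ∈ T) (hl : es.length = Xa.length) (ha : ∀ e ∈ es, WT T X e) :
      WT T X (.app t es)

/-- Sorts with well-formed arguments. -/
def SWT (T : Set (Judg A)) (X : PreCtx A) (U : SortE A) : Prop := ∀ e ∈ U.args, WT T X e

/-- Good contexts whose sorts are well-formed. -/
def GoodC (T : Set (Judg A)) (X : PreCtx A) : Prop :=
  Good X ∧ ∀ X1 p X2, X = X1 ++ p :: X2 → SWT T X1 p.2

theorem WT.weaken {X Z : PreCtx A} (hXZ : keys X ⊆ keys Z) {e : Expr A} (h : WT T X e) :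
    WT T Z e := by
  induction h with
  | var hx => exact .var (hXZ hx)
  | app hax hl _ ih => exact .app hax hl ih

theorem SWT.weaken {X Z : PreCtx A} (hXZ : keys X ⊆ keys Z) {U : SortE A} (h : SWT T X U) :
    SWT T Z U := fun e he => (h e he).weaken hXZ

theorem WT.occurs {X : PreCtx A} {e : Expr A} (h : WT T X e) {v : A.Var} (hv : Occurs v e) :
    v ∈ keys X := by
  induction h with
  | var hx => exact occurs_var.1 hv ▸ hx
  | app hax hl _ ih =>
    obtain ⟨e, he, hv⟩ := occurs_app.1 hv
    exact ih e he hv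

theorem WT.subst {X Z : PreCtx A} {σ : A.Var → Expr A} (hσ : ∀ x ∈ keys X, WT T Z (σ x))
    {e : Expr A} (h : WT T X e) : WT T Z (e.subst σ) := by
  induction h with
  | var hx => simpa using hσ _ hx
  | app hax hl _ ih =>
    rw [Expr.subst_app]
    refine .app hax (by simpa using hl) fun e he => ?_
    obtain ⟨e', he', rfl⟩ := List.mem_map.1 he
    exact ih e' he'

theorem SWT.subst {X Z : PreCtx A} {σ : A.Var → Expr A} (hσ : ∀ x ∈ keys X, WT T Z (σ x))
    {U : SortE A} (h : SWT T X U) : SWT T Z (U.subst σ) := by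
  intro e he
  obtain ⟨e', he', rfl⟩ := List.mem_map.1 he
  exact (h e' he').subst hσ

/-- Raw well-formedness of the components of a judgment. -/
def CJ.WF (T : Set (Judg A)) (X : PreCtx A) : CJ A → Prop
  | .sort U => SWT T X U
  | .term u U => WT T X u ∧ SWT T X U
  | .sortEq U V => SWT T X U ∧ SWT T X V
  | .termEq u v U => WT T X u ∧ WT T X v ∧ SWT T X U

theorem Der.wf {X : PreCtx A} {j : CJ A} (h : Der T X j) : j.WF T X := by
  induction h with
  | s1 _ ih => exact ⟨ih, ih⟩
  | s2 _ ih => exact ⟨ih.2, ih.1⟩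
  | s3 _ _ ih ih' => exact ⟨ih.1, ih'.2⟩
  | t1 _ ih => exact ⟨ih.1, ih.1, ih.2⟩
  | t2 _ ih => exact ⟨ih.2.1, ih.1, ih.2.2⟩
  | t3 _ _ ih ih' => exact ⟨ih.1, ih'.2⟩
  | conv _ _ ih ih' => exact ⟨ih'.1, ih.2⟩
  | econv _ _ _ _ ih ih' ih1 ih2 => exact ⟨ih1.1, ih2⟩
  | var hx _ ih => exact ⟨.var (mem_keys hx), ih⟩
  | sort hax hg hc ha ihc iha =>
    intro e he
    obtain ⟨p, hp, rfl⟩ := List.mem_map.1 he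
    exact (iha p hp).1
  | term hax hg hc hV ha h ihc ihV iha ih =>
    refine ⟨.app hax (by simp) fun e he => ?_, ih⟩
    obtain ⟨p, hp, rfl⟩ := List.mem_map.1 he
    exact (iha p hp).1
  | sax hax hg hc hU hV ha h1 h2 ihc ihU ihV iha ih1 ih2 => exact ⟨ih1, ih2⟩
  | scong hax hg hc ha h1 h2 ihc iha ih1 ih2 => exact ⟨ih1, ih2⟩
  | tax hax hg hc hU hV ha h1 h2 ihc ihU ihV iha ih1 ih2 => exact ⟨ih1.1, ih2⟩
  | tcong hax hg hc hV ha h1 h2 ihc ihV iha ih1 ih2 => exact ⟨ih1.1, ih2⟩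

theorem LC.goodC {X : PreCtx A} (h : LC (Der T) X) : GoodC T X :=
  ⟨h.1, fun X1 p X2 he => (h.2 X1 p X2 he).wf⟩

theorem GoodC.front {X Y : PreCtx A} (h : GoodC T (X ++ Y)) : GoodC T X :=
  ⟨h.1.front, fun X1 p X2 he => h.2 X1 p (X2 ++ Y) (by rw [he]; simp)⟩

theorem GoodC.swt_of_mem {X : PreCtx A} (hX : GoodC T X) {p : A.Var × SortE A} (hp : p ∈ X) :
    SWT T X p.2 := by
  obtain ⟨X1, X2, rfl⟩ := List.append_of_mem hp
  exact (hX.2 X1 p X2 rfl).weaken (by simp [keys])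

/-! ## Contexts and canonical sorts over a generalized algebraic theory -/

theorem IsPretheory.shape (h : IsPretheory T) : Shape T := ⟨h.sort_shape, h.term_shape⟩

theorem IsGAT.lc_of_introSort (hT : IsGAT T) {X : PreCtx A} {S : A.SortSym}
    (h : introSort X S ∈ T) : LC (Der T) X :=
  ((hT.2 _ h).jder hT.1.shape).1

theorem IsGAT.lc_of_introTerm (hT : IsGAT T) {X : PreCtx A} {t : A.TermSym} {V : SortE A}
    (h : introTerm X t V ∈ T) : LC (Der T) X ∧ Der T X (.sort V) :=
  ⟨((hT.2 _ h).jder hT.1.shape).1, ((hT.2 _ h).jder hT.1.shape).2.presup⟩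

/-- Extension of a context by a part of another context. -/
theorem LC.append {Z P R : PreCtx A} (hZ : LC (Der T) Z) (hR : LC (Der T) (P ++ R)) (hP : P ⊆ Z)
    (hd : ∀ x ∈ keys R, x ∉ keys Z) : LC (Der T) (Z ++ R) := by
  induction R using List.reverseRecOn with
  | nil => simpa using hZ
  | append_singleton R p ih =>
    rw [← List.append_assoc] at hR ⊢
    obtain ⟨h1, h2, h3, h4⟩ := LC.snoc_iff.1 hR
    have hsub : P ++ R ⊆ Z ++ R := fun q hq => by
      rcases List.mem_append.1 hq with h | h
      · exact List.mem_append_left _ (hP h)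
      · exact List.mem_append_right _ h
    refine LC.snoc_iff.2 ⟨ih h1 fun x hx => hd x (by simp at hx ⊢; exact .inl hx),
      h2.weaken hsub, ?_, fun v hv => ?_⟩
    · simp only [keys, List.map_append, List.mem_append, not_or] at h3 ⊢
      exact ⟨hd _ (by simp), h3.2⟩
    · obtain ⟨q, hq, rfl⟩ := List.mem_map.1 (h4 v hv)
      exact mem_keys (hsub hq)

theorem keys_mono {X Z : PreCtx A} (h : X ⊆ Z) : keys X ⊆ keys Z := List.map_subset _ h

theorem CanonSort.app_inv {X : PreCtx A} {t : A.TermSym} {f : List (Expr A)} {U : SortE A}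
    (h : CanonSort T X (.app t f) U) :
    ∃ Xa V, introTerm Xa t V ∈ T ∧ U = V.substL (mkSub Xa f) := by
  generalize he : Expr.app t f = e at h
  cases h with
  | var => cases he
  | app hax => obtain ⟨rfl, rfl⟩ := Expr.app.inj he; exact ⟨_, _, hax, rfl⟩

theorem CanonSort.app_ctx {X Z : PreCtx A} {t : A.TermSym} {f : List (Expr A)} {U : SortE A}
    (h : CanonSort T X (.app t f) U) : CanonSort T Z (.app t f) U := by
  obtain ⟨Xa, V, hax, rfl⟩ := h.app_inv
  exact .app hax

theorem CanonSort.mono {X Z : PreCtx A} (hXZ : X ⊆ Z) {u : Expr A} {U : SortE A}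
    (h : CanonSort T X u U) : CanonSort T Z u U := by
  cases u with
  | var x => exact canonSort_var_iff.2 (hXZ (canonSort_var_iff.1 h))
  | app t f => exact h.app_ctx

theorem CanonSort.unique (hT : IsGAT T) {X : PreCtx A} (hX : GoodC T X) {u : Expr A}
    {U V : SortE A} (h : CanonSort T X u U) (h' : CanonSort T X u V) : U = V := by
  cases u with
  | var x => exact hX.1.unique (canonSort_var_iff.1 h) (canonSort_var_iff.1 h')
  | app t f =>
    obtain ⟨Xa, U, hax, rfl⟩ := h.app_inv
    obtain ⟨Xb, V, hax', rfl⟩ := h'.app_inv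
    have := (hT.1.term_intro t).unique (y₁ := (Xa, U)) (y₂ := (Xb, V)) hax hax'
    cases this
    rfl

theorem WT.app_inv {X : PreCtx A} {t : A.TermSym} {es : List (Expr A)} (h : WT T X (.app t es)) :
    ∃ Xa V, introTerm Xa t V ∈ T ∧ es.length = Xa.length ∧ ∀ e ∈ es, WT T X e := by
  cases h with
  | app hax hl ha => exact ⟨_, _, hax, hl, ha⟩

theorem WT.args {X : PreCtx A} {t : A.TermSym} {es : List (Expr A)} (h : WT T X (.app t es)) :
    ∀ e ∈ es, WT T X e := by
  obtain ⟨_, _, _, _, h⟩ := h.app_inv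
  exact h

theorem WT.var_mem {X : PreCtx A} {x : A.Var} (h : WT T X (.var x)) : x ∈ keys X := by
  cases h; assumption

theorem CanonSort.swt (hT : IsGAT T) {X : PreCtx A} (hX : GoodC T X) {u : Expr A} {U : SortE A}
    (hu : WT T X u) (h : CanonSort T X u U) : SWT T X U := by
  cases u with
  | var x => exact hX.swt_of_mem (canonSort_var_iff.1 h)
  | app t f =>
    obtain ⟨Xa, V, hax, rfl⟩ := h.app_inv
    obtain ⟨Xb, V', hax', hl, ha⟩ := hu.app_inv
    have := (hT.1.term_intro t).unique (y₁ := (Xa, V)) (y₂ := (Xb, V')) hax hax'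
    cases this
    obtain ⟨hc, hV⟩ := hT.lc_of_introTerm hax
    refine SWT.subst (X := Xa) (fun x hx => ?_) hV.wf
    obtain ⟨p, hp, rfl⟩ := List.mem_map.1 hx
    obtain ⟨i, hi, rfl⟩ := List.mem_iff_getElem.1 hp
    rw [show lookupV (mkSub Xa f) = sub Xa f from rfl, sub_getElem hc.1.1 hi (by omega)]
    exact ha _ (List.getElem_mem _)

theorem WT.exists_canon (hT : IsGAT T) {X : PreCtx A} (hX : GoodC T X) {u : Expr A}
    (hu : WT T X u) : ∃ U, CanonSort T X u U ∧ SWT T X U := by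
  suffices h : ∃ U, CanonSort T X u U by
    obtain ⟨U, h⟩ := h
    exact ⟨U, h, h.swt hT hX hu⟩
  cases u with
  | var x =>
    obtain ⟨U, hU⟩ := exists_of_mem_keys hu.var_mem
    exact ⟨U, .of_mem hU⟩
  | app t f =>
    obtain ⟨Xa, V, hax, _⟩ := hu.app_inv
    exact ⟨_, .app hax⟩

theorem GoodC.snoc {X : PreCtx A} (hX : GoodC T X) {x : A.Var} (hx : x ∉ keys X) {U : SortE A}
    (hU : SWT T X U) : GoodC T (X ++ [(x, U)]) := by
  refine ⟨Good.snoc_iff.2 ⟨hX.1, hx, fun v ⟨e, he, hv⟩ => (hU e he).occurs hv⟩, ?_⟩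
  intro X1 p X2 he
  rcases List.eq_nil_or_concat X2 with rfl | ⟨X2, q, rfl⟩
  · obtain ⟨rfl, h⟩ := List.append_inj' he rfl
    cases h
    exact hU
  · rw [List.concat_eq_append, ← List.cons_append, ← List.append_assoc] at he
    exact hX.2 X1 p X2 (List.append_inj' he rfl).1

theorem GoodC.take {X : PreCtx A} (hX : GoodC T X) (n : ℕ) : GoodC T (X.take n) := by
  rw [← List.take_append_drop n X] at hX
  exact hX.front

/-! ## Grids -/

section Grid
variable {α β γ δ : Type}

/-- The lexicographically ordered list of the values of `M` on two lists. -/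
def grid (M : α → β → γ) (l : List α) (l' : List β) : List γ := l.flatMap fun a => l'.map (M a)

theorem mem_grid {M : α → β → γ} {l : List α} {l' : List β} {c : γ} :
    c ∈ grid M l l' ↔ ∃ a ∈ l, ∃ b ∈ l', M a b = c := by
  simp [grid]

theorem grid_congr {M M' : α → β → γ} {l : List α} {l' : List β}
    (h : ∀ a ∈ l, ∀ b ∈ l', M a b = M' a b) : grid M l l' = grid M' l l' :=
  List.flatMap_congr fun a ha => List.map_congr_left (h a ha)

theorem map_grid (f : γ → δ) (M : α → β → γ) (l : List α) (l' : List β) :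
    (grid M l l').map f = grid (fun a b => f (M a b)) l l' := by
  simp [grid, List.map_flatMap, Function.comp_def]

theorem grid_map {α' β' : Type} (M : α → β → γ) (f : α' → α) (g : β' → β) (l : List α')
    (l' : List β') : grid M (l.map f) (l'.map g) = grid (fun a b => M (f a) (g b)) l l' := by
  simp [grid, List.flatMap_map, Function.comp_def]

theorem grid_append (M : α → β → γ) (l₁ l₂ : List α) (l' : List β) :
    grid M (l₁ ++ l₂) l' = grid M l₁ l' ++ grid M l₂ l' := by
  simp [grid]

@[simp] theorem grid_nil (M : α → β → γ) (l' : List β) : grid M [] l' = [] := rfl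

theorem grid_cons (M : α → β → γ) (a : α) (l : List α) (l' : List β) :
    grid M (a :: l) l' = l'.map (M a) ++ grid M l l' := by
  simp [grid]

theorem grid_singleton (M : α → β → γ) (a : α) (l' : List β) :
    grid M [a] l' = l'.map (M a) := by
  simp [grid]

theorem length_grid (M : α → β → γ) (l : List α) (l' : List β) :
    (grid M l l').length = l.length * l'.length := by
  induction l with
  | nil => simp
  | cons a l ih => rw [grid_cons, List.length_append, ih]; simp; ring

theorem getElem_grid (M : α → β → γ) {l : List α} {l' : List β} {i j : ℕ} (hi : i < l.length)
    (hj : j < l'.length) (h : i * l'.length + j < (grid M l l').length) :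
    (grid M l l')[i * l'.length + j] = M l[i] l'[j] := by
  induction l generalizing i with
  | nil => simp at hi
  | cons a l ih =>
    simp only [grid_cons]
    cases i with
    | zero =>
      rw [List.getElem_append_left (by simpa using hj)]
      simp
    | succ i =>
      have e : (i + 1) * l'.length + j = l'.length + (i * l'.length + j) := by ring
      rw [List.getElem_append_right (by simp [e])]
      simp only [List.length_cons, Nat.add_lt_add_iff_right] at hi
      have hlt : i * l'.length + j < (grid M l l').length := by
        rw [length_grid]
        nlinarith
      have := ih hi hlt
      simp only [List.getElem_cons_succ]
      rw [← this]
      congr 1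
      simp [e]

theorem eq_grid {M : α → β → γ} {l : List α} {l' : List β} {L : List γ}
    (hl : L.length = l.length * l'.length)
    (h : ∀ i j (hi : i < l.length) (hj : j < l'.length) (hij : i * l'.length + j < L.length),
      L[i * l'.length + j] = M l[i] l'[j]) : L = grid M l l' := by
  refine List.ext_getElem (by rw [hl, length_grid]) fun k h1 h2 => ?_
  have hn : 0 < l'.length := by
    rcases Nat.eq_zero_or_pos l'.length with h0 | h0
    · rw [hl, h0] at h1; simp at h1
    · exact h0
  have hi : k / l'.length < l.length := by
    rw [Nat.div_lt_iff_lt_mul hn]; omega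
  have hj := Nat.mod_lt k hn
  have hk : k / l'.length * l'.length + k % l'.length = k := Nat.div_add_mod' k l'.length
  have e1 := h _ _ hi hj (by omega)
  have e2 := getElem_grid M hi hj (by omega)
  simp only [hk] at e1 e2
  rw [e1, e2]

theorem IsGrid.eq_grid {N : ℕ → ℕ → γ} {M : α → β → γ} {l : List α} {l' : List β} {L : List γ}
    {m n : ℕ} (h : IsGrid m n N L) (hm : l.length = m) (hn : l'.length = n)
    (hN : ∀ i j (hi : i < l.length) (hj : j < l'.length), N i j = M l[i] l'[j]) :
    L = grid M l l' := by
  subst hm hn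
  exact GATPaper.eq_grid h.1 fun i j hi hj hij => by rw [h.2 i j hi hj hij, hN i j hi hj]

theorem exists_isGrid (m n : ℕ) (N : ℕ → ℕ → γ) : ∃ L, IsGrid m n N L := by
  refine ⟨grid N (List.range m) (List.range n), by simp [length_grid], fun i j hi hj h => ?_⟩
  have := getElem_grid N (l := List.range m) (l' := List.range n) (i := i) (j := j) (by simpa) (by simpa)
    (by simpa using h)
  simpa using this

end Grid

end

section
variable {A B : Alphabet} {TA : Set (Judg A)} {TB : Set (Judg B)}

/-! ## The tensor of terms -/

/-- The tensor `e` of two terms at their canonical sorts, by a substitution-free recursion. -/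
inductive TT (TA : Set (Judg A)) (TB : Set (Judg B)) (X : PreCtx A) (Y : PreCtx B) :
    Expr A → Expr B → Expr (A.tensor B) → Prop where
  | var (x : A.Var) (y : B.Var) : TT TA TB X Y (.var x) (.var y) (.var (x, y))
  | left {s : A.TermSym} {ss : List (Expr A)} {y : B.Var} {V : SortE B}
      (hc : CanonSort TB Y (.var y) V) (M : Expr A → Expr B → Expr (A.tensor B))
      (h : ∀ a ∈ ss, ∀ b ∈ V.args ++ [.var y], TT TA TB X Y a b (M a b)) :
      TT TA TB X Y (.app s ss) (.var y) (.app (.inr (s, V.head)) (grid M ss (V.args ++ [.var y])))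
  | right {u : Expr A} {U : SortE A} {t : B.TermSym} {ts : List (Expr B)}
      (hc : CanonSort TA X u U) (M : Expr A → Expr B → Expr (A.tensor B))
      (h : ∀ a ∈ U.args ++ [u], ∀ b ∈ ts, TT TA TB X Y a b (M a b)) :
      TT TA TB X Y u (.app t ts) (.app (.inl (U.head, t)) (grid M (U.args ++ [u]) ts))

theorem TT.det (hA : IsGAT TA) (hB : IsGAT TB) {X : PreCtx A} {Y : PreCtx B} (hX : GoodC TA X)
    (hY : GoodC TB Y) {u : Expr A} {v : Expr B} {e e' : Expr (A.tensor B)}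
    (h : TT TA TB X Y u v e) (h' : TT TA TB X Y u v e') : e = e' := by
  induction h generalizing e' with
  | var => cases h'; rfl
  | left hc M h ih =>
    cases h' with
    | left hc' M' h' =>
      obtain rfl := hc.unique hB hY hc'
      rw [grid_congr fun a ha b hb => ih a ha b hb (h' a ha b hb)]
  | right hc M h ih =>
    cases h' with
    | right hc' M' h' =>
      obtain rfl := hc.unique hA hX hc'
      rw [grid_congr fun a ha b hb => ih a ha b hb (h' a ha b hb)]

theorem TT.mono {X X' : PreCtx A} {Y Y' : PreCtx B} (hX : X ⊆ X') (hY : Y ⊆ Y') {u : Expr A}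
    {v : Expr B} {e : Expr (A.tensor B)} (h : TT TA TB X Y u v e) : TT TA TB X' Y' u v e := by
  induction h with
  | var => exact .var _ _
  | left hc M h ih => exact .left (hc.mono hY) M ih
  | right hc M h ih => exact .right (hc.mono hX) M ih

theorem GoodC.exists_take {X : PreCtx A} (hX : GoodC TA X) {k : ℕ} {x : A.Var}
    (hx : x ∈ keys (X.take k)) :
    ∃ j < k, ∃ hj : j < X.length, ∃ U, X[j] = (x, U) ∧ SWT TA (X.take j) U := by
  obtain ⟨U, hU⟩ := exists_of_mem_keys hx
  obtain ⟨j, hj, he⟩ := List.mem_iff_getElem.1 hU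
  rw [List.length_take] at hj
  rw [List.getElem_take] at he
  refine ⟨j, by omega, by omega, U, he, ?_⟩
  have := hX.2 (X.take j) X[j] (X.drop (j + 1)) (by
    rw [List.getElem_cons_drop, List.take_append_drop])
  rwa [he] at this

theorem exists_grid_fun {α β γ : Type} [Nonempty γ] {l : List α} {l' : List β}
    {R : α → β → γ → Prop} (h : ∀ a ∈ l, ∀ b ∈ l', ∃ c, R a b c) :
    ∃ M : α → β → γ, ∀ a ∈ l, ∀ b ∈ l', R a b (M a b) := by
  have : ∀ a b, ∃ c, a ∈ l → b ∈ l' → R a b c := fun a b => by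
    by_cases ha : a ∈ l
    · by_cases hb : b ∈ l'
      · obtain ⟨c, hc⟩ := h a ha b hb
        exact ⟨c, fun _ _ => hc⟩
      · exact ⟨Classical.arbitrary γ, fun _ h => absurd h hb⟩
    · exact ⟨Classical.arbitrary γ, fun h => absurd h ha⟩
  choose M hM using this
  exact ⟨M, fun a ha b hb => hM a b ha hb⟩

instance (A : Alphabet) : Nonempty (Expr A) := ⟨.var (Infinite.nonempty A.Var).some⟩

theorem TT.exists (hA : IsGAT TA) {X : PreCtx A} {Y : PreCtx B} (hX : GoodC TA X)
    (hY : GoodC TB Y) {u : Expr A} {v : Expr B} (hu : WT TA X u) (hv : WT TB Y v) :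
    ∃ e, TT TA TB X Y u v e := by
  suffices h : ∀ k v, WT TB (Y.take k) v → ∀ u, WT TA X u → ∃ e, TT TA TB X Y u v e from
    h Y.length v (by rwa [List.take_length]) u hu
  intro k
  induction k using Nat.strong_induction_on with
  | _ k ihk =>
    intro v
    induction v using Expr.induct with
    | hv y =>
      intro hv u
      induction u using Expr.induct with
      | hv x => exact fun _ => ⟨_, .var x y⟩
      | ha s ss ihs =>
        intro hu
        obtain ⟨j, hj, hjY, V, he, hV⟩ := hY.exists_take hv.var_mem
        obtain ⟨M, hM⟩ := exists_grid_fun (l := ss) (l' := V.args ++ [.var y])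
          (R := TT TA TB X Y) fun a ha b hb => by
            rcases List.mem_append.1 hb with hb | hb
            · exact ihk j hj b (hV b hb) a (hu.args a ha)
            · rw [List.mem_singleton] at hb
              subst hb
              exact ihs a ha (hu.args a ha)
        exact ⟨_, .left (.of_mem (he ▸ List.getElem_mem hjY)) M hM⟩
    | ha t ts iht =>
      intro hv u hu
      obtain ⟨U, hc, hU⟩ := hu.exists_canon hA hX
      obtain ⟨M, hM⟩ := exists_grid_fun (l := U.args ++ [u]) (l' := ts)
        (R := TT TA TB X Y) fun a ha b hb => by
          refine iht b hb (hv.args b hb) a ?_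
          rcases List.mem_append.1 ha with ha | ha
          · exact hU a ha
          · rwa [List.mem_singleton.1 ha]
      exact ⟨_, .right hc M hM⟩

/-- The tensor of two terms at their canonical sorts. -/
noncomputable def tens (TA : Set (Judg A)) (TB : Set (Judg B)) (X : PreCtx A) (Y : PreCtx B)
    (u : Expr A) (v : Expr B) : Expr (A.tensor B) :=
  Classical.epsilon (TT TA TB X Y u v)

theorem tens_var (X : PreCtx A) (Y : PreCtx B) (x : A.Var) (y : B.Var) :
    tens TA TB X Y (.var x) (.var y) = .var (x, y) := by
  have : TT TA TB X Y (.var x) (.var y) (tens TA TB X Y (.var x) (.var y)) :=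
    Classical.epsilon_spec ⟨_, .var x y⟩
  generalize tens TA TB X Y (.var x) (.var y) = e at this
  cases this
  rfl

section
variable {X : PreCtx A} {Y : PreCtx B}

theorem tens_spec (hA : IsGAT TA) (hX : GoodC TA X)
    (hY : GoodC TB Y) {u : Expr A} {v : Expr B} (hu : WT TA X u) (hv : WT TB Y v) :
    TT TA TB X Y u v (tens TA TB X Y u v) :=
  Classical.epsilon_spec (TT.exists hA hX hY hu hv)

theorem TT.eq_tens (hA : IsGAT TA) (hB : IsGAT TB) (hX : GoodC TA X)
    (hY : GoodC TB Y) {u : Expr A} {v : Expr B} {e : Expr (A.tensor B)}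
    (h : TT TA TB X Y u v e) : e = tens TA TB X Y u v :=
  h.det hA hB hX hY (Classical.epsilon_spec (p := TT TA TB X Y u v) ⟨e, h⟩)

theorem tens_right (hA : IsGAT TA) (hB : IsGAT TB) (hX : GoodC TA X) (hY : GoodC TB Y)
    {u : Expr A} {U : SortE A} {t : B.TermSym} {ts : List (Expr B)} (hc : CanonSort TA X u U)
    (hu : WT TA X u) (hv : ∀ b ∈ ts, WT TB Y b) :
    tens TA TB X Y u (.app t ts) =
      .app (.inl (U.head, t)) (grid (tens TA TB X Y) (U.args ++ [u]) ts) := by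
  refine (TT.eq_tens hA hB hX hY (.right hc _ fun a ha b hb => ?_)).symm
  refine tens_spec hA hX hY ?_ (hv b hb)
  rcases List.mem_append.1 ha with ha | ha
  · exact hc.swt hA hX hu a ha
  · rwa [List.mem_singleton.1 ha]

theorem tens_left (hA : IsGAT TA) (hB : IsGAT TB) (hX : GoodC TA X) (hY : GoodC TB Y)
    {s : A.TermSym} {ss : List (Expr A)} {y : B.Var} {V : SortE B} (hc : (y, V) ∈ Y)
    (hu : ∀ a ∈ ss, WT TA X a) :
    tens TA TB X Y (.app s ss) (.var y) =
      .app (.inr (s, V.head)) (grid (tens TA TB X Y) ss (V.args ++ [.var y])) := by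
  refine (TT.eq_tens hA hB hX hY (.left (.of_mem hc) _ fun a ha b hb => ?_)).symm
  refine tens_spec hA hX hY (hu a ha) ?_
  rcases List.mem_append.1 hb with hb | hb
  · exact hY.swt_of_mem hc b hb
  · rw [List.mem_singleton.1 hb]
    exact .var (mem_keys hc)

theorem tens_mono (hA : IsGAT TA) (hB : IsGAT TB) {X' : PreCtx A} {Y' : PreCtx B}
    (hX : GoodC TA X) (hY : GoodC TB Y) (hX' : GoodC TA X') (hY' : GoodC TB Y')
    (hXX : X ⊆ X') (hYY : Y ⊆ Y') {u : Expr A} {v : Expr B} (hu : WT TA X u) (hv : WT TB Y v) :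
    tens TA TB X' Y' u v = tens TA TB X Y u v :=
  (TT.eq_tens hA hB hX' hY' ((tens_spec hA hX hY hu hv).mono hXX hYY)).symm

theorem TT.occurs (hA : IsGAT TA) (hX : GoodC TA X) (hY : GoodC TB Y) {u : Expr A} {v : Expr B}
    {e : Expr (A.tensor B)} (h : TT TA TB X Y u v e) (hu : WT TA X u) (hv : WT TB Y v)
    {z : A.Var × B.Var} (hz : Occurs (A := A.tensor B) z e) : z.1 ∈ keys X ∧ z.2 ∈ keys Y := by
  induction h with
  | var x y =>
    obtain rfl := occurs_var.1 hz
    exact ⟨hu.var_mem, hv.var_mem⟩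
  | left hc M h ih =>
    obtain ⟨e, he, hz⟩ := occurs_app.1 hz
    obtain ⟨a, ha, b, hb, rfl⟩ := mem_grid.1 he
    refine ih a ha b hb (hu.args a ha) ?_ hz
    rcases List.mem_append.1 hb with hb | hb
    · exact hY.swt_of_mem (canonSort_var_iff.1 hc) b hb
    · rwa [List.mem_singleton.1 hb]
  | right hc M h ih =>
    obtain ⟨e, he, hz⟩ := occurs_app.1 hz
    obtain ⟨a, ha, b, hb, rfl⟩ := mem_grid.1 he
    refine ih a ha b hb ?_ (hv.args b hb) hz
    rcases List.mem_append.1 ha with ha | ha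
    · exact hc.swt hA hX hu a ha
    · rwa [List.mem_singleton.1 ha]

theorem tens_occurs (hA : IsGAT TA) (hX : GoodC TA X) (hY : GoodC TB Y) {u : Expr A} {v : Expr B}
    (hu : WT TA X u) (hv : WT TB Y v) {z : A.Var × B.Var}
    (hz : Occurs (A := A.tensor B) z (tens TA TB X Y u v)) : z.1 ∈ keys X ∧ z.2 ∈ keys Y :=
  (tens_spec hA hX hY hu hv).occurs hA hX hY hu hv hz

/-- Substituting `u` for a fresh variable in the first component of a tensor. -/
theorem tens_subst_fst (hA : IsGAT TA) (hB : IsGAT TB) (hX : GoodC TA X) (hY : GoodC TB Y)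
    {u : Expr A} {U : SortE A} {x : A.Var} (hx : x ∉ keys X) (hu : WT TA X u)
    (hc : CanonSort TA X u U) {θ : A.Var × B.Var → Expr (A.tensor B)}
    (h1 : ∀ y ∈ keys Y, θ (x, y) = tens TA TB X Y u (.var y))
    (h2 : ∀ z, z.1 ≠ x → θ z = .var z) {v : Expr B} (hv : WT TB Y v) :
    (tens TA TB (X ++ [(x, U)]) Y (.var x) v).subst θ = tens TA TB X Y u v := by
  have hU := hc.swt hA hX hu
  have hX' := hX.snoc hx hU
  have hxX : CanonSort TA (X ++ [(x, U)]) (.var x) U := .of_mem (by simp)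
  induction v using Expr.induct with
  | hv y => rw [tens_var, Expr.subst_var', h1 y hv.var_mem]
  | ha t ts ih =>
    rw [tens_right hA hB hX' hY hxX (.var (by simp [keys])) hv.args,
      tens_right hA hB hX hY hc hu hv.args, Expr.subst_app, map_grid, grid_append, grid_append,
      grid_singleton, grid_singleton]
    congr 2
    · refine grid_congr fun a ha b hb => ?_
      rw [tens_mono hA hB hX hY hX' hY (by simp) (by simp) (hU a ha) (hv.args b hb)]
      conv_rhs => rw [← Expr.subst_id (tens TA TB X Y a b)]
      refine Expr.subst_congr fun z hz => h2 z ?_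
      rintro rfl
      exact hx (tens_occurs hA hX hY (hU a ha) (hv.args b hb) hz).1
    · exact List.map_congr_left fun b hb => ih b hb (hv.args b hb)

end

theorem pairsR_eq {x : A.Var} {Y : PreCtx B} {g : ℕ → Expr (A.tensor B)}
    {G : B.Var → Expr (A.tensor B)} (h : ∀ j (hj : j < Y.length), g j = G (Y[j]).1) :
    pairsR x Y g =
      (Y.map fun p => (x, p.1)).zip ((Y.map fun p => (x, p.1)).map fun z : A.Var × B.Var => G z.2) := by
  refine List.ext_getElem (by simp [pairsR]) fun i h1 h2 => ?_
  simp only [pairsR, List.getElem_map, List.getElem_finRange, List.getElem_zip]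
  simpa using h i _

theorem pairsL_eq {X : PreCtx A} {y : B.Var} {g : ℕ → Expr (A.tensor B)}
    {G : A.Var → Expr (A.tensor B)} (h : ∀ j (hj : j < X.length), g j = G (X[j]).1) :
    pairsL X y g =
      (X.map fun p => (p.1, y)).zip ((X.map fun p => (p.1, y)).map fun z : A.Var × B.Var => G z.1) := by
  refine List.ext_getElem (by simp [pairsL]) fun i h1 h2 => ?_
  simp only [pairsL, List.getElem_map, List.getElem_finRange, List.getElem_zip]
  simpa using h i _

theorem lookupV_pairsR {x : A.Var} {Y : PreCtx B} {g : ℕ → Expr (A.tensor B)}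
    {G : B.Var → Expr (A.tensor B)} (h : ∀ j (hj : j < Y.length), g j = G (Y[j]).1) {y : B.Var}
    (hy : y ∈ keys Y) : lookupV (A := A.tensor B) (pairsR x Y g) (x, y) = G y := by
  rw [pairsR_eq h]
  obtain ⟨p, hp, rfl⟩ := List.mem_map.1 hy
  exact lookupV_zip_map (A := A.tensor B) (fun z => G z.2) _ (List.mem_map.2 ⟨p, hp, rfl⟩)

theorem lookupV_pairsL {y : B.Var} {X : PreCtx A} {g : ℕ → Expr (A.tensor B)}
    {G : A.Var → Expr (A.tensor B)} (h : ∀ j (hj : j < X.length), g j = G (X[j]).1) {x : A.Var}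
    (hx : x ∈ keys X) : lookupV (A := A.tensor B) (pairsL X y g) (x, y) = G x := by
  rw [pairsL_eq h]
  obtain ⟨p, hp, rfl⟩ := List.mem_map.1 hx
  exact lookupV_zip_map (A := A.tensor B) (fun z => G z.1) _ (List.mem_map.2 ⟨p, hp, rfl⟩)

theorem mem_pairsR_keys {x : A.Var} {Y : PreCtx B} {g : ℕ → Expr (A.tensor B)}
    {z : A.Var × B.Var} : z ∈ (pairsR x Y g).map Prod.fst ↔ z.1 = x ∧ z.2 ∈ keys Y := by
  obtain ⟨a, b⟩ := z
  simp only [pairsR, List.map_map, List.mem_map, List.mem_finRange, true_and, Function.comp_apply,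
    Prod.mk.injEq]
  constructor
  · rintro ⟨i, rfl, rfl⟩
    exact ⟨rfl, _, List.get_mem _ _, rfl⟩
  · rintro ⟨rfl, p, hp, rfl⟩
    obtain ⟨i, hi, rfl⟩ := List.mem_iff_getElem.1 hp
    exact ⟨⟨i, hi⟩, rfl, rfl⟩

theorem mem_pairsL_keys {y : B.Var} {X : PreCtx A} {g : ℕ → Expr (A.tensor B)}
    {z : A.Var × B.Var} : z ∈ (pairsL X y g).map Prod.fst ↔ z.2 = y ∧ z.1 ∈ keys X := by
  obtain ⟨a, b⟩ := z
  simp only [pairsL, List.map_map, List.mem_map, List.mem_finRange, true_and, Function.comp_apply,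
    Prod.mk.injEq]
  constructor
  · rintro ⟨i, rfl, rfl⟩
    exact ⟨rfl, _, List.get_mem _ _, rfl⟩
  · rintro ⟨rfl, p, hp, rfl⟩
    obtain ⟨i, hi, rfl⟩ := List.mem_iff_getElem.1 hp
    exact ⟨⟨i, hi⟩, rfl, rfl⟩

/-! ## The graph of the tensor of terms -/

/-- An argument of the tensor operation at its canonical sort in an ambient context. -/
structure Adm (T : Set (Judg A)) (Z : PreCtx A) (a : TArg A) : Prop where
  sub : a.ctx ⊆ Z
  good : GoodC T a.ctx
  canon : CanonSort T Z a.tm a.srt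
  swt : SWT T a.ctx a.srt
  wt : WT T a.ctx a.tm ∨ ∃ x, a.tm = .var x

theorem Adm.ofWT (hT : IsGAT TA) {X Z : PreCtx A} (hX : GoodC TA X) (hXZ : X ⊆ Z) {u : Expr A}
    {U : SortE A} (hu : WT TA X u) (hc : CanonSort TA X u U) : Adm TA Z ⟨X, u, U⟩ :=
  ⟨hXZ, hX, hc.mono hXZ, hc.swt hT hX hu, .inl hu⟩

theorem Adm.take {X : PreCtx A} (hX : GoodC TA X) {Z : PreCtx A} (hXZ : X ⊆ Z) {j : ℕ}
    (hj : j < X.length) : Adm TA Z ⟨X.take j, .var (X[j]).1, (X[j]).2⟩ :=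
  ⟨fun p hp => hXZ (List.mem_of_mem_take hp), hX.take j, .of_mem (hXZ (List.getElem_mem hj)),
    hX.2 (X.take j) X[j] (X.drop (j + 1)) (by rw [List.getElem_cons_drop, List.take_append_drop]),
    .inr ⟨_, rfl⟩⟩

theorem Adm.fresh {X : PreCtx A} (hX : GoodC TA X) {x : A.Var} {U : SortE A} (hU : SWT TA X U) :
    Adm TA (X ++ [(x, U)]) ⟨X, .var x, U⟩ :=
  ⟨by simp, hX, .of_mem (by simp), hU, .inr ⟨_, rfl⟩⟩

theorem Adm.wt_ambient {Z : PreCtx A} {a : TArg A} (h : Adm TA Z a) : WT TA Z a.tm := by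
  obtain h' | ⟨x, hx⟩ := h.wt
  · exact h'.weaken (keys_mono h.sub)
  · have := h.canon
    rw [hx] at this ⊢
    exact .var (mem_keys (canonSort_var_iff.1 this))

theorem Adm.app_wt {Z X : PreCtx A} {s : A.TermSym} {ss : List (Expr A)} {U : SortE A}
    (h : Adm TA Z ⟨X, .app s ss, U⟩) : WT TA X (.app s ss) := by
  obtain h' | ⟨x, hx⟩ := h.wt
  · exact h'
  · cases hx

theorem TTg.eq_tens_aux (hA : IsGAT TA) (hB : IsGAT TB) {c : Bool} {a : TArg A} {b : TArg B}
    {e : Expr (A.tensor B)} (h : TTg TA TB c a b e) (hcf : c = false) {X : PreCtx A}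
    {Y : PreCtx B} (hX : GoodC TA X) (hY : GoodC TB Y) (ha : Adm TA X a) (hb : Adm TB Y b) :
    e = tens TA TB X Y a.tm b.tm := by
  induction h generalizing X Y with
  | varvar => exact (tens_var _ _ _ _).symm
  | @varapp c X₀ x S ss Y₀ t ts V SS TSf hSS hTS M out hM hMx hout ihM ihMx =>
    have hv := hb.app_wt
    have hxc : CanonSort TA X (.var x) ⟨S, ss⟩ := ha.canon
    rw [tens_right hA hB hX hY hxc ha.wt_ambient hb.wt_ambient.args]
    rw [hout.eq_grid (M := tens TA TB X Y) (l := ss ++ [.var x]) (l' := ts) (by simp) rfl]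
    intro i j hi hj
    have hbj := Adm.ofWT hB hb.good hb.sub (hv.args _ (List.getElem_mem hj)) (hTS j hj)
    rcases Nat.lt_or_ge i ss.length with h | h
    · rw [List.getElem_append_left h]
      exact ihM i h j hj hcf hX hY
        (Adm.ofWT hA ha.good ha.sub (ha.swt _ (List.getElem_mem h)) (hSS i h)) hbj
    · have : i = ss.length := by simp at hi; omega
      subst this
      simpa using ihMx j hj hcf hX hY ha hbj
  | @appvar c X₀ s ss U Y₀ y S ts SS TSf hSS hTS M out hM hMy hout ihM ihMy =>
    have hu := ha.app_wt
    have hyc : (y, ⟨S, ts⟩) ∈ Y := canonSort_var_iff.1 hb.canon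
    rw [tens_left hA hB hX hY hyc ha.wt_ambient.args]
    rw [hout.eq_grid (M := tens TA TB X Y) (l := ss) (l' := ts ++ [.var y]) rfl (by simp)]
    intro i j hi hj
    have hai := Adm.ofWT hA ha.good ha.sub (hu.args _ (List.getElem_mem hi)) (hSS i hi)
    rcases Nat.lt_or_ge j ts.length with h | h
    · rw [List.getElem_append_left h]
      exact ihM i hi j h hcf hX hY hai
        (Adm.ofWT hB hb.good hb.sub (hb.swt _ (List.getElem_mem h)) (hTS j h))
    · have : j = ts.length := by simp at hj; omega
      subst this
      simpa using ihMy i hi hcf hX hY hai hb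
  | @appapp_base X₀ s ss U Y₀ t ts V x hx e0 h0 g hg ih0 ihg =>
    have hu := ha.app_wt
    have hv := hb.app_wt
    have hc : CanonSort TA X₀ (.app s ss) U := ha.canon.app_ctx
    have hx' : x ∉ keys X₀ := fun h => by
      obtain ⟨p, hp, he⟩ := List.mem_map.1 h
      exact hx p hp he
    have hX₀ := ha.good
    have hY₀ := hb.good
    have hv0 : CanonSort TB Y₀ (.app t ts) V := hb.canon.app_ctx
    have e1 := ih0 hcf (hX₀.snoc hx' ha.swt) hY₀ (Adm.fresh hX₀ ha.swt)
      (Adm.ofWT hB hY₀ (List.Subset.refl _) hv hv0)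
    have hG : ∀ j (hj : j < Y₀.length),
        g j = tens TA TB X₀ Y₀ (.app s ss) (.var (Y₀[j]).1) := fun j hj =>
      ihg j hj hcf hX₀ hY₀ (Adm.ofWT hA hX₀ (List.Subset.refl _) hu hc)
        (Adm.take hY₀ (List.Subset.refl _) hj)
    rw [e1]
    have := tens_subst_fst hA hB hX₀ hY₀ hx' hu hc
      (θ := lookupV (A := A.tensor B) (pairsR x Y₀ g))
      (fun y hy => lookupV_pairsR (G := fun y => tens TA TB X₀ Y₀ (.app s ss) (.var y)) hG hy)
      (fun z hz => lookupV_of_not_mem fun h => hz (mem_pairsR_keys.1 h).1) hv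
    refine this.trans ?_
    exact (tens_mono hA hB hX₀ hY₀ hX hY ha.sub hb.sub hu hv).symm
  | appapp_star => cases hcf

theorem TTg.eq_tens (hA : IsGAT TA) (hB : IsGAT TB) {a : TArg A} {b : TArg B}
    {e : Expr (A.tensor B)} (h : TTg TA TB false a b e) {X : PreCtx A}
    {Y : PreCtx B} (hX : GoodC TA X) (hY : GoodC TB Y) (ha : Adm TA X a) (hb : Adm TB Y b) :
    e = tens TA TB X Y a.tm b.tm := h.eq_tens_aux hA hB rfl hX hY ha hb

theorem exists_nat_fun {γ : Type} [Nonempty γ] {m : ℕ} {R : (i : ℕ) → i < m → γ → Prop}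
    (h : ∀ i hi, ∃ c, R i hi c) : ∃ f : ℕ → γ, ∀ i hi, R i hi (f i) := by
  have : ∀ i, ∃ c, ∀ hi, R i hi c := fun i => by
    by_cases hi : i < m
    · obtain ⟨c, hc⟩ := h i hi
      exact ⟨c, fun _ => hc⟩
    · exact ⟨Classical.arbitrary γ, fun h => absurd h hi⟩
  choose f hf using this
  exact ⟨f, hf⟩

theorem exists_nat_fun₂ {γ : Type} [Nonempty γ] {m n : ℕ}
    {R : (i : ℕ) → i < m → (j : ℕ) → j < n → γ → Prop}
    (h : ∀ i hi j hj, ∃ c, R i hi j hj c) : ∃ f : ℕ → ℕ → γ, ∀ i hi j hj, R i hi j hj (f i j) :=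
  exists_nat_fun (γ := ℕ → γ) (R := fun i hi f => ∀ j hj, R i hi j hj (f j)) fun i hi => exists_nat_fun (h i hi)

/-- An argument on which the tensor operation is defined. -/
structure Inp (T : Set (Judg A)) (a : TArg A) : Prop where
  good : GoodC T a.ctx
  swt : SWT T a.ctx a.srt
  wt : WT T a.ctx a.tm ∨ ∃ x, a.tm = .var x

theorem Adm.inp {Z : PreCtx A} {a : TArg A} (h : Adm TA Z a) : Inp TA a := ⟨h.good, h.swt, h.wt⟩

theorem exists_fresh (X : PreCtx A) : ∃ x, ∀ p ∈ X, p.1 ≠ x := by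
  obtain ⟨x, hx⟩ := (keys X).finite_toSet.exists_notMem
  exact ⟨x, fun p hp h => hx (h ▸ mem_keys hp)⟩

/-- The argument `v` at the sort `V` only involves the first `k` variables of `Y`. -/
def Below (T : Set (Judg B)) (Y : PreCtx B) (k : ℕ) (v : Expr B) (V : SortE B) : Prop :=
  WT T (Y.take k) v ∧ (∃ t ts, v = .app t ts) ∨ (∃ y, v = .var y) ∧ ∃ k' < k, SWT T (Y.take k') V

theorem GoodC.swt_take {X : PreCtx A} (hX : GoodC TA X) {j : ℕ} (hj : j < X.length) :
    SWT TA (X.take j) X[j].2 :=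
  hX.2 (X.take j) X[j] (X.drop (j + 1)) (by rw [List.getElem_cons_drop, List.take_append_drop])

theorem Below.exists_canon (hB : IsGAT TB) {Y : PreCtx B} (hY : GoodC TB Y) {k : ℕ} {v : Expr B}
    (hv : WT TB (Y.take k) v) : ∃ V, CanonSort TB Y v V ∧ Below TB Y k v V := by
  cases v with
  | var y =>
    obtain ⟨j, hj, hjY, V, he, hV⟩ := hY.exists_take hv.var_mem
    exact ⟨V, .of_mem (he ▸ List.getElem_mem hjY), .inr ⟨⟨y, rfl⟩, j, hj, hV⟩⟩
  | app t ts =>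
    obtain ⟨V, hV, -⟩ := WT.exists_canon hB hY (hv.weaken (keys_mono (List.take_subset k Y)))
    exact ⟨V, hV, .inl ⟨hv, t, ts, rfl⟩⟩

theorem TTg.exists_below (hA : IsGAT TA) (hB : IsGAT TB) (N : ℕ) : ∀ {Y : PreCtx B},
    Y.length = N → GoodC TB Y → ∀ (k : ℕ) (v : Expr B) (V : SortE B), Below TB Y k v V →
    ∀ {X : PreCtx A} {u : Expr A} {U : SortE A}, Inp TA ⟨X, u, U⟩ →
    ∃ e, TTg TA TB false ⟨X, u, U⟩ ⟨Y, v, V⟩ e := by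
  induction N using Nat.strong_induction_on with
  | _ N ihN =>
  intro Y hN hY k
  induction k using Nat.strong_induction_on with
  | _ k ihk =>
  intro v
  induction v using Expr.induct with
  | hv y =>
    rintro ⟨T, ts⟩ hV X u
    obtain ⟨-, k', hk, hV⟩ : (∃ y', Expr.var y = Expr.var y') ∧ ∃ k' < k, SWT TB (Y.take k') ⟨T, ts⟩ := by
      rcases hV with ⟨-, t, ts, h⟩ | h
      · cases h
      · exact h
    induction u using Expr.induct with
    | hv x => exact fun _ => ⟨_, .varvar⟩
    | ha s ss ihs =>
      intro U hu
      have huW : WT TA X (.app s ss) := hu.wt.resolve_right (by rintro ⟨x, hx⟩; cases hx)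
      have hX : GoodC TA X := hu.good
      have : Nonempty (SortE A) := ⟨U⟩
      have : Nonempty (SortE B) := ⟨⟨T, ts⟩⟩
      obtain ⟨SS, hSS⟩ := exists_nat_fun (m := ss.length)
        (R := fun i hi c => CanonSort TA X ss[i] c ∧ SWT TA X c) fun i hi =>
          (huW.args _ (List.getElem_mem hi)).exists_canon hA hX
      obtain ⟨TS, hTS⟩ := exists_nat_fun (m := ts.length)
        (R := fun j hj c => CanonSort TB Y ts[j] c ∧ Below TB Y k' ts[j] c) fun j hj =>
          Below.exists_canon hB hY (hV _ (List.getElem_mem hj))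
      have hin : ∀ i (hi : i < ss.length), Inp TA ⟨X, ss[i], SS i⟩ := fun i hi =>
        ⟨hX, (hSS i hi).2, .inl (huW.args _ (List.getElem_mem hi))⟩
      obtain ⟨M, hM⟩ := exists_nat_fun₂ (m := ss.length) (n := ts.length)
        (R := fun i hi j hj c => TTg TA TB false ⟨X, ss[i], SS i⟩ ⟨Y, ts[j], TS j⟩ c)
        fun i hi j hj => ihk k' hk ts[j] (TS j) (hTS j hj).2 (hin i hi)
      obtain ⟨My, hMy⟩ := exists_nat_fun (m := ss.length)
        (R := fun i hi c => TTg TA TB false ⟨X, ss[i], SS i⟩ ⟨Y, .var y, ⟨T, ts⟩⟩ c)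
        fun i hi => ihs _ (List.getElem_mem hi) (hin i hi)
      obtain ⟨out, hout⟩ := exists_isGrid ss.length (ts.length + 1)
        fun i j => if j < ts.length then M i j else My i
      exact ⟨_, .appvar SS TS (fun i hi => (hSS i hi).1) (fun j hj => (hTS j hj).1) _ out
        (fun i hi j hj => by simpa [hj] using hM i hi j hj)
        (fun i hi => by simpa using hMy i hi) hout⟩
  | ha t ts iht =>
    intro V hV X
    have hvk : WT TB (Y.take k) (.app t ts) := by
      rcases hV with ⟨h, -⟩ | ⟨⟨y, h⟩, -⟩
      · exact h
      · cases h
    have key : ∀ (x : A.Var) (U : SortE A), GoodC TA X → SWT TA X U →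
        ∃ e, TTg TA TB false ⟨X, .var x, U⟩ ⟨Y, .app t ts, V⟩ e := by
      rintro x ⟨S, ss⟩ hX hU
      have : Nonempty (SortE A) := ⟨⟨S, ss⟩⟩
      have : Nonempty (SortE B) := ⟨V⟩
      obtain ⟨SS, hSS⟩ := exists_nat_fun (m := ss.length)
        (R := fun i hi c => CanonSort TA X ss[i] c ∧ SWT TA X c) fun i hi =>
          (hU _ (List.getElem_mem hi)).exists_canon hA hX
      obtain ⟨TS, hTS⟩ := exists_nat_fun (m := ts.length)
        (R := fun j hj c => CanonSort TB Y ts[j] c ∧ Below TB Y k ts[j] c) fun j hj =>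
          Below.exists_canon hB hY (hvk.args _ (List.getElem_mem hj))
      obtain ⟨M, hM⟩ := exists_nat_fun₂ (m := ss.length) (n := ts.length)
        (R := fun i hi j hj c => TTg TA TB false ⟨X, ss[i], SS i⟩ ⟨Y, ts[j], TS j⟩ c)
        fun i hi j hj => iht ts[j] (List.getElem_mem hj) (TS j) (hTS j hj).2
          ⟨hX, (hSS i hi).2, .inl (hU _ (List.getElem_mem hi))⟩
      obtain ⟨Mx, hMx⟩ := exists_nat_fun (m := ts.length)
        (R := fun j hj c => TTg TA TB false ⟨X, .var x, ⟨S, ss⟩⟩ ⟨Y, ts[j], TS j⟩ c)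
        fun j hj => iht ts[j] (List.getElem_mem hj) (TS j) (hTS j hj).2
          ⟨hX, hU, .inr ⟨x, rfl⟩⟩
      obtain ⟨out, hout⟩ := exists_isGrid (ss.length + 1) ts.length
        fun i j => if i < ss.length then M i j else Mx j
      exact ⟨_, .varapp SS TS (fun i hi => (hSS i hi).1) (fun j hj => (hTS j hj).1) _ out
        (fun i hi j hj => by simpa [hi] using hM i hi j hj)
        (fun j hj => by simpa using hMx j hj) hout⟩
    intro u U hu
    cases u with
    | var x => exact key x U hu.good hu.swt
    | app s ss =>
      obtain ⟨x, hx⟩ := exists_fresh X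
      obtain ⟨e0, h0⟩ := key x U hu.good hu.swt
      obtain ⟨g, hg⟩ := exists_nat_fun (m := Y.length)
        (R := fun j hj c => TTg TA TB false ⟨X, .app s ss, U⟩
          ⟨Y.take j, .var (Y[j]'hj).1, (Y[j]'hj).2⟩ c) fun j hj =>
        ihN j (hN ▸ hj) (by simp; omega) (hY.take j) (j + 1) _ _
          (.inr ⟨⟨_, rfl⟩, j, by omega, by rw [List.take_take, min_self]; exact hY.swt_take hj⟩) hu
      exact ⟨_, .appapp_base hx e0 h0 g hg⟩

theorem TTg.exists (hA : IsGAT TA) (hB : IsGAT TB) {a : TArg A} {b : TArg B} (ha : Inp TA a)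
    (hb : Inp TB b) : ∃ e, TTg TA TB false a b e := by
  obtain ⟨X, u, U⟩ := a
  obtain ⟨Y, v, V⟩ := b
  refine TTg.exists_below hA hB _ rfl hb.good (Y.length + 1) v V ?_ ha
  have hw := hb.wt
  have hs := hb.swt
  cases v with
  | var y => exact .inr ⟨⟨y, rfl⟩, Y.length, by omega, by rwa [List.take_length]⟩
  | app t ts =>
    exact .inl ⟨by
      rw [List.take_of_length_le (Nat.le_succ _)]
      exact hw.resolve_right (by rintro ⟨x, hx⟩; cases hx), t, ts, rfl⟩

/-- The tensor of two admissible arguments is the tensor of the terms. -/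
theorem TTg.of_adm (hA : IsGAT TA) (hB : IsGAT TB) {X : PreCtx A} {Y : PreCtx B}
    (hX : GoodC TA X) (hY : GoodC TB Y) {a : TArg A} {b : TArg B} (ha : Adm TA X a)
    (hb : Adm TB Y b) : TTg TA TB false a b (tens TA TB X Y a.tm b.tm) := by
  obtain ⟨e, he⟩ := TTg.exists hA hB ha.inp hb.inp
  rwa [← he.eq_tens hA hB hX hY ha hb]

theorem dropLast_grid {α β γ : Type} (M : α → β → γ) (l : List α) (a : α) (l' : List β) (b : β) :
    (grid M (l ++ [a]) (l' ++ [b])).dropLast = grid M l (l' ++ [b]) ++ l'.map (M a) := by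
  rw [grid_append, grid_singleton, List.map_append, List.map_singleton, ← List.append_assoc,
    List.dropLast_concat]

theorem isGrid_range {γ : Type} (m n : ℕ) (N : ℕ → ℕ → γ) :
    IsGrid m n N (grid N (List.range m) (List.range n)) := by
  refine ⟨by simp [length_grid], fun i j hi hj h => ?_⟩
  have := getElem_grid N (l := List.range m) (l' := List.range n) (i := i) (j := j) (by simpa)
    (by simpa) (by simpa using h)
  simpa using this

theorem IsGrid.eq_range {γ : Type} {m n : ℕ} {N : ℕ → ℕ → γ} {L : List γ} (h : IsGrid m n N L) :
    L = grid N (List.range m) (List.range n) :=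
  h.eq_grid (by simp) (by simp) fun i j hi hj => by simp

/-- The tensor of two sorts at given terms. -/
noncomputable def tsort (TA : Set (Judg A)) (TB : Set (Judg B)) (X : PreCtx A) (Y : PreCtx B)
    (u : Expr A) (U : SortE A) (v : Expr B) (V : SortE B) : SortE (A.tensor B) :=
  ⟨(U.head, V.head), grid (tens TA TB X Y) U.args (V.args ++ [v]) ++ V.args.map (tens TA TB X Y u)⟩

/-- The entry of a tensor context determined by two entries. -/
noncomputable def ent (TA : Set (Judg A)) (TB : Set (Judg B)) (X : PreCtx A) (Y : PreCtx B)
    (p : A.Var × SortE A) (q : B.Var × SortE B) :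
    (A.tensor B).Var × SortE (A.tensor B) :=
  ((p.1, q.1), tsort TA TB X Y (.var p.1) p.2 (.var q.1) q.2)

/-- The tensor of two contexts. -/
noncomputable def tctx (TA : Set (Judg A)) (TB : Set (Judg B)) (X : PreCtx A) (Y : PreCtx B) :
    PreCtx (A.tensor B) := grid (ent TA TB X Y) X Y

/-- The context of the tensor of two sorts. -/
noncomputable def hat (TA : Set (Judg A)) (TB : Set (Judg B)) (X : PreCtx A)
    (p : A.Var × SortE A) (Y : PreCtx B) (q : B.Var × SortE B) : PreCtx (A.tensor B) :=
  (tctx TA TB (X ++ [p]) (Y ++ [q])).dropLast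

theorem hat_eq (X : PreCtx A) (p : A.Var × SortE A) (Y : PreCtx B) (q : B.Var × SortE B) :
    hat TA TB X p Y q = grid (ent TA TB (X ++ [p]) (Y ++ [q])) X (Y ++ [q]) ++
      Y.map (ent TA TB (X ++ [p]) (Y ++ [q]) p) := dropLast_grid _ _ _ _ _

theorem mem_tctx {X : PreCtx A} {Y : PreCtx B} {z : (A.tensor B).Var × SortE (A.tensor B)} :
    z ∈ tctx TA TB X Y ↔ ∃ p ∈ X, ∃ q ∈ Y, ent TA TB X Y p q = z := mem_grid

theorem mem_hat {X : PreCtx A} {p : A.Var × SortE A} {Y : PreCtx B} {q : B.Var × SortE B}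
    {z : (A.tensor B).Var × SortE (A.tensor B)} :
    z ∈ hat TA TB X p Y q ↔ ∃ p' ∈ X ++ [p], ∃ q' ∈ Y ++ [q], (p' ∈ X ∨ q' ∈ Y) ∧
      ent TA TB (X ++ [p]) (Y ++ [q]) p' q' = z := by
  rw [hat_eq, List.mem_append, mem_grid, List.mem_map]
  constructor
  · rintro (⟨p', hp, q', hq, h⟩ | ⟨q', hq, h⟩)
    · exact ⟨p', by simp [hp], q', hq, .inl hp, h⟩
    · exact ⟨p, by simp, q', by simp [hq], .inr hq, h⟩
  · rintro ⟨p', hp, q', hq, h', h⟩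
    by_cases hpX : p' ∈ X
    · exact .inl ⟨p', hpX, q', hq, h⟩
    · obtain rfl : p' = p := by simpa [hpX] using hp
      exact .inr ⟨q', h'.resolve_left hpX, h⟩

section
variable {X X' : PreCtx A} {Y Y' : PreCtx B}

theorem tsort_mono (hA : IsGAT TA) (hB : IsGAT TB) (hX : GoodC TA X) (hY : GoodC TB Y)
    (hX' : GoodC TA X') (hY' : GoodC TB Y') (hXX : X ⊆ X') (hYY : Y ⊆ Y') {u : Expr A}
    {U : SortE A} {v : Expr B} {V : SortE B} (hu : WT TA X u) (hU : SWT TA X U) (hv : WT TB Y v)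
    (hV : SWT TB Y V) : tsort TA TB X' Y' u U v V = tsort TA TB X Y u U v V := by
  unfold tsort
  congr 2
  · refine grid_congr fun a ha b hb => tens_mono hA hB hX hY hX' hY' hXX hYY (hU a ha) ?_
    rcases List.mem_append.1 hb with hb | hb
    · exact hV b hb
    · rwa [List.mem_singleton.1 hb]
  · exact List.map_congr_left fun b hb =>
      tens_mono hA hB hX hY hX' hY' hXX hYY hu (hV b hb)

theorem ent_mono (hA : IsGAT TA) (hB : IsGAT TB) (hX : GoodC TA X) (hY : GoodC TB Y)
    (hX' : GoodC TA X') (hY' : GoodC TB Y') (hXX : X ⊆ X') (hYY : Y ⊆ Y') {p : A.Var × SortE A}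
    {q : B.Var × SortE B} (hp : p ∈ X) (hq : q ∈ Y) :
    ent TA TB X' Y' p q = ent TA TB X Y p q := by
  unfold ent
  rw [tsort_mono hA hB hX hY hX' hY' hXX hYY (.var (mem_keys hp)) (hX.swt_of_mem hp)
    (.var (mem_keys hq)) (hY.swt_of_mem hq)]

theorem grid_ent_eq (hA : IsGAT TA) (hB : IsGAT TB) (hX : GoodC TA X) (hY : GoodC TB Y)
    (hX' : GoodC TA X') (hY' : GoodC TB Y') (hXX : X ⊆ X') (hYY : Y ⊆ Y') :
    grid (ent TA TB X' Y') X Y = tctx TA TB X Y :=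
  grid_congr fun p hp q hq => ent_mono hA hB hX hY hX' hY' hXX hYY hp hq

theorem tctx_subset (hA : IsGAT TA) (hB : IsGAT TB) (hX : GoodC TA X) (hY : GoodC TB Y)
    (hX' : GoodC TA X') (hY' : GoodC TB Y') (hXX : X ⊆ X') (hYY : Y ⊆ Y') :
    tctx TA TB X Y ⊆ tctx TA TB X' Y' := fun z hz => by
  obtain ⟨p, hp, q, hq, rfl⟩ := mem_tctx.1 hz
  exact mem_tctx.2 ⟨p, hXX hp, q, hYY hq, ent_mono hA hB hX hY hX' hY' hXX hYY hp hq⟩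

theorem not_mem_keys {x : A.Var} (h : ∀ p ∈ X, p.1 ≠ x) : x ∉ keys X := fun hx => by
  obtain ⟨U, hU⟩ := exists_of_mem_keys hx
  exact h _ hU rfl

/-! ## The graphs of the tensor operations on sorts and contexts -/

theorem TSo.eq_tsort (hA : IsGAT TA) (hB : IsGAT TB) (hX : GoodC TA X) (hY : GoodC TB Y)
    {Z : PreCtx A} {Z' : PreCtx B} (hZ : GoodC TA Z) (hZ' : GoodC TB Z')
    {x : A.Var} {U : SortE A} {y : B.Var} {V : SortE B} {W : SortE (A.tensor B)}
    (hx : Adm TA Z ⟨X, .var x, U⟩) (hy : Adm TB Z' ⟨Y, .var y, V⟩)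
    (h : TSo TA TB false X x U Y y V W) : W = tsort TA TB Z Z' (.var x) U (.var y) V := by
  obtain ⟨hxX, hyY, SS, TSf, hSS, hTS, M, out, hM, hMx, hMy, hout⟩ := h
  rename_i S ss T ts
  have hi' : ∀ i (h : i < ss.length), Adm TA Z ⟨X, ss[i], SS i⟩ := fun i h =>
    .ofWT hA hX hx.sub (hx.swt _ (List.getElem_mem h)) (hSS i h)
  have hj' : ∀ j (h : j < ts.length), Adm TB Z' ⟨Y, ts[j], TSf j⟩ := fun j h =>
    .ofWT hB hY hy.sub (hy.swt _ (List.getElem_mem h)) (hTS j h)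
  rw [hout.eq_range, List.range_succ, List.range_succ, dropLast_grid, ← List.range_succ]
  unfold tsort
  congr 2
  · refine (isGrid_range _ _ M).eq_grid rfl (by simp) fun i j hi hj => ?_
    rcases Nat.lt_or_ge j ts.length with h | h
    · rw [List.getElem_append_left h]
      exact (hM i hi j h).eq_tens hA hB hZ hZ' (hi' i hi) (hj' j h)
    · obtain rfl : j = ts.length := by simp at hj; omega
      simpa using (hMy i hi).eq_tens hA hB hZ hZ' (hi' i hi) hy
  · refine List.ext_getElem (by simp) fun j h1 h2 => ?_
    have hj : j < ts.length := by simpa using h1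
    simpa using (hMx j hj).eq_tens hA hB hZ hZ' hx (hj' j hj)

theorem ne_of_not_mem_keys {x : A.Var} (h : x ∉ keys X) : ∀ p ∈ X, p.1 ≠ x := fun p hp e =>
  h (e ▸ mem_keys hp)

theorem TSo.of_tsort (hA : IsGAT TA) (hB : IsGAT TB) (hX : GoodC TA X) (hY : GoodC TB Y)
    {Z : PreCtx A} {Z' : PreCtx B} (hZ : GoodC TA Z) (hZ' : GoodC TB Z')
    {x : A.Var} {U : SortE A} {y : B.Var} {V : SortE B} (hxX : x ∉ keys X) (hyY : y ∉ keys Y)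
    (hx : Adm TA Z ⟨X, .var x, U⟩) (hy : Adm TB Z' ⟨Y, .var y, V⟩) :
    TSo TA TB false X x U Y y V (tsort TA TB Z Z' (.var x) U (.var y) V) := by
  obtain ⟨S, ss⟩ := U
  obtain ⟨T, ts⟩ := V
  have : Nonempty (SortE A) := ⟨⟨S, ss⟩⟩
  have : Nonempty (SortE B) := ⟨⟨T, ts⟩⟩
  obtain ⟨SS, hSS⟩ := exists_nat_fun (m := ss.length)
    (R := fun i hi c => CanonSort TA X ss[i] c ∧ SWT TA X c) fun i hi =>
      (hx.swt _ (List.getElem_mem hi)).exists_canon hA hX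
  obtain ⟨TS, hTS⟩ := exists_nat_fun (m := ts.length)
    (R := fun i hi c => CanonSort TB Y ts[i] c ∧ SWT TB Y c) fun i hi =>
      (hy.swt _ (List.getElem_mem hi)).exists_canon hB hY
  have hi' : ∀ i (h : i < ss.length), Adm TA Z ⟨X, ss[i], SS i⟩ := fun i h =>
    .ofWT hA hX hx.sub (hx.swt _ (List.getElem_mem h)) (hSS i h).1
  have hj' : ∀ j (h : j < ts.length), Adm TB Z' ⟨Y, ts[j], TS j⟩ := fun j h =>
    .ofWT hB hY hy.sub (hy.swt _ (List.getElem_mem h)) (hTS j h).1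
  obtain ⟨out, hout⟩ := exists_isGrid (ss.length + 1) (ts.length + 1) fun i j =>
    tens TA TB Z Z' ((ss ++ [Expr.var x]).getD i (Expr.var x))
      ((ts ++ [Expr.var y]).getD j (Expr.var y))
  have key : TSo TA TB false X x ⟨S, ss⟩ Y y ⟨T, ts⟩ ⟨(S, T), out.dropLast⟩ := by
    refine .mk (ne_of_not_mem_keys hxX) (ne_of_not_mem_keys hyY) SS TS
      (fun i hi => (hSS i hi).1) (fun j hj => (hTS j hj).1) _ out (fun i hi j hj => ?_)
      (fun j hj => ?_) (fun i hi => ?_) hout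
    · simpa [hi, hj, List.getElem?_append_left] using TTg.of_adm hA hB hZ hZ' (hi' i hi) (hj' j hj)
    · simpa [hj, List.getElem?_append_left] using TTg.of_adm hA hB hZ hZ' hx (hj' j hj)
    · simpa [hi, List.getElem?_append_left] using TTg.of_adm hA hB hZ hZ' (hi' i hi) hy
  rwa [key.eq_tsort hA hB hX hY hZ hZ' hx hy] at key

theorem GoodC.take_not_mem (hX : GoodC TA X) {i : ℕ} (hi : i < X.length) :
    (X[i]).1 ∉ keys (X.take i) := by
  have h : Good (X.take i ++ [X[i]]) := by
    have := hX.1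
    rw [← List.take_append_drop (i + 1) X, List.take_succ_eq_append_getElem hi] at this
    exact this.front
  exact (Good.snoc_iff.1 h).2.1

theorem tCtx_iff (hA : IsGAT TA) (hB : IsGAT TB) (hX : GoodC TA X) (hY : GoodC TB Y)
    {Z : PreCtx (A.tensor B)} : TCtx TA TB false X Y Z ↔ Z = tctx TA TB X Y := by
  constructor
  · rintro ⟨hl, h⟩
    refine eq_grid hl fun i j hi hj hij => ?_
    obtain ⟨h1, h2⟩ := h i j hi hj hij
    exact Prod.ext h1 (h2.eq_tsort hA hB (hX.take i) (hY.take j) hX hY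
      (Adm.take hX (List.Subset.refl _) hi) (Adm.take hY (List.Subset.refl _) hj))
  · rintro rfl
    refine ⟨length_grid _ _ _, fun i j hi hj h => ?_⟩
    have e : (tctx TA TB X Y)[i * Y.length + j] = ent TA TB X Y X[i] Y[j] := getElem_grid _ hi hj h
    rw [e]
    exact ⟨rfl, TSo.of_tsort hA hB (hX.take i) (hY.take j) hX hY (hX.take_not_mem hi)
      (hY.take_not_mem hj) (Adm.take hX (List.Subset.refl _) hi)
      (Adm.take hY (List.Subset.refl _) hj)⟩

theorem TMor.eq_grid (hA : IsGAT TA) (hB : IsGAT TB) (hX : GoodC TA X) (hY : GoodC TB Y)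
    {f : List (Expr A)} {g : List (Expr B)} {out : List (Expr (A.tensor B))}
    (hf : ∀ a ∈ f, WT TA X a) (hg : ∀ b ∈ g, WT TB Y b)
    (h : TMor TA TB false X f Y g out) : out = grid (tens TA TB X Y) f g := by
  refine GATPaper.eq_grid h.1 fun i j hi hj hij => ?_
  obtain ⟨U, V, hU, hV, h⟩ := h.2 i j hi hj hij
  exact h.eq_tens hA hB hX hY (.ofWT hA hX (List.Subset.refl _) (hf _ (List.getElem_mem hi)) hU)
    (.ofWT hB hY (List.Subset.refl _) (hg _ (List.getElem_mem hj)) hV)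

end

/-! ## The axioms of the tensor product -/

/-- The substitution determined by the tensors of the values of two substitutions. -/
noncomputable def tsub (TA : Set (Judg A)) (TB : Set (Judg B)) (X : PreCtx A) (Y : PreCtx B)
    (σ : A.Var → Expr A) (τ : B.Var → Expr B) : A.Var × B.Var → Expr (A.tensor B) :=
  fun z => tens TA TB X Y (σ z.1) (τ z.2)

open Classical in
/-- The substitution of a single variable. -/
noncomputable def single (x : A.Var) (u : Expr A) : A.Var → Expr A :=
  fun a => if a = x then u else .var a

@[simp] theorem single_self (x : A.Var) (u : Expr A) : single x u x = u := if_pos rfl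

theorem single_of_ne {x a : A.Var} (h : a ≠ x) (u : Expr A) : single x u a = .var a := if_neg h

theorem TTg.congr_right {c : Bool} {X : PreCtx A} {Y : PreCtx B} {x : A.Var} {U : SortE A}
    {v : Expr B} {V V' : SortE B} {e : Expr (A.tensor B)}
    (h : TTg TA TB c ⟨X, .var x, U⟩ ⟨Y, v, V⟩ e) : TTg TA TB c ⟨X, .var x, U⟩ ⟨Y, v, V'⟩ e := by
  cases h with
  | varvar => exact .varvar
  | varapp SS TSf hSS hTS M out hM hMx hout => exact .varapp SS TSf hSS hTS M out hM hMx hout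

theorem TTg.congr_left {c : Bool} {X : PreCtx A} {Y : PreCtx B} {y : B.Var} {V : SortE B}
    {u : Expr A} {U U' : SortE A} {e : Expr (A.tensor B)}
    (h : TTg TA TB c ⟨X, u, U⟩ ⟨Y, .var y, V⟩ e) : TTg TA TB c ⟨X, u, U'⟩ ⟨Y, .var y, V⟩ e := by
  cases h with
  | varvar => exact .varvar
  | appvar SS TSf hSS hTS M out hM hMy hout => exact .appvar SS TSf hSS hTS M out hM hMy hout

section
variable {X Z : PreCtx A} {Y Z' : PreCtx B}

theorem TTg.of_adm_left (hA : IsGAT TA) (hB : IsGAT TB) (hZ : GoodC TA Z) (hY : GoodC TB Y)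
    {x : A.Var} {U : SortE A} (hx : Adm TA Z ⟨X, .var x, U⟩) {v : Expr B} (hv : WT TB Y v)
    (V : SortE B) : TTg TA TB false ⟨X, .var x, U⟩ ⟨Y, v, V⟩ (tens TA TB Z Y (.var x) v) := by
  obtain ⟨V', hV', -⟩ := hv.exists_canon hB hY
  exact (TTg.of_adm hA hB hZ hY hx (.ofWT hB hY (List.Subset.refl _) hv hV')).congr_right

theorem TTg.of_adm_right (hA : IsGAT TA) (hB : IsGAT TB) (hX : GoodC TA X) (hZ' : GoodC TB Z')
    {y : B.Var} {V : SortE B} (hy : Adm TB Z' ⟨Y, .var y, V⟩) {u : Expr A} (hu : WT TA X u)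
    (U : SortE A) : TTg TA TB false ⟨X, u, U⟩ ⟨Y, .var y, V⟩ (tens TA TB X Z' u (.var y)) := by
  obtain ⟨U', hU', -⟩ := hu.exists_canon hA hX
  exact (TTg.of_adm hA hB hX hZ' (.ofWT hA hX (List.Subset.refl _) hu hU') hy).congr_left

theorem tsort_occurs (hA : IsGAT TA) (hB : IsGAT TB) (hX : GoodC TA X) (hY : GoodC TB Y)
    (hZ : GoodC TA Z) (hZ' : GoodC TB Z') (hXZ : X ⊆ Z) (hYZ : Y ⊆ Z') {u : Expr A} {U : SortE A}
    {v : Expr B} {V : SortE B} (hu : WT TA Z u) (hU : SWT TA X U) (hv : WT TB Z' v)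
    (hV : SWT TB Y V) {z : A.Var × B.Var}
    (h : SOccurs (A := A.tensor B) z (tsort TA TB Z Z' u U v V)) :
    z.1 ∈ keys X ∧ z.2 ∈ keys Z' ∨ z.1 ∈ keys Z ∧ z.2 ∈ keys Y := by
  obtain ⟨e, he, hz⟩ := h
  rcases List.mem_append.1 he with he | he
  · obtain ⟨a, ha, b, hb, rfl⟩ := mem_grid.1 he
    have hb' : WT TB Z' b := by
      rcases List.mem_append.1 hb with hb | hb
      · exact (hV b hb).weaken (keys_mono hYZ)
      · rwa [List.mem_singleton.1 hb]
    rw [tens_mono hA hB hX hZ' hZ hZ' hXZ (List.Subset.refl _) (hU a ha) hb'] at hz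
    exact .inl (tens_occurs hA hX hZ' (hU a ha) hb' hz)
  · obtain ⟨b, hb, rfl⟩ := List.mem_map.1 he
    rw [tens_mono hA hB hZ hY hZ hZ' (List.Subset.refl _) hYZ hu (hV b hb)] at hz
    exact .inr (tens_occurs hA hZ hY hu (hV b hb) hz)

end

section
variable {chA : PreCtx A → A.Var} {chB : PreCtx B → B.Var} {X : PreCtx A} {Y : PreCtx B}
  {U U' : SortE A} {V V' : SortE B} {u u' : Expr A} {v v' : Expr B}

/-- The data of a pair of sort judgments over which axioms are formed. -/
structure Pair (TA : Set (Judg A)) (TB : Set (Judg B)) (x : A.Var) (y : B.Var)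
    (X : PreCtx A) (U : SortE A) (Y : PreCtx B) (V : SortE B) : Prop where
  hA : IsGAT TA
  hB : IsGAT TB
  hx : x ∉ keys X
  hy : y ∉ keys Y
  hX : GoodC TA X
  hY : GoodC TB Y
  hU : SWT TA X U
  hV : SWT TB Y V

/-- The tensor of two sorts in the extended contexts. -/
noncomputable def tso (TA : Set (Judg A)) (TB : Set (Judg B)) (x : A.Var) (y : B.Var)
    (X : PreCtx A) (U : SortE A) (Y : PreCtx B) (V : SortE B) : SortE (A.tensor B) :=
  tsort TA TB (X ++ [(x, U)]) (Y ++ [(y, V)]) (.var x) U (.var y) V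

variable {x : A.Var} {y : B.Var}

theorem Pair.goodX (h : Pair TA TB x y X U Y V) : GoodC TA (X ++ [(x, U)]) := h.hX.snoc h.hx h.hU
theorem Pair.goodY (h : Pair TA TB x y X U Y V) : GoodC TB (Y ++ [(y, V)]) := h.hY.snoc h.hy h.hV
theorem Pair.admX (h : Pair TA TB x y X U Y V) : Adm TA (X ++ [(x, U)]) ⟨X, .var x, U⟩ :=
  .fresh h.hX h.hU
theorem Pair.admY (h : Pair TA TB x y X U Y V) : Adm TB (Y ++ [(y, V)]) ⟨Y, .var y, V⟩ :=
  .fresh h.hY h.hV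

theorem Pair.tso (h : Pair TA TB x y X U Y V) :
    TSo TA TB false X x U Y y V (tso TA TB x y X U Y V) :=
  .of_tsort h.hA h.hB h.hX h.hY h.goodX h.goodY h.hx h.hy h.admX h.admY

theorem Pair.tso_occurs (h : Pair TA TB x y X U Y V) {z : A.Var × B.Var}
    (hz : SOccurs (A := A.tensor B) z (GATPaper.tso TA TB x y X U Y V)) :
    (z.1 ∈ keys X ∨ z.1 = x) ∧ (z.2 ∈ keys Y ∨ z.2 = y) ∧ (z.1 ∈ keys X ∨ z.2 ∈ keys Y) := by
  have := tsort_occurs h.hA h.hB h.hX h.hY h.goodX h.goodY (by simp) (by simp) h.admX.wt_ambient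
    h.hU h.admY.wt_ambient h.hV hz
  simp only [keys, List.map_append, List.mem_append, List.map_cons, List.map_nil,
    List.mem_singleton] at this ⊢
  tauto

theorem ne_of_mem_keys {x a : A.Var} (ha : a ∈ keys X) (hx : x ∉ keys X) : a ≠ x :=
  fun h => hx (h ▸ ha)

theorem Pair.substL_left (h : Pair TA TB x y X U Y V) {g : ℕ → Expr (A.tensor B)}
    (hg : ∀ i (hi : i < X.length), g i = tens TA TB (X ++ [(x, U)]) Y (.var (X[i]).1) v) :
    (GATPaper.tso TA TB x y X U Y V).substL (A := A.tensor B) (pairsL X y g) =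
      (GATPaper.tso TA TB x y X U Y V).subst (A := A.tensor B)
        (tsub TA TB (X ++ [(x, U)]) Y .var (single y v)) := by
  refine SortE.subst_congr fun z hz => ?_
  obtain ⟨h1, h2, h3⟩ := h.tso_occurs hz
  obtain ⟨a, b⟩ := z
  unfold tsub
  by_cases hb : b = y
  · subst hb
    have ha : a ∈ keys X := h3.resolve_right h.hy
    rw [lookupV_pairsL (G := fun a => tens TA TB (X ++ [(x, U)]) Y (.var a) v) hg ha]
    simp
  · rw [lookupV_of_not_mem fun h => hb (mem_pairsL_keys.1 h).1, single_of_ne hb, tens_var]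

theorem Pair.substL_right (h : Pair TA TB x y X U Y V) {g : ℕ → Expr (A.tensor B)}
    (hg : ∀ j (hj : j < Y.length), g j = tens TA TB X (Y ++ [(y, V)]) u (.var (Y[j]).1)) :
    (GATPaper.tso TA TB x y X U Y V).substL (A := A.tensor B) (pairsR x Y g) =
      (GATPaper.tso TA TB x y X U Y V).subst (A := A.tensor B)
        (tsub TA TB X (Y ++ [(y, V)]) (single x u) .var) := by
  refine SortE.subst_congr fun z hz => ?_
  obtain ⟨h1, h2, h3⟩ := h.tso_occurs hz
  obtain ⟨a, b⟩ := z
  unfold tsub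
  by_cases ha : a = x
  · subst ha
    have hb : b ∈ keys Y := h3.resolve_left h.hx
    rw [lookupV_pairsR (G := fun b => tens TA TB X (Y ++ [(y, V)]) u (.var b)) hg hb]
    simp
  · rw [lookupV_of_not_mem fun h => ha (mem_pairsR_keys.1 h).1, single_of_ne ha, tens_var]

theorem Pair.substL_both (h : Pair TA TB x y X U Y V) {gx gy : ℕ → Expr (A.tensor B)}
    (hgx : ∀ i (hi : i < X.length), gx i = tens TA TB X Y (.var (X[i]).1) v)
    (hgy : ∀ j (hj : j < Y.length), gy j = tens TA TB X Y u (.var (Y[j]).1)) :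
    (GATPaper.tso TA TB x y X U Y V).substL (A := A.tensor B) (pairsL X y gx ++ pairsR x Y gy) =
      (GATPaper.tso TA TB x y X U Y V).subst (A := A.tensor B)
        (tsub TA TB X Y (single x u) (single y v)) := by
  refine SortE.subst_congr fun z hz => ?_
  obtain ⟨h1, h2, h3⟩ := h.tso_occurs hz
  obtain ⟨a, b⟩ := z
  unfold tsub
  by_cases hb : b = y
  · subst hb
    have ha : a ∈ keys X := h3.resolve_right h.hy
    have hm : ((a, b) : A.Var × B.Var) ∈ (pairsL X b gx).map Prod.fst :=
      mem_pairsL_keys.2 ⟨rfl, ha⟩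
    rw [lookupV_append_left (A := A.tensor B) hm,
      lookupV_pairsL (G := fun a => tens TA TB X Y (.var a) v) hgx ha]
    simp [single_of_ne (ne_of_mem_keys ha h.hx)]
  · have hm : ((a, b) : A.Var × B.Var) ∉ (pairsL X y gx).map Prod.fst :=
      fun h => hb (mem_pairsL_keys.1 h).1
    rw [lookupV_append_right (A := A.tensor B) hm, single_of_ne hb]
    by_cases ha : a = x
    · subst ha
      rw [lookupV_pairsR (G := fun b => tens TA TB X Y u (.var b)) hgy (h3.resolve_left h.hx)]
      simp
    · rw [lookupV_of_not_mem fun h => ha (mem_pairsR_keys.1 h).1, single_of_ne ha, tens_var]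

theorem Pair.ss_mem (h : Pair TA TB (chA X) (chB Y) X U Y V) (hU : .sort X U ∈ TA)
    (hV : .sort Y V ∈ TB) :
    .sort (hat TA TB X (chA X, U) Y (chB Y, V)) (GATPaper.tso TA TB (chA X) (chB Y) X U Y V) ∈
      tensorAx TA TB chA chB :=
  ⟨_, _, hU, hV, .ss ((tCtx_iff h.hA h.hB h.goodX h.goodY).2 rfl) h.tso⟩

theorem Pair.sseq_mem (h : Pair TA TB (chA X) (chB Y) X U Y V) (hU : .sort X U ∈ TA)
    (hV' : SWT TB Y V') (hV : .sortEq Y V V' ∈ TB) :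
    .sortEq (hat TA TB X (chA X, U) Y (chB Y, V)) (GATPaper.tso TA TB (chA X) (chB Y) X U Y V)
      (GATPaper.tso TA TB (chA X) (chB Y) X U Y V') ∈ tensorAx TA TB chA chB :=
  ⟨_, _, hU, hV, .sseq ((tCtx_iff h.hA h.hB h.goodX h.goodY).2 rfl) h.tso
    (Pair.tso ⟨h.hA, h.hB, h.hx, h.hy, h.hX, h.hY, h.hU, hV'⟩)⟩

theorem Pair.seqs_mem (h : Pair TA TB (chA X) (chB Y) X U Y V) (hU' : SWT TA X U')
    (hU : .sortEq X U U' ∈ TA) (hV : .sort Y V ∈ TB) :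
    .sortEq (hat TA TB X (chA X, U) Y (chB Y, V)) (GATPaper.tso TA TB (chA X) (chB Y) X U Y V)
      (GATPaper.tso TA TB (chA X) (chB Y) X U' Y V) ∈ tensorAx TA TB chA chB :=
  ⟨_, _, hU, hV, .seqs ((tCtx_iff h.hA h.hB h.goodX h.goodY).2 rfl) h.tso
    (Pair.tso ⟨h.hA, h.hB, h.hx, h.hy, h.hX, h.hY, hU', h.hV⟩)⟩

theorem Pair.ttg_left (h : Pair TA TB x y X U Y V) (hv : WT TB Y v) (i : ℕ) (hi : i < X.length) :
    TTg TA TB false ⟨X.take i, .var (X[i]).1, (X[i]).2⟩ ⟨Y, v, V⟩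
      (tens TA TB (X ++ [(x, U)]) Y (.var (X.getD i (x, U)).1) v) := by
  rw [List.getD_eq_getElem X (x, U) hi]
  exact .of_adm_left h.hA h.hB h.goodX h.hY (Adm.take h.hX (by simp) hi) hv _

theorem Pair.ttg_right (h : Pair TA TB x y X U Y V) (hu : WT TA X u) (j : ℕ) (hj : j < Y.length) :
    TTg TA TB false ⟨X, u, U⟩ ⟨Y.take j, .var (Y[j]).1, (Y[j]).2⟩
      (tens TA TB X (Y ++ [(y, V)]) u (.var (Y.getD j (y, V)).1)) := by
  rw [List.getD_eq_getElem Y (y, V) hj]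
  exact .of_adm_right h.hA h.hB h.hX h.goodY (Adm.take h.hY (by simp) hj) hu _

theorem Pair.ttg_fresh_left (h : Pair TA TB x y X U Y V) (hv : WT TB Y v) :
    TTg TA TB false ⟨X, .var x, U⟩ ⟨Y, v, V⟩ (tens TA TB (X ++ [(x, U)]) Y (.var x) v) :=
  .of_adm_left h.hA h.hB h.goodX h.hY h.admX hv _

theorem Pair.ttg_fresh_right (h : Pair TA TB x y X U Y V) (hu : WT TA X u) :
    TTg TA TB false ⟨X, u, U⟩ ⟨Y, .var y, V⟩ (tens TA TB X (Y ++ [(y, V)]) u (.var y)) :=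
  .of_adm_right h.hA h.hB h.hX h.goodY h.admY hu _

theorem Pair.st_mem (h : Pair TA TB (chA X) (chB Y) X U Y V) (hU : .sort X U ∈ TA)
    (hv : WT TB Y v) (hV : .term Y v V ∈ TB) :
    .term (tctx TA TB (X ++ [(chA X, U)]) Y) (tens TA TB (X ++ [(chA X, U)]) Y (.var (chA X)) v)
      ((GATPaper.tso TA TB (chA X) (chB Y) X U Y V).subst (A := A.tensor B)
        (tsub TA TB (X ++ [(chA X, U)]) Y .var (single (chB Y) v))) ∈ tensorAx TA TB chA chB := by
  rw [← h.substL_left fun i hi => by rw [← List.getD_eq_getElem X (chA X, U) hi]]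
  exact ⟨_, _, hU, hV, .st ((tCtx_iff h.hA h.hB h.goodX h.hY).2 rfl) (h.ttg_fresh_left hv) h.tso
    (h.ttg_left hv)⟩

theorem Pair.ts_mem (h : Pair TA TB (chA X) (chB Y) X U Y V) (hu : WT TA X u)
    (hU : .term X u U ∈ TA) (hV : .sort Y V ∈ TB) :
    .term (tctx TA TB X (Y ++ [(chB Y, V)])) (tens TA TB X (Y ++ [(chB Y, V)]) u (.var (chB Y)))
      ((GATPaper.tso TA TB (chA X) (chB Y) X U Y V).subst (A := A.tensor B)
        (tsub TA TB X (Y ++ [(chB Y, V)]) (single (chA X) u) .var)) ∈ tensorAx TA TB chA chB := by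
  rw [← h.substL_right fun j hj => by rw [← List.getD_eq_getElem Y (chB Y, V) hj]]
  exact ⟨_, _, hU, hV, .ts ((tCtx_iff h.hA h.hB h.hX h.goodY).2 rfl) (h.ttg_fresh_right hu) h.tso
    (h.ttg_right hu)⟩

theorem Pair.steq_mem (h : Pair TA TB (chA X) (chB Y) X U Y V) (hU : .sort X U ∈ TA)
    (hv : WT TB Y v) (hv' : WT TB Y v') (hV : .termEq Y v v' V ∈ TB) :
    .termEq (tctx TA TB (X ++ [(chA X, U)]) Y)
      (tens TA TB (X ++ [(chA X, U)]) Y (.var (chA X)) v)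
      (tens TA TB (X ++ [(chA X, U)]) Y (.var (chA X)) v')
      ((GATPaper.tso TA TB (chA X) (chB Y) X U Y V).subst (A := A.tensor B)
        (tsub TA TB (X ++ [(chA X, U)]) Y .var (single (chB Y) v))) ∈ tensorAx TA TB chA chB := by
  rw [← h.substL_left fun i hi => by rw [← List.getD_eq_getElem X (chA X, U) hi]]
  exact ⟨_, _, hU, hV, .steq ((tCtx_iff h.hA h.hB h.goodX h.hY).2 rfl) (h.ttg_fresh_left hv)
    (h.ttg_fresh_left hv') h.tso (h.ttg_left hv)⟩

theorem Pair.teqs_mem (h : Pair TA TB (chA X) (chB Y) X U Y V) (hu : WT TA X u)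
    (hu' : WT TA X u') (hU : .termEq X u u' U ∈ TA) (hV : .sort Y V ∈ TB) :
    .termEq (tctx TA TB X (Y ++ [(chB Y, V)]))
      (tens TA TB X (Y ++ [(chB Y, V)]) u (.var (chB Y)))
      (tens TA TB X (Y ++ [(chB Y, V)]) u' (.var (chB Y)))
      ((GATPaper.tso TA TB (chA X) (chB Y) X U Y V).subst (A := A.tensor B)
        (tsub TA TB X (Y ++ [(chB Y, V)]) (single (chA X) u) .var)) ∈ tensorAx TA TB chA chB := by
  rw [← h.substL_right fun j hj => by rw [← List.getD_eq_getElem Y (chB Y, V) hj]]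
  exact ⟨_, _, hU, hV, .teqs ((tCtx_iff h.hA h.hB h.hX h.goodY).2 rfl) (h.ttg_fresh_right hu)
    (h.ttg_fresh_right hu') h.tso (h.ttg_right hu)⟩

theorem Pair.seqt_mem (h : Pair TA TB (chA X) (chB Y) X U Y V) (hU' : SWT TA X U')
    (hU : .sortEq X U U' ∈ TA) (hv : WT TB Y v) (hV : .term Y v V ∈ TB) :
    .termEq (tctx TA TB (X ++ [(chA X, U)]) Y)
      (tens TA TB (X ++ [(chA X, U)]) Y (.var (chA X)) v)
      (tens TA TB (X ++ [(chA X, U')]) Y (.var (chA X)) v)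
      ((GATPaper.tso TA TB (chA X) (chB Y) X U Y V).subst (A := A.tensor B)
        (tsub TA TB (X ++ [(chA X, U)]) Y .var (single (chB Y) v))) ∈ tensorAx TA TB chA chB := by
  rw [← h.substL_left fun i hi => by rw [← List.getD_eq_getElem X (chA X, U) hi]]
  exact ⟨_, _, hU, hV, .seqt ((tCtx_iff h.hA h.hB h.goodX h.hY).2 rfl) (h.ttg_fresh_left hv)
    (Pair.ttg_fresh_left ⟨h.hA, h.hB, h.hx, h.hy, h.hX, h.hY, hU', h.hV⟩ hv) h.tso (h.ttg_left hv)⟩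

theorem Pair.tseq_mem (h : Pair TA TB (chA X) (chB Y) X U Y V) (hu : WT TA X u)
    (hU : .term X u U ∈ TA) (hV' : SWT TB Y V') (hV : .sortEq Y V V' ∈ TB) :
    .termEq (tctx TA TB X (Y ++ [(chB Y, V)]))
      (tens TA TB X (Y ++ [(chB Y, V)]) u (.var (chB Y)))
      (tens TA TB X (Y ++ [(chB Y, V')]) u (.var (chB Y)))
      ((GATPaper.tso TA TB (chA X) (chB Y) X U Y V).subst (A := A.tensor B)
        (tsub TA TB X (Y ++ [(chB Y, V)]) (single (chA X) u) .var)) ∈ tensorAx TA TB chA chB := by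
  rw [← h.substL_right fun j hj => by rw [← List.getD_eq_getElem Y (chB Y, V) hj]]
  exact ⟨_, _, hU, hV, .tseq ((tCtx_iff h.hA h.hB h.hX h.goodY).2 rfl) (h.ttg_fresh_right hu)
    (Pair.ttg_fresh_right ⟨h.hA, h.hB, h.hx, h.hy, h.hX, h.hY, h.hU, hV'⟩ hu) h.tso (h.ttg_right hu)⟩

theorem canonSort_intro (hT : IsGAT TA) {X : PreCtx A} {s : A.TermSym} {U : SortE A}
    (h : introTerm X s U ∈ TA) : CanonSort TA X (.app s (ctxVars X)) U := by
  have := CanonSort.app (X := X) (f := ctxVars X) h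
  rwa [← imgs_var, SortE.substL_imgs (hT.lc_of_introTerm h).2.scoped, SortE.subst_id] at this

theorem wt_intro {X : PreCtx A} {s : A.TermSym} {U : SortE A}
    (h : introTerm X s U ∈ TA) : WT TA X (.app s (ctxVars X)) :=
  .app h (by simp [ctxVars]) fun a ha => by
    obtain ⟨p, hp, rfl⟩ := List.mem_map.1 ha
    exact .var (List.mem_map_of_mem hp)

theorem Pair.tt_mem {s : A.TermSym} {t : B.TermSym} (h : Pair TA TB (chA X) (chB Y) X U Y V)
    (hs : introTerm X s U ∈ TA) (ht : introTerm Y t V ∈ TB) :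
    .termEq (tctx TA TB X Y) (tens TA TB X Y (.app s (ctxVars X)) (.app t (ctxVars Y)))
      (.app (.inr (s, V.head))
        (grid (tens TA TB X Y) (ctxVars X) (V.args ++ [.app t (ctxVars Y)])))
      ((GATPaper.tso TA TB (chA X) (chB Y) X U Y V).subst (A := A.tensor B)
        (tsub TA TB X Y (single (chA X) (.app s (ctxVars X)))
          (single (chB Y) (.app t (ctxVars Y))))) ∈ tensorAx TA TB chA chB := by
  have hA := h.hA
  have hB := h.hB
  have hcs := canonSort_intro hA hs
  have hct := canonSort_intro hB ht
  have hwu := wt_intro hs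
  have hwv := wt_intro ht
  have au : Adm TA X ⟨X, .app s (ctxVars X), U⟩ := .ofWT hA h.hX (List.Subset.refl _) hwu hcs
  have av : Adm TB Y ⟨Y, .app t (ctxVars Y), V⟩ := .ofWT hB h.hY (List.Subset.refl _) hwv hct
  have gx : ∀ i (hi : i < X.length),
      TTg TA TB false ⟨X.take i, .var (X[i]).1, (X[i]).2⟩ ⟨Y, .app t (ctxVars Y), V⟩
        (tens TA TB X Y (.var (X.getD i (chA X, U)).1) (.app t (ctxVars Y))) := fun i hi => by
    rw [List.getD_eq_getElem X (chA X, U) hi]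
    exact .of_adm hA hB h.hX h.hY (Adm.take h.hX (List.Subset.refl _) hi) av
  have gy : ∀ j (hj : j < Y.length),
      TTg TA TB false ⟨X, .app s (ctxVars X), U⟩ ⟨Y.take j, .var (Y[j]).1, (Y[j]).2⟩
        (tens TA TB X Y (.app s (ctxVars X)) (.var (Y.getD j (chB Y, V)).1)) := fun j hj => by
    rw [List.getD_eq_getElem Y (chB Y, V) hj]
    exact .of_adm hA hB h.hX h.hY au (Adm.take h.hY (List.Subset.refl _) hj)
  have key : (tens TA TB X (Y ++ [(chB Y, V)]) (.app s (ctxVars X)) (.var (chB Y))).substL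
      (A := A.tensor B) (pairsL X (chB Y) fun i =>
        tens TA TB X Y (.var (X.getD i (chA X, U)).1) (.app t (ctxVars Y))) =
      .app (.inr (s, V.head))
        (grid (tens TA TB X Y) (ctxVars X) (V.args ++ [.app t (ctxVars Y)])) := by
    have hvars : ∀ a ∈ ctxVars X, ∃ x ∈ keys X, a = .var x := fun a ha => by
      obtain ⟨p, hp, rfl⟩ := List.mem_map.1 ha
      exact ⟨p.1, List.mem_map_of_mem hp, rfl⟩
    have hwa : ∀ a ∈ ctxVars X, WT TA X a := fun a ha => by
      obtain ⟨x, hx, rfl⟩ := hvars a ha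
      exact .var hx
    rw [tens_left hA hB h.hX h.goodY (y := chB Y) (V := V) (by simp) hwa]
    unfold Expr.substL
    rw [Expr.subst_app, map_grid]
    have e : V.args ++ [Expr.app t (ctxVars Y)] =
        (V.args ++ [Expr.var (chB Y)]).map (Expr.subst (single (chB Y) (.app t (ctxVars Y)))) := by
      rw [List.map_append, List.map_singleton, Expr.subst_var', single_self]
      congr 1
      conv_lhs => rw [← List.map_id V.args]
      refine List.map_congr_left fun b hb => ?_
      rw [id, Expr.subst_congr (τ := Expr.var), Expr.subst_id]
      intro v hv
      exact single_of_ne (ne_of_mem_keys ((h.hV b hb).occurs hv) h.hy) _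
    rw [e, ← List.map_id (ctxVars X), grid_map, List.map_id]
    congr 1
    refine grid_congr fun a ha b hb => ?_
    obtain ⟨x, hx, rfl⟩ := hvars a ha
    rcases List.mem_append.1 hb with hb | hb
    · have hwb := h.hV b hb
      rw [tens_mono hA hB h.hX h.hY h.hX h.goodY (List.Subset.refl _) (by simp) (.var hx) hwb]
      conv_rhs => rw [Expr.subst_congr (τ := Expr.var) (fun v hv =>
        single_of_ne (ne_of_mem_keys (hwb.occurs hv) h.hy) _), Expr.subst_id]
      rw [Expr.subst_congr (A := A.tensor B) (τ := Expr.var), Expr.subst_id]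
      · rfl
      · intro z hz
        have := tens_occurs hA h.hX h.hY (.var hx) hwb hz
        exact lookupV_of_not_mem fun hm => h.hy ((mem_pairsL_keys.1 hm).1 ▸ this.2)
    · rw [List.mem_singleton.1 hb, tens_var, Expr.subst_var', Expr.subst_var', single_self]
      exact lookupV_pairsL (G := fun a => tens TA TB X Y (.var a) (.app t (ctxVars Y)))
        (fun i hi => by rw [← List.getD_eq_getElem X (chA X, U) hi]) hx
  rw [← h.substL_both (gx := fun i => tens TA TB X Y (.var (X.getD i (chA X, U)).1)
      (.app t (ctxVars Y))) (gy := fun j => tens TA TB X Y (.app s (ctxVars X))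
      (.var (Y.getD j (chB Y, V)).1)) (fun i hi => by rw [← List.getD_eq_getElem X (chA X, U) hi])
      (fun j hj => by rw [← List.getD_eq_getElem Y (chB Y, V) hj]), ← key]
  exact ⟨_, _, hs, ht, .tt ((tCtx_iff hA hB h.hX h.hY).2 rfl) (.of_adm hA hB h.hX h.hY au av)
    (.appapp_base (ne_of_not_mem_keys h.hy) _ (h.ttg_fresh_right hwu) _ gx) h.tso gx gy⟩

end

end

section
variable {A B : Alphabet} {T : Set (Judg A)}

/-! ## Morphisms into extended contexts -/

theorem lev_var_of_mem {n : ℕ} {X : PreCtx A} {p : A.Var × SortE A} (h : lev T n X (.sort p.2))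
    (hp : p ∈ X) : lev T n X (.term (.var p.1) p.2) := by
  cases n with
  | zero => exact h.elim
  | succ n => exact NS.var hp h

theorem LC.lev_sort_of_mem {n : ℕ} {X : PreCtx A} (hX : LC (lev T n) X) {p : A.Var × SortE A}
    (hp : p ∈ X) : lev T n X (.sort p.2) := by
  obtain ⟨X1, X2, rfl⟩ := List.append_of_mem hp
  exact lev_weaken (hX.2 X1 p X2 rfl) (by simp)

theorem LC.smor_var {n : ℕ} {X Z : PreCtx A} (hX : LC (lev T n) X) (hXZ : X ⊆ Z) :
    SMor (lev T n) Z X Expr.var := fun p hp => by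
  rw [SortE.subst_id]
  exact lev_var_of_mem (lev_weaken (hX.lev_sort_of_mem hp) hXZ) (hXZ hp)

theorem lev_wt {n : ℕ} {X : PreCtx A} {u : Expr A} {U : SortE A} (h : lev T n X (.term u U)) :
    WT T X u := (lev_der h).wf.1

theorem lev_swt {n : ℕ} {X : PreCtx A} {U : SortE A} (h : lev T n X (.sort U)) :
    SWT T X U := (lev_der h).wf

theorem lev_srt {n : ℕ} {X : PreCtx A} {u : Expr A} {U : SortE A} (h : lev T n X (.term u U)) :
    lev T n X (.sort U) := lev_presup h

theorem SMor.wt {n : ℕ} {Z X : PreCtx A} {σ : A.Var → Expr A} (h : SMor (lev T n) Z X σ) :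
    ∀ x ∈ keys X, WT T Z (σ x) := fun x hx => by
  obtain ⟨U, hU⟩ := exists_of_mem_keys hx
  exact lev_wt (h _ hU)

theorem SMor.lev_mono {n m : ℕ} (hnm : n ≤ m) {Z X : PreCtx A} {σ : A.Var → Expr A}
    (h : SMor (lev T n) Z X σ) : SMor (lev T m) Z X σ := fun p hp => GATPaper.lev_mono hnm (h p hp)

theorem SMor.lev_weaken {n : ℕ} {Z Z' X : PreCtx A} {σ : A.Var → Expr A}
    (h : SMor (lev T n) Z X σ) (hZ : Z ⊆ Z') : SMor (lev T n) Z' X σ :=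
  fun p hp => GATPaper.lev_weaken (h p hp) hZ

open Classical in
/-- The update of a substitution at a variable. -/
noncomputable def upd (σ : A.Var → Expr A) (x : A.Var) (u : Expr A) : A.Var → Expr A :=
  fun a => if a = x then u else σ a

@[simp] theorem upd_self (σ : A.Var → Expr A) (x : A.Var) (u : Expr A) : upd σ x u x = u :=
  if_pos rfl

theorem upd_of_ne (σ : A.Var → Expr A) {x a : A.Var} (u : Expr A) (h : a ≠ x) :
    upd σ x u a = σ a := if_neg h

theorem upd_of_mem (σ : A.Var → Expr A) {X : PreCtx A} {x : A.Var} (u : Expr A)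
    (hx : x ∉ keys X) {a : A.Var} (ha : a ∈ keys X) : upd σ x u a = σ a :=
  upd_of_ne σ u (ne_of_mem_keys ha hx)

theorem SWT.subst_congr {X : PreCtx A} {U : SortE A} (hU : SWT T X U) {σ τ : A.Var → Expr A}
    (h : ∀ a ∈ keys X, σ a = τ a) : U.subst σ = U.subst τ :=
  SortE.subst_congr fun v ⟨e, he, hv⟩ => h v ((hU e he).occurs hv)

theorem WT.subst_congr {X : PreCtx A} {u : Expr A} (hu : WT T X u) {σ τ : A.Var → Expr A}
    (h : ∀ a ∈ keys X, σ a = τ a) : u.subst σ = u.subst τ :=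
  Expr.subst_congr fun v hv => h v (hu.occurs hv)

theorem SMor.congr {D : PreCtx A → CJ A → Prop} {Z X : PreCtx A} (hX : GoodC T X)
    {σ τ : A.Var → Expr A} (hσ : SMor D Z X σ) (h : ∀ a ∈ keys X, σ a = τ a) : SMor D Z X τ :=
  fun p hp => by
    rw [← h _ (mem_keys hp), ← (hX.swt_of_mem hp).subst_congr h]
    exact hσ p hp

theorem imgs_inj {X : PreCtx A} {σ τ : A.Var → Expr A} (h : imgs X σ = imgs X τ) :
    ∀ a ∈ keys X, σ a = τ a := fun a ha => by
  obtain ⟨p, hp, rfl⟩ := List.mem_map.1 ha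
  exact List.map_inj_left.1 h p hp

theorem lev_sort_imgs (hT : IsGAT T) {n : ℕ} {X Xa : PreCtx A} {S : A.SortSym}
    {σ : A.Var → Expr A} (hax : introSort Xa S ∈ T)
    (h : lev T (n + 1) X (.sort ⟨S, imgs Xa σ⟩)) :
    LC (lev T n) Xa ∧ SMor (lev T n) X Xa σ := by
  obtain ⟨Xa', σ', hax', hc, hσ, he⟩ := lev_sort_inv h
  obtain rfl := (hT.1.sort_intro S).unique hax' hax
  exact ⟨hc, hσ.congr hc.lev_der.goodC fun a ha => (imgs_inj he a ha).symm⟩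

/-- A morphism to an extended context `X', x : U'`, of which the part over `X'` has a lower
level and takes its values in a part `X1` of the ambient context `X`. -/
structure HatMor (T : Set (Judg A)) (n : ℕ) (X X1 X' : PreCtx A) (x : A.Var) (U' : SortE A)
    (σ : A.Var → Expr A) : Prop where
  gat : IsGAT T
  sub : X1 ⊆ X
  good : GoodC T X
  good₁ : GoodC T X1
  lc : LC (lev T n) X'
  mor : SMor (lev T n) X1 X' σ
  fresh : x ∉ keys X'
  srt : lev T (n + 1) X' (.sort U')
  last : lev T (n + 1) X (.term (σ x) (U'.subst σ))

namespace HatMor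
variable {n : ℕ} {X X1 X' : PreCtx A} {x : A.Var} {U' : SortE A} {σ : A.Var → Expr A}

theorem goodC (h : HatMor T n X X1 X' x U' σ) : GoodC T X' := h.lc.lev_der.goodC
theorem swt (h : HatMor T n X X1 X' x U' σ) : SWT T X' U' := lev_swt h.srt

theorem lcHat (h : HatMor T n X X1 X' x U' σ) : LC (lev T (n + 1)) (X' ++ [(x, U')]) :=
  LC.snoc_iff.2 ⟨h.lc.lev_mono (by omega), h.srt, h.fresh, (lev_der h.srt).scoped⟩

theorem goodHat (h : HatMor T n X X1 X' x U' σ) : GoodC T (X' ++ [(x, U')]) :=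
  h.lcHat.lev_der.goodC

theorem mor' (h : HatMor T n X X1 X' x U' σ) : SMor (lev T n) X X' σ := h.mor.lev_weaken h.sub

theorem morHat (h : HatMor T n X X1 X' x U' σ) : SMor (lev T (n + 1)) X (X' ++ [(x, U')]) σ :=
  fun p hp => by
    rcases List.mem_append.1 hp with hp | hp
    · exact lev_succ (h.mor' p hp)
    · rw [List.mem_singleton.1 hp]
      exact h.last

theorem weak (h : HatMor T n X X1 X' x U' σ) : HatMor T n X X X' x U' σ :=
  { h with sub := List.Subset.refl _, good₁ := h.good, mor := h.mor' }

theorem of_sort (hT : IsGAT T) {ch : PreCtx A → A.Var} (hch : FreshCh ch) (hX : GoodC T X)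
    (hX1 : GoodC T X1) (hs : X1 ⊆ X) {Xa : PreCtx A} {S : A.SortSym} {u : Expr A}
    (hax : introSort Xa S ∈ T) (hl : LC (lev T n) Xa) (hσ : SMor (lev T n) X1 Xa σ)
    (hu : lev T (n + 1) X (.term u ⟨S, imgs Xa σ⟩)) :
    HatMor T n X X1 Xa (ch Xa) ⟨S, ctxVars Xa⟩ (upd σ (ch Xa) u) := by
  have hf : ch Xa ∉ keys Xa := not_mem_keys (hch Xa)
  have he : imgs Xa (upd σ (ch Xa) u) = imgs Xa σ :=
    imgs_congr fun p hp => upd_of_mem σ u hf (mem_keys hp)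
  refine ⟨hT, hs, hX, hX1, hl, hσ.congr hl.lev_der.goodC fun a ha => (upd_of_mem σ u hf ha).symm,
    hf, NS.sort hax hl (hl.smor_var (List.Subset.refl _)), ?_⟩
  rw [upd_self, ← imgs_var, SortE.subst_mk, imgs_subst]
  simpa only [Expr.subst_var', he] using hu

theorem of_term (hT : IsGAT T) {ch : PreCtx A → A.Var} (hch : FreshCh ch) (hX : GoodC T X)
    {Xa : PreCtx A} {t : A.TermSym} {V : SortE A} (hl : LC (lev T n) Xa)
    (hV : lev T n Xa (.sort V)) (hσ : SMor (lev T n) X Xa σ)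
    (hu : lev T (n + 1) X (.term (.app t (imgs Xa σ)) (V.subst σ))) :
    HatMor T n X X Xa (ch Xa) V (upd σ (ch Xa) (.app t (imgs Xa σ))) := by
  have hf : ch Xa ∉ keys Xa := not_mem_keys (hch Xa)
  refine ⟨hT, List.Subset.refl _, hX, hX, hl,
    hσ.congr hl.lev_der.goodC fun a ha => (upd_of_mem σ _ hf ha).symm, hf, lev_succ hV, ?_⟩
  rw [upd_self, (lev_swt hV).subst_congr fun a ha => upd_of_mem σ _ hf ha]
  exact hu

theorem id (hT : IsGAT T) (hl : LC (lev T n) X') (hf : x ∉ keys X')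
    (hU : lev T (n + 1) X' (.sort U')) :
    HatMor T n (X' ++ [(x, U')]) X' X' x U' Expr.var := by
  have hl' : LC (lev T (n + 1)) (X' ++ [(x, U')]) :=
    LC.snoc_iff.2 ⟨hl.lev_mono (by omega), hU, hf, (lev_der hU).scoped⟩
  refine ⟨hT, by simp, hl'.lev_der.goodC, hl.lev_der.goodC, hl, hl.smor_var (List.Subset.refl _),
    hf, hU, ?_⟩
  exact hl'.smor_var (List.Subset.refl _) (x, U') (by simp)

theorem single (hT : IsGAT T) (hl : LC (lev T n) X') (hf : x ∉ keys X')
    (hU : lev T (n + 1) X' (.sort U')) {u : Expr A} (hu : lev T (n + 1) X' (.term u U')) :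
    HatMor T n X' X' X' x U' (single x u) := by
  have he : ∀ a ∈ keys X', Expr.var a = GATPaper.single x u a :=
    fun a ha => (single_of_ne (ne_of_mem_keys ha hf) _).symm
  refine ⟨hT, List.Subset.refl _, hl.lev_der.goodC, hl.lev_der.goodC, hl,
    (hl.smor_var (List.Subset.refl _)).congr hl.lev_der.goodC he, hf, hU, ?_⟩
  rw [single_self, ← (lev_swt hU).subst_congr he, SortE.subst_id]
  exact hu

end HatMor

end

section
variable {A B : Alphabet} {TA : Set (Judg A)} {TB : Set (Judg B)}
  {chA : PreCtx A → A.Var} {chB : PreCtx B → B.Var}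

local notation "𝔻" => Der (tensorAx TA TB chA chB)
local notation "𝕥" => tens TA TB
local notation "𝕤" => tsort TA TB
local notation "𝕔" => tctx TA TB
local notation "Θ" => tsub TA TB
local notation "𝔼" e:max ρ:max => Expr.subst (A := Alphabet.tensor A B) ρ e
local notation "𝕊" e:max ρ:max => SortE.subst (A := Alphabet.tensor A B) ρ e

/-! ## The properties proved by induction on levels -/

variable (TA TB chA chB) in
/-- Derivability of tensors of judgments at the levels `n` and `m`. -/
structure PP (n m : ℕ) : Prop where
  ctx : ∀ {X : PreCtx A} {Y : PreCtx B}, LC (lev TA n) X → LC (lev TB m) Y → LC 𝔻 (𝕔 X Y)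
  ty : ∀ {X : PreCtx A} {Y : PreCtx B} {u : Expr A} {U : SortE A} {v : Expr B} {V : SortE B},
    GoodC TA X → GoodC TB Y → lev TA n X (.term u U) → lev TB m Y (.term v V) →
    𝔻 (𝕔 X Y) (.term (𝕥 X Y u v) (𝕤 X Y u U v V))
  ts : ∀ {X X' : PreCtx A} {Y Y' : PreCtx B} {σ : A.Var → Expr A} {τ : B.Var → Expr B}
    {u : Expr A} {U : SortE A} {v : Expr B} {V : SortE B},
    GoodC TA X → GoodC TB Y → GoodC TA X' → GoodC TB Y' → SMor (lev TA n) X X' σ →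
    SMor (lev TB m) Y Y' τ → WT TA X' u → WT TB Y' v → lev TA n X (.term (u.subst σ) U) →
    lev TB m Y (.term (v.subst τ) V) →
    𝔻 (𝕔 X Y) (.termEq (𝔼 (𝕥 X' Y' u v) (Θ X Y σ τ)) (𝕥 X Y (u.subst σ) (v.subst τ))
      (𝕤 X Y (u.subst σ) U (v.subst τ) V))
  tss : ∀ {X X' : PreCtx A} {Y Y' : PreCtx B} {σ : A.Var → Expr A} {τ : B.Var → Expr B}
    {p : A.Var × SortE A} {q : B.Var × SortE B},
    GoodC TA X → GoodC TB Y → LC (lev TA n) X' → LC (lev TB m) Y' → SMor (lev TA n) X X' σ →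
    SMor (lev TB m) Y Y' τ → p ∈ X' → q ∈ Y' →
    𝔻 (𝕔 X Y) (.sortEq (𝕊 ((ent TA TB X' Y' p q).2) (Θ X Y σ τ))
      (𝕤 X Y (σ p.1) (p.2.subst σ) (τ q.1) (q.2.subst τ)))
  eql : ∀ {X : PreCtx A} {Y : PreCtx B} {u u' : Expr A} {U : SortE A} {v : Expr B} {V : SortE B},
    GoodC TA X → GoodC TB Y → lev TA n X (.termEq u u' U) → lev TB m Y (.term v V) →
    𝔻 (𝕔 X Y) (.termEq (𝕥 X Y u v) (𝕥 X Y u' v) (𝕤 X Y u U v V))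
  eqr : ∀ {X : PreCtx A} {Y : PreCtx B} {u : Expr A} {U : SortE A} {v v' : Expr B} {V : SortE B},
    GoodC TA X → GoodC TB Y → lev TA n X (.term u U) → lev TB m Y (.termEq v v' V) →
    𝔻 (𝕔 X Y) (.termEq (𝕥 X Y u v) (𝕥 X Y u v') (𝕤 X Y u U v V))

variable (TA TB chA chB) in
/-- The induction hypotheses available at the levels `n + 1` and `m + 1`. -/
structure Stp (n m : ℕ) : Prop where
  hA : IsGAT TA
  hB : IsGAT TB
  fA : FreshCh chA
  fB : FreshCh chB
  L : PP TA TB chA chB n (m + 1)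
  R : PP TA TB chA chB (n + 1) m

/-! ## Contexts of tensors of sorts -/

theorem ent_subst_congr (hA : IsGAT TA) (hB : IsGAT TB) {X : PreCtx A} {Y : PreCtx B}
    (hX : GoodC TA X) (hY : GoodC TB Y) {p : A.Var × SortE A} {q : B.Var × SortE B} (hp : p ∈ X)
    (hq : q ∈ Y) {ρ ρ' : A.Var × B.Var → Expr (A.tensor B)}
    (h : ∀ a ∈ keys X, ∀ b ∈ keys Y, ρ (a, b) = ρ' (a, b)) :
    𝕊 ((ent TA TB X Y p q).2) ρ = 𝕊 ((ent TA TB X Y p q).2) ρ' := by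
  refine SortE.subst_congr fun z hz => ?_
  have := tsort_occurs hA hB hX hY hX hY (List.Subset.refl _) (List.Subset.refl _)
    (.var (mem_keys hp)) (hX.swt_of_mem hp) (.var (mem_keys hq)) (hY.swt_of_mem hq) hz
  obtain ⟨a, b⟩ := z
  exact h a (by tauto) b (by tauto)

namespace HatMor
variable {n : ℕ} {X X1 Xa : PreCtx A} {x : A.Var} {U : SortE A} {σ : A.Var → Expr A}

theorem wt (h : HatMor TA n X X1 Xa x U σ) : ∀ a ∈ keys Xa, WT TA X1 (σ a) := h.mor.wt
theorem wtHat (h : HatMor TA n X X1 Xa x U σ) : ∀ a ∈ keys (Xa ++ [(x, U)]), WT TA X (σ a) :=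
  h.morHat.wt
theorem wtLast (h : HatMor TA n X X1 Xa x U σ) : WT TA X (σ x) := lev_wt h.last

end HatMor

namespace Stp
variable {n m : ℕ} {X X1 Xa : PreCtx A} {x : A.Var} {U : SortE A} {σ : A.Var → Expr A}
  {Y Y1 Ya : PreCtx B} {y : B.Var} {V : SortE B} {τ : B.Var → Expr B}
  {Z : PreCtx (A.tensor B)}

/-- Images of the entries of the context of a tensor of sorts. -/
theorem fine (S : Stp TA TB chA chB n m) (h : HatMor TA n X X1 Xa x U σ)
    (k : HatMor TB m Y Y1 Ya y V τ) (hZ : 𝕔 X1 Y ⊆ Z) (hZ' : 𝕔 X Y1 ⊆ Z)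
    {p : A.Var × SortE A} {q : B.Var × SortE B} (hp : p ∈ Xa ++ [(x, U)])
    (hq : q ∈ Ya ++ [(y, V)]) (hpq : p ∈ Xa ∨ q ∈ Ya) :
    𝔻 Z (.term (𝕥 X Y (σ p.1) (τ q.1)) (𝕤 X Y (σ p.1) (p.2.subst σ) (τ q.1) (q.2.subst τ))) ∧
      𝔻 Z (.sortEq (𝕊 (ent TA TB (Xa ++ [(x, U)]) (Ya ++ [(y, V)]) p q).2 (Θ X Y σ τ))
        (𝕤 X Y (σ p.1) (p.2.subst σ) (τ q.1) (q.2.subst τ))) := by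
  rcases hpq with hpq | hpq
  · have h1 := S.L.ty h.good₁ k.good (h.mor p hpq) (k.morHat q hq)
    have h2 := S.L.tss h.good₁ k.good h.lc k.lcHat h.mor k.morHat hpq hq
    rw [← tens_mono S.hA S.hB h.good₁ k.good h.good k.good h.sub (List.Subset.refl _)
        (h.wt _ (mem_keys hpq)) (k.wtHat _ (mem_keys hq))] at h1
    rw [← tsort_mono S.hA S.hB h.good₁ k.good h.good k.good h.sub (List.Subset.refl _)
        (h.wt _ (mem_keys hpq)) (.subst h.wt (h.goodC.swt_of_mem hpq)) (k.wtHat _ (mem_keys hq))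
        (.subst k.wtHat (k.goodHat.swt_of_mem hq))] at h1 h2
    rw [← ent_mono S.hA S.hB h.goodC k.goodHat h.goodHat k.goodHat (by simp)
        (List.Subset.refl _) hpq hq] at h2
    refine ⟨h1.weaken hZ, ?_⟩
    rw [ent_mono S.hA S.hB h.goodC k.goodHat h.goodHat k.goodHat (by simp)
        (List.Subset.refl _) hpq hq] at h2 ⊢
    rw [ent_subst_congr S.hA S.hB h.goodC k.goodHat hpq hq (ρ' := Θ X1 Y σ τ)
      fun a ha b hb => tens_mono S.hA S.hB h.good₁ k.good h.good k.good h.sub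
        (List.Subset.refl _) (h.wt _ ha) (k.wtHat _ hb)]
    exact h2.weaken hZ
  · have h1 := S.R.ty h.good k.good₁ (h.morHat p hp) (k.mor q hpq)
    have h2 := S.R.tss h.good k.good₁ h.lcHat k.lc h.morHat k.mor hp hpq
    rw [← tens_mono S.hA S.hB h.good k.good₁ h.good k.good (List.Subset.refl _) k.sub
        (h.wtHat _ (mem_keys hp)) (k.wt _ (mem_keys hpq))] at h1
    rw [← tsort_mono S.hA S.hB h.good k.good₁ h.good k.good (List.Subset.refl _) k.sub
        (h.wtHat _ (mem_keys hp)) (.subst h.wtHat (h.goodHat.swt_of_mem hp))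
        (k.wt _ (mem_keys hpq)) (.subst k.wt (k.goodC.swt_of_mem hpq))] at h1 h2
    refine ⟨h1.weaken hZ', ?_⟩
    rw [ent_mono S.hA S.hB h.goodHat k.goodC h.goodHat k.goodHat (List.Subset.refl _) (by simp)
        hp hpq]
    rw [ent_subst_congr S.hA S.hB h.goodHat k.goodC hp hpq (ρ' := Θ X Y1 σ τ)
      fun a ha b hb => tens_mono S.hA S.hB h.good k.good₁ h.good k.good (List.Subset.refl _)
        k.sub (h.wtHat _ ha) (k.wt _ hb)]
    exact h2.weaken hZ'

theorem smor_hat (S : Stp TA TB chA chB n m) (h : HatMor TA n X X1 Xa x U σ)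
    (k : HatMor TB m Y Y1 Ya y V τ) (hZ : 𝕔 X1 Y ⊆ Z) (hZ' : 𝕔 X Y1 ⊆ Z) :
    SMor 𝔻 Z (hat TA TB Xa (x, U) Ya (y, V)) (Θ X Y σ τ) := by
  intro z hz
  obtain ⟨p, hp, q, hq, hpq, rfl⟩ := mem_hat.1 hz
  obtain ⟨h1, h2⟩ := S.fine h k hZ hZ' hp hq hpq
  exact .conv (.s2 h2) h1

theorem hat_sub_left (S : Stp TA TB chA chB n m) (h : HatMor TA n X X1 Xa x U σ)
    (k : HatMor TB m Y Y1 Ya y V τ) :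
    𝕔 Xa (Ya ++ [(y, V)]) ⊆ hat TA TB Xa (x, U) Ya (y, V) := fun z hz => by
  obtain ⟨p, hp, q, hq, rfl⟩ := mem_tctx.1 hz
  exact mem_hat.2 ⟨p, by simp [hp], q, hq, .inl hp, ent_mono S.hA S.hB h.goodC k.goodHat
    h.goodHat k.goodHat (by simp) (List.Subset.refl _) hp hq⟩

theorem hat_sub_right (S : Stp TA TB chA chB n m) (h : HatMor TA n X X1 Xa x U σ)
    (k : HatMor TB m Y Y1 Ya y V τ) :
    𝕔 (Xa ++ [(x, U)]) Ya ⊆ hat TA TB Xa (x, U) Ya (y, V) := fun z hz => by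
  obtain ⟨p, hp, q, hq, rfl⟩ := mem_tctx.1 hz
  exact mem_hat.2 ⟨p, hp, q, by simp [hq], .inr hq, ent_mono S.hA S.hB h.goodHat k.goodC
    h.goodHat k.goodHat (List.Subset.refl _) (by simp) hp hq⟩

/-- The initial part of a tensor context is a context if its two parts are. -/
theorem lc_hat_of (hA : IsGAT TA) (hB : IsGAT TB) (hX : LC (Der TA) (Xa ++ [(x, U)]))
    (hY : LC (Der TB) (Ya ++ [(y, V)])) (h1 : LC 𝔻 (𝕔 Xa (Ya ++ [(y, V)])))
    (h2 : LC 𝔻 (𝕔 (Xa ++ [(x, U)]) Ya)) : LC 𝔻 (hat TA TB Xa (x, U) Ya (y, V)) := by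
  have gX' := hX.goodC
  have gY' := hY.goodC
  have gX := hX.front.goodC
  have gY := hY.front.goodC
  have e1 : 𝕔 (Xa ++ [(x, U)]) Ya =
      𝕔 Xa Ya ++ Ya.map (ent TA TB (Xa ++ [(x, U)]) (Ya ++ [(y, V)]) (x, U)) := by
    rw [tctx, grid_append, grid_singleton, grid_ent_eq hA hB gX gY gX' gY
      (by simp) (List.Subset.refl _)]
    congr 1
    refine List.map_congr_left fun q hq => ?_
    exact (ent_mono hA hB gX' gY gX' gY' (List.Subset.refl _) (by simp) (by simp) hq).symm
  rw [hat_eq, grid_ent_eq hA hB gX gY' gX' gY' (by simp) (List.Subset.refl _)]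
  rw [e1] at h2
  refine h1.append h2 (tctx_subset hA hB gX gY gX gY' (List.Subset.refl _) (by simp))
    fun z hz hz' => (LC.snoc_iff.1 hX).2.2.1 ?_
  obtain ⟨e, he, rfl⟩ := List.mem_map.1 hz
  obtain ⟨q, hq, rfl⟩ := List.mem_map.1 he
  obtain ⟨e', he', hee⟩ := List.mem_map.1 hz'
  obtain ⟨p', hp', q', hq', rfl⟩ := mem_tctx.1 he'
  have : p'.1 = x := congrArg Prod.fst hee
  change x ∈ keys Xa
  exact this ▸ mem_keys hp'

theorem lc_hat (S : Stp TA TB chA chB n m) (h : HatMor TA n X X1 Xa x U σ)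
    (k : HatMor TB m Y Y1 Ya y V τ) : LC 𝔻 (hat TA TB Xa (x, U) Ya (y, V)) :=
  lc_hat_of S.hA S.hB h.lcHat.lev_der k.lcHat.lev_der (S.L.ctx h.lc k.lcHat)
    (S.R.ctx h.lcHat k.lc)

/-- Substitutions agreeing pointwise with the tensor of two morphisms. -/
theorem hat_congr (S : Stp TA TB chA chB n m) (h : HatMor TA n X X1 Xa x U σ)
    (k : HatMor TB m Y Y1 Ya y V τ) (hZ : 𝕔 X1 Y ⊆ Z) (hZ' : 𝕔 X Y1 ⊆ Z)
    {Ψ : A.Var × B.Var → Expr (A.tensor B)}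
    (hΨ : ∀ p ∈ Xa ++ [(x, U)], ∀ q ∈ Ya ++ [(y, V)], p ∈ Xa ∨ q ∈ Ya →
      𝔻 Z (.termEq (Ψ (p.1, q.1)) (𝕥 X Y (σ p.1) (τ q.1))
        (𝕤 X Y (σ p.1) (p.2.subst σ) (τ q.1) (q.2.subst τ)))) :
    SMor 𝔻 Z (hat TA TB Xa (x, U) Ya (y, V)) Ψ ∧
      SEq 𝔻 Z (hat TA TB Xa (x, U) Ya (y, V)) Ψ (Θ X Y σ τ) := by
  refine SMor.of_seq (S.lc_hat h k) (S.smor_hat h k hZ hZ') fun z hz => ?_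
  obtain ⟨p, hp, q, hq, hpq, rfl⟩ := mem_hat.1 hz
  exact .econv' (.s2 (S.fine h k hZ hZ' hp hq hpq).2) (hΨ p hp q hq hpq)

theorem pair (S : Stp TA TB chA chB n m) (h : HatMor TA n X X1 Xa x U σ)
    (k : HatMor TB m Y Y1 Ya y V τ) : Pair TA TB x y Xa U Ya V :=
  ⟨S.hA, S.hB, h.fresh, k.fresh, h.goodC, k.goodC, h.swt, k.swt⟩

end Stp

theorem imgs_hat {C : Type} (F : Expr A → Expr B → C) (X : PreCtx A) (p : A.Var × SortE A)
    (Y : PreCtx B) (q : B.Var × SortE B) (ρ : A.Var → Expr A) (κ : B.Var → Expr B) :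
    (hat TA TB X p Y q).map (fun z => F (ρ z.1.1) (κ z.1.2)) =
      grid F (imgs X ρ) (imgs Y κ ++ [κ q.1]) ++ (imgs Y κ).map (F (ρ p.1)) := by
  have e : imgs Y κ ++ [κ q.1] = (Y ++ [q]).map fun b => κ b.1 := by simp [imgs]
  rw [hat_eq, List.map_append, map_grid, e, grid_map, List.map_map, List.map_map]
  rfl

theorem imgs_tctx {C : Type} (F : Expr A → Expr B → C) (X : PreCtx A) (Y : PreCtx B)
    (ρ : A.Var → Expr A) (κ : B.Var → Expr B) :
    (tctx TA TB X Y).map (fun z => F (ρ z.1.1) (κ z.1.2)) = grid F (imgs X ρ) (imgs Y κ) := by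
  rw [tctx, map_grid, grid_map]
  rfl

theorem tso_intro {X : PreCtx A} {Y : PreCtx B} {x : A.Var} {y : B.Var} (S : A.SortSym)
    (T : B.SortSym) : tso TA TB x y X ⟨S, ctxVars X⟩ Y ⟨T, ctxVars Y⟩ =
      ⟨(S, T), ctxVars (A := A.tensor B)
        (hat TA TB X (x, ⟨S, ctxVars X⟩) Y (y, ⟨T, ctxVars Y⟩))⟩ := by
  have := imgs_hat (TA := TA) (TB := TB) (fun u v => tens TA TB (X ++ [(x, ⟨S, ctxVars X⟩)])
    (Y ++ [(y, ⟨T, ctxVars Y⟩)]) u v) X (x, ⟨S, ctxVars X⟩) Y (y, ⟨T, ctxVars Y⟩) .var .var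
  rw [imgs_var, imgs_var] at this
  unfold tso tsort
  dsimp only
  rw [← this]
  congr 1
  refine List.map_congr_left fun z hz => ?_
  exact tens_var _ _ _ _

/-! ## Sorts -/

theorem imgs_upd {X : PreCtx A} {x : A.Var} (σ : A.Var → Expr A) (u : Expr A) (hx : x ∉ keys X) :
    imgs X (upd σ x u) = imgs X σ :=
  imgs_congr fun p hp => upd_of_mem σ u hx (mem_keys hp)

theorem upd_subst (σ ρ : A.Var → Expr A) (x : A.Var) (u : Expr A) (a : A.Var) :
    (upd ρ x u a).subst σ = upd (fun a => (ρ a).subst σ) x (u.subst σ) a := by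
  unfold upd
  split <;> rfl

theorem HatMor.exists_of_sort (hT : IsGAT TA) (hch : FreshCh chA) {n : ℕ} {X X1 : PreCtx A}
    (hX : GoodC TA X) (hX1 : GoodC TA X1) (hs : X1 ⊆ X) {u : Expr A} {U : SortE A}
    (hU : lev TA (n + 1) X1 (.sort U)) (hu : lev TA (n + 1) X (.term u U)) :
    ∃ Xa s σ, introSort Xa s ∈ TA ∧ HatMor TA n X X1 Xa (chA Xa) ⟨s, ctxVars Xa⟩ σ ∧
      U = ⟨s, imgs Xa σ⟩ ∧ σ (chA Xa) = u := by
  obtain ⟨s, rs⟩ := U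
  obtain ⟨Xa, σ, hax, hl, hσ, rfl⟩ := lev_sort_inv hU
  exact ⟨Xa, s, _, hax, .of_sort hT hch hX hX1 hs hax hl hσ hu,
    by rw [imgs_upd _ _ (not_mem_keys (hch Xa))], upd_self _ _ _⟩

theorem HatMor.exists_of_subst (hT : IsGAT TA) (hch : FreshCh chA) {n : ℕ} {X X' : PreCtx A}
    (hX : GoodC TA X) {σ : A.Var → Expr A} {u : Expr A} {U : SortE A}
    (hU : lev TA (n + 1) X' (.sort U)) (hu : lev TA (n + 1) X (.term u (U.subst σ))) :
    ∃ Xa s ρ, introSort Xa s ∈ TA ∧ U = ⟨s, imgs Xa ρ⟩ ∧ SMor (lev TA n) X' Xa ρ ∧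
      HatMor TA n X X Xa (chA Xa) ⟨s, ctxVars Xa⟩
        (GATPaper.upd (fun a => (ρ a).subst σ) (chA Xa) u) := by
  obtain ⟨s, rs⟩ := U
  obtain ⟨Xa, ρ, hax, hl, hρ, rfl⟩ := lev_sort_inv hU
  rw [SortE.subst_mk, imgs_subst] at hu
  obtain ⟨hl, hσ⟩ := lev_sort_imgs hT hax (lev_srt hu)
  exact ⟨Xa, s, ρ, hax, rfl, hρ, .of_sort hT hch hX hX (List.Subset.refl _) hax hl hσ hu⟩

namespace Stp
variable {n m : ℕ} {X X1 Xa : PreCtx A} {x : A.Var} {U : SortE A} {σ : A.Var → Expr A}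
  {Y Y1 Ya : PreCtx B} {y : B.Var} {V : SortE B} {τ : B.Var → Expr B}
  {Z : PreCtx (A.tensor B)}

theorem introSort_hat (S : Stp TA TB chA chB n m) {s : A.SortSym} {t : B.SortSym}
    (hs : introSort Xa s ∈ TA) (ht : introSort Ya t ∈ TB)
    (h : HatMor TA n X X1 Xa (chA Xa) ⟨s, ctxVars Xa⟩ σ)
    (k : HatMor TB m Y Y1 Ya (chB Ya) ⟨t, ctxVars Ya⟩ τ) :
    introSort (A := A.tensor B)
      (hat TA TB Xa (chA Xa, ⟨s, ctxVars Xa⟩) Ya (chB Ya, ⟨t, ctxVars Ya⟩)) (s, t) ∈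
        tensorAx TA TB chA chB := by
  have := (S.pair h k).ss_mem hs ht
  rw [tso_intro] at this
  exact this

theorem imgs_hat_tsub {s : A.SortSym} {t : B.SortSym} {C : SortE A} {E : SortE B} :
    (⟨(s, t), imgs (A := A.tensor B) (hat TA TB Xa (x, C) Ya (y, E)) (Θ X Y σ τ)⟩ :
      SortE (A.tensor B)) = 𝕤 X Y (σ x) ⟨s, imgs Xa σ⟩ (τ y) ⟨t, imgs Ya τ⟩ := by
  exact congrArg (SortE.mk (A := A.tensor B) (s, t)) (imgs_hat (𝕥 X Y) Xa (x, C) Ya (y, E) σ τ)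

theorem sort_hat (S : Stp TA TB chA chB n m) {s : A.SortSym} {t : B.SortSym}
    (hs : introSort Xa s ∈ TA) (ht : introSort Ya t ∈ TB)
    (h : HatMor TA n X X1 Xa (chA Xa) ⟨s, ctxVars Xa⟩ σ)
    (k : HatMor TB m Y Y1 Ya (chB Ya) ⟨t, ctxVars Ya⟩ τ) (hZ : 𝕔 X1 Y ⊆ Z) (hZ' : 𝕔 X Y1 ⊆ Z) :
    𝔻 Z (.sort (𝕤 X Y (σ (chA Xa)) ⟨s, imgs Xa σ⟩ (τ (chB Ya)) ⟨t, imgs Ya τ⟩)) := by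
  have hl := S.lc_hat h k
  rw [← imgs_hat_tsub (C := ⟨s, ctxVars Xa⟩) (E := ⟨t, ctxVars Ya⟩)]
  exact .sort (S.introSort_hat hs ht h k) hl.1 hl.2 (S.smor_hat h k hZ hZ')

/-- Congruence of the tensor of two sort symbols. -/
theorem cong_sort (S : Stp TA TB chA chB n m) {s : A.SortSym} {t : B.SortSym}
    (hs : introSort Xa s ∈ TA) (ht : introSort Ya t ∈ TB)
    (h : HatMor TA n X X1 Xa (chA Xa) ⟨s, ctxVars Xa⟩ σ)
    (k : HatMor TB m Y Y1 Ya (chB Ya) ⟨t, ctxVars Ya⟩ τ) (hZ : 𝕔 X1 Y ⊆ Z) (hZ' : 𝕔 X Y1 ⊆ Z)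
    {Ψ : A.Var × B.Var → Expr (A.tensor B)}
    (hΨ : ∀ p ∈ Xa ++ [(chA Xa, ⟨s, ctxVars Xa⟩)], ∀ q ∈ Ya ++ [(chB Ya, ⟨t, ctxVars Ya⟩)],
      p ∈ Xa ∨ q ∈ Ya → 𝔻 Z (.termEq (Ψ (p.1, q.1)) (𝕥 X Y (σ p.1) (τ q.1))
        (𝕤 X Y (σ p.1) (p.2.subst σ) (τ q.1) (q.2.subst τ)))) :
    𝔻 Z (.sortEq ⟨(s, t), imgs (A := A.tensor B)
        (hat TA TB Xa (chA Xa, ⟨s, ctxVars Xa⟩) Ya (chB Ya, ⟨t, ctxVars Ya⟩)) Ψ⟩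
      (𝕤 X Y (σ (chA Xa)) ⟨s, imgs Xa σ⟩ (τ (chB Ya)) ⟨t, imgs Ya τ⟩)) := by
  have hl := S.lc_hat h k
  have hax := S.introSort_hat hs ht h k
  obtain ⟨h1, h2⟩ := S.hat_congr h k hZ hZ' hΨ
  rw [← imgs_hat_tsub (C := ⟨s, ctxVars Xa⟩) (E := ⟨t, ctxVars Ya⟩)]
  exact .scong hax hl.1 hl.2 h2 (.sort hax hl.1 hl.2 h1)
    (.sort hax hl.1 hl.2 (S.smor_hat h k hZ hZ'))

theorem sort (S : Stp TA TB chA chB n m) (hX : GoodC TA X) (hX1 : GoodC TA X1) (hs : X1 ⊆ X)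
    (hY : GoodC TB Y) (hY1 : GoodC TB Y1) (ht : Y1 ⊆ Y) {u : Expr A} {v : Expr B}
    (hU : lev TA (n + 1) X1 (.sort U)) (hu : lev TA (n + 1) X (.term u U))
    (hV : lev TB (m + 1) Y1 (.sort V)) (hv : lev TB (m + 1) Y (.term v V))
    (hZ : 𝕔 X1 Y ⊆ Z) (hZ' : 𝕔 X Y1 ⊆ Z) : 𝔻 Z (.sort (𝕤 X Y u U v V)) := by
  obtain ⟨Xa, s, σ, hax, h, rfl, rfl⟩ := HatMor.exists_of_sort S.hA S.fA hX hX1 hs hU hu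
  obtain ⟨Ya, t, τ, hax', k, rfl, rfl⟩ := HatMor.exists_of_sort S.hB S.fB hY hY1 ht hV hv
  exact S.sort_hat hax hax' h k hZ hZ'

theorem sort_tso (S : Stp TA TB chA chB n m) (h : HatMor TA n X X1 Xa x U σ)
    (k : HatMor TB m Y Y1 Ya y V τ) :
    𝔻 (hat TA TB Xa (x, U) Ya (y, V)) (.sort (tso TA TB x y Xa U Ya V)) :=
  S.sort h.goodHat h.goodC (by simp) k.goodHat k.goodC (by simp) h.srt
    (h.lcHat.smor_var (List.Subset.refl _) (x, U) (by simp) |> fun e => by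
      simpa only [SortE.subst_id] using e) k.srt
    (k.lcHat.smor_var (List.Subset.refl _) (y, V) (by simp) |> fun e => by
      simpa only [SortE.subst_id] using e) (S.hat_sub_left h k) (S.hat_sub_right h k)

/-- Substitution in a tensor of sorts, given substitution in its arguments. -/
theorem tss_of_args (S : Stp TA TB chA chB n m) {X' : PreCtx A} {Y' : PreCtx B} (hX : GoodC TA X)
    (hY : GoodC TB Y) {u : Expr A} {v : Expr B} (hU : lev TA (n + 1) X' (.sort U))
    (hV : lev TB (m + 1) Y' (.sort V)) (hu : lev TA (n + 1) X (.term (u.subst σ) (U.subst σ)))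
    (hv : lev TB (m + 1) Y (.term (v.subst τ) (V.subst τ)))
    (h1 : ∀ a ∈ U.args, ∀ b ∈ V.args ++ [v], ∀ C E, lev TA n X (.term (a.subst σ) C) →
      lev TB (m + 1) Y (.term (b.subst τ) E) →
      𝔻 (𝕔 X Y) (.termEq (𝔼 (𝕥 X' Y' a b) (Θ X Y σ τ)) (𝕥 X Y (a.subst σ) (b.subst τ))
        (𝕤 X Y (a.subst σ) C (b.subst τ) E)))
    (h2 : ∀ b ∈ V.args, ∀ C E, lev TA (n + 1) X (.term (u.subst σ) C) →
      lev TB m Y (.term (b.subst τ) E) →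
      𝔻 (𝕔 X Y) (.termEq (𝔼 (𝕥 X' Y' u b) (Θ X Y σ τ)) (𝕥 X Y (u.subst σ) (b.subst τ))
        (𝕤 X Y (u.subst σ) C (b.subst τ) E))) :
    𝔻 (𝕔 X Y) (.sortEq (𝕊 (𝕤 X' Y' u U v V) (Θ X Y σ τ))
      (𝕤 X Y (u.subst σ) (U.subst σ) (v.subst τ) (V.subst τ))) := by
  obtain ⟨Xa, s, ρ, hs, rfl, hρ, h⟩ := HatMor.exists_of_subst S.hA S.fA hX hU hu
  obtain ⟨Ya, t, κ, ht, rfl, hκ, k⟩ := HatMor.exists_of_subst S.hB S.fB hY hV hv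
  have key := S.cong_sort (Z := 𝕔 X Y) (Ψ := fun z => 𝔼 (𝕥 X' Y' (upd ρ (chA Xa) u z.1)
    (upd κ (chB Ya) v z.2)) (Θ X Y σ τ)) hs ht h k (List.Subset.refl _) (List.Subset.refl _)
    fun p hp q hq hpq => by
      rw [← upd_subst, ← upd_subst]
      have hq' := k.morHat q hq
      have hp' := h.morHat p hp
      rw [← upd_subst] at hq' hp'
      rcases hpq with hpq | hpq
      · have hp' := h.mor p hpq
        rw [← upd_subst] at hp'
        refine h1 _ ?_ _ ?_ _ _ hp' hq'
        · rw [upd_of_mem _ _ h.fresh (mem_keys hpq)]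
          exact List.mem_map_of_mem hpq
        · rcases List.mem_append.1 hq with hq | hq
          · rw [upd_of_mem _ _ k.fresh (mem_keys hq)]
            exact List.mem_append_left _ (List.mem_map_of_mem hq)
          · rw [List.mem_singleton.1 hq]
            simp
      · rcases List.mem_append.1 hp with hp | hp
        · have hp' := h.mor p hp
          rw [← upd_subst] at hp'
          refine h1 _ ?_ _ ?_ _ _ hp' hq'
          · rw [upd_of_mem _ _ h.fresh (mem_keys hp)]
            exact List.mem_map_of_mem hp
          · rw [upd_of_mem _ _ k.fresh (mem_keys hpq)]
            exact List.mem_append_left _ (List.mem_map_of_mem hpq)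
        · obtain rfl := List.mem_singleton.1 hp
          have hq' := k.mor q hpq
          rw [← upd_subst] at hq'
          have e : upd ρ (chA Xa) u (chA Xa) = u := upd_self _ _ _
          simp only [e] at hp' ⊢
          refine h2 _ ?_ _ _ hp' hq'
          rw [upd_of_mem _ _ k.fresh (mem_keys hpq)]
          exact List.mem_map_of_mem hpq
  rw [imgs_upd _ _ h.fresh, imgs_upd _ _ k.fresh, upd_self, upd_self] at key
  have e1 : (⟨s, imgs Xa ρ⟩ : SortE A).subst σ = ⟨s, imgs Xa fun a => (ρ a).subst σ⟩ := by
    rw [SortE.subst_mk, imgs_subst]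
  have e2 : (⟨t, imgs Ya κ⟩ : SortE B).subst τ = ⟨t, imgs Ya fun a => (κ a).subst τ⟩ := by
    rw [SortE.subst_mk, imgs_subst]
  rw [e1, e2]
  refine Eq.mp (congrArg (fun C => 𝔻 (𝕔 X Y) (.sortEq C _)) ?_) key
  have := imgs_hat (TA := TA) (TB := TB) (fun a b => 𝔼 (𝕥 X' Y' a b) (Θ X Y σ τ)) Xa
    (chA Xa, ⟨s, ctxVars Xa⟩) Ya (chB Ya, ⟨t, ctxVars Ya⟩) (upd ρ (chA Xa) u) (upd κ (chB Ya) v)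
  rw [imgs_upd _ _ h.fresh, imgs_upd _ _ k.fresh, upd_self, upd_self] at this
  simp only [imgs]
  simp only [imgs] at this
  rw [this, tsort, SortE.subst_mk, List.map_append, map_grid, List.map_map, List.map_map, List.map_map]
  rfl

theorem ts_fst (S : Stp TA TB chA chB n m) (h : HatMor TA n X X1 Xa x U σ)
    (k : HatMor TB m Y Y1 Ya y V τ) {Y' : PreCtx B} (hY' : GoodC TB Y')
    (hk : SMor (lev TB (m + 1)) Y Y' τ) {a : Expr A} {b : Expr B} {C : SortE A} {E : SortE B}
    (ha : WT TA Xa a) (hb : WT TB Y' b) (haC : lev TA n X (.term (a.subst σ) C))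
    (hbE : lev TB (m + 1) Y (.term (b.subst τ) E)) :
    𝔻 (𝕔 X Y) (.termEq (𝔼 (𝕥 (Xa ++ [(x, U)]) Y' a b) (Θ X Y σ τ))
      (𝕥 X Y (a.subst σ) (b.subst τ)) (𝕤 X Y (a.subst σ) C (b.subst τ) E)) := by
  rw [tens_mono S.hA S.hB h.goodC hY' h.goodHat hY' (by simp) (List.Subset.refl _) ha hb]
  exact S.L.ts h.good k.good h.goodC hY' h.mor' hk ha hb haC hbE

theorem ts_snd (S : Stp TA TB chA chB n m) (h : HatMor TA n X X1 Xa x U σ)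
    (k : HatMor TB m Y Y1 Ya y V τ) {X' : PreCtx A} (hX' : GoodC TA X')
    (hh : SMor (lev TA (n + 1)) X X' σ) {a : Expr A} {b : Expr B} {C : SortE A} {E : SortE B}
    (ha : WT TA X' a) (hb : WT TB Ya b) (haC : lev TA (n + 1) X (.term (a.subst σ) C))
    (hbE : lev TB m Y (.term (b.subst τ) E)) :
    𝔻 (𝕔 X Y) (.termEq (𝔼 (𝕥 X' (Ya ++ [(y, V)]) a b) (Θ X Y σ τ))
      (𝕥 X Y (a.subst σ) (b.subst τ)) (𝕤 X Y (a.subst σ) C (b.subst τ) E)) := by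
  rw [tens_mono S.hA S.hB hX' k.goodC hX' k.goodHat (List.Subset.refl _) (by simp) ha hb]
  exact S.R.ts h.good k.good hX' k.goodC hh k.mor' ha hb haC hbE

/-- Substitution in the tensor of two sorts along the tensor of two morphisms. -/
theorem tss_tso (S : Stp TA TB chA chB n m) (h : HatMor TA n X X1 Xa x U σ)
    (k : HatMor TB m Y Y1 Ya y V τ) :
    𝔻 (𝕔 X Y) (.sortEq (𝕊 (tso TA TB x y Xa U Ya V) (Θ X Y σ τ))
      (𝕤 X Y (σ x) (U.subst σ) (τ y) (V.subst τ))) := by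
  rw [← Expr.subst_var' σ x, ← Expr.subst_var' τ y]
  refine S.tss_of_args (X' := Xa ++ [(x, U)]) (Y' := Ya ++ [(y, V)]) (σ := σ) (τ := τ)
    (u := .var x) (v := .var y) h.good k.good (lev_weaken h.srt (by simp))
    (lev_weaken k.srt (by simp))
    (by rw [Expr.subst_var']; exact h.last) (by rw [Expr.subst_var']; exact k.last) ?_ ?_
  · intro a ha b hb C E haC hbE
    refine S.ts_fst h k k.goodHat k.morHat (h.swt a ha) ?_ haC hbE
    rcases List.mem_append.1 hb with hb | hb
    · exact (k.swt b hb).weaken (by simp)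
    · rw [List.mem_singleton.1 hb]
      exact .var (by simp)
  · intro b hb C E huC hbE
    exact S.ts_snd h k h.goodHat h.morHat (.var (by simp)) (k.swt b hb) huC hbE

/-- Substitution in the tensor of two sorts along a composite morphism. -/
theorem comp (S : Stp TA TB chA chB n m) (h : HatMor TA n X X1 Xa x U σ)
    (k : HatMor TB m Y Y1 Ya y V τ) {ρ ρ' : A.Var × B.Var → Expr (A.tensor B)}
    (hρ : ∀ p ∈ Xa ++ [(x, U)], ∀ q ∈ Ya ++ [(y, V)], p ∈ Xa ∨ q ∈ Ya →
      𝔻 (𝕔 X Y) (.termEq (𝔼 (ρ (p.1, q.1)) ρ') (𝕥 X Y (σ p.1) (τ q.1))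
        (𝕤 X Y (σ p.1) (p.2.subst σ) (τ q.1) (q.2.subst τ)))) :
    𝔻 (𝕔 X Y) (.sortEq (𝕊 (𝕊 (tso TA TB x y Xa U Ya V) ρ) ρ')
      (𝕤 X Y (σ x) (U.subst σ) (τ y) (V.subst τ))) := by
  have hh := h.weak
  have kk := k.weak
  obtain ⟨h1, h2⟩ := S.hat_congr (Ψ := fun z => 𝔼 (ρ z) ρ') hh kk (List.Subset.refl _)
    (List.Subset.refl _) hρ
  rw [SortE.subst_subst]
  exact .s3 ((S.sort_tso h k).cong h1 (S.smor_hat hh kk (List.Subset.refl _)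
    (List.Subset.refl _)) h2) (S.tss_tso h k)

theorem term_fine (S : Stp TA TB chA chB n m) (h : HatMor TA n X X1 Xa x U σ)
    (k : HatMor TB m Y Y1 Ya y V τ) {p : A.Var × SortE A} {q : B.Var × SortE B}
    (hp : p ∈ Xa ++ [(x, U)]) (hq : q ∈ Ya ++ [(y, V)]) (hpq : p ∈ Xa ∨ q ∈ Ya) :
    𝔻 (𝕔 X Y) (.termEq (𝔼 (𝕥 (Xa ++ [(x, U)]) (Ya ++ [(y, V)]) (.var p.1) (.var q.1))
      (Θ X Y σ τ)) (𝕥 X Y (σ p.1) (τ q.1))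
        (𝕤 X Y (σ p.1) (p.2.subst σ) (τ q.1) (q.2.subst τ))) := by
  rw [tens_var, Expr.subst_var']
  exact .t1 (S.fine h.weak k.weak (List.Subset.refl _) (List.Subset.refl _) hp hq hpq).1

/-- The substitution sending the last variable of the second context to `v`. -/
theorem smor_right (S : Stp TA TB chA chB n m) (h : HatMor TA n X X1 Xa x U σ)
    (k : HatMor TB m Y Y1 Ya y V τ) {v : Expr B} (hv : lev TB (m + 1) Ya (.term v V)) :
    SMor 𝔻 (𝕔 (Xa ++ [(x, U)]) Ya) (hat TA TB Xa (x, U) Ya (y, V))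
      (Θ (Xa ++ [(x, U)]) Ya .var (single y v)) :=
  S.smor_hat (.id S.hA h.lc h.fresh h.srt) (.single S.hB k.lc k.fresh k.srt hv)
    (tctx_subset S.hA S.hB h.goodC k.goodC h.goodHat k.goodC (by simp) (List.Subset.refl _))
    (List.Subset.refl _)

theorem smor_left (S : Stp TA TB chA chB n m) (h : HatMor TA n X X1 Xa x U σ)
    (k : HatMor TB m Y Y1 Ya y V τ) {u : Expr A} (hu : lev TA (n + 1) Xa (.term u U)) :
    SMor 𝔻 (𝕔 Xa (Ya ++ [(y, V)])) (hat TA TB Xa (x, U) Ya (y, V))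
      (Θ Xa (Ya ++ [(y, V)]) (single x u) .var) :=
  S.smor_hat (.single S.hA h.lc h.fresh h.srt hu) (.id S.hB k.lc k.fresh k.srt)
    (List.Subset.refl _)
    (tctx_subset S.hA S.hB h.goodC k.goodC h.goodC k.goodHat (List.Subset.refl _) (by simp))

theorem comp_right (S : Stp TA TB chA chB n m) (h : HatMor TA n X X1 Xa x U σ)
    (k : HatMor TB m Y Y1 Ya y V τ) {v : Expr B} (hv : WT TB Ya v) (hvτ : v.subst τ = τ y) :
    𝔻 (𝕔 X Y) (.sortEq (𝕊 (𝕊 (tso TA TB x y Xa U Ya V)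
      (Θ (Xa ++ [(x, U)]) Ya .var (single y v))) (Θ X Y σ τ))
        (𝕤 X Y (σ x) (U.subst σ) (τ y) (V.subst τ))) := by
  refine S.comp h k fun p hp q hq hpq => ?_
  by_cases hqY : q ∈ Ya
  · have := S.term_fine h k hp hq hpq
    rw [tens_var] at this
    rw [tsub, single_of_ne (ne_of_mem_keys (mem_keys hqY) k.fresh), tens_var]
    exact this
  · obtain rfl := List.mem_singleton.1 ((List.mem_append.1 hq).resolve_left hqY)
    have hpX := hpq.resolve_right hqY
    have := S.ts_fst (a := .var p.1) h k k.goodC (k.mor'.lev_mono (by omega))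
      (.var (mem_keys hpX)) hv
      (C := p.2.subst σ) (by rw [Expr.subst_var']; exact h.mor' p hpX) (hvτ ▸ k.last)
    rw [tsub, single_self]
    rw [hvτ, Expr.subst_var'] at this
    exact this

theorem comp_left (S : Stp TA TB chA chB n m) (h : HatMor TA n X X1 Xa x U σ)
    (k : HatMor TB m Y Y1 Ya y V τ) {u : Expr A} (hu : WT TA Xa u) (huσ : u.subst σ = σ x) :
    𝔻 (𝕔 X Y) (.sortEq (𝕊 (𝕊 (tso TA TB x y Xa U Ya V)
      (Θ Xa (Ya ++ [(y, V)]) (single x u) .var)) (Θ X Y σ τ))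
        (𝕤 X Y (σ x) (U.subst σ) (τ y) (V.subst τ))) := by
  refine S.comp h k fun p hp q hq hpq => ?_
  by_cases hpX : p ∈ Xa
  · have := S.term_fine h k hp hq hpq
    rw [tens_var] at this
    rw [tsub, single_of_ne (ne_of_mem_keys (mem_keys hpX) h.fresh), tens_var]
    exact this
  · obtain rfl := List.mem_singleton.1 ((List.mem_append.1 hp).resolve_left hpX)
    have hqY := hpq.resolve_left hpX
    have := S.ts_snd (b := .var q.1) h k h.goodC (h.mor'.lev_mono (by omega))
      hu (.var (mem_keys hqY)) (huσ ▸ h.last) 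
      (E := q.2.subst τ) (by rw [Expr.subst_var']; exact k.mor' q hqY)
    rw [tsub, single_self]
    rw [huσ, Expr.subst_var'] at this
    exact this

theorem comp_both (S : Stp TA TB chA chB n m) (h : HatMor TA n X X1 Xa x U σ)
    (k : HatMor TB m Y Y1 Ya y V τ) {u : Expr A} (hu : WT TA Xa u) (huσ : u.subst σ = σ x)
    {v : Expr B} (hv : WT TB Ya v) (hvτ : v.subst τ = τ y) :
    𝔻 (𝕔 X Y) (.sortEq (𝕊 (𝕊 (tso TA TB x y Xa U Ya V)
      (Θ Xa Ya (single x u) (single y v))) (Θ X Y σ τ))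
        (𝕤 X Y (σ x) (U.subst σ) (τ y) (V.subst τ))) := by
  refine S.comp h k fun p hp q hq hpq => ?_
  by_cases hpX : p ∈ Xa
  · rw [tsub, single_of_ne (ne_of_mem_keys (mem_keys hpX) h.fresh)]
    by_cases hqY : q ∈ Ya
    · have := S.term_fine h k hp hq hpq
      rw [tens_var] at this
      rw [single_of_ne (ne_of_mem_keys (mem_keys hqY) k.fresh), tens_var]
      exact this
    · obtain rfl := List.mem_singleton.1 ((List.mem_append.1 hq).resolve_left hqY)
      have := S.L.ts (u := .var p.1) h.good k.good h.goodC k.goodC h.mor'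
        (k.mor'.lev_mono (by omega)) (.var (mem_keys hpX)) hv
        (U := p.2.subst σ) (by rw [Expr.subst_var']; exact h.mor' p hpX) (hvτ ▸ k.last)
      rw [single_self]
      rw [hvτ, Expr.subst_var'] at this
      exact this
  · obtain rfl := List.mem_singleton.1 ((List.mem_append.1 hp).resolve_left hpX)
    have hqY := hpq.resolve_left hpX
    have := S.R.ts (v := .var q.1) h.good k.good h.goodC k.goodC (h.mor'.lev_mono (by omega))
      k.mor' hu (.var (mem_keys hqY)) (huσ ▸ h.last) 
      (V := q.2.subst τ) (by rw [Expr.subst_var']; exact k.mor' q hqY)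
    rw [tsub, single_self, single_of_ne (ne_of_mem_keys (mem_keys hqY) k.fresh)]
    rw [huσ, Expr.subst_var'] at this
    exact this

theorem _root_.GATPaper.HatMor.extend (hT : IsGAT TA) (hch : FreshCh chA) (hX : GoodC TA X)
    (hl : LC (lev TA n) Xa) (hU : lev TA n Xa (.sort U)) (hσ : SMor (lev TA n) X Xa σ)
    {u : Expr A} (hu : lev TA (n + 1) X (.term u (U.subst σ))) :
    HatMor TA n X X Xa (chA Xa) U (upd σ (chA Xa) u) := by
  have hf : chA Xa ∉ keys Xa := not_mem_keys (hch Xa)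
  refine ⟨hT, List.Subset.refl _, hX, hX, hl,
    hσ.congr hl.lev_der.goodC fun a ha => (upd_of_mem σ _ hf ha).symm, hf, lev_succ hU, ?_⟩
  rw [upd_self, (lev_swt hU).subst_congr fun a ha => upd_of_mem σ _ hf ha]
  exact hu

theorem _root_.GATPaper.upd_sort (hx : x ∉ keys Xa) {U : SortE A} (hU : SWT TA Xa U)
    (σ : A.Var → Expr A) (u : Expr A) : U.subst (upd σ x u) = U.subst σ :=
  hU.subst_congr fun a ha => upd_of_mem σ u hx ha

theorem _root_.GATPaper.HatMor.change (h : HatMor TA n X X1 Xa x U σ) {U' : SortE A}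
    (hU' : lev TA (n + 1) Xa (.sort U')) (hl : lev TA (n + 1) X (.term (σ x) (U'.subst σ))) :
    HatMor TA n X X1 Xa x U' σ :=
  { h with srt := hU', last := hl }

theorem _root_.GATPaper.HatMor.lastVar (h : HatMor TA n X X1 Xa x U σ) :
    lev TA (n + 1) (Xa ++ [(x, U)]) (.term (.var x) U) := by
  simpa only [SortE.subst_id] using h.lcHat.smor_var (List.Subset.refl _) (x, U) (by simp)

theorem _root_.GATPaper.HatMor.sax_hat (h : HatMor TA n X X1 Xa x U σ) {U' : SortE A}
    (hax : Judg.sortEq Xa U U' ∈ TA) (hU : lev TA n Xa (.sort U)) (hU' : lev TA n Xa (.sort U')) :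
    lev TA (n + 1) Xa (.sortEq U U') := by
  have := NS.sax hax h.lc hU hU' (h.lc.smor_var (List.Subset.refl _))
    (by rw [SortE.subst_id]; exact lev_succ hU) (by rw [SortE.subst_id]; exact lev_succ hU')
  rwa [SortE.subst_id, SortE.subst_id] at this

theorem _root_.GATPaper.intro_subst (s : A.SortSym) (Xa : PreCtx A) (σ : A.Var → Expr A) :
    (⟨s, ctxVars Xa⟩ : SortE A).subst σ = ⟨s, imgs Xa σ⟩ := by
  rw [← imgs_var, SortE.subst_mk, imgs_subst]
  simp only [Expr.subst_var']

theorem tso_left (S : Stp TA TB chA chB n m) {t : B.SortSym} {U' : SortE A}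
    (h : HatMor TA n X X1 Xa x U σ) (h' : HatMor TA n X X1 Xa x U' σ)
    (k : HatMor TB m Y Y1 Ya y ⟨t, ctxVars Ya⟩ τ) :
    𝕤 (Xa ++ [(x, U)]) (Ya ++ [(y, ⟨t, ctxVars Ya⟩)]) (.var x) U' (.var y) ⟨t, ctxVars Ya⟩ =
      tso TA TB x y Xa U' Ya ⟨t, ctxVars Ya⟩ := by
  have hb : ∀ b ∈ ctxVars Ya ++ [Expr.var y], ∃ z, b = .var z ∧
      z ∈ keys (Ya ++ [(y, (⟨t, ctxVars Ya⟩ : SortE B))]) := by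
    simp only [ctxVars, List.mem_append, List.mem_map, List.mem_singleton]
    rintro b (⟨z, hz, rfl⟩ | rfl)
    · exact ⟨_, rfl, by simp; exact .inl ⟨_, hz⟩⟩
    · exact ⟨_, rfl, by simp⟩
  unfold tso tsort
  congr 2
  · refine grid_congr fun a ha b hb' => ?_
    obtain ⟨z, rfl, hz⟩ := hb b hb'
    rw [tens_mono S.hA S.hB h.goodC k.goodHat h.goodHat k.goodHat (by simp)
      (List.Subset.refl _) (h'.swt a ha) (.var hz),
      tens_mono S.hA S.hB h.goodC k.goodHat h'.goodHat k.goodHat (by simp)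
      (List.Subset.refl _) (h'.swt a ha) (.var hz)]
  · refine List.map_congr_left fun b hb' => ?_
    obtain ⟨z, rfl, hz⟩ := hb b (List.mem_append_left _ hb')
    rw [tens_var, tens_var]

/-- Equal sorts in the first variable have equal tensors. -/
theorem seql (S : Stp TA TB chA chB n m) (hX : GoodC TA X) (hY : GoodC TB Y) {U' : SortE A}
    (hUU : lev TA (n + 1) X (.sortEq U U')) {u : Expr A} (hu : lev TA (n + 1) X (.term u U))
    {v : Expr B} (hv : lev TB (m + 1) Y (.term v V)) :
    𝔻 (𝕔 X Y) (.sortEq (𝕤 X Y u U v V) (𝕤 X Y u U' v V)) := by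
  obtain ⟨Ya, t, τ, ht, k, rfl, rfl⟩ := HatMor.exists_of_sort S.hB S.fB hY hY
    (List.Subset.refl _) (lev_srt hv) hv
  generalize hj : CJ.sortEq U U' = j at hUU
  change NS TA (lev TA n) X j at hUU
  induction hUU generalizing U U' with
  | s1 h _ =>
    cases hj
    exact .s1 (S.sort hX hX (List.Subset.refl _) hY hY (List.Subset.refl _) h hu (lev_srt hv) hv
      (List.Subset.refl _) (List.Subset.refl _))
  | s2 h ih =>
    cases hj
    exact .s2 (ih (NS.conv (.s2 h) hu) rfl)
  | s3 h h' ih ih' =>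
    cases hj
    exact .s3 (ih hu rfl) (ih' (NS.conv h hu) rfl)
  | @sax Xa U U' σ hax hc hU hU' ha h1 h2 =>
    cases hj
    have h := HatMor.extend S.hA S.fA hX hc hU ha hu
    have hl := h.last
    have h' := h.change (U' := U') (lev_succ hU') (by
      rw [upd_sort h.fresh (lev_swt hU'), upd_self]
      exact NS.conv (.sax hax hc hU hU' ha h1 h2) hu)
    have hs := S.smor_hat h k (List.Subset.refl _) (List.Subset.refl _)
    have hs' := S.sort h.goodHat h.goodC (by simp) k.goodHat k.goodC (by simp) (lev_succ hU')
      (.conv (lev_weaken (h.sax_hat hax hU hU') (by simp)) h.lastVar) k.srt k.lastVar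
      (S.hat_sub_left h k) (S.hat_sub_right h k)
    rw [S.tso_left h h' k] at hs'
    have hlc := S.lc_hat h k
    have := Der.sax ((S.pair h k).seqs_mem (lev_swt hU') hax ht) hlc.1 hlc.2 (S.sort_tso h k) hs' hs
      ((S.sort_tso h k).subst hs) (hs'.subst hs)
    have e := Der.s3 (.s2 (S.tss_tso h k)) (.s3 this (S.tss_tso h' k))
    rw [upd_sort h.fresh h.swt, upd_sort h.fresh h'.swt, upd_self] at e
    rwa [intro_subst] at e
  | @scong Xa s σ σ' hax hc ha h1 h2 =>
    cases hj
    obtain ⟨hl, hσ⟩ := lev_sort_imgs S.hA hax h1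
    have h := HatMor.of_sort S.hA S.fA hX hX (List.Subset.refl _) hax hl hσ hu
    have e := S.cong_sort (Ψ := Θ X Y (upd σ' (chA Xa) u) τ) hax ht h k (List.Subset.refl _)
      (List.Subset.refl _) fun p hp q hq hpq => by
        by_cases hpX : p ∈ Xa
        · have hpk := mem_keys hpX
          rw [tsub, upd_of_mem _ _ h.fresh hpk, upd_of_mem _ _ h.fresh hpk]
          rw [upd_sort h.fresh (h.goodC.swt_of_mem hpX)]
          exact .t2 (S.L.eql hX hY (ha p hpX) (k.morHat q hq))
        · obtain rfl := List.mem_singleton.1 ((List.mem_append.1 hp).resolve_left hpX)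
          have := (S.fine h k (List.Subset.refl _) (List.Subset.refl _) hp hq hpq).1
          rw [tsub, upd_self]
          rw [upd_self] at this ⊢
          exact .t1 this
    rw [imgs_hat_tsub, imgs_upd _ _ h.fresh, imgs_upd _ _ h.fresh, upd_self, upd_self] at e
    exact .s2 e
  | _ => cases hj

theorem tso_right (S : Stp TA TB chA chB n m) {s : A.SortSym} {V' : SortE B}
    (h : HatMor TA n X X1 Xa x ⟨s, ctxVars Xa⟩ σ) (k : HatMor TB m Y Y1 Ya y V τ)
    (k' : HatMor TB m Y Y1 Ya y V' τ) :
    𝕤 (Xa ++ [(x, ⟨s, ctxVars Xa⟩)]) (Ya ++ [(y, V)]) (.var x) ⟨s, ctxVars Xa⟩ (.var y) V' =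
      tso TA TB x y Xa ⟨s, ctxVars Xa⟩ Ya V' := by
  have ha : ∀ a ∈ ctxVars Xa ++ [Expr.var x], ∃ z, a = .var z ∧
      z ∈ keys (Xa ++ [(x, (⟨s, ctxVars Xa⟩ : SortE A))]) := by
    simp only [ctxVars, List.mem_append, List.mem_map, List.mem_singleton]
    rintro a (⟨z, hz, rfl⟩ | rfl)
    · exact ⟨_, rfl, by simp; exact .inl ⟨_, hz⟩⟩
    · exact ⟨_, rfl, by simp⟩
  have hm : ∀ a ∈ ctxVars Xa ++ [Expr.var x], ∀ b ∈ V'.args,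
      𝕥 (Xa ++ [(x, ⟨s, ctxVars Xa⟩)]) (Ya ++ [(y, V)]) a b =
        𝕥 (Xa ++ [(x, ⟨s, ctxVars Xa⟩)]) (Ya ++ [(y, V')]) a b := fun a ha' b hb => by
    obtain ⟨z, rfl, hz⟩ := ha a ha'
    rw [tens_mono S.hA S.hB h.goodHat k.goodC h.goodHat k.goodHat (List.Subset.refl _) (by simp)
      (.var hz) (k'.swt b hb),
      tens_mono S.hA S.hB h.goodHat k.goodC h.goodHat k'.goodHat (List.Subset.refl _) (by simp)
      (.var hz) (k'.swt b hb)]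
  unfold tso tsort
  congr 2
  · refine grid_congr fun a ha' b hb => ?_
    rcases List.mem_append.1 hb with hb | hb
    · exact hm a (List.mem_append_left _ ha') b hb
    · obtain ⟨z, rfl, hz⟩ := ha a (List.mem_append_left _ ha')
      rw [List.mem_singleton.1 hb, tens_var, tens_var]
  · exact List.map_congr_left fun b hb => hm _ (by simp) b hb

/-- Equal sorts in the second variable have equal tensors. -/
theorem seqr (S : Stp TA TB chA chB n m) (hX : GoodC TA X) (hY : GoodC TB Y) {V' : SortE B}
    (hVV : lev TB (m + 1) Y (.sortEq V V')) {u : Expr A} (hu : lev TA (n + 1) X (.term u U))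
    {v : Expr B} (hv : lev TB (m + 1) Y (.term v V)) :
    𝔻 (𝕔 X Y) (.sortEq (𝕤 X Y u U v V) (𝕤 X Y u U v V')) := by
  obtain ⟨Xa, s, σ, hs, h, rfl, rfl⟩ := HatMor.exists_of_sort S.hA S.fA hX hX
    (List.Subset.refl _) (lev_srt hu) hu
  generalize hj : CJ.sortEq V V' = j at hVV
  change NS TB (lev TB m) Y j at hVV
  induction hVV generalizing V V' with
  | s1 k _ =>
    cases hj
    exact .s1 (S.sort hX hX (List.Subset.refl _) hY hY (List.Subset.refl _) (lev_srt hu) hu k hv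
      (List.Subset.refl _) (List.Subset.refl _))
  | s2 k ih =>
    cases hj
    exact .s2 (ih (NS.conv (.s2 k) hv) rfl)
  | s3 k k' ih ih' =>
    cases hj
    exact .s3 (ih hv rfl) (ih' (NS.conv k hv) rfl)
  | @sax Ya V V' τ hax hc hV hV' hb h1 h2 =>
    cases hj
    have k := HatMor.extend S.hB S.fB hY hc hV hb hv
    have hl := k.last
    have k' := k.change (U' := V') (lev_succ hV') (by
      rw [upd_sort k.fresh (lev_swt hV'), upd_self]
      exact NS.conv (.sax hax hc hV hV' hb h1 h2) hv)
    have hs' := S.smor_hat h k (List.Subset.refl _) (List.Subset.refl _)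
    have hr := S.sort h.goodHat h.goodC (by simp) k.goodHat k.goodC (by simp) h.srt h.lastVar
      (lev_succ hV') (.conv (lev_weaken (k.sax_hat hax hV hV') (by simp)) k.lastVar)
      (S.hat_sub_left h k) (S.hat_sub_right h k)
    rw [S.tso_right h k k'] at hr
    have hlc := S.lc_hat h k
    have := Der.sax ((S.pair h k).sseq_mem hs (lev_swt hV') hax) hlc.1 hlc.2 (S.sort_tso h k) hr hs'
      ((S.sort_tso h k).subst hs') (hr.subst hs')
    have e := Der.s3 (.s2 (S.tss_tso h k)) (.s3 this (S.tss_tso h k'))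
    rw [upd_sort k.fresh k.swt, upd_sort k.fresh k'.swt, upd_self] at e
    rwa [intro_subst] at e
  | @scong Ya t τ τ' hax hc hb h1 h2 =>
    cases hj
    obtain ⟨hl, hτ⟩ := lev_sort_imgs S.hB hax h1
    have k := HatMor.of_sort S.hB S.fB hY hY (List.Subset.refl _) hax hl hτ hv
    have e := S.cong_sort (Ψ := Θ X Y σ (upd τ' (chB Ya) v)) hs hax h k (List.Subset.refl _)
      (List.Subset.refl _) fun p hp q hq hpq => by
        by_cases hqY : q ∈ Ya
        · have hqk := mem_keys hqY
          rw [tsub, upd_of_mem _ _ k.fresh hqk, upd_of_mem _ _ k.fresh hqk]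
          rw [upd_sort k.fresh (k.goodC.swt_of_mem hqY)]
          exact .t2 (S.R.eqr hX hY (h.morHat p hp) (hb q hqY))
        · obtain rfl := List.mem_singleton.1 ((List.mem_append.1 hq).resolve_left hqY)
          have := (S.fine h k (List.Subset.refl _) (List.Subset.refl _) hp hq hpq).1
          rw [tsub, upd_self]
          rw [upd_self] at this ⊢
          exact .t1 this
    rw [imgs_hat_tsub, imgs_upd _ _ k.fresh, imgs_upd _ _ k.fresh, upd_self, upd_self] at e
    exact .s2 e
  | _ => cases hj

/-- Tensors of sorts respect equality of the first term. -/
theorem sequ (S : Stp TA TB chA chB n m) (hX : GoodC TA X) (hY : GoodC TB Y) {u u' : Expr A}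
    (hu : lev TA (n + 1) X (.termEq u u' U)) {v : Expr B} (hv : lev TB (m + 1) Y (.term v V)) :
    𝔻 (𝕔 X Y) (.sortEq (𝕤 X Y u U v V) (𝕤 X Y u' U v V)) := by
  have hu1 := (lev_presup hu).1
  obtain ⟨Ya, t, τ, ht, k, rfl, rfl⟩ := HatMor.exists_of_sort S.hB S.fB hY hY
    (List.Subset.refl _) (lev_srt hv) hv
  obtain ⟨Xa, s, σ, hs, h, rfl, rfl⟩ := HatMor.exists_of_sort S.hA S.fA hX hX
    (List.Subset.refl _) (lev_srt hu1) hu1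
  have e := S.cong_sort (Ψ := Θ X Y (upd σ (chA Xa) u') τ) hs ht h k (List.Subset.refl _)
    (List.Subset.refl _) fun p hp q hq hpq => by
      by_cases hpX : p ∈ Xa
      · rw [tsub, upd_of_mem _ _ h.fresh (mem_keys hpX)]
        exact .t1 (S.fine h k (List.Subset.refl _) (List.Subset.refl _) hp hq hpq).1
      · obtain rfl := List.mem_singleton.1 ((List.mem_append.1 hp).resolve_left hpX)
        rw [tsub, upd_self, intro_subst]
        exact .t2 (S.R.eql hX hY hu (k.mor q (hpq.resolve_left hpX)))
  rw [imgs_hat_tsub, imgs_upd _ _ h.fresh, upd_self] at e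
  exact .s2 e

/-- Tensors of sorts respect equality of the second term. -/
theorem seqv (S : Stp TA TB chA chB n m) (hX : GoodC TA X) (hY : GoodC TB Y) {u : Expr A}
    (hu : lev TA (n + 1) X (.term u U)) {v v' : Expr B}
    (hv : lev TB (m + 1) Y (.termEq v v' V)) :
    𝔻 (𝕔 X Y) (.sortEq (𝕤 X Y u U v V) (𝕤 X Y u U v' V)) := by
  have hv1 := (lev_presup hv).1
  obtain ⟨Ya, t, τ, ht, k, rfl, rfl⟩ := HatMor.exists_of_sort S.hB S.fB hY hY
    (List.Subset.refl _) (lev_srt hv1) hv1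
  obtain ⟨Xa, s, σ, hs, h, rfl, rfl⟩ := HatMor.exists_of_sort S.hA S.fA hX hX
    (List.Subset.refl _) (lev_srt hu) hu
  have e := S.cong_sort (Ψ := Θ X Y σ (upd τ (chB Ya) v')) hs ht h k (List.Subset.refl _)
    (List.Subset.refl _) fun p hp q hq hpq => by
      by_cases hqY : q ∈ Ya
      · rw [tsub, upd_of_mem _ _ k.fresh (mem_keys hqY)]
        exact .t1 (S.fine h k (List.Subset.refl _) (List.Subset.refl _) hp hq hpq).1
      · obtain rfl := List.mem_singleton.1 ((List.mem_append.1 hq).resolve_left hqY)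
        rw [tsub, upd_self, intro_subst]
        exact .t2 (S.L.eqr hX hY (h.mor p (hpq.resolve_right hqY)) hv)
  rw [imgs_hat_tsub, imgs_upd _ _ k.fresh, upd_self] at e
  exact .s2 e

end Stp

/-- A morphism to the context extended by the sort of a term symbol, of which the last value is
an application of this symbol. -/
structure TmMor (T : Set (Judg A)) (n : ℕ) (X Xa : PreCtx A) (x : A.Var) (t : A.TermSym)
    (V : SortE A) (σ : A.Var → Expr A) : Prop extends HatMor T n X X Xa x V σ where
  ax : introTerm Xa t V ∈ T
  lvl : lev T n Xa (.sort V)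
  app : σ x = .app t (imgs Xa σ)

namespace TmMor
variable {T : Set (Judg A)} {ch : PreCtx A → A.Var} {n : ℕ} {X Xa : PreCtx A} {x : A.Var}
  {t : A.TermSym} {V : SortE A} {σ : A.Var → Expr A}

theorem of_imgs (hT : IsGAT T) (hch : FreshCh ch) (hX : GoodC T X) (hax : introTerm Xa t V ∈ T)
    (hl : LC (lev T n) Xa) (hV : lev T n Xa (.sort V)) (hσ : SMor (lev T n) X Xa σ)
    (h : lev T (n + 1) X (.sort (V.subst σ))) :
    TmMor T n X Xa (ch Xa) t V (upd σ (ch Xa) (.app t (imgs Xa σ))) where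
  toHatMor := HatMor.of_term hT hch hX hl hV hσ (NS.term hax hl hV hσ h)
  ax := hax
  lvl := hV
  app := by rw [upd_self, imgs_upd _ _ (not_mem_keys (hch Xa))]

theorem exists_of_app (hT : IsGAT T) (hch : FreshCh ch) (hX : GoodC T X) {rs : List (Expr A)}
    {U : SortE A} (hu : lev T (n + 1) X (.term (.app t rs) U)) :
    ∃ Xa V σ, TmMor T n X Xa (ch Xa) t V σ ∧ rs = imgs Xa σ ∧
      lev T (n + 1) X (.sortEq (V.subst σ) U) := by
  obtain ⟨Xa, V, σ, hax, hl, hV, hσ, h, rfl, he⟩ := lev_app_inv hu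
  have hf : ch Xa ∉ keys Xa := not_mem_keys (hch Xa)
  refine ⟨Xa, V, _, .of_imgs hT hch hX hax hl hV hσ h, ?_, ?_⟩
  · rw [imgs_upd _ _ hf]
  · rwa [upd_sort hf (lev_swt hV)]

theorem term (h : TmMor T n X Xa x t V σ) :
    lev T (n + 1) X (.term (.app t (imgs Xa σ)) (V.subst σ)) := h.app ▸ h.last

theorem generic (h : TmMor T n X Xa x t V σ) :
    lev T (n + 1) Xa (.term (.app t (ctxVars Xa)) V) := by
  have := NS.term h.ax h.lc h.lvl (h.lc.smor_var (List.Subset.refl _))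
    (by rw [SortE.subst_id]; exact lev_succ h.lvl)
  rwa [SortE.subst_id] at this

theorem canon (h : TmMor T n X Xa x t V σ) : CanonSort T X (.app t (imgs Xa σ)) (V.subst σ) := by
  rw [← SortE.substL_imgs (h.gat.lc_of_introTerm h.ax).2.scoped]
  exact .app h.ax

theorem genericSubst (h : TmMor T n X Xa x t V σ) :
    (Expr.app t (ctxVars Xa)).subst σ = σ x := by
  rw [← imgs_var, Expr.subst_app, imgs_subst, h.app]
  simp only [Expr.subst_var']

end TmMor

variable (TA TB) in
/-- The tensor of a term `u : U` with an application `t(ts)`. -/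
noncomputable def tlt (X : PreCtx A) (Y : PreCtx B) (u : Expr A) (U : SortE A) (t : B.TermSym)
    (ts : List (Expr B)) : Expr (A.tensor B) :=
  .app (.inl (U.head, t)) (grid (𝕥 X Y) (U.args ++ [u]) ts)

variable (TA TB) in
/-- The tensor of an application `s(ss)` with a term `v : V`. -/
noncomputable def trt (X : PreCtx A) (Y : PreCtx B) (s : A.TermSym) (ss : List (Expr A))
    (v : Expr B) (V : SortE B) : Expr (A.tensor B) :=
  .app (.inr (s, V.head)) (grid (𝕥 X Y) ss (V.args ++ [v]))

namespace Stp
variable {s : A.SortSym} {f : A.TermSym} {t : B.SortSym} {g : B.TermSym}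

theorem gen_left (S : Stp TA TB chA chB n m) (hs : introSort Xa s ∈ TA)
    (h : HatMor TA n X X Xa (chA Xa) ⟨s, ctxVars Xa⟩ σ) (k : TmMor TB m Y Ya (chB Ya) g V τ) :
    𝔻 (𝕔 (Xa ++ [(chA Xa, ⟨s, ctxVars Xa⟩)]) Ya)
      (.term (.app (.inl (s, g)) (ctxVars (𝕔 (Xa ++ [(chA Xa, ⟨s, ctxVars Xa⟩)]) Ya)))
        (𝕊 (tso TA TB (chA Xa) (chB Ya) Xa ⟨s, ctxVars Xa⟩ Ya V)
          (Θ (Xa ++ [(chA Xa, ⟨s, ctxVars Xa⟩)]) Ya .var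
            (single (chB Ya) (.app g (ctxVars Ya)))))) := by
  have hv := wt_intro k.ax
  have hax := (S.pair h k.toHatMor).st_mem hs hv k.ax
  have hl := S.R.ctx h.lcHat k.lc
  have e : 𝕥 (Xa ++ [(chA Xa, ⟨s, ctxVars Xa⟩)]) Ya (.var (chA Xa)) (.app g (ctxVars Ya)) =
      .app (.inl (s, g)) (ctxVars (𝕔 (Xa ++ [(chA Xa, ⟨s, ctxVars Xa⟩)]) Ya)) := by
    rw [tens_right S.hA S.hB h.goodHat k.goodC (.of_mem (U := ⟨s, ctxVars Xa⟩) (by simp)) (.var (by simp))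
      (fun b hb => (WT.args hv) b hb)]
    have := imgs_tctx (TA := TA) (TB := TB)
      (𝕥 (Xa ++ [(chA Xa, ⟨s, ctxVars Xa⟩)]) Ya) (Xa ++ [(chA Xa, ⟨s, ctxVars Xa⟩)]) Ya .var .var
    simp only [tens_var] at this
    exact congrArg (Expr.app (A := A.tensor B) _)
      (((congrArg (grid _ · _) (by simp [ctxVars])).trans this.symm))
  rw [e] at hax
  have hs' := (S.sort_tso h k.toHatMor).subst (S.smor_right h k.toHatMor k.generic)
  have := Der.term hax hl.1 hl.2 hs' (fun p hp => by
    rw [SortE.subst_id]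
    exact hl.var_of_mem hp) (by rw [SortE.subst_id]; exact hs')
  rwa [SortE.subst_id] at this

variable {s : A.SortSym} {f : A.TermSym} {t : B.SortSym} {g : B.TermSym}
  {Ψ : A.Var × B.Var → Expr (A.tensor B)}

theorem gen_right (S : Stp TA TB chA chB n m) (ht : introSort Ya t ∈ TB)
    (h : TmMor TA n X Xa (chA Xa) f U σ) (k : HatMor TB m Y Y Ya (chB Ya) ⟨t, ctxVars Ya⟩ τ) :
    𝔻 (𝕔 Xa (Ya ++ [(chB Ya, ⟨t, ctxVars Ya⟩)]))
      (.term (.app (.inr (f, t)) (ctxVars (𝕔 Xa (Ya ++ [(chB Ya, ⟨t, ctxVars Ya⟩)]))))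
        (𝕊 (tso TA TB (chA Xa) (chB Ya) Xa U Ya ⟨t, ctxVars Ya⟩)
          (Θ Xa (Ya ++ [(chB Ya, ⟨t, ctxVars Ya⟩)]) (single (chA Xa) (.app f (ctxVars Xa)))
            .var))) := by
  have hu := wt_intro h.ax
  have hax := (S.pair h.toHatMor k).ts_mem hu h.ax ht
  have hl := S.L.ctx h.lc k.lcHat
  have e : 𝕥 Xa (Ya ++ [(chB Ya, ⟨t, ctxVars Ya⟩)]) (.app f (ctxVars Xa)) (.var (chB Ya)) =
      .app (.inr (f, t)) (ctxVars (𝕔 Xa (Ya ++ [(chB Ya, ⟨t, ctxVars Ya⟩)]))) := by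
    rw [tens_left S.hA S.hB h.goodC k.goodHat (V := ⟨t, ctxVars Ya⟩) (by simp)
      (fun a ha => (WT.args hu) a ha)]
    have := imgs_tctx (TA := TA) (TB := TB)
      (𝕥 Xa (Ya ++ [(chB Ya, ⟨t, ctxVars Ya⟩)])) Xa (Ya ++ [(chB Ya, ⟨t, ctxVars Ya⟩)]) .var .var
    simp only [tens_var] at this
    exact congrArg (Expr.app (A := A.tensor B) _)
      (((congrArg (grid _ _ ·) (by simp [ctxVars])).trans this.symm))
  rw [e] at hax
  have hs' := (S.sort_tso h.toHatMor k).subst (S.smor_left h.toHatMor k h.generic)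
  have := Der.term hax hl.1 hl.2 hs' (fun p hp => by
    rw [SortE.subst_id]
    exact hl.var_of_mem hp) (by rw [SortE.subst_id]; exact hs')
  rwa [SortE.subst_id] at this

theorem seq_right (S : Stp TA TB chA chB n m) (h : HatMor TA n X X Xa x U σ)
    (k : HatMor TB m Y Y Ya y V τ)
    (hΨ : ∀ p ∈ Xa ++ [(x, U)], ∀ q ∈ Ya, 𝔻 (𝕔 X Y) (.termEq (Ψ (p.1, q.1))
      (𝕥 X Y (σ p.1) (τ q.1)) (𝕤 X Y (σ p.1) (p.2.subst σ) (τ q.1) (q.2.subst τ)))) :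
    SMor 𝔻 (𝕔 X Y) (𝕔 (Xa ++ [(x, U)]) Ya) Ψ ∧
      SEq 𝔻 (𝕔 X Y) (𝕔 (Xa ++ [(x, U)]) Ya) (Θ X Y σ τ) Ψ := by
  have hθ := S.smor_hat h k (List.Subset.refl _) (List.Subset.refl _)
  have key : ∀ z ∈ 𝕔 (Xa ++ [(x, U)]) Ya, 𝔻 (𝕔 X Y) (.termEq (Ψ z.1) (Θ X Y σ τ z.1)
      (𝕊 z.2 (Θ X Y σ τ))) := by
    intro z hz
    obtain ⟨p, hp, q, hq, rfl⟩ := mem_tctx.1 hz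
    have e := (S.fine h k (List.Subset.refl _) (List.Subset.refl _) hp
      (List.mem_append_left _ hq) (.inr hq)).2
    rw [ent_mono S.hA S.hB h.goodHat k.goodC h.goodHat k.goodHat (List.Subset.refl _) (by simp)
      hp hq] at e
    exact .econv' (.s2 e) (hΨ p hp q hq)
  exact ⟨(SMor.of_seq (S.R.ctx h.lcHat k.lc) (fun z hz => hθ z (S.hat_sub_right h k hz)) key).1,
    fun z hz => .t2 (key z hz)⟩

theorem seq_left (S : Stp TA TB chA chB n m) (h : HatMor TA n X X Xa x U σ)
    (k : HatMor TB m Y Y Ya y V τ)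
    (hΨ : ∀ p ∈ Xa, ∀ q ∈ Ya ++ [(y, V)], 𝔻 (𝕔 X Y) (.termEq (Ψ (p.1, q.1))
      (𝕥 X Y (σ p.1) (τ q.1)) (𝕤 X Y (σ p.1) (p.2.subst σ) (τ q.1) (q.2.subst τ)))) :
    SMor 𝔻 (𝕔 X Y) (𝕔 Xa (Ya ++ [(y, V)])) Ψ ∧
      SEq 𝔻 (𝕔 X Y) (𝕔 Xa (Ya ++ [(y, V)])) (Θ X Y σ τ) Ψ := by
  have hθ := S.smor_hat h k (List.Subset.refl _) (List.Subset.refl _)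
  have key : ∀ z ∈ 𝕔 Xa (Ya ++ [(y, V)]), 𝔻 (𝕔 X Y) (.termEq (Ψ z.1) (Θ X Y σ τ z.1)
      (𝕊 z.2 (Θ X Y σ τ))) := by
    intro z hz
    obtain ⟨p, hp, q, hq, rfl⟩ := mem_tctx.1 hz
    have e := (S.fine h k (List.Subset.refl _) (List.Subset.refl _)
      (List.mem_append_left _ hp) hq (.inl hp)).2
    rw [ent_mono S.hA S.hB h.goodC k.goodHat h.goodHat k.goodHat (by simp) (List.Subset.refl _)
      hp hq] at e
    exact .econv' (.s2 e) (hΨ p hp q hq)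
  exact ⟨(SMor.of_seq (S.L.ctx h.lc k.lcHat) (fun z hz => hθ z (S.hat_sub_left h k hz)) key).1,
    fun z hz => .t2 (key z hz)⟩

theorem imgs_snoc {C : Alphabet} (W : PreCtx C) (p : C.Var × SortE C)
    (ρ : C.Var → Expr C) : imgs (W ++ [p]) ρ = imgs W ρ ++ [ρ p.1] := List.map_append

theorem app_vars_subst {c : (A.tensor B).TermSym} {W : PreCtx (A.tensor B)} :
    𝔼 (Expr.app c (ctxVars W)) Ψ = .app c (imgs W Ψ) := by
  rw [← imgs_var, Expr.subst_app, imgs_subst]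
  simp only [Expr.subst_var']

/-- The tensor of a term with an application. -/
theorem left_term (S : Stp TA TB chA chB n m) (hs : introSort Xa s ∈ TA)
    (h : HatMor TA n X X Xa (chA Xa) ⟨s, ctxVars Xa⟩ σ) (k : TmMor TB m Y Ya (chB Ya) g V τ) :
    𝔻 (𝕔 X Y) (.term (tlt TA TB X Y (σ (chA Xa)) ⟨s, imgs Xa σ⟩ g (imgs Ya τ))
      (𝕤 X Y (σ (chA Xa)) ⟨s, imgs Xa σ⟩ (τ (chB Ya)) (V.subst τ))) := by
  have hθ := S.smor_hat h k.toHatMor (List.Subset.refl _) (List.Subset.refl _)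
  have e := (S.gen_left hs h k).subst fun z hz => hθ z (S.hat_sub_right h k.toHatMor hz)
  have e2 := S.comp_right h k.toHatMor (wt_intro k.ax) k.genericSubst
  have e3 := Der.conv e2 e
  rw [app_vars_subst, intro_subst] at e3
  have := imgs_tctx (TA := TA) (TB := TB) (𝕥 X Y) (Xa ++ [(chA Xa, ⟨s, ctxVars Xa⟩)]) Ya σ τ
  rw [imgs_snoc] at this
  unfold tlt
  exact this ▸ e3

/-- Congruence of the tensor of a sort symbol and a term symbol. -/
theorem left_cong (S : Stp TA TB chA chB n m) (hs : introSort Xa s ∈ TA)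
    (h : HatMor TA n X X Xa (chA Xa) ⟨s, ctxVars Xa⟩ σ) (k : TmMor TB m Y Ya (chB Ya) g V τ)
    (hΨ : ∀ p ∈ Xa ++ [(chA Xa, ⟨s, ctxVars Xa⟩)], ∀ q ∈ Ya, 𝔻 (𝕔 X Y) (.termEq (Ψ (p.1, q.1))
      (𝕥 X Y (σ p.1) (τ q.1)) (𝕤 X Y (σ p.1) (p.2.subst σ) (τ q.1) (q.2.subst τ)))) :
    𝔻 (𝕔 X Y) (.termEq
      (.app (.inl (s, g)) (imgs (𝕔 (Xa ++ [(chA Xa, ⟨s, ctxVars Xa⟩)]) Ya) Ψ))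
      (tlt TA TB X Y (σ (chA Xa)) ⟨s, imgs Xa σ⟩ g (imgs Ya τ))
      (𝕤 X Y (σ (chA Xa)) ⟨s, imgs Xa σ⟩ (τ (chB Ya)) (V.subst τ))) := by
  have hθ := S.smor_hat h k.toHatMor (List.Subset.refl _) (List.Subset.refl _)
  obtain ⟨h1, h2⟩ := S.seq_right h k.toHatMor hΨ
  have e : 𝔻 (𝕔 X Y) (.termEq _ _ _) := (S.gen_left hs h k).cong
    (fun z hz => hθ z (S.hat_sub_right h k.toHatMor hz)) h1 h2
  have e2 := S.comp_right h k.toHatMor (wt_intro k.ax) k.genericSubst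
  have e3 := Der.t2 (Der.econv' e2 e)
  rw [app_vars_subst, app_vars_subst, intro_subst] at e3
  have := imgs_tctx (TA := TA) (TB := TB) (𝕥 X Y) (Xa ++ [(chA Xa, ⟨s, ctxVars Xa⟩)]) Ya σ τ
  rw [imgs_snoc] at this
  unfold tlt
  exact this ▸ e3

/-- The tensor of an application with a term. -/
theorem right_term (S : Stp TA TB chA chB n m) (ht : introSort Ya t ∈ TB)
    (h : TmMor TA n X Xa (chA Xa) f U σ) (k : HatMor TB m Y Y Ya (chB Ya) ⟨t, ctxVars Ya⟩ τ) :
    𝔻 (𝕔 X Y) (.term (trt TA TB X Y f (imgs Xa σ) (τ (chB Ya)) ⟨t, imgs Ya τ⟩)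
      (𝕤 X Y (σ (chA Xa)) (U.subst σ) (τ (chB Ya)) ⟨t, imgs Ya τ⟩)) := by
  have hθ := S.smor_hat h.toHatMor k (List.Subset.refl _) (List.Subset.refl _)
  have e := (S.gen_right ht h k).subst fun z hz => hθ z (S.hat_sub_left h.toHatMor k hz)
  have e2 := S.comp_left h.toHatMor k (wt_intro h.ax) h.genericSubst
  have e3 := Der.conv e2 e
  rw [app_vars_subst, intro_subst] at e3
  have := imgs_tctx (TA := TA) (TB := TB) (𝕥 X Y) Xa (Ya ++ [(chB Ya, ⟨t, ctxVars Ya⟩)]) σ τ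
  rw [imgs_snoc] at this
  unfold trt
  exact this ▸ e3

/-- Congruence of the tensor of a term symbol and a sort symbol. -/
theorem right_cong (S : Stp TA TB chA chB n m) (ht : introSort Ya t ∈ TB)
    (h : TmMor TA n X Xa (chA Xa) f U σ) (k : HatMor TB m Y Y Ya (chB Ya) ⟨t, ctxVars Ya⟩ τ)
    (hΨ : ∀ p ∈ Xa, ∀ q ∈ Ya ++ [(chB Ya, ⟨t, ctxVars Ya⟩)], 𝔻 (𝕔 X Y) (.termEq (Ψ (p.1, q.1))
      (𝕥 X Y (σ p.1) (τ q.1)) (𝕤 X Y (σ p.1) (p.2.subst σ) (τ q.1) (q.2.subst τ)))) :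
    𝔻 (𝕔 X Y) (.termEq
      (.app (.inr (f, t)) (imgs (𝕔 Xa (Ya ++ [(chB Ya, ⟨t, ctxVars Ya⟩)])) Ψ))
      (trt TA TB X Y f (imgs Xa σ) (τ (chB Ya)) ⟨t, imgs Ya τ⟩)
      (𝕤 X Y (σ (chA Xa)) (U.subst σ) (τ (chB Ya)) ⟨t, imgs Ya τ⟩)) := by
  have hθ := S.smor_hat h.toHatMor k (List.Subset.refl _) (List.Subset.refl _)
  obtain ⟨h1, h2⟩ := S.seq_left h.toHatMor k hΨ
  have e : 𝔻 (𝕔 X Y) (.termEq _ _ _) := (S.gen_right ht h k).cong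
    (fun z hz => hθ z (S.hat_sub_left h.toHatMor k hz)) h1 h2
  have e2 := S.comp_left h.toHatMor k (wt_intro h.ax) h.genericSubst
  have e3 := Der.t2 (Der.econv' e2 e)
  rw [app_vars_subst, app_vars_subst, intro_subst] at e3
  have := imgs_tctx (TA := TA) (TB := TB) (𝕥 X Y) Xa (Ya ++ [(chB Ya, ⟨t, ctxVars Ya⟩)]) σ τ
  rw [imgs_snoc] at this
  unfold trt
  exact this ▸ e3

end Stp

theorem HatMor.exists_of_subst' (hT : IsGAT TA) (hch : FreshCh chA) {n : ℕ} {X : PreCtx A}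
    (hX : GoodC TA X) {σ : A.Var → Expr A} {u : Expr A} {U : SortE A}
    (hu : lev TA (n + 1) X (.term u (U.subst σ))) :
    ∃ Xa s ρ, introSort Xa s ∈ TA ∧ U = ⟨s, imgs Xa ρ⟩ ∧
      HatMor TA n X X Xa (chA Xa) ⟨s, ctxVars Xa⟩
        (GATPaper.upd (fun a => (ρ a).subst σ) (chA Xa) u) := by
  obtain ⟨s, rs⟩ := U
  obtain ⟨Xa, σ', hax, -, -, he⟩ := lev_sort_inv (lev_srt hu)
  have hl : rs.length = Xa.length := by simpa using congrArg List.length he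
  have hr := imgs_sub (hT.lc_of_introSort hax).goodC.1 hl
  rw [← hr, SortE.subst_mk, imgs_subst] at hu
  obtain ⟨hl, hσ⟩ := lev_sort_imgs hT hax (lev_srt hu)
  exact ⟨Xa, s, GATPaper.sub Xa rs, hax, by rw [hr],
    .of_sort hT hch hX hX (List.Subset.refl _) hax hl hσ hu⟩

theorem TmMor.exists_of_subst (hT : IsGAT TA) (hch : FreshCh chA) {n : ℕ} {X : PreCtx A}
    (hX : GoodC TA X) {σ : A.Var → Expr A} {t : A.TermSym} {rs : List (Expr A)} {U : SortE A}
    (hu : lev TA (n + 1) X (.term (.app t (rs.map (Expr.subst σ))) U)) :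
    ∃ Xa V ρ, rs = imgs Xa ρ ∧ TmMor TA n X Xa (chA Xa) t V
        (GATPaper.upd (fun a => (ρ a).subst σ) (chA Xa) (.app t (rs.map (Expr.subst σ)))) ∧
      lev TA (n + 1) X (.sortEq (V.subst (fun a => (ρ a).subst σ)) U) := by
  obtain ⟨Xa, V, σ', hax, hlc, hV, hσ, h, he, hs⟩ := lev_app_inv hu
  have hl : rs.length = Xa.length := by simpa using congrArg List.length he
  have hr := imgs_sub (hT.lc_of_introTerm hax).1.goodC.1 hl
  have hk : ∀ a ∈ keys Xa, σ' a = (GATPaper.sub Xa rs a).subst σ := by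
    refine imgs_inj (he.symm.trans ?_)
    rw [← imgs_subst, hr]
  have hVe := (lev_swt hV).subst_congr hk
  rw [hVe] at h hs
  have := TmMor.of_imgs hT hch hX hax hlc hV (hσ.congr hlc.lev_der.goodC hk) h
  rw [← imgs_subst, hr] at this
  exact ⟨Xa, V, GATPaper.sub Xa rs, hr.symm, this, hs⟩

namespace Stp
variable {n m : ℕ} {X X1 Xa : PreCtx A} {x : A.Var} {U : SortE A} {σ : A.Var → Expr A}
  {Y Y1 Ya : PreCtx B} {y : B.Var} {V : SortE B} {τ : B.Var → Expr B}
  {Z : PreCtx (A.tensor B)}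
variable {s : A.SortSym} {f : A.TermSym} {t : B.SortSym} {g : B.TermSym}
  {ss : List (Expr A)} {ts : List (Expr B)} {u : Expr A} {v : Expr B}

theorem tlt_term (S : Stp TA TB chA chB n m) (hX : GoodC TA X) (hY : GoodC TB Y)
    (hu : lev TA (n + 1) X (.term u U)) (hv : lev TB (m + 1) Y (.term (.app g ts) V)) :
    𝔻 (𝕔 X Y) (.term (tlt TA TB X Y u U g ts) (𝕤 X Y u U (.app g ts) V)) := by
  obtain ⟨Ya, V, τ, k, rfl, he⟩ := TmMor.exists_of_app S.hB S.fB hY hv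
  have key := S.seqr hX hY he hu k.term
  obtain ⟨Xa, s, σ, hs, h, rfl, rfl⟩ := HatMor.exists_of_sort S.hA S.fA hX hX
    (List.Subset.refl _) (lev_srt hu) hu
  have := S.left_term hs h k
  rw [k.app] at this
  exact .conv key this

theorem trt_term (S : Stp TA TB chA chB n m) (hX : GoodC TA X) (hY : GoodC TB Y)
    (hu : lev TA (n + 1) X (.term (.app f ss) U)) (hv : lev TB (m + 1) Y (.term v V)) :
    𝔻 (𝕔 X Y) (.term (trt TA TB X Y f ss v V) (𝕤 X Y (.app f ss) U v V)) := by
  obtain ⟨Xa, U, σ, h, rfl, he⟩ := TmMor.exists_of_app S.hA S.fA hX hu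
  have key := S.seql hX hY he h.term hv
  obtain ⟨Ya, t, τ, ht, k, rfl, rfl⟩ := HatMor.exists_of_sort S.hB S.fB hY hY
    (List.Subset.refl _) (lev_srt hv) hv
  have := S.right_term ht h k
  rw [h.app] at this
  exact .conv key this

/-- Tensors of terms are terms. -/
theorem ty (S : Stp TA TB chA chB n m) (hX : GoodC TA X) (hY : GoodC TB Y)
    (hu : lev TA (n + 1) X (.term u U)) (hv : lev TB (m + 1) Y (.term v V)) :
    𝔻 (𝕔 X Y) (.term (𝕥 X Y u v) (𝕤 X Y u U v V)) := by
  obtain ⟨U0, hc, hu0, he⟩ := lev_canon hu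
  refine .conv (S.seql hX hY he hu0 hv) ?_
  cases v with
  | app g ts =>
    rw [tens_right S.hA S.hB hX hY hc (lev_wt hu) (lev_wt hv).args]
    exact S.tlt_term hX hY hu0 hv
  | var y =>
    obtain ⟨V0, hV0, hs, he'⟩ := lev_var_inv hv
    have hv0 : lev TB (m + 1) Y (.term (.var y) V0) := NS.var hV0 hs
    refine .conv (S.seqr hX hY he' hu0 hv0) ?_
    cases u with
    | app f ss =>
      rw [tens_left S.hA S.hB hX hY hV0 (lev_wt hu).args]
      exact S.trt_term hX hY hu0 hv0
    | var x =>
      have hU0 := canonSort_var_iff.1 hc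
      have h := S.sort hX hX (List.Subset.refl _) hY hY (List.Subset.refl _) (lev_srt hu0) hu0
        (lev_srt hv0) hv0 (List.Subset.refl _) (List.Subset.refl _)
      rw [tens_var]
      exact .var (mem_tctx.2 ⟨_, hU0, _, hV0, rfl⟩) h

theorem tlt_subst (S : Stp TA TB chA chB n m) {X' : PreCtx A} {Y' : PreCtx B} (hX : GoodC TA X)
    (hY : GoodC TB Y) (hu : lev TA (n + 1) X (.term (u.subst σ) (U.subst σ)))
    (hv : lev TB (m + 1) Y (.term (.app g (ts.map (Expr.subst τ))) V))
    (H : ∀ a ∈ U.args ++ [u], ∀ b ∈ ts, ∀ C E, lev TA (n + 1) X (.term (a.subst σ) C) →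
      lev TB m Y (.term (b.subst τ) E) →
      𝔻 (𝕔 X Y) (.termEq (𝔼 (𝕥 X' Y' a b) (Θ X Y σ τ)) (𝕥 X Y (a.subst σ) (b.subst τ))
        (𝕤 X Y (a.subst σ) C (b.subst τ) E))) :
    𝔻 (𝕔 X Y) (.termEq (𝔼 (tlt TA TB X' Y' u U g ts) (Θ X Y σ τ))
      (tlt TA TB X Y (u.subst σ) (U.subst σ) g (ts.map (Expr.subst τ)))
      (𝕤 X Y (u.subst σ) (U.subst σ) (.app g (ts.map (Expr.subst τ))) V)) := by
  obtain ⟨Ya, V0, κ, rfl, k, he⟩ := TmMor.exists_of_subst S.hB S.fB hY hv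
  have key := S.seqr hX hY he hu (V := V0.subst fun a => (κ a).subst τ) (.conv (.s2 he) hv)
  obtain ⟨Xa, s, ρ, hs, rfl, h⟩ := HatMor.exists_of_subst' S.hA S.fA hX hu
  refine .econv' key ?_
  have e := S.left_cong (Ψ := fun z => 𝔼 (𝕥 X' Y' (upd ρ (chA Xa) u z.1) (κ z.2)) (Θ X Y σ τ))
    hs h k fun p hp q hq => by
      have hp' := h.morHat p hp
      have hq' := k.mor q hq
      rw [← upd_subst] at hp' ⊢
      rw [upd_of_mem _ _ k.fresh (mem_keys hq)] at hq' ⊢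
      refine H _ ?_ _ ?_ _ _ hp' hq'
      · rcases List.mem_append.1 hp with hp | hp
        · rw [upd_of_mem _ _ h.fresh (mem_keys hp)]
          exact List.mem_append_left _ (List.mem_map_of_mem hp)
        · rw [List.mem_singleton.1 hp]
          simp
      · exact List.mem_map_of_mem hq
  rw [imgs_upd _ _ h.fresh, imgs_upd _ _ k.fresh, upd_self, upd_self] at e
  rw [upd_sort k.fresh (lev_swt k.lvl), ← imgs_subst Xa, ← imgs_subst Ya] at e
  rw [SortE.subst_mk]
  refine Eq.mp (congrArg (fun C => 𝔻 (𝕔 X Y) (.termEq C _ _)) ?_) e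
  have := imgs_tctx (TA := TA) (TB := TB) (fun a b => 𝔼 (𝕥 X' Y' a b) (Θ X Y σ τ))
    (Xa ++ [(chA Xa, ⟨s, ctxVars Xa⟩)]) Ya (upd ρ (chA Xa) u) κ
  rw [imgs_snoc, imgs_upd _ _ h.fresh, upd_self] at this
  rw [tlt, Expr.subst_app, map_grid]
  exact congrArg (Expr.app (A := A.tensor B) _) this

theorem trt_subst (S : Stp TA TB chA chB n m) {X' : PreCtx A} {Y' : PreCtx B} (hX : GoodC TA X)
    (hY : GoodC TB Y) (hu : lev TA (n + 1) X (.term (.app f (ss.map (Expr.subst σ))) U))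
    (hv : lev TB (m + 1) Y (.term (v.subst τ) (V.subst τ)))
    (H : ∀ a ∈ ss, ∀ b ∈ V.args ++ [v], ∀ C E, lev TA n X (.term (a.subst σ) C) →
      lev TB (m + 1) Y (.term (b.subst τ) E) →
      𝔻 (𝕔 X Y) (.termEq (𝔼 (𝕥 X' Y' a b) (Θ X Y σ τ)) (𝕥 X Y (a.subst σ) (b.subst τ))
        (𝕤 X Y (a.subst σ) C (b.subst τ) E))) :
    𝔻 (𝕔 X Y) (.termEq (𝔼 (trt TA TB X' Y' f ss v V) (Θ X Y σ τ))
      (trt TA TB X Y f (ss.map (Expr.subst σ)) (v.subst τ) (V.subst τ))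
      (𝕤 X Y (.app f (ss.map (Expr.subst σ))) U (v.subst τ) (V.subst τ))) := by
  obtain ⟨Xa, U0, ρ, rfl, h, he⟩ := TmMor.exists_of_subst S.hA S.fA hX hu
  have key := S.seql hX hY he (U := U0.subst fun a => (ρ a).subst σ) (.conv (.s2 he) hu) hv
  obtain ⟨Ya, t, κ, ht, rfl, k⟩ := HatMor.exists_of_subst' S.hB S.fB hY hv
  refine .econv' key ?_
  have e := S.right_cong (Ψ := fun z => 𝔼 (𝕥 X' Y' (ρ z.1) (upd κ (chB Ya) v z.2)) (Θ X Y σ τ))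
    ht h k fun p hp q hq => by
      have hp' := h.mor p hp
      have hq' := k.morHat q hq
      rw [← upd_subst] at hq' ⊢
      rw [upd_of_mem _ _ h.fresh (mem_keys hp)] at hp' ⊢
      refine H _ ?_ _ ?_ _ _ hp' hq'
      · exact List.mem_map_of_mem hp
      · rcases List.mem_append.1 hq with hq | hq
        · rw [upd_of_mem _ _ k.fresh (mem_keys hq)]
          exact List.mem_append_left _ (List.mem_map_of_mem hq)
        · rw [List.mem_singleton.1 hq]
          simp
  rw [imgs_upd _ _ h.fresh, imgs_upd _ _ k.fresh, upd_self, upd_self] at e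
  rw [upd_sort h.fresh (lev_swt h.lvl), ← imgs_subst Xa, ← imgs_subst Ya] at e
  rw [SortE.subst_mk]
  refine Eq.mp (congrArg (fun C => 𝔻 (𝕔 X Y) (.termEq C _ _)) ?_) e
  have := imgs_tctx (TA := TA) (TB := TB) (fun a b => 𝔼 (𝕥 X' Y' a b) (Θ X Y σ τ)) Xa
    (Ya ++ [(chB Ya, ⟨t, ctxVars Ya⟩)]) ρ (upd κ (chB Ya) v)
  rw [imgs_snoc, imgs_upd _ _ k.fresh, upd_self] at this
  rw [trt, Expr.subst_app, map_grid]
  exact congrArg (Expr.app (A := A.tensor B) _) this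

theorem _root_.GATPaper.Der.tax_subst {T : Set (Judg A)} {X Z : PreCtx A} {e e' : Expr A}
    {C : SortE A} {ρ : A.Var → Expr A} (hax : Judg.termEq X e e' C ∈ T) (hl : LC (Der T) X)
    (h : Der T X (.term e C)) (h' : Der T X (.term e' C)) (hρ : SMor (Der T) Z X ρ) :
    Der T Z (.termEq (e.subst ρ) (e'.subst ρ) (C.subst ρ)) :=
  .tax hax hl.1 hl.2 h h' hρ (h.subst hρ) (h'.subst hρ)

theorem _root_.GATPaper.subst_single {T : Set (Judg A)} (hx : x ∉ keys X) (hU : SWT T X U)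
    (u : Expr A) : U.subst (single x u) = U := by
  rw [hU.subst_congr (τ := Expr.var) fun a ha => single_of_ne (ne_of_mem_keys ha hx) u,
    SortE.subst_id]

theorem sort_left (S : Stp TA TB chA chB n m) (h : HatMor TA n X X1 Xa x U σ)
    (k : TmMor TB m Y Ya y g V τ) :
    𝔻 (𝕔 (Xa ++ [(x, U)]) Ya) (.sortEq
      (𝕊 (tso TA TB x y Xa U Ya V) (Θ (Xa ++ [(x, U)]) Ya .var (single y (.app g (ctxVars Ya)))))
      (𝕤 (Xa ++ [(x, U)]) Ya (.var x) U (.app g (ctxVars Ya)) V)) := by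
  have := S.tss_tso (.id S.hA h.lc h.fresh h.srt) (.single S.hB k.lc k.fresh k.srt k.generic)
  rwa [SortE.subst_id, single_self, subst_single k.fresh (lev_swt k.lvl)] at this

theorem sort_right (S : Stp TA TB chA chB n m) (h : TmMor TA n X Xa x f U σ)
    (k : HatMor TB m Y Y1 Ya y V τ) :
    𝔻 (𝕔 Xa (Ya ++ [(y, V)])) (.sortEq
      (𝕊 (tso TA TB x y Xa U Ya V) (Θ Xa (Ya ++ [(y, V)]) (single x (.app f (ctxVars Xa))) .var))
      (𝕤 Xa (Ya ++ [(y, V)]) (.app f (ctxVars Xa)) U (.var y) V)) := by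
  have := S.tss_tso (.single S.hA h.lc h.fresh h.srt h.generic) (.id S.hB k.lc k.fresh k.srt)
  rwa [SortE.subst_id, single_self, subst_single h.fresh (lev_swt h.lvl)] at this

theorem tlt_ts (S : Stp TA TB chA chB n m) {X' : PreCtx A} {Y' : PreCtx B} (hX : GoodC TA X)
    (hY : GoodC TB Y) (hX' : GoodC TA X') (hY' : GoodC TB Y') (hσ : SMor (lev TA (n + 1)) X X' σ)
    (hτ : SMor (lev TB m) Y Y' τ) (hu : WT TA X' u) (hU : SWT TA X' U) (hts : ∀ b ∈ ts, WT TB Y' b)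
    (huU : lev TA (n + 1) X (.term (u.subst σ) (U.subst σ)))
    (hv : lev TB (m + 1) Y (.term (.app g (ts.map (Expr.subst τ))) V)) :
    𝔻 (𝕔 X Y) (.termEq (𝔼 (tlt TA TB X' Y' u U g ts) (Θ X Y σ τ))
      (tlt TA TB X Y (u.subst σ) (U.subst σ) g (ts.map (Expr.subst τ)))
      (𝕤 X Y (u.subst σ) (U.subst σ) (.app g (ts.map (Expr.subst τ))) V)) :=
  S.tlt_subst hX hY huU hv fun a ha b hb C E hC hE =>
    S.R.ts hX hY hX' hY' hσ hτ (by
      rcases List.mem_append.1 ha with ha | ha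
      · exact hU a ha
      · exact List.mem_singleton.1 ha ▸ hu) (hts b hb) hC hE

theorem trt_ts (S : Stp TA TB chA chB n m) {X' : PreCtx A} {Y' : PreCtx B} (hX : GoodC TA X)
    (hY : GoodC TB Y) (hX' : GoodC TA X') (hY' : GoodC TB Y') (hσ : SMor (lev TA n) X X' σ)
    (hτ : SMor (lev TB (m + 1)) Y Y' τ) (hss : ∀ a ∈ ss, WT TA X' a) (hv : WT TB Y' v)
    (hV : SWT TB Y' V)
    (hu : lev TA (n + 1) X (.term (.app f (ss.map (Expr.subst σ))) U))
    (hvV : lev TB (m + 1) Y (.term (v.subst τ) (V.subst τ))) :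
    𝔻 (𝕔 X Y) (.termEq (𝔼 (trt TA TB X' Y' f ss v V) (Θ X Y σ τ))
      (trt TA TB X Y f (ss.map (Expr.subst σ)) (v.subst τ) (V.subst τ))
      (𝕤 X Y (.app f (ss.map (Expr.subst σ))) U (v.subst τ) (V.subst τ))) :=
  S.trt_subst hX hY hu hvV fun a ha b hb C E hC hE =>
    S.L.ts hX hY hX' hY' hσ hτ (hss a ha) (by
      rcases List.mem_append.1 hb with hb | hb
      · exact hV b hb
      · exact List.mem_singleton.1 hb ▸ hv) hC hE

theorem tens_hat_left (S : Stp TA TB chA chB n m) (h : HatMor TA n X X1 Xa x U σ)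
    (k : TmMor TB m Y Ya y g V τ) : 𝕥 (Xa ++ [(x, U)]) Ya (.var x) (.app g (ctxVars Ya)) =
      tlt TA TB (Xa ++ [(x, U)]) Ya (.var x) U g (ctxVars Ya) :=
  tens_right S.hA S.hB h.goodHat k.goodC (.of_mem (by simp)) (.var (by simp))
    (lev_wt k.generic).args

theorem tens_hat_right (S : Stp TA TB chA chB n m) (h : TmMor TA n X Xa x f U σ)
    (k : HatMor TB m Y Y1 Ya y V τ) : 𝕥 Xa (Ya ++ [(y, V)]) (.app f (ctxVars Xa)) (.var y) =
      trt TA TB Xa (Ya ++ [(y, V)]) f (ctxVars Xa) (.var y) V :=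
  tens_left S.hA S.hB h.goodC k.goodHat (by simp) (lev_wt h.generic).args

theorem ctxVars_subst (Y : PreCtx B) (τ : B.Var → Expr B) :
    (ctxVars Y).map (Expr.subst τ) = imgs Y τ := by
  rw [← imgs_var, imgs_subst]
  simp only [Expr.subst_var']

theorem tlt_hat (S : Stp TA TB chA chB n m) (h : HatMor TA n X X Xa x U σ)
    (k : TmMor TB m Y Ya y g V τ) :
    𝔻 (𝕔 X Y) (.termEq (𝔼 (tlt TA TB (Xa ++ [(x, U)]) Ya (.var x) U g (ctxVars Ya)) (Θ X Y σ τ))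
      (tlt TA TB X Y (σ x) (U.subst σ) g (imgs Ya τ))
      (𝕤 X Y (σ x) (U.subst σ) (.app g (imgs Ya τ)) (V.subst τ))) := by
  have := S.tlt_ts h.good k.good h.goodHat k.goodC h.morHat k.mor (u := .var x) (.var (by simp))
    (fun a ha => (h.swt a ha).weaken (by simp)) (lev_wt k.generic).args (U := U) (g := g)
    (V := V.subst τ) (by rw [Expr.subst_var']; exact h.last) (by rw [ctxVars_subst]; exact k.term)
  rwa [ctxVars_subst, Expr.subst_var'] at this

theorem trt_hat (S : Stp TA TB chA chB n m) (h : TmMor TA n X Xa x f U σ)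
    (k : HatMor TB m Y Y Ya y V τ) :
    𝔻 (𝕔 X Y) (.termEq (𝔼 (trt TA TB Xa (Ya ++ [(y, V)]) f (ctxVars Xa) (.var y) V) (Θ X Y σ τ))
      (trt TA TB X Y f (imgs Xa σ) (τ y) (V.subst τ))
      (𝕤 X Y (.app f (imgs Xa σ)) (U.subst σ) (τ y) (V.subst τ))) := by
  have := S.trt_ts h.good k.good h.goodC k.goodHat h.mor k.morHat (v := .var y)
    (lev_wt h.generic).args (.var (by simp)) (fun a ha => (k.swt a ha).weaken (by simp)) (V := V)
    (f := f) (U := U.subst σ) (by rw [ctxVars_subst]; exact h.term)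
    (by rw [Expr.subst_var']; exact k.last)
  rwa [ctxVars_subst, Expr.subst_var'] at this

theorem tlt_change (S : Stp TA TB chA chB n m) {U' : SortE A} (h : HatMor TA n X X1 Xa x U σ)
    (h' : HatMor TA n X X1 Xa x U' σ) (k : TmMor TB m Y Ya y g V τ) :
    tlt TA TB (Xa ++ [(x, U')]) Ya (.var x) U' g (ctxVars Ya) =
      tlt TA TB (Xa ++ [(x, U)]) Ya (.var x) U' g (ctxVars Ya) := by
  unfold tlt
  congr 1
  refine grid_congr fun a ha b hb => ?_
  have hb' := (lev_wt k.generic).args b hb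
  rcases List.mem_append.1 ha with ha | ha
  · rw [tens_mono S.hA S.hB h.goodC k.goodC h.goodHat k.goodC (by simp) (List.Subset.refl _)
        (h'.swt a ha) hb', tens_mono S.hA S.hB h.goodC k.goodC h'.goodHat k.goodC (by simp)
        (List.Subset.refl _) (h'.swt a ha) hb']
  · obtain ⟨q, -, rfl⟩ := List.mem_map.1 hb
    rw [List.mem_singleton.1 ha, tens_var, tens_var]

theorem trt_change (S : Stp TA TB chA chB n m) {V' : SortE B} (h : TmMor TA n X Xa x f U σ)
    (k : HatMor TB m Y Y1 Ya y V τ) (k' : HatMor TB m Y Y1 Ya y V' τ) :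
    trt TA TB Xa (Ya ++ [(y, V')]) f (ctxVars Xa) (.var y) V' =
      trt TA TB Xa (Ya ++ [(y, V)]) f (ctxVars Xa) (.var y) V' := by
  unfold trt
  congr 1
  refine grid_congr fun a ha b hb => ?_
  have ha' := (lev_wt h.generic).args a ha
  rcases List.mem_append.1 hb with hb | hb
  · rw [tens_mono S.hA S.hB h.goodC k.goodC h.goodC k.goodHat (List.Subset.refl _) (by simp)
        ha' (k'.swt b hb), tens_mono S.hA S.hB h.goodC k.goodC h.goodC k'.goodHat
        (List.Subset.refl _) (by simp) ha' (k'.swt b hb)]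
  · obtain ⟨q, -, rfl⟩ := List.mem_map.1 ha
    rw [List.mem_singleton.1 hb, tens_var, tens_var]

/-- Equal sorts of the first term have equal tensors with an application. -/
theorem tlt_sort (S : Stp TA TB chA chB n m) (hX : GoodC TA X) (hY : GoodC TB Y) {U' : SortE A}
    (hUU : lev TA (n + 1) X (.sortEq U U')) (hu : lev TA (n + 1) X (.term u U))
    (hv : lev TB (m + 1) Y (.term (.app g ts) V)) :
    𝔻 (𝕔 X Y) (.termEq (tlt TA TB X Y u U g ts) (tlt TA TB X Y u U' g ts)
      (𝕤 X Y u U (.app g ts) V)) := by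
  obtain ⟨Ya, V0, τ, k, rfl, he⟩ := TmMor.exists_of_app S.hB S.fB hY hv
  refine .econv' (S.seqr hX hY he hu k.term) ?_
  clear he hv V
  generalize hj : CJ.sortEq U U' = j at hUU
  change NS TA (lev TA n) X j at hUU
  induction hUU generalizing U U' with
  | s1 h _ =>
    cases hj
    exact .t1 (S.tlt_term hX hY hu k.term)
  | s2 h ih =>
    cases hj
    exact .econv' (S.seql hX hY h (NS.conv (.s2 h) hu) k.term) (.t2 (ih (NS.conv (.s2 h) hu) rfl))
  | s3 h h' ih ih' =>
    cases hj
    exact .t3 (ih hu rfl) (.econv' (.s2 (S.seql hX hY h hu k.term)) (ih' (NS.conv h hu) rfl))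
  | @sax Xa U U' σ hax hc hU hU' ha h1 h2 =>
    cases hj
    have h := HatMor.extend S.hA S.fA hX hc hU ha hu
    have h' := h.change (U' := U') (lev_succ hU') (by
      rw [upd_sort h.fresh (lev_swt hU'), upd_self]
      exact NS.conv (.sax hax hc hU hU' ha h1 h2) hu)
    have hθ := S.smor_hat h k.toHatMor (List.Subset.refl _) (List.Subset.refl _)
    have hs := lev_weaken (h.sax_hat hax hU hU') (Z := Xa ++ [(chA Xa, U)]) (by simp)
    have e1 := S.tlt_term h.goodHat k.goodC h.lastVar k.generic
    have e2 := S.tlt_term h.goodHat k.goodC (.conv hs h.lastVar) k.generic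
    have hs' := S.sort_left h k
    have e1' := Der.conv (.s2 hs') e1
    have e2' := Der.conv (.s2 (.s3 hs' (S.seql h.goodHat k.goodC hs h.lastVar k.generic))) e2
    rw [← S.tlt_change h h' k, ← S.tens_hat_left h' k] at e2'
    rw [← S.tens_hat_left h k] at e1'
    have := Der.tax_subst ((S.pair h k.toHatMor).seqt_mem (lev_swt hU') hax (wt_intro k.ax) k.ax)
      (S.R.ctx h.lcHat k.lc) e1' e2' fun z hz => hθ z (S.hat_sub_right h k.toHatMor hz)
    have := Der.econv' (S.comp_right h k.toHatMor (wt_intro k.ax) k.genericSubst) this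
    rw [S.tens_hat_left h k, S.tens_hat_left h' k] at this
    have r1 := S.tlt_hat h k
    have r2 := S.tlt_hat h' k
    rw [← k.app] at r1 r2
    have r2 := Der.econv' (.s2 (S.seql hX hY (.sax hax hc hU hU' ha h1 h2) hu k.last)) (by
      rwa [upd_sort h'.fresh h'.swt, upd_self] at r2)
    rw [upd_sort h.fresh h.swt, upd_self] at r1 this
    rw [← k.app]
    exact .t3 (.t2 r1) (.t3 this r2)
  | @scong Xa s σ σ' hax hc ha h1 h2 =>
    cases hj
    obtain ⟨hl, hσ⟩ := lev_sort_imgs S.hA hax h1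
    have h := HatMor.of_sort S.hA S.fA hX hX (List.Subset.refl _) hax hl hσ hu
    have e := S.left_cong (Ψ := Θ X Y (upd σ' (chA Xa) u) τ) hax h k fun p hp q hq => by
        by_cases hpX : p ∈ Xa
        · have hpk := mem_keys hpX
          rw [tsub, upd_of_mem _ _ h.fresh hpk, upd_of_mem _ _ h.fresh hpk]
          rw [upd_sort h.fresh (h.goodC.swt_of_mem hpX)]
          exact .t2 (S.L.eql hX hY (ha p hpX) (k.morHat q (List.mem_append_left _ hq)))
        · obtain rfl := List.mem_singleton.1 ((List.mem_append.1 hp).resolve_left hpX)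
          have := (S.fine h k.toHatMor (List.Subset.refl _) (List.Subset.refl _) hp
            (List.mem_append_left _ hq) (.inr hq)).1
          rw [tsub, upd_self]
          rw [upd_self] at this ⊢
          exact .t1 this
    have e' := imgs_tctx (TA := TA) (TB := TB) (𝕥 X Y) (Xa ++ [(chA Xa, ⟨s, ctxVars Xa⟩)]) Ya
      (upd σ' (chA Xa) u) τ
    rw [imgs_snoc, imgs_upd _ _ h.fresh, upd_self] at e'
    rw [imgs_upd _ _ h.fresh, upd_self, k.app] at e
    exact .t2 (Eq.mp (congrArg (fun C => 𝔻 (𝕔 X Y) (.termEq (.app (.inl (s, g)) C) _ _)) e') e)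
  | _ => cases hj

/-- Equal sorts of the second term have equal tensors with an application. -/
theorem trt_sort (S : Stp TA TB chA chB n m) (hX : GoodC TA X) (hY : GoodC TB Y) {V' : SortE B}
    (hVV : lev TB (m + 1) Y (.sortEq V V')) (hu : lev TA (n + 1) X (.term (.app f ss) U))
    (hv : lev TB (m + 1) Y (.term v V)) :
    𝔻 (𝕔 X Y) (.termEq (trt TA TB X Y f ss v V) (trt TA TB X Y f ss v V')
      (𝕤 X Y (.app f ss) U v V)) := by
  obtain ⟨Xa, U0, σ, h, rfl, he⟩ := TmMor.exists_of_app S.hA S.fA hX hu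
  refine .econv' (S.seql hX hY he h.term hv) ?_
  clear he hu U
  generalize hj : CJ.sortEq V V' = j at hVV
  change NS TB (lev TB m) Y j at hVV
  induction hVV generalizing V V' with
  | s1 k _ =>
    cases hj
    exact .t1 (S.trt_term hX hY h.term hv)
  | s2 k ih =>
    cases hj
    exact .econv' (S.seqr hX hY k h.term (NS.conv (.s2 k) hv)) (.t2 (ih (NS.conv (.s2 k) hv) rfl))
  | s3 k k' ih ih' =>
    cases hj
    exact .t3 (ih hv rfl) (.econv' (.s2 (S.seqr hX hY k h.term hv)) (ih' (NS.conv k hv) rfl))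
  | @sax Ya V V' τ hax hc hV hV' hb h1 h2 =>
    cases hj
    have k := HatMor.extend S.hB S.fB hY hc hV hb hv
    have k' := k.change (U' := V') (lev_succ hV') (by
      rw [upd_sort k.fresh (lev_swt hV'), upd_self]
      exact NS.conv (.sax hax hc hV hV' hb h1 h2) hv)
    have hθ := S.smor_hat h.toHatMor k (List.Subset.refl _) (List.Subset.refl _)
    have hs := lev_weaken (k.sax_hat hax hV hV') (Z := Ya ++ [(chB Ya, V)]) (by simp)
    have e1 := S.trt_term h.goodC k.goodHat h.generic k.lastVar
    have e2 := S.trt_term h.goodC k.goodHat h.generic (.conv hs k.lastVar)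
    have hs' := S.sort_right h k
    have e1' := Der.conv (.s2 hs') e1
    have e2' := Der.conv (.s2 (.s3 hs' (S.seqr h.goodC k.goodHat hs h.generic k.lastVar))) e2
    rw [← S.trt_change h k k', ← S.tens_hat_right h k'] at e2'
    rw [← S.tens_hat_right h k] at e1'
    have := Der.tax_subst ((S.pair h.toHatMor k).tseq_mem (wt_intro h.ax) h.ax (lev_swt hV') hax)
      (S.L.ctx h.lc k.lcHat) e1' e2' fun z hz => hθ z (S.hat_sub_left h.toHatMor k hz)
    have := Der.econv' (S.comp_left h.toHatMor k (wt_intro h.ax) h.genericSubst) this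
    rw [S.tens_hat_right h k, S.tens_hat_right h k'] at this
    have r1 := S.trt_hat h k
    have r2 := S.trt_hat h k'
    rw [← h.app] at r1 r2
    have r2 := Der.econv' (.s2 (S.seqr hX hY (.sax hax hc hV hV' hb h1 h2) h.last hv)) (by
      rwa [upd_sort k'.fresh k'.swt, upd_self] at r2)
    rw [upd_sort k.fresh k.swt, upd_self] at r1 this
    rw [← h.app]
    exact .t3 (.t2 r1) (.t3 this r2)
  | @scong Ya t τ τ' hax hc hb h1 h2 =>
    cases hj
    obtain ⟨hl, hτ⟩ := lev_sort_imgs S.hB hax h1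
    have k := HatMor.of_sort S.hB S.fB hY hY (List.Subset.refl _) hax hl hτ hv
    have e := S.right_cong (Ψ := Θ X Y σ (upd τ' (chB Ya) v)) hax h k fun p hp q hq => by
        by_cases hqY : q ∈ Ya
        · have hqk := mem_keys hqY
          rw [tsub, upd_of_mem _ _ k.fresh hqk, upd_of_mem _ _ k.fresh hqk]
          rw [upd_sort k.fresh (k.goodC.swt_of_mem hqY)]
          exact .t2 (S.R.eqr hX hY (h.morHat p (List.mem_append_left _ hp)) (hb q hqY))
        · obtain rfl := List.mem_singleton.1 ((List.mem_append.1 hq).resolve_left hqY)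
          have := (S.fine h.toHatMor k (List.Subset.refl _) (List.Subset.refl _)
            (List.mem_append_left _ hp) hq (.inl hp)).1
          rw [tsub, upd_self]
          rw [upd_self] at this ⊢
          exact .t1 this
    have e' := imgs_tctx (TA := TA) (TB := TB) (𝕥 X Y) Xa (Ya ++ [(chB Ya, ⟨t, ctxVars Ya⟩)])
      σ (upd τ' (chB Ya) v)
    rw [imgs_snoc, imgs_upd _ _ k.fresh, upd_self] at e'
    rw [imgs_upd _ _ k.fresh, upd_self, h.app] at e
    exact .t2 (Eq.mp (congrArg (fun C => 𝔻 (𝕔 X Y) (.termEq (.app (.inr (f, t)) C) _ _)) e') e)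
  | _ => cases hj

theorem interchange_app (S : Stp TA TB chA chB n m) (h : TmMor TA n X Xa (chA Xa) f U σ)
    (k : TmMor TB m Y Ya (chB Ya) g V τ) :
    𝔻 (𝕔 X Y) (.termEq (𝕥 X Y (σ (chA Xa)) (τ (chB Ya)))
      (trt TA TB X Y f (imgs Xa σ) (τ (chB Ya)) (V.subst τ))
      (𝕤 X Y (σ (chA Xa)) (U.subst σ) (τ (chB Ya)) (V.subst τ))) := by
  have hθ := S.smor_hat h.toHatMor k.toHatMor (List.Subset.refl _) (List.Subset.refl _)
  have hsub : 𝕔 Xa Ya ⊆ 𝕔 Xa (Ya ++ [(chB Ya, V)]) :=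
    tctx_subset S.hA S.hB h.goodC k.goodC h.goodC k.goodHat (List.Subset.refl _) (by simp)
  have hs := S.tss_tso (.single S.hA h.lc h.fresh h.srt h.generic)
    (.single S.hB k.lc k.fresh k.srt k.generic)
  rw [single_self, single_self, subst_single h.fresh (lev_swt h.lvl),
    subst_single k.fresh (lev_swt k.lvl)] at hs
  have e := Der.tax_subst ((S.pair h.toHatMor k.toHatMor).tt_mem h.ax k.ax)
    (S.R.ctx (h.lc.lev_mono (by omega)) k.lc)
    (.conv (.s2 hs) (S.ty h.goodC k.goodC h.generic k.generic))
    (.conv (.s2 hs) (S.trt_term h.goodC k.goodC h.generic k.generic))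
    fun z hz => hθ z (S.hat_sub_left h.toHatMor k.toHatMor (hsub hz))
  have e := Der.econv' (S.comp_both h.toHatMor k.toHatMor (wt_intro h.ax) h.genericSubst
    (wt_intro k.ax) k.genericSubst) e
  have hf := (lev_wt h.generic).args
  have hg := (lev_wt k.generic).args
  rw [tens_right S.hA S.hB h.goodC k.goodC (canonSort_intro S.hA h.ax) (lev_wt h.generic) hg] at e
  have r1 := S.tlt_ts h.good k.good h.goodC k.goodC (h.mor.lev_mono (by omega)) k.mor
    (lev_wt h.generic) (lev_swt h.lvl) hg (g := g) (V := V.subst τ)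
    (by rw [h.genericSubst]; exact h.last) (by rw [ctxVars_subst]; exact k.term)
  have r2 := S.trt_ts h.good k.good h.goodC k.goodC h.mor (k.mor.lev_mono (by omega)) hf
    (lev_wt k.generic) (lev_swt k.lvl) (f := f) (U := U.subst σ)
    (by rw [ctxVars_subst]; exact h.term) (by rw [k.genericSubst]; exact k.last)
  rw [ctxVars_subst, h.genericSubst, ← k.app] at r1
  rw [ctxVars_subst, k.genericSubst, ← h.app] at r2
  have e1 : 𝕥 X Y (σ (chA Xa)) (τ (chB Ya)) =
      tlt TA TB X Y (σ (chA Xa)) (U.subst σ) g (imgs Ya τ) := by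
    rw [k.app, tens_right S.hA S.hB h.good k.good (h.app ▸ h.canon) h.wtLast (lev_wt k.term).args]
    rfl
  rw [e1]
  exact .t3 (.t2 r1) (.t3 e r2)

/-- The two ways of forming the tensor of two applications agree. -/
theorem interchange (S : Stp TA TB chA chB n m) (hX : GoodC TA X) (hY : GoodC TB Y)
    (hu : lev TA (n + 1) X (.term (.app f ss) U)) (hv : lev TB (m + 1) Y (.term v V)) :
    𝔻 (𝕔 X Y) (.termEq (𝕥 X Y (.app f ss) v) (trt TA TB X Y f ss v V)
      (𝕤 X Y (.app f ss) U v V)) := by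
  cases v with
  | var y =>
    obtain ⟨V0, hV0, hs, he⟩ := lev_var_inv hv
    rw [tens_left S.hA S.hB hX hY hV0 (lev_wt hu).args]
    have hv0 : lev TB (m + 1) Y (.term (.var y) V0) := NS.var hV0 hs
    exact .econv' (S.seqr hX hY he hu hv0) (S.trt_sort hX hY he hu hv0)
  | app g ts =>
    obtain ⟨Xa, U0, σ, h, rfl, hU⟩ := TmMor.exists_of_app S.hA S.fA hX hu
    obtain ⟨Ya, V0, τ, k, rfl, hV⟩ := TmMor.exists_of_app S.hB S.fB hY hv
    have e := S.interchange_app h k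
    rw [h.app, k.app] at e
    exact .econv' (S.seql hX hY hU h.term hv) (.econv' (S.seqr hX hY hV h.term k.term)
      (.t3 e (S.trt_sort hX hY hV h.term k.term)))

/-- Equal first terms have equal tensors. -/
theorem eql (S : Stp TA TB chA chB n m) (hX : GoodC TA X) (hY : GoodC TB Y) {u' : Expr A}
    (huu : lev TA (n + 1) X (.termEq u u' U)) (hv : lev TB (m + 1) Y (.term v V)) :
    𝔻 (𝕔 X Y) (.termEq (𝕥 X Y u v) (𝕥 X Y u' v) (𝕤 X Y u U v V)) := by
  have hv' := hv
  obtain ⟨Ya, t, τ, ht, k, rfl, rfl⟩ := HatMor.exists_of_sort S.hB S.fB hY hY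
    (List.Subset.refl _) (lev_srt hv) hv
  generalize hj : CJ.termEq u u' U = j at huu
  change NS TA (lev TA n) X j at huu
  induction huu generalizing u u' U with
  | t1 h _ =>
    cases hj
    exact .t1 (S.ty hX hY h hv)
  | t2 h ih =>
    cases hj
    exact .econv' (S.sequ hX hY h hv) (.t2 (ih rfl))
  | t3 h h' ih ih' =>
    cases hj
    exact .t3 (ih rfl) (.econv' (.s2 (S.sequ hX hY h hv)) (ih' rfl))
  | econv hs h _ ih =>
    cases hj
    exact .econv' (S.seql hX hY hs (lev_presup (n := n + 1) h).1 hv) (ih rfl)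
  | @tax Xa u u' U σ hax hc hu hu' ha h1 h2 =>
    cases hj
    have h := HatMor.extend S.hA S.fA hX hc (lev_srt hu) ha (lev_succ h1)
    have hθ := S.smor_hat h k (List.Subset.refl _) (List.Subset.refl _)
    have huu : lev TA (n + 1) Xa (.termEq u u' U) := by
      have := NS.tax (X := Xa) (σ := Expr.var) hax hc hu hu' (hc.smor_var (List.Subset.refl _))
        (by rwa [Expr.subst_id, SortE.subst_id]) (by rwa [Expr.subst_id, SortE.subst_id])
      rwa [Expr.subst_id, Expr.subst_id, SortE.subst_id] at this
    have hs := S.tss_tso (.single S.hA h.lc h.fresh h.srt (lev_succ hu))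
      (.id S.hB k.lc k.fresh k.srt)
    rw [single_self, subst_single h.fresh h.swt, SortE.subst_id] at hs
    have e1 := S.L.ty h.goodC k.goodHat hu k.lastVar
    have e2 := S.L.ty h.goodC k.goodHat hu' k.lastVar
    have hs2 := S.sequ h.goodC k.goodHat huu k.lastVar
    have e := Der.tax_subst ((S.pair h k).teqs_mem (lev_wt hu) (lev_wt hu') hax ht)
      (S.L.ctx h.lc k.lcHat) (.conv (.s2 hs) e1) (.conv (.s2 (.s3 hs hs2)) e2)
      fun z hz => hθ z (S.hat_sub_left h k hz)
    have hσ : ∀ a ∈ keys Xa, upd σ (chA Xa) (u.subst σ) a = σ a :=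
      fun a ha => upd_of_mem _ _ h.fresh ha
    have eu : u.subst (upd σ (chA Xa) (u.subst σ)) = u.subst σ := (lev_wt hu).subst_congr hσ
    have eu' : u'.subst (upd σ (chA Xa) (u.subst σ)) = u'.subst σ := (lev_wt hu').subst_congr hσ
    have e := Der.econv' (S.comp_left h k (lev_wt hu) (by rw [eu, upd_self])) e
    have r1 := S.L.ts hX hY h.goodC k.goodHat h.mor k.morHat (lev_wt hu) (lev_wt k.lastVar)
      (by rw [eu]; exact h1) (by rw [Expr.subst_var']; exact k.last)
    have r2 := S.L.ts hX hY h.goodC k.goodHat h.mor k.morHat (lev_wt hu') (lev_wt k.lastVar)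
      (by rw [eu']; exact h2) (by rw [Expr.subst_var']; exact k.last)
    have hq := S.sequ hX hY (NS.tax hax hc hu hu' ha h1 h2) k.last
    rw [upd_sort h.fresh h.swt, upd_self] at e
    rw [eu, Expr.subst_var'] at r1
    rw [eu', Expr.subst_var'] at r2
    rw [intro_subst] at *
    exact .t3 (.t2 r1) (.t3 e (.econv' (.s2 hq) r2))
  | @tcong Xa f U σ σ' hax hc hU ha h1 h2 =>
    cases hj
    have hl := S.interchange hX hY h1 hv
    have hr := S.interchange hX hY h2 hv
    have hq := S.sequ hX hY (NS.tcong hax hc hU ha h1 h2) hv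
    have h := TmMor.of_imgs S.hA S.fA hX hax hc hU (fun p hp => (lev_presup (ha p hp)).1)
      (lev_srt h1)
    have e := S.right_cong (Ψ := Θ X Y σ' τ) ht h k fun p hp q hq => by
      rw [tsub, upd_of_mem _ _ h.fresh (mem_keys hp), upd_sort h.fresh (h.goodC.swt_of_mem hp)]
      exact .t2 (S.L.eql hX hY (ha p hp) (k.morHat q hq))
    have e' := imgs_tctx (TA := TA) (TB := TB) (𝕥 X Y) Xa (Ya ++ [(chB Ya, ⟨t, ctxVars Ya⟩)])
      σ' τ
    rw [imgs_snoc] at e'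
    rw [imgs_upd _ _ h.fresh, upd_sort h.fresh h.swt, upd_self] at e
    have e := Eq.mp (congrArg (fun C => 𝔻 (𝕔 X Y) (.termEq (.app (.inr (f, t)) C) _ _)) e') e
    exact .t3 hl (.t3 (.t2 e) (.econv' (.s2 hq) (.t2 hr)))
  | _ => cases hj

/-- Equal second terms have equal tensors. -/
theorem eqr (S : Stp TA TB chA chB n m) (hX : GoodC TA X) (hY : GoodC TB Y) {v' : Expr B}
    (hu : lev TA (n + 1) X (.term u U)) (hvv : lev TB (m + 1) Y (.termEq v v' V)) :
    𝔻 (𝕔 X Y) (.termEq (𝕥 X Y u v) (𝕥 X Y u v') (𝕤 X Y u U v V)) := by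
  obtain ⟨U0, hc, hu0, he⟩ := lev_canon hu
  refine .econv' (S.seql hX hY he hu0 (lev_presup hvv).1) ?_
  clear he hu
  obtain ⟨Xa, s, σ, hs, h, rfl, rfl⟩ := HatMor.exists_of_sort S.hA S.fA hX hX
    (List.Subset.refl _) (lev_srt hu0) hu0
  generalize hj : CJ.termEq v v' V = j at hvv
  change NS TB (lev TB m) Y j at hvv
  induction hvv generalizing v v' V with
  | t1 k _ =>
    cases hj
    exact .t1 (S.ty hX hY hu0 k)
  | t2 k ih =>
    cases hj
    exact .econv' (S.seqv hX hY hu0 k) (.t2 (ih rfl))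
  | t3 k k' ih ih' =>
    cases hj
    exact .t3 (ih rfl) (.econv' (.s2 (S.seqv hX hY hu0 k)) (ih' rfl))
  | econv hs k _ ih =>
    cases hj
    exact .econv' (S.seqr hX hY hs hu0 (lev_presup (n := m + 1) k).1) (ih rfl)
  | @tax Ya v v' V τ hax hl hv hv' hb h1 h2 =>
    cases hj
    have k := HatMor.extend S.hB S.fB hY hl (lev_srt hv) hb (lev_succ h1)
    have hθ := S.smor_hat h k (List.Subset.refl _) (List.Subset.refl _)
    have hvv : lev TB (m + 1) Ya (.termEq v v' V) := by
      have := NS.tax (X := Ya) (σ := Expr.var) hax hl hv hv' (hl.smor_var (List.Subset.refl _))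
        (by rwa [Expr.subst_id, SortE.subst_id]) (by rwa [Expr.subst_id, SortE.subst_id])
      rwa [Expr.subst_id, Expr.subst_id, SortE.subst_id] at this
    have hq := S.tss_tso (.id S.hA h.lc h.fresh h.srt)
      (.single S.hB k.lc k.fresh k.srt (lev_succ hv))
    rw [single_self, subst_single k.fresh k.swt, SortE.subst_id] at hq
    have e1 := S.R.ty h.goodHat k.goodC h.lastVar hv
    have e2 := S.R.ty h.goodHat k.goodC h.lastVar hv'
    have hq2 := S.seqv h.goodHat k.goodC h.lastVar hvv
    have e := Der.tax_subst ((S.pair h k).steq_mem hs (lev_wt hv) (lev_wt hv') hax)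
      (S.R.ctx h.lcHat k.lc) (.conv (.s2 hq) e1) (.conv (.s2 (.s3 hq hq2)) e2)
      fun z hz => hθ z (S.hat_sub_right h k hz)
    have hτ : ∀ b ∈ keys Ya, upd τ (chB Ya) (v.subst τ) b = τ b :=
      fun b hb => upd_of_mem _ _ k.fresh hb
    have ev : v.subst (upd τ (chB Ya) (v.subst τ)) = v.subst τ := (lev_wt hv).subst_congr hτ
    have ev' : v'.subst (upd τ (chB Ya) (v.subst τ)) = v'.subst τ := (lev_wt hv').subst_congr hτ
    have e := Der.econv' (S.comp_right h k (lev_wt hv) (by rw [ev, upd_self])) e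
    have r1 := S.R.ts hX hY h.goodHat k.goodC h.morHat k.mor (lev_wt h.lastVar) (lev_wt hv)
      (by rw [Expr.subst_var']; exact h.last) (by rw [ev]; exact h1)
    have r2 := S.R.ts hX hY h.goodHat k.goodC h.morHat k.mor (lev_wt h.lastVar) (lev_wt hv')
      (by rw [Expr.subst_var']; exact h.last) (by rw [ev']; exact h2)
    have hq := S.seqv hX hY h.last (NS.tax hax hl hv hv' hb h1 h2)
    rw [upd_sort k.fresh k.swt, upd_self] at e
    rw [ev, Expr.subst_var'] at r1
    rw [ev', Expr.subst_var'] at r2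
    rw [intro_subst] at *
    exact .t3 (.t2 r1) (.t3 e (.econv' (.s2 hq) r2))
  | @tcong Ya g V τ τ' hax hl hV hb h1 h2 =>
    cases hj
    have hq := S.seqv hX hY hu0 (NS.tcong hax hl hV hb h1 h2)
    have k := TmMor.of_imgs S.hB S.fB hY hax hl hV (fun p hp => (lev_presup (hb p hp)).1)
      (lev_srt h1)
    have e := S.left_cong (Ψ := Θ X Y σ τ') hs h k fun p hp q hq => by
      rw [tsub, upd_of_mem _ _ k.fresh (mem_keys hq), upd_sort k.fresh (k.goodC.swt_of_mem hq)]
      exact .t2 (S.R.eqr hX hY (h.morHat p hp) (hb q hq))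
    have e' := imgs_tctx (TA := TA) (TB := TB) (𝕥 X Y) (Xa ++ [(chA Xa, ⟨s, ctxVars Xa⟩)]) Ya
      σ τ'
    rw [imgs_snoc] at e'
    rw [imgs_upd _ _ k.fresh, upd_sort k.fresh k.swt, upd_self] at e
    have e := Eq.mp (congrArg (fun C => 𝔻 (𝕔 X Y) (.termEq (.app (.inl (s, g)) C) _ _)) e') e
    rw [tens_right S.hA S.hB hX hY hc (lev_wt hu0) (lev_wt (n := m + 1) h1).args,
      tens_right S.hA S.hB hX hY hc (lev_wt hu0) (lev_wt (n := m + 1) h2).args]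
    exact .t2 e
  | _ => cases hj

end Stp

/-- Two sorts of one term are equal. -/
theorem lev_sort_unique (hT : IsGAT TA) {n : ℕ} {X : PreCtx A} (hX : GoodC TA X) {u : Expr A}
    {U U' : SortE A} (h : lev TA (n + 1) X (.term u U)) (h' : lev TA (n + 1) X (.term u U')) :
    lev TA (n + 1) X (.sortEq U U') := by
  obtain ⟨U0, hc, -, h0⟩ := lev_canon h
  obtain ⟨U1, hc1, -, h1⟩ := lev_canon h'
  obtain rfl := hc.unique hT hX hc1
  exact NS.s3 (.s2 h0) h1

/-- A substituted term has the substituted canonical sort. -/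
theorem lev_canon_subst (hT : IsGAT TA) (hch : FreshCh chA) {n : ℕ} {X X' : PreCtx A}
    (hX : GoodC TA X) (hX' : GoodC TA X') {σ : A.Var → Expr A} (hσ : SMor (lev TA (n + 1)) X X' σ)
    {u : Expr A} {U U0 : SortE A} (hc : CanonSort TA X' u U0)
    (h : lev TA (n + 1) X (.term (u.subst σ) U)) :
    lev TA (n + 1) X (.term (u.subst σ) (U0.subst σ)) := by
  cases u with
  | var x =>
    rw [Expr.subst_var']
    exact hσ _ (canonSort_var_iff.1 hc)
  | app f ss =>
    rw [Expr.subst_app] at h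
    obtain ⟨Xa, V, κ, rfl, k, -⟩ := TmMor.exists_of_subst hT hch hX h
    have hc' : CanonSort TA X' (.app f (imgs Xa κ)) (V.subst κ) := by
      rw [← SortE.substL_imgs (hT.lc_of_introTerm k.ax).2.scoped]
      exact .app k.ax
    obtain rfl := hc.unique hT hX' hc'
    rw [SortE.subst_subst, Expr.subst_app]
    have := k.last
    rw [upd_sort k.fresh k.swt, upd_self] at this
    exact this

namespace Stp
variable {n m : ℕ} {X X1 Xa : PreCtx A} {x : A.Var} {U : SortE A} {σ : A.Var → Expr A}
  {Y Y1 Ya : PreCtx B} {y : B.Var} {V : SortE B} {τ : B.Var → Expr B}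
  {Z : PreCtx (A.tensor B)}
variable {s : A.SortSym} {f : A.TermSym} {t : B.SortSym} {g : B.TermSym}
  {ss : List (Expr A)} {ts : List (Expr B)} {u : Expr A} {v : Expr B}

theorem tens_subst (S : Stp TA TB chA chB n m) {X' : PreCtx A} {Y' : PreCtx B} (hX : GoodC TA X)
    (hY : GoodC TB Y) (hX' : GoodC TA X') (hY' : GoodC TB Y') (hσ : SMor (lev TA (n + 1)) X X' σ)
    (hτ : SMor (lev TB (m + 1)) Y Y' τ) (hu' : WT TA X' u) (hv' : WT TB Y' v)
    (hu : lev TA (n + 1) X (.term (u.subst σ) U)) (hv : lev TB (m + 1) Y (.term (v.subst τ) V)) :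
    𝔻 (𝕔 X Y) (.termEq (𝔼 (𝕥 X' Y' u v) (Θ X Y σ τ)) (𝕥 X Y (u.subst σ) (v.subst τ))
      (𝕤 X Y (u.subst σ) U (v.subst τ) V)) := by
  have h := tens_spec (TB := TB) S.hA hX' hY' hu' hv'
  generalize 𝕥 X' Y' u v = e at h
  clear hu' hv'
  induction h generalizing U V with
  | var x y =>
    simp only [Expr.subst_var'] at hu hv ⊢
    exact .t1 (S.ty hX hY hu hv)
  | @left f ss y V0 hc M hM ih =>
    have hv0 := lev_canon_subst S.hB S.fB hY hY' hτ hc hv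
    have hg : grid M ss (V0.args ++ [.var y]) = grid (𝕥 X' Y') ss (V0.args ++ [.var y]) :=
      grid_congr fun a ha b hb => (hM a ha b hb).eq_tens S.hA S.hB hX' hY'
    have hf : (Expr.app f ss).subst σ = .app f (ss.map (Expr.subst σ)) := Expr.subst_app ..
    rw [hf] at hu ⊢
    refine .econv' (S.seqr hX hY (lev_sort_unique S.hB hY hv0 hv) hu hv0) ?_
    refine .t3 ?_ (.t2 (S.interchange hX hY hu hv0))
    rw [hg]
    refine S.trt_subst hX hY hu hv0 fun a ha b hb C E hC hE => ?_
    rw [← (hM a ha b hb).eq_tens S.hA S.hB hX' hY']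
    exact ih a ha b hb (lev_succ hC) hE
  | @right u U0 g ts hc M hM ih =>
    have hu0 := lev_canon_subst S.hA S.fA hX hX' hσ hc hu
    obtain ⟨U1, hc1, hu1, he1⟩ := lev_canon hu0
    have hg : grid M (U0.args ++ [u]) ts = grid (𝕥 X' Y') (U0.args ++ [u]) ts :=
      grid_congr fun a ha b hb => (hM a ha b hb).eq_tens S.hA S.hB hX' hY'
    have hf : (Expr.app g ts).subst τ = .app g (ts.map (Expr.subst τ)) := Expr.subst_app ..
    rw [hf] at hv ⊢
    refine .econv' (S.seql hX hY (lev_sort_unique S.hA hX hu0 hu) hu0 hv) ?_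
    rw [hg, tens_right S.hA S.hB hX hY hc1 (lev_wt hu0) (lev_wt hv).args]
    refine .t3 (S.tlt_subst hX hY hu0 hv fun a ha b hb C E hC hE => ?_)
      (S.tlt_sort hX hY (.s2 he1) hu0 hv)
    rw [← (hM a ha b hb).eq_tens S.hA S.hB hX' hY']
    exact ih a ha b hb hC (lev_succ hE)

theorem ent_subst (S : Stp TA TB chA chB n m) {X' : PreCtx A} {Y' : PreCtx B} (hX : GoodC TA X)
    (hY : GoodC TB Y) (hX' : LC (lev TA (n + 1)) X') (hY' : LC (lev TB (m + 1)) Y')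
    (hσ : SMor (lev TA (n + 1)) X X' σ) (hτ : SMor (lev TB (m + 1)) Y Y' τ)
    {p : A.Var × SortE A} {q : B.Var × SortE B} (hp : p ∈ X') (hq : q ∈ Y') :
    𝔻 (𝕔 X Y) (.sortEq (𝕊 ((ent TA TB X' Y' p q).2) (Θ X Y σ τ))
      (𝕤 X Y (σ p.1) (p.2.subst σ) (τ q.1) (q.2.subst τ))) := by
  have gX := hX'.lev_der.goodC
  have gY := hY'.lev_der.goodC
  have hu := hσ p hp
  have hv := hτ q hq
  rw [← Expr.subst_var' σ p.1] at hu ⊢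
  rw [← Expr.subst_var' τ q.1] at hv ⊢
  refine S.tss_of_args hX hY (hX'.lev_sort_of_mem hp) (hY'.lev_sort_of_mem hq) hu hv ?_ ?_
  · intro a ha b hb C E hC hE
    refine S.tens_subst hX hY gX gY hσ hτ (gX.swt_of_mem hp a ha) ?_ (lev_succ hC) hE
    rcases List.mem_append.1 hb with hb | hb
    · exact gY.swt_of_mem hq b hb
    · rw [List.mem_singleton.1 hb]
      exact .var (mem_keys hq)
  · intro b hb C E hC hE
    exact S.tens_subst hX hY gX gY hσ hτ (.var (mem_keys hp)) (gY.swt_of_mem hq b hb) hC (lev_succ hE)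

end Stp

theorem tctx_nil (X : PreCtx A) : 𝕔 X [] = [] := by
  simp [tctx, grid]

namespace Stp
variable {n m : ℕ} {X X1 Xa : PreCtx A} {x : A.Var} {U : SortE A} {σ : A.Var → Expr A}
  {Y Y1 Ya : PreCtx B} {y : B.Var} {V : SortE B} {τ : B.Var → Expr B}
  {Z : PreCtx (A.tensor B)}
variable {s : A.SortSym} {f : A.TermSym} {t : B.SortSym} {g : B.TermSym}
  {ss : List (Expr A)} {ts : List (Expr B)} {u : Expr A} {v : Expr B}

theorem ctx (S : Stp TA TB chA chB n m) (hX : LC (lev TA (n + 1)) X)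
    (hY : LC (lev TB (m + 1)) Y) : LC 𝔻 (𝕔 X Y) := by
  induction X using List.reverseRecOn generalizing Y with
  | nil => exact LC.nil _
  | append_singleton X p ihX =>
    induction Y using List.reverseRecOn with
    | nil =>
      rw [tctx_nil]
      exact LC.nil _
    | append_singleton Y q ihY =>
      obtain ⟨x, U⟩ := p
      obtain ⟨y, V⟩ := q
      have gX := hX.lev_der.goodC
      have gY := hY.lev_der.goodC
      have gX1 := hX.front.lev_der.goodC
      have gY1 := hY.front.lev_der.goodC
      obtain ⟨-, hU, fx, -⟩ := LC.snoc_iff.1 hX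
      obtain ⟨-, hV, fy, -⟩ := LC.snoc_iff.1 hY
      have hl := lc_hat_of S.hA S.hB hX.lev_der hY.lev_der (ihX hX.front hY) (ihY hY.front)
      have hs := S.sort (Z := hat TA TB X (x, U) Y (y, V)) gX gX1 (by simp) gY gY1 (by simp) hU
        (lev_var_of_mem (p := (x, U)) (lev_weaken hU (by simp)) (by simp)) hV
        (lev_var_of_mem (p := (y, V)) (lev_weaken hV (by simp)) (by simp))
        (fun z hz => by
          obtain ⟨p', hp, q', hq, rfl⟩ := mem_tctx.1 hz
          exact mem_hat.2 ⟨p', List.mem_append_left _ hp, q', hq, .inl hp,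
            ent_mono S.hA S.hB gX1 gY gX gY (by simp) (List.Subset.refl _) hp hq⟩)
        (fun z hz => by
          obtain ⟨p', hp, q', hq, rfl⟩ := mem_tctx.1 hz
          exact mem_hat.2 ⟨p', hp, q', List.mem_append_left _ hq, .inr hq,
            ent_mono S.hA S.hB gX gY1 gX gY (List.Subset.refl _) (by simp) hp hq⟩)
      have e : 𝕔 (X ++ [(x, U)]) (Y ++ [(y, V)]) = hat TA TB X (x, U) Y (y, V) ++
          [ent TA TB (X ++ [(x, U)]) (Y ++ [(y, V)]) (x, U) (y, V)] := by
        rw [hat_eq, tctx, grid_append, grid_singleton, List.map_append, List.append_assoc]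
        rfl
      rw [e]
      refine LC.snoc_iff.2 ⟨hl, hs, fun hz => ?_, hs.scoped⟩
      obtain ⟨e', he', hee⟩ := List.mem_map.1 hz
      obtain ⟨p', hp', q', hq', hpq, rfl⟩ := mem_hat.1 he'
      have h1 : p'.1 = x := congrArg Prod.fst hee
      have h2 : q'.1 = y := congrArg Prod.snd hee
      rcases hpq with h | h
      · exact fx (h1 ▸ (mem_keys h : p'.1 ∈ keys X))
      · exact fy (h2 ▸ (mem_keys h : q'.1 ∈ keys Y))

/-- All assertions at the next levels. -/
theorem next (S : Stp TA TB chA chB n m) : PP TA TB chA chB (n + 1) (m + 1) where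
  ctx := S.ctx
  ty := S.ty
  ts := S.tens_subst
  tss hX hY hX1 hY1 hs ht hp hq := S.ent_subst hX hY hX1 hY1 hs ht hp hq
  eql hX hY hu hv := S.eql hX hY hu hv
  eqr hX hY hu hv := S.eqr hX hY hu hv

end Stp

theorem LC.lev_zero {T : Set (Judg A)} {X : PreCtx A} (h : LC (lev T 0) X) : X = [] := by
  cases X with
  | nil => rfl
  | cons p X => exact (h.2 [] p X rfl).elim

theorem PP.zero_left (m : ℕ) : PP TA TB chA chB 0 m where
  ctx hX _ := by
    rw [hX.lev_zero]
    exact LC.nil _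
  ty _ _ h _ := h.elim
  ts _ _ _ _ _ _ _ _ h _ := h.elim
  tss _ _ hX _ _ _ hp _ := by
    rw [hX.lev_zero] at hp
    cases hp
  eql _ _ h _ := h.elim
  eqr _ _ h _ := h.elim

theorem PP.zero_right (n : ℕ) : PP TA TB chA chB n 0 where
  ctx _ hY := by
    rw [hY.lev_zero, tctx_nil]
    exact LC.nil _
  ty _ _ _ h := h.elim
  ts _ _ _ _ _ _ _ _ _ h := h.elim
  tss _ _ _ hY _ _ _ hq := by
    rw [hY.lev_zero] at hq
    cases hq
  eql _ _ _ h := h.elim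
  eqr _ _ _ h := h.elim

theorem PP.all (hA : IsGAT TA) (hB : IsGAT TB) (fA : FreshCh chA) (fB : FreshCh chB) (n m : ℕ) :
    PP TA TB chA chB n m := by
  induction n generalizing m with
  | zero => exact .zero_left m
  | succ n ihn =>
    induction m with
    | zero => exact .zero_right _
    | succ m ihm => exact Stp.next ⟨hA, hB, fA, fB, ihn (m + 1), ihm⟩

/-- A term in context together with a morphism into that context, at a common level. -/
theorem exists_lev_mor {T : Set (Judg A)} (hT : IsGAT T) {X Xa : PreCtx A} {f : List (Expr A)}
    {u : Expr A} (hf : IsMor T X Xa f) (hu : DerTerm T Xa u) :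
    ∃ n σ U, LC (lev T n) X ∧ LC (lev T n) Xa ∧ SMor (lev T n) X Xa σ ∧ f = imgs Xa σ ∧
      WT T Xa u ∧ lev T n X (.term (u.subst σ) U) := by
  obtain ⟨hX, hXa, hl, ha⟩ := hf
  obtain ⟨U, hU⟩ := hu
  have hX : LC (Der T) X := hX.jder hT.1.shape
  have hU : LC (Der T) Xa ∧ Der T Xa (.term u U) := hU.jder hT.1.shape
  have gXa := hU.1.1
  have hσ : SMor (Der T) X Xa (sub Xa f) :=
    (args_iff (Q := fun e W => Der T X (.term e W)) gXa hl).1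
      fun i hi hif => ((ha i hi hif).jder hT.1.shape).2
  have hu : Der T X (.term (u.subst (sub Xa f)) _) := hU.2.subst hσ
  obtain ⟨n1, h1⟩ := hX.exists_lev
  obtain ⟨n2, h2⟩ := hU.1.exists_lev
  obtain ⟨n3, h3⟩ := exists_lev_of_mem fun p hp => (hσ p hp).exists_lev
  obtain ⟨n4, h4⟩ := hu.exists_lev
  exact ⟨n1 + n2 + n3 + n4, sub Xa f, _, h1.lev_mono (by omega), h2.lev_mono (by omega),
    SMor.lev_mono (by omega) h3, (imgs_sub gXa hl).symm, hU.2.wf.1, lev_mono (by omega) h4⟩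

theorem imgs_tsub (X' X : PreCtx A) (Y' Y : PreCtx B) (σ : A.Var → Expr A) (τ : B.Var → Expr B) :
    imgs (𝕔 X' Y') (Θ X Y σ τ) = grid (𝕥 X Y) (imgs X' σ) (imgs Y' τ) :=
  imgs_tctx (𝕥 X Y) X' Y' σ τ

end

/-- **two-sided substitution.** Given a derivable judgment
`A ⊢ u term` and a context morphism `f : X → A` in `𝔸`, and a derivable judgment
`B ⊢ v term` and a context morphism `g : Y → B` in `𝔹`, the judgment
`X⊗Y ⊢ (u ⊗ v)[f ⊗ g] ≡ u[f] ⊗ v[g] term` is derivable in `𝔸⊗𝔹`, where tensors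
of terms are formed at their canonical sorts. -/
theorem two_sided_substitution
    (A B : Alphabet) (TA : Set (Judg A)) (TB : Set (Judg B))
    (hA : IsGAT TA) (hB : IsGAT TB)
    (chA : PreCtx A → A.Var) (hchA : FreshCh chA)
    (chB : PreCtx B → B.Var) (hchB : FreshCh chB)
    (X Ac : PreCtx A) (f : List (Expr A)) (u : Expr A)
    (Y Bc : PreCtx B) (g : List (Expr B)) (v : Expr B)
    (hf : IsMor TA X Ac f) (hu : DerTerm TA Ac u)
    (hg : IsMor TB Y Bc g) (hv : DerTerm TB Bc v)
    (Su : SortE A) (Sv : SortE B)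
    (hSu : CanonSort TA Ac u Su) (hSv : CanonSort TB Bc v Sv)
    (e : Expr (A.tensor B))
    (he : TTg TA TB false ⟨Ac, u, Su⟩ ⟨Bc, v, Sv⟩ e)
    (fg : List (Expr (A.tensor B))) (hfg : TMor TA TB false X f Y g fg)
    (ZAB ZXY : PreCtx (A.tensor B))
    (hZAB : TCtx TA TB false Ac Bc ZAB) (hZXY : TCtx TA TB false X Y ZXY)
    (Su' : SortE A) (Sv' : SortE B)
    (hSu' : CanonSort TA X (u.substL (mkSub Ac f)) Su')
    (hSv' : CanonSort TB Y (v.substL (mkSub Bc g)) Sv')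
    (e' : Expr (A.tensor B))
    (he' : TTg TA TB false ⟨X, u.substL (mkSub Ac f), Su'⟩
      ⟨Y, v.substL (mkSub Bc g), Sv'⟩ e') :
    DerTermEq (tensorAx TA TB chA chB) ZXY (e.substL (mkSub ZAB fg)) e' := by
  obtain ⟨n, σ, U0, hX, hAc, hσ, rfl, hu, hu0⟩ := exists_lev_mor hA hf hu
  obtain ⟨m, τ, V0, hY, hBc, hτ, rfl, hv, hv0⟩ := exists_lev_mor hB hg hv
  have gX := hX.lev_der.goodC
  have gAc := hAc.lev_der.goodC
  have gY := hY.lev_der.goodC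
  have gBc := hBc.lev_der.goodC
  rw [Expr.substL_imgs (fun _ h => hu.occurs h)] at hSu' he'
  rw [Expr.substL_imgs (fun _ h => hv.occurs h)] at hSv' he'
  obtain rfl := (tCtx_iff hA hB gX gY).1 hZXY
  obtain rfl := (tCtx_iff hA hB gAc gBc).1 hZAB
  have sA : ∀ a ∈ imgs Ac σ, WT TA X a := fun a ha => by
    obtain ⟨p, hp, rfl⟩ := List.mem_map.1 ha
    exact lev_wt (hσ p hp)
  have sB : ∀ b ∈ imgs Bc τ, WT TB Y b := fun b hb => by
    obtain ⟨p, hp, rfl⟩ := List.mem_map.1 hb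
    exact lev_wt (hτ p hp)
  obtain rfl := hfg.eq_grid hA hB gX gY sA sB
  obtain rfl := he.eq_tens hA hB gAc gBc (.ofWT hA gAc (List.Subset.refl _) hu hSu)
    (.ofWT hB gBc (List.Subset.refl _) hv hSv)
  obtain rfl := he'.eq_tens hA hB gX gY (.ofWT hA gX (List.Subset.refl _) (lev_wt hu0) hSu')
    (.ofWT hB gY (List.Subset.refl _) (lev_wt hv0) hSv')
  have P := PP.all hA hB hchA hchB n m
  rw [← imgs_tsub, Expr.substL_imgs]
  · exact ⟨_, (P.ts gX gY gAc gBc hσ hτ hu hv hu0 hv0).derivable (P.ctx hX hY)⟩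
  · intro z hz
    obtain ⟨h1, h2⟩ := tens_occurs hA gAc gBc hu hv hz
    obtain ⟨U1, h1⟩ := exists_of_mem_keys h1
    obtain ⟨V1, h2⟩ := exists_of_mem_keys h2
    exact mem_keys (mem_tctx.2 ⟨_, h1, _, h2, rfl⟩)

end GATPaper
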